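/- Let n ≥ 1 and let Θ = (θ_{j,k}) be a real skew-symmetric n×n matrix all of whose entries are rational. Then for every ε > 0 there exists δ > 0 such that: for every purely infinite simple unital C*-algebra A and all unitaries v₁, …, vₙ ∈ A satisfying ‖v_k v_j − e^{2πi θ_{j,k}} v_j v_k‖ < δ for all 1 ≤ j,k ≤ n, there exist unitaries ṽ₁, …, ṽₙ ∈ A with ṽ_k ṽ_j = e^{2πi θ_{j,k}} ṽ_j ṽ_k and ‖ṽ_j − v_j‖ < ε for all 1 ≤ j,k ≤ n. -/

import Mathlib

open scoped Real

/-- A unital C*-algebra is purely infinite simple if it is not `ℂ·1` and for every nonzero `a`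
there exist `x`, `y` with `x * a * y = 1`. -/
def IsPurelyInfiniteSimple (A : Type*) [CStarAlgebra A] : Prop :=
  (∃ a : A, a ∉ Set.range (algebraMap ℂ A)) ∧
    ∀ a : A, a ≠ 0 → ∃ x y : A, x * a * y = 1

namespace PIS

universe u

section Basics
variable {D : Type*} [CStarAlgebra D]

lemma norm_one_le : ‖(1 : D)‖ ≤ 1 := (IsStarProjection.one (R := D)).norm_le

lemma norm_sq_star_mul (a : D) : ‖a‖ ^ 2 = ‖star a * a‖ := by
  rw [CStarRing.norm_star_mul_self, sq]

lemma norm_sq_mul_star (a : D) : ‖a‖ ^ 2 = ‖a * star a‖ := by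
  rw [CStarRing.norm_self_mul_star, sq]

lemma norm_le_of_sq {a : D} {c : ℝ} (hc : 0 ≤ c) (h : ‖star a * a‖ ≤ c ^ 2) : ‖a‖ ≤ c := by
  rw [← norm_sq_star_mul] at h
  exact le_of_sq_le_sq h hc

lemma norm_le_of_sq' {a : D} {c : ℝ} (hc : 0 ≤ c) (h : ‖a * star a‖ ≤ c ^ 2) : ‖a‖ ≤ c := by
  rw [← norm_sq_mul_star] at h
  exact le_of_sq_le_sq h hc

lemma norm_le_one_of_proj {a p : D} (hp : IsStarProjection p) (h : star a * a = p) : ‖a‖ ≤ 1 := by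
  apply norm_le_of_sq zero_le_one
  rw [h]; simpa using hp.norm_le

lemma norm_unitary_le {a : D} (h : a ∈ unitary D) : ‖a‖ ≤ 1 :=
  norm_le_one_of_proj (IsStarProjection.one (R := D)) (Unitary.mem_iff.1 h).1

lemma nmul {a b : D} {s t : ℝ} (ha : ‖a‖ ≤ s) (hb : ‖b‖ ≤ t) : ‖a * b‖ ≤ s * t :=
  norm_mul_le_of_le ha hb

lemma nadd {a b : D} {s t : ℝ} (ha : ‖a‖ ≤ s) (hb : ‖b‖ ≤ t) : ‖a + b‖ ≤ s + t :=
  norm_add_le_of_le ha hb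

lemma nsub {a b : D} {s t : ℝ} (ha : ‖a‖ ≤ s) (hb : ‖b‖ ≤ t) : ‖a - b‖ ≤ s + t :=
  norm_sub_le_of_le ha hb

/-- left multiplication by a contraction -/
lemma nmulL {a b : D} {t : ℝ} (ha : ‖a‖ ≤ 1) (hb : ‖b‖ ≤ t) : ‖a * b‖ ≤ t := by
  have := norm_nonneg b
  exact (nmul ha hb).trans (by linarith)

lemma nmulR {a b : D} {t : ℝ} (hb : ‖b‖ ≤ t) (ha : ‖a‖ ≤ 1) : ‖b * a‖ ≤ t := by
  have := norm_nonneg b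
  exact (nmul hb ha).trans (by linarith)

/-- a projection of norm `< 1` vanishes -/
lemma proj_eq_zero {p : D} (hp : IsStarProjection p) (h : ‖p‖ < 1) : p = 0 := by
  have h1 : ‖p‖ * ‖p‖ = ‖p‖ := by
    have := CStarRing.norm_star_mul_self (x := p)
    rw [hp.isSelfAdjoint.star_eq, hp.isIdempotentElem.eq] at this
    exact this.symm
  have h2 := norm_nonneg p
  have : ‖p‖ = 0 := by nlinarith
  simpa using this

/-- `y p = y` from `y* y = p`. -/
lemma mul_proj_of_star_mul {y p : D} (hp : IsStarProjection p) (h : star y * y = p) : y * p = y := by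
  have h0 : star (y - y * p) * (y - y * p) = 0 := by
    have e1 := hp.isSelfAdjoint.star_eq
    have e2 := hp.isIdempotentElem.eq
    simp only [star_sub, star_mul, e1, sub_mul, mul_sub, mul_assoc]
    simp only [← mul_assoc (star y) y, h, e2]
    simp
  have := (CStarRing.star_mul_self_eq_zero_iff _).1 h0
  exact (sub_eq_zero.1 this).symm

end Basics

section ISQ
variable {D : Type*} [CStarAlgebra D]

lemma isq {b : D} (hb : IsSelfAdjoint b) {ε : ℝ} (hε : ε ≤ 1 / 2) (h : ‖b - 1‖ ≤ ε) :
    ∃ c : D, IsSelfAdjoint c ∧ c * b * c = 1 ∧ ‖c - 1‖ ≤ 2 * ε ∧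
      ∀ x, Commute b x → Commute c x := by
  have hε0 : 0 ≤ ε := (norm_nonneg _).trans h
  have hsp : ∀ t ∈ spectrum ℝ b, |t - 1| ≤ ε := by
    intro t ht
    have h1 : b - 1 = cfc (fun x : ℝ => x - 1) b := by
      rw [cfc_sub (fun x : ℝ => x) (fun _ => 1), cfc_id' ℝ b, cfc_const_one ℝ b]
    rw [h1] at h
    have := norm_apply_le_norm_cfc (fun x : ℝ => x - 1) b ht
    simpa using this.trans h
  let f : ℝ → ℝ := fun t => (√(max t (1 / 2)))⁻¹
  have hpos : ∀ t : ℝ, 0 < √(max t (1 / 2)) := fun t => by positivity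
  have hf : Continuous f := by
    refine Continuous.inv₀ (by fun_prop) fun t => (hpos t).ne'
  have hsp2 : ∀ t ∈ spectrum ℝ b, max t (1 / 2) = t := fun t ht => by
    have := hsp t ht
    rw [abs_le] at this
    exact max_eq_left (by linarith)
  refine ⟨cfc f b, cfc_predicate f b, ?_, ?_, ?_⟩
  · have hm : cfc f b * b * cfc f b = cfc (fun x => f x * x * f x) b := by
      rw [cfc_mul (fun x => f x * x) f b (hf.mul continuous_id').continuousOn hf.continuousOn,
        cfc_mul f (fun x => x) b hf.continuousOn continuous_id'.continuousOn, cfc_id' ℝ b]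
    · rw [hm, ← cfc_one ℝ b]
      apply cfc_congr
      intro t ht
      have h1 := hsp2 t ht
      have h2 := hpos t
      simp only [f, Pi.one_apply]
      rw [h1] at h2 ⊢
      have h3 : √t * √t = t := Real.mul_self_sqrt (Real.sqrt_pos.1 h2).le
      field_simp
      nlinarith
  · have h1 : cfc f b - 1 = cfc (fun x : ℝ => f x - 1) b := by
      rw [cfc_sub f (fun _ => 1) b hf.continuousOn, cfc_const_one ℝ b]
    rw [h1]
    apply norm_cfc_le (by linarith)
    intro t ht
    have h1 := hsp2 t ht
    have h2 := hpos t
    have h4 := hsp t ht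
    simp only [f]
    rw [h1] at h2 ⊢
    set s := √t with hs
    have h3 : s * s = t := Real.mul_self_sqrt (Real.sqrt_pos.1 h2).le
    rw [← h3] at h4
    have ht2 : 1 / 2 ≤ s * s := by rw [abs_le] at h4; linarith
    have h6 : s⁻¹ - 1 = -(s * s - 1) * (s * (1 + s))⁻¹ := by field_simp; ring
    rw [h6, Real.norm_eq_abs, abs_mul, abs_neg, mul_comm]
    have h7 : |(s * (1 + s))⁻¹| ≤ 2 := by
      rw [abs_of_pos (by positivity)]
      apply inv_le_of_inv_le₀ (by norm_num)
      nlinarith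
    exact mul_le_mul h7 h4 (abs_nonneg _) (by norm_num)
  · intro x hx
    exact hx.cfc_real f

/-- polar correction -/
lemma polar {a Y : D} (ha : IsStarProjection a) (hY : Y * a = Y) {ε : ℝ} (hε : ε ≤ 1 / 2)
    (h : ‖star Y * Y - a‖ ≤ ε) :
    ∃ c : D, star (Y * c) * (Y * c) = a ∧ ‖Y * c - Y‖ ≤ 4 * ε := by
  have hε0 : 0 ≤ ε := (norm_nonneg _).trans h
  have e1 := ha.isSelfAdjoint.star_eq
  have e2 := ha.isIdempotentElem.eq
  have hY' : a * star Y = star Y := by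
    have := congrArg star hY
    rwa [star_mul, e1] at this
  obtain ⟨c, c1, c2, c3, c4⟩ := isq (b := star Y * Y + 1 - a) (by
    have := ha.isSelfAdjoint
    exact ((IsSelfAdjoint.star_mul_self Y).add (IsSelfAdjoint.one D)).sub this) hε
    (by convert h using 2; abel)
  have hca : Commute c a := c4 a (by
    simp only [Commute, SemiconjBy, sub_mul, add_mul, mul_sub, mul_add, mul_assoc, hY, e2]
    simp only [← mul_assoc a (star Y), hY']
    simp)
  refine ⟨c, ?_, ?_⟩
  · have h1 : star Y * Y = (star Y * Y + 1 - a) * a := by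
      simp only [sub_mul, add_mul, mul_assoc, hY, e2]; simp
    rw [star_mul, c1.star_eq]
    calc c * star Y * (Y * c) = c * (star Y * Y) * c := by simp only [mul_assoc]
      _ = c * ((star Y * Y + 1 - a) * a) * c := by rw [← h1]
      _ = c * (star Y * Y + 1 - a) * c * a := by
        simp only [mul_assoc]; rw [hca.eq]
      _ = a := by rw [c2, one_mul]
  · have hYn : ‖Y‖ ≤ 2 := by
      apply norm_le_of_sq (by norm_num)
      calc ‖star Y * Y‖ = ‖(star Y * Y - a) + a‖ := by simp
        _ ≤ ε + 1 := nadd h ha.norm_le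
        _ ≤ _ := by linarith
    have : Y * c - Y = Y * (c - 1) := by rw [mul_sub, mul_one]
    rw [this]
    exact (nmul hYn c3).trans (by linarith)

lemma polar2 {a b Y : D} (ha : IsStarProjection a) (hb : IsStarProjection b) (hY : Y * a = Y)
    {t : ℝ} (ht0 : 0 ≤ t) (ht : t ≤ 1 / 50)
    (h : ‖star Y * Y - a‖ ≤ t ^ 2) (h' : ‖Y * star Y - b‖ ≤ t ^ 2) :
    ∃ R : D, star R * R = a ∧ R * star R = b ∧ ‖R - Y‖ ≤ 9 * t := by
  have e1 := hb.isSelfAdjoint.star_eq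
  have e2 := hb.isIdempotentElem.eq
  have hb1 := hb.one_sub
  have f1 := hb1.isSelfAdjoint.star_eq
  have f2 := hb1.isIdempotentElem.eq
  have h1 : ‖(1 - b) * Y‖ ≤ t := by
    apply norm_le_of_sq' ht0
    have : (1 - b) * Y * star ((1 - b) * Y) = (1 - b) * (Y * star Y - b) * (1 - b) := by
      rw [star_mul, f1, mul_sub (1 - b), hb.one_sub_mul_self, sub_zero]
      simp only [mul_assoc]
    rw [this]
    exact nmulR (nmulL hb1.norm_le h') hb1.norm_le
  have hdif : b * Y - Y = - ((1 - b) * Y) := by rw [sub_mul, one_mul]; abel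
  have h2 : ‖star (b * Y) * (b * Y) - a‖ ≤ 2 * t ^ 2 := by
    have : star (b * Y) * (b * Y) - a
        = (star Y * Y - a) - star ((1 - b) * Y) * ((1 - b) * Y) := by
      simp only [star_mul, e1, f1, mul_assoc]
      simp only [← mul_assoc b b, ← mul_assoc (1 - b) (1 - b), e2, f2]
      noncomm_ring
    rw [this]
    have : ‖star ((1 - b) * Y) * ((1 - b) * Y)‖ ≤ t * t := nmul (by rwa [norm_star]) h1
    exact (nsub h this).trans (by nlinarith)
  obtain ⟨c, c1, c2⟩ := polar (Y := b * Y) ha (by rw [mul_assoc, hY]) (by nlinarith) h2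
  have hRY : ‖b * Y * c - Y‖ ≤ 9 * t := by
    calc ‖b * Y * c - Y‖ = ‖(b * Y * c - b * Y) + (b * Y - Y)‖ := by congr 1; abel
      _ ≤ 4 * (2 * t ^ 2) + t := nadd c2 (by rw [hdif, norm_neg]; exact h1)
      _ ≤ 9 * t := by nlinarith
  set R := b * Y * c with hR
  refine ⟨R, c1, ?_, hRY⟩
  have hRa := mul_proj_of_star_mul ha c1
  have hbR : b * R = R := by rw [hR]; simp only [← mul_assoc, e2]
  have hRb : star R * b = star R := by
    have := congrArg star hbR
    rwa [star_mul, e1] at this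
  have hRR : R * star R * (R * star R) = R * star R := by
    calc R * star R * (R * star R) = R * (star R * R) * star R := by simp only [mul_assoc]
      _ = _ := by rw [c1, hRa]
  have hpr : IsStarProjection (b - R * star R) := by
    refine ⟨?_, ?_⟩
    · rw [IsIdempotentElem]
      have : b * (R * star R) = R * star R := by rw [← mul_assoc, hbR]
      have h3 : R * star R * b = R * star R := by rw [mul_assoc, hRb]
      rw [sub_mul, mul_sub, mul_sub, e2, this, h3, hRR]; abel
    · exact hb.isSelfAdjoint.sub (IsSelfAdjoint.mul_star_self R)
  have hRn : ‖R‖ ≤ 1 := norm_le_one_of_proj ha c1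
  have hYn : ‖Y‖ ≤ 2 := by
    have : Y = R - (R - Y) := by abel
    rw [this]
    exact (nsub hRn hRY).trans (by linarith)
  have hlt : ‖b - R * star R‖ < 1 := by
    have : b - R * star R = -(Y * star Y - b) - ((R - Y) * star R + Y * star (R - Y)) := by
      simp only [star_sub]; noncomm_ring
    rw [this]
    have h4 : ‖(R - Y) * star R‖ ≤ 9 * t := nmulR hRY (by rwa [norm_star])
    have h5 : ‖Y * star (R - Y)‖ ≤ 2 * (9 * t) := nmul hYn (by rwa [norm_star])
    have := nsub (show ‖-(Y * star Y - b)‖ ≤ t ^ 2 by rwa [norm_neg]) (nadd h4 h5)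
    refine this.trans_lt (by nlinarith)
  have := proj_eq_zero hpr hlt
  exact (sub_eq_zero.1 this).symm

/-- almost projections are close to projections -/
lemma near_proj {a : D} (ha : IsSelfAdjoint a) {ε : ℝ} (hε : ε ≤ 1 / 8) (h : ‖a * a - a‖ ≤ ε) :
    ∃ g : D, IsStarProjection g ∧ ‖g - a‖ ≤ 2 * ε ∧
      (∀ y, ‖g * y - y * g‖ ≤ 4 * ‖a * y - y * a‖) ∧ ∃ k, g = a * k := by
  have hε0 : 0 ≤ ε := (norm_nonneg _).trans h
  have hsp : ∀ t ∈ spectrum ℝ a, |t * t - t| ≤ ε := by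
    intro t ht
    have h1 : a * a - a = cfc (fun x : ℝ => x * x - x) a := by
      rw [cfc_sub (fun x : ℝ => x * x) (fun x => x), cfc_mul (fun x : ℝ => x) (fun x => x),
        cfc_id' ℝ a]
    rw [h1] at h
    have := norm_apply_le_norm_cfc (fun x : ℝ => x * x - x) a ht
    simpa using this.trans h
  let f : ℝ → ℝ := fun t => max 0 (min 1 (4 * t - 3 / 2))
  have hf : Continuous f := by fun_prop
  have hsp2 : ∀ t ∈ spectrum ℝ a, (f t = 0 ∧ t ≤ 1 / 4) ∨ (f t = 1 ∧ 3 / 4 ≤ t) := by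
    intro t ht
    have h1 := hsp t ht
    rw [abs_le] at h1
    rcases le_or_gt t (1 / 2) with h2 | h2
    · left
      have h3 : t ≤ 1 / 4 := by nlinarith
      refine ⟨?_, h3⟩
      simp only [f]
      rw [max_eq_left]
      exact (min_le_right _ _).trans (by linarith)
    · right
      have h3 : 3 / 4 ≤ t := by nlinarith
      refine ⟨?_, h3⟩
      simp only [f]
      rw [min_eq_left (by linarith)]; norm_num
  set g := cfc f a with hg
  have hgs : IsSelfAdjoint g := cfc_predicate f a
  have hgp : IsStarProjection g := by
    refine ⟨?_, hgs⟩
    rw [IsIdempotentElem, hg, ← cfc_mul f f a]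
    apply cfc_congr
    intro t ht
    rcases hsp2 t ht with h | h <;> simp [h.1]
  have hga : ‖g - a‖ ≤ 2 * ε := by
    have h1 : g - a = cfc (fun x : ℝ => f x - x) a := by
      rw [cfc_sub f (fun x => x), cfc_id' ℝ a]
    rw [h1]
    apply norm_cfc_le (by linarith)
    intro t ht
    have h1 := hsp t ht
    rw [Real.norm_eq_abs]
    rw [abs_le] at h1 ⊢
    rcases hsp2 t ht with h | h
    · rw [h.1]; constructor <;> nlinarith [h.2]
    · rw [h.1]; constructor <;> nlinarith [h.2]
  have hcom : Commute g a := Commute.cfc_real (Commute.refl a) f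
  refine ⟨g, hgp, hga, ?_, ?_⟩
  · intro y
    have e2 := hgp.isIdempotentElem.eq
    have f2 := hgp.one_sub.isIdempotentElem.eq
    have gn := hgp.norm_le
    have gn1 := hgp.one_sub.norm_le
    have s1 : ‖(1 - a) * g‖ ≤ 2 * ε := by
      have : (1 - a) * g = g * (g - a) := by rw [mul_sub, e2, sub_mul, one_mul, hcom.eq]
      rw [this]; exact nmulL gn hga
    have s1' : ‖g * (1 - a)‖ ≤ 2 * ε := by
      have : g * (1 - a) = g * (g - a) := by rw [mul_sub, mul_sub, e2, mul_one]
      rw [this]; exact nmulL gn hga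
    have s2 : ‖(1 - g) * a‖ ≤ 2 * ε := by
      have : (1 - g) * a = - ((1 - g) * (g - a)) := by
        rw [mul_sub, hgp.one_sub_mul_self]; abel
      rw [this, norm_neg]; exact nmulL gn1 hga
    have s2' : ‖a * (1 - g)‖ ≤ 2 * ε := by
      have : a * (1 - g) = (1 - g) * a := by rw [mul_sub, sub_mul, hcom.eq, one_mul, mul_one]
      rw [this]; exact s2
    have c1 : a * g = g * a := hcom.eq.symm
    have c2 : a * (1 - g) = (1 - g) * a := by rw [mul_sub, sub_mul, hcom.eq, one_mul, mul_one]
    set K := ‖a * y - y * a‖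
    have b1 : ‖g * y * (1 - g)‖ ≤ 2 * K := by
      have : g * y * (1 - g) = g * (a * y - y * a) * (1 - g)
          + ((1 - a) * g) * (g * y * (1 - g)) + (g * y * (1 - g)) * ((1 - g) * a) := by
        have r1 : ((1 - a) * g) * (g * y * (1 - g)) = (1 - a) * (g * g) * y * (1 - g) := by
          simp only [mul_assoc]
        have r2 : (g * y * (1 - g)) * ((1 - g) * a) = g * y * ((1 - g) * (1 - g)) * a := by
          simp only [mul_assoc]
        have r3 : g * (a * y - y * a) * (1 - g) = a * g * y * (1 - g) - g * y * (1 - g) * a := by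
          rw [c1]
          simp only [mul_assoc]
          rw [← c2]
          noncomm_ring
        rw [r1, r2, r3, e2, f2]; noncomm_ring
      have i1 : ‖g * (a * y - y * a) * (1 - g)‖ ≤ K := nmulR (nmulL gn le_rfl) gn1
      have i2 : ‖((1 - a) * g) * (g * y * (1 - g))‖ ≤ 2 * ε * ‖g * y * (1 - g)‖ := nmul s1 le_rfl
      have i3 : ‖(g * y * (1 - g)) * ((1 - g) * a)‖ ≤ ‖g * y * (1 - g)‖ * (2 * ε) := nmul le_rfl s2
      have i4 := nadd (nadd i1 i2) i3
      rw [← this] at i4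
      have := norm_nonneg (g * y * (1 - g))
      nlinarith
    have b2 : ‖(1 - g) * y * g‖ ≤ 2 * K := by
      have : (1 - g) * y * g = - ((1 - g) * (a * y - y * a) * g)
          + (a * (1 - g)) * ((1 - g) * y * g) + ((1 - g) * y * g) * (g * (1 - a)) := by
        have r1 : (a * (1 - g)) * ((1 - g) * y * g) = a * ((1 - g) * (1 - g)) * y * g := by
          simp only [mul_assoc]
        have r2 : ((1 - g) * y * g) * (g * (1 - a)) = (1 - g) * y * (g * g) * (1 - a) := by
          simp only [mul_assoc]
        have r3 : (1 - g) * (a * y - y * a) * g = a * (1 - g) * y * g - (1 - g) * y * g * a := by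
          rw [c2]
          simp only [mul_assoc]
          rw [← c1]
          noncomm_ring
        rw [r1, r2, r3, e2, f2]; noncomm_ring
      have i1 : ‖-((1 - g) * (a * y - y * a) * g)‖ ≤ K := by
        rw [norm_neg]; exact nmulR (nmulL gn1 le_rfl) gn
      have i2 : ‖(a * (1 - g)) * ((1 - g) * y * g)‖ ≤ 2 * ε * ‖(1 - g) * y * g‖ := nmul s2' le_rfl
      have i3 : ‖((1 - g) * y * g) * (g * (1 - a))‖ ≤ ‖(1 - g) * y * g‖ * (2 * ε) := nmul le_rfl s1'
      have i4 := nadd (nadd i1 i2) i3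
      rw [← this] at i4
      have := norm_nonneg ((1 - g) * y * g)
      nlinarith
    have : g * y - y * g = g * y * (1 - g) - (1 - g) * y * g := by noncomm_ring
    rw [this]
    exact (nsub b1 b2).trans (by linarith)
  · refine ⟨cfc (fun t : ℝ => f t * (max t (1 / 4))⁻¹) a, ?_⟩
    have hk : Continuous (fun t : ℝ => f t * (max t (1 / 4))⁻¹) := by
      refine hf.mul (Continuous.inv₀ (by fun_prop) fun t => ?_)
      have : (0 : ℝ) < max t (1 / 4) := by positivity
      exact this.ne'
    have hm : a * cfc (fun t : ℝ => f t * (max t (1 / 4))⁻¹) a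
        = cfc (fun x => x * (f x * (max x (1 / 4))⁻¹)) a := by
      rw [cfc_mul (fun x : ℝ => x) _ a continuous_id'.continuousOn hk.continuousOn, cfc_id' ℝ a]
    rw [hm, hg]
    apply cfc_congr
    intro t ht
    rcases hsp2 t ht with h | h
    · simp [h.1]
    · simp only [h.1]
      rw [max_eq_left (by linarith [h.2])]
      have : t ≠ 0 := by linarith [h.2]
      field_simp

end ISQ

end PIS

namespace PIS
universe u

section IL

/-- extension by zero of a function on the circle -/
noncomputable def ext0 (g : C(Metric.sphere (0 : ℂ) 1, ℂ)) (z : ℂ) : ℂ :=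
  open Classical in if h : z ∈ Metric.sphere (0 : ℂ) 1 then g ⟨z, h⟩ else 0

lemma ext0_apply (g : C(Metric.sphere (0 : ℂ) 1, ℂ)) {z : ℂ} (h : z ∈ Metric.sphere (0 : ℂ) 1) :
    ext0 g z = g ⟨z, h⟩ := by simp only [ext0, h, dif_pos]

lemma ext0_cont (g : C(Metric.sphere (0 : ℂ) 1, ℂ)) :
    ContinuousOn (ext0 g) (Metric.sphere (0 : ℂ) 1) := by
  rw [continuousOn_iff_continuous_domRestrict]
  have : (Metric.sphere (0 : ℂ) 1).domRestrict (ext0 g) = g := by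
    ext z; exact ext0_apply g z.2
  rw [this]; exact g.continuous

section
variable {D : Type*} [CStarAlgebra D]

lemma spec_sphere {v : D} (hv : v ∈ unitary D) : spectrum ℂ v ⊆ Metric.sphere (0 : ℂ) 1 :=
  spectrum.subset_circle_of_unitary hv

lemma normal_of_unitary {v : D} (hv : v ∈ unitary D) : IsStarNormal v :=
  ⟨by rw [Commute, SemiconjBy, (Unitary.mem_iff.1 hv).1, (Unitary.mem_iff.1 hv).2]⟩

lemma norm_cfc_ext0_le (g : C(Metric.sphere (0 : ℂ) 1, ℂ)) {v : D} (hv : v ∈ unitary D) :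
    ‖cfc (ext0 g) v‖ ≤ ‖g‖ := by
  have := normal_of_unitary hv
  apply norm_cfc_le (norm_nonneg _)
  intro x hx
  rw [ext0_apply g (spec_sphere hv hx)]
  exact g.norm_coe_le_norm _
end

def ILprop.{v} (g : C(Metric.sphere (0 : ℂ) 1, ℂ)) : Prop :=
  ∀ κ > (0 : ℝ), ∃ c > (0 : ℝ), ∀ (D : Type v) [CStarAlgebra D] (a b p : D),
    a ∈ unitary D → b ∈ unitary D → ‖p‖ ≤ 1 → ‖a * p - p * b‖ ≤ c →
    ‖cfc (ext0 g) a * p - p * cfc (ext0 g) b‖ ≤ κ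

lemma IL_all (g : C(Metric.sphere (0 : ℂ) 1, ℂ)) : ILprop.{u} g := by
  induction g using ContinuousMap.induction_on_of_compact with
  | const r =>
    intro κ hκ
    refine ⟨1, one_pos, ?_⟩
    intro D _ a b p ha hb hp h
    have h1 : ∀ v ∈ unitary D, cfc (ext0 (ContinuousMap.const _ r)) v = algebraMap ℂ D r := by
      intro v hv
      have := normal_of_unitary hv
      rw [← cfc_const r v]
      exact cfc_congr fun x hx => by rw [ext0_apply _ (spec_sphere hv hx)]; rfl
    rw [h1 a ha, h1 b hb, Algebra.commutes, sub_self, norm_zero]; exact hκ.le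
  | id =>
    intro κ hκ
    refine ⟨κ, hκ, ?_⟩
    intro D _ a b p ha hb hp h
    have h1 : ∀ v ∈ unitary D, cfc (ext0 (ContinuousMap.restrict _ (.id ℂ))) v = v := by
      intro v hv
      have := normal_of_unitary hv
      nth_rw 2 [← cfc_id ℂ v]
      exact cfc_congr fun x hx => by rw [ext0_apply _ (spec_sphere hv hx)]; rfl
    rw [h1 a ha, h1 b hb]; exact h
  | star_id =>
    intro κ hκ
    refine ⟨κ, hκ, ?_⟩
    intro D _ a b p ha hb hp h
    have h1 : ∀ v ∈ unitary D, cfc (ext0 (star (ContinuousMap.restrict _ (.id ℂ)))) v = star v := by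
      intro v hv
      have := normal_of_unitary hv
      rw [← cfc_star_id (R := ℂ) (a := v)]
      exact cfc_congr fun x hx => by rw [ext0_apply _ (spec_sphere hv hx)]; rfl
    rw [h1 a ha, h1 b hb]
    have : star a * p - p * star b = - (star a * (a * p - p * b) * star b) := by
      rw [mul_sub, sub_mul, ← mul_assoc, (Unitary.mem_iff.1 ha).1, one_mul]
      simp only [mul_assoc, (Unitary.mem_iff.1 hb).2]
      simp
    rw [this, norm_neg]
    exact nmulR (nmulL (by rw [norm_star]; exact norm_unitary_le ha) h)
      (by rw [norm_star]; exact norm_unitary_le hb)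
  | add f g hf hg =>
    intro κ hκ
    obtain ⟨c1, c10, h1⟩ := hf (κ / 2) (by positivity)
    obtain ⟨c2, c20, h2⟩ := hg (κ / 2) (by positivity)
    refine ⟨min c1 c2, lt_min c10 c20, ?_⟩
    intro D _ a b p ha hb hp h
    have e : ∀ v ∈ unitary D, cfc (ext0 (f + g)) v = cfc (ext0 f) v + cfc (ext0 g) v := by
      intro v hv
      have := normal_of_unitary hv
      rw [← cfc_add v (ext0 f) (ext0 g) ((ext0_cont f).mono (spec_sphere hv))
        ((ext0_cont g).mono (spec_sphere hv))]
      exact cfc_congr fun x hx => by simp [ext0_apply _ (spec_sphere hv hx)]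
    rw [e a ha, e b hb]
    have := nadd (h1 D a b p ha hb hp (h.trans (min_le_left _ _)))
      (h2 D a b p ha hb hp (h.trans (min_le_right _ _)))
    convert this using 1
    · congr 1; noncomm_ring
    · ring
  | mul f g hf hg =>
    intro κ hκ
    have hM : 0 < ‖f‖ + ‖g‖ + 1 := by positivity
    obtain ⟨c1, c10, h1⟩ := hf (κ / (2 * (‖f‖ + ‖g‖ + 1))) (by positivity)
    obtain ⟨c2, c20, h2⟩ := hg (κ / (2 * (‖f‖ + ‖g‖ + 1))) (by positivity)
    refine ⟨min c1 c2, lt_min c10 c20, ?_⟩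
    intro D _ a b p ha hb hp h
    have e : ∀ v ∈ unitary D, cfc (ext0 (f * g)) v = cfc (ext0 f) v * cfc (ext0 g) v := by
      intro v hv
      have := normal_of_unitary hv
      rw [← cfc_mul (ext0 f) (ext0 g) v ((ext0_cont f).mono (spec_sphere hv))
        ((ext0_cont g).mono (spec_sphere hv))]
      exact cfc_congr fun x hx => by simp [ext0_apply _ (spec_sphere hv hx)]
    rw [e a ha, e b hb]
    have i1 := nmul (norm_cfc_ext0_le f ha) (h2 D a b p ha hb hp (h.trans (min_le_right _ _)))
    have i2 := nmul (h1 D a b p ha hb hp (h.trans (min_le_left _ _))) (norm_cfc_ext0_le g hb)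
    have := nadd i1 i2
    calc _ = ‖cfc (ext0 f) a * (cfc (ext0 g) a * p - p * cfc (ext0 g) b)
          + (cfc (ext0 f) a * p - p * cfc (ext0 f) b) * cfc (ext0 g) b‖ := by
            congr 1; noncomm_ring
      _ ≤ _ := this
      _ = κ * ((‖f‖ + ‖g‖) / (‖f‖ + ‖g‖ + 1) / 2) := by field_simp
      _ ≤ κ * 1 := by
        apply mul_le_mul_of_nonneg_left _ hκ.le
        have : (‖f‖ + ‖g‖) / (‖f‖ + ‖g‖ + 1) ≤ 1 := by rw [div_le_one hM]; linarith
        linarith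
      _ = κ := mul_one _
  | frequently f hfr =>
    intro κ hκ
    obtain ⟨g, hg, hgd⟩ := (hfr.and_eventually (Metric.ball_mem_nhds f (show 0 < κ / 4 by positivity))).exists
    obtain ⟨c, c0, h1⟩ := hg (κ / 2) (by positivity)
    refine ⟨c, c0, ?_⟩
    intro D _ a b p ha hb hp h
    have e : ∀ v ∈ unitary D, ‖cfc (ext0 f) v - cfc (ext0 g) v‖ ≤ κ / 4 := by
      intro v hv
      have := normal_of_unitary hv
      rw [← cfc_sub (ext0 f) (ext0 g) v ((ext0_cont f).mono (spec_sphere hv))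
        ((ext0_cont g).mono (spec_sphere hv))]
      apply norm_cfc_le (by positivity)
      intro x hx
      rw [ext0_apply _ (spec_sphere hv hx), ext0_apply _ (spec_sphere hv hx), ← dist_eq_norm]
      rw [dist_comm] at hgd
      exact (ContinuousMap.dist_apply_le_dist _).trans hgd.le
    have := nadd (nadd (nmulR (e a ha) hp) (h1 D a b p ha hb hp h))
      (show ‖-(p * (cfc (ext0 f) b - cfc (ext0 g) b))‖ ≤ κ / 4 by
        rw [norm_neg]; exact nmulL hp (e b hb))
    calc _ = _ := by congr 1; noncomm_ring
      _ ≤ _ := this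
      _ = κ := by ring

lemma IL {f : ℂ → ℂ} (hf : ContinuousOn f (Metric.sphere (0 : ℂ) 1)) {κ : ℝ} (hκ : 0 < κ) :
    ∃ c > (0 : ℝ), ∀ (D : Type u) [CStarAlgebra D] (a b p : D),
    a ∈ unitary D → b ∈ unitary D → ‖p‖ ≤ 1 → ‖a * p - p * b‖ ≤ c →
    ‖cfc f a * p - p * cfc f b‖ ≤ κ := by
  obtain ⟨c, c0, h⟩ := IL_all.{u} ⟨(Metric.sphere (0 : ℂ) 1).domRestrict f, hf.domRestrict⟩ κ hκ
  refine ⟨c, c0, ?_⟩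
  intro D _ a b p ha hb hp hh
  have e : ∀ v ∈ unitary D,
      cfc f v = cfc (ext0 ⟨(Metric.sphere (0 : ℂ) 1).domRestrict f, hf.domRestrict⟩) v := by
    intro v hv
    exact cfc_congr fun x hx => by rw [ext0_apply _ (spec_sphere hv hx)]; rfl
  rw [e a ha, e b hb]
  exact h D a b p ha hb hp hh

/-- uniform version over a finite family -/
lemma IL_finset {ι : Type*} (s : Finset ι) {f : ι → ℂ → ℂ}
    (hf : ∀ i ∈ s, ContinuousOn (f i) (Metric.sphere (0 : ℂ) 1)) {κ : ℝ} (hκ : 0 < κ) :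
    ∃ c > (0 : ℝ), ∀ (D : Type u) [CStarAlgebra D] (a b p : D),
    a ∈ unitary D → b ∈ unitary D → ‖p‖ ≤ 1 → ‖a * p - p * b‖ ≤ c →
    ∀ i ∈ s, ‖cfc (f i) a * p - p * cfc (f i) b‖ ≤ κ := by
  classical
  induction s using Finset.induction_on with
  | empty => exact ⟨1, one_pos, by simp⟩
  | insert i s hi ih =>
    obtain ⟨c1, c10, h1⟩ := ih (fun j hj => hf j (Finset.mem_insert_of_mem hj))
    obtain ⟨c2, c20, h2⟩ := IL.{u} (hf i (Finset.mem_insert_self _ _)) hκ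
    refine ⟨min c1 c2, lt_min c10 c20, ?_⟩
    intro D _ a b p ha hb hp h j hj
    rcases Finset.mem_insert.1 hj with rfl | hj
    · exact h2 D a b p ha hb hp (h.trans (min_le_right _ _))
    · exact h1 D a b p ha hb hp (h.trans (min_le_left _ _)) j hj

end IL

section PU

lemma exp_I_sub_le (a b : ℝ) : ‖Complex.exp (a * Complex.I) - Complex.exp (b * Complex.I)‖ ≤ |a - b| := by
  have : Complex.exp (a * Complex.I) - Complex.exp (b * Complex.I)
      = Complex.exp (b * Complex.I) * (Complex.exp (Complex.I * (a - b : ℝ)) - 1) := by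
    rw [mul_sub, ← Complex.exp_add]; push_cast; ring_nf
  rw [this, norm_mul, Complex.norm_exp_ofReal_mul_I, one_mul]
  exact Real.norm_exp_I_mul_ofReal_sub_one_le

lemma PU {mesh : ℝ} (hm : 0 < mesh) : ∃ (G : Finset ℂ) (N : ℕ) (h : ℂ → ℂ → ℝ), 0 < N ∧
    (∀ w ∈ G, w ^ N = 1) ∧ (∀ w ∈ G, ContinuousOn (h w) (Metric.sphere (0 : ℂ) 1)) ∧
    (∀ w z, 0 ≤ h w z) ∧ (∀ z ∈ Metric.sphere (0 : ℂ) 1, ∑ w ∈ G, h w z = 1) ∧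
    (∀ w z, h w z ≠ 0 → ‖z - w‖ < mesh) := by
  obtain ⟨N, hN⟩ := exists_nat_gt (2 * π / mesh)
  have hN0 : (0 : ℝ) < N := lt_of_le_of_lt (by positivity) hN
  have hN' : 2 * π / N < mesh := by
    rw [div_lt_iff₀ hm] at hN; rw [div_lt_iff₀ hN0]; linarith
  let w : ℤ → ℂ := fun k => Complex.exp ((2 * π * k / N : ℝ) * Complex.I)
  let G : Finset ℂ := (Finset.Icc (-(N : ℤ)) N).image w
  let b : ℂ → ℂ → ℝ := fun w z => max 0 (mesh - ‖z - w‖)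
  have hb0 : ∀ w z, 0 ≤ b w z := fun w z => le_max_left _ _
  have hcov : ∀ z ∈ Metric.sphere (0 : ℂ) 1, 0 < ∑ w ∈ G, b w z := by
    intro z hz
    apply Finset.sum_pos' (fun w _ => hb0 w z)
    let α := Complex.arg z
    have hzα : z = Complex.exp (α * Complex.I) := by
      have := Complex.norm_mul_exp_arg_mul_I z
      rw [mem_sphere_zero_iff_norm.1 hz] at this
      simpa using this.symm
    let k := round (α * N / (2 * π))
    have hk := abs_sub_round (α * N / (2 * π))
    have hα : |α| ≤ π := Complex.abs_arg_le_pi z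
    have hpi := Real.pi_pos
    have hα' : |α * N / (2 * π)| ≤ N / 2 := by
      rw [abs_div, abs_mul, abs_of_pos hN0, abs_of_pos (by positivity : 0 < 2 * π),
        div_le_iff₀ (by positivity)]
      nlinarith
    have hNn : (1 : ℝ) ≤ N := by exact_mod_cast (Nat.cast_pos.1 hN0)
    have hkN : |(k : ℝ)| ≤ N := by
      have : (k : ℝ) = α * N / (2 * π) - (α * N / (2 * π) - k) := by ring
      rw [this]
      refine (abs_sub _ _).trans ?_
      linarith
    refine ⟨w k, Finset.mem_image_of_mem _ ?_, ?_⟩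
    · rw [abs_le] at hkN
      rw [Finset.mem_Icc]
      constructor
      · exact_mod_cast hkN.1
      · exact_mod_cast hkN.2
    · apply lt_max_of_lt_right
      rw [sub_pos, hzα]
      refine (exp_I_sub_le _ _).trans_lt ?_
      have e : α - 2 * π * k / N = (2 * π / N) * (α * N / (2 * π) - k) := by field_simp
      rw [e, abs_mul, abs_of_pos (by positivity)]
      have : (2 * π / N) * |α * N / (2 * π) - k| ≤ (2 * π / N) * (1 / 2) :=
        mul_le_mul_of_nonneg_left hk (by positivity)
      have h2 : 0 < 2 * π / N := by positivity
      linarith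
  refine ⟨G, N, fun w z => b w z / ∑ w ∈ G, b w z, by exact_mod_cast hN0, ?_, ?_, ?_, ?_, ?_⟩
  · intro x hx
    obtain ⟨k, -, rfl⟩ := Finset.mem_image.1 hx
    simp only [w]
    rw [← Complex.exp_nat_mul, Complex.exp_eq_one_iff]
    refine ⟨k, ?_⟩
    have : (N : ℂ) ≠ 0 := by exact_mod_cast hN0.ne'
    push_cast
    field_simp
  · intro x hx
    refine ContinuousOn.div (by fun_prop) (by fun_prop) fun z hz => (hcov z hz).ne'
  · intro w z
    exact div_nonneg (hb0 _ _) (Finset.sum_nonneg fun w _ => hb0 w z)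
  · intro z hz
    rw [← Finset.sum_div, div_self (hcov z hz).ne']
  · intro w z h
    have : b w z ≠ 0 := fun h0 => h (by simp [h0])
    by_contra hcon
    push Not at hcon
    exact this (max_eq_left (by linarith))

end PU
end PIS

namespace PIS
universe u
set_option linter.all false

noncomputable instance cmi (κ : Type) [Fintype κ] [DecidableEq κ] (D : Type*) [CStarAlgebra D] :
    CStarAlgebra (CStarMatrix κ κ D) :=
  letI := CStarAlgebra.spectralOrder D
  letI := CStarAlgebra.spectralOrderedRing D
  CStarMatrix.instCStarAlgebra

section Mat
variable {κ : Type} [Fintype κ] [DecidableEq κ] {D : Type*} [CStarAlgebra D]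

lemma cm_entry (M : CStarMatrix κ κ D) (i j : κ) : ‖M i j‖ ≤ ‖M‖ :=
  letI := CStarAlgebra.spectralOrder D
  letI := CStarAlgebra.spectralOrderedRing D
  CStarMatrix.norm_entry_le_norm

lemma cm_sum_apply {ι : Type*} (s : Finset ι) (f : ι → CStarMatrix κ κ D) (i j : κ) :
    (∑ k ∈ s, f k) i j = ∑ k ∈ s, f k i j := by
  classical
  induction s using Finset.induction_on with
  | empty => simp
  | insert a s ha ih => rw [Finset.sum_insert ha, Finset.sum_insert ha, CStarMatrix.add_apply, ih]

noncomputable def dgf (d : κ → D) : CStarMatrix κ κ D :=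
  CStarMatrix.ofMatrix (fun i j => if i = j then d i else 0)

lemma dgf_apply (d : κ → D) (i j : κ) : dgf d i j = if i = j then d i else 0 := rfl

/-- diagonal matrices -/
noncomputable def dgh : (κ → D) →⋆ₐ[ℂ] CStarMatrix κ κ D where
  toFun := dgf
  map_one' := by
    ext i j; simp [CStarMatrix.one_apply, dgf_apply]
  map_mul' a b := by
    ext i j
    rw [CStarMatrix.mul_apply]
    rw [Finset.sum_eq_single i]
    · by_cases h : i = j <;> simp [dgf_apply, h]
    · intro c _ hc; simp [dgf_apply, Ne.symm hc]
    · simp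
  map_zero' := by ext i j; simp [dgf_apply]
  map_add' a b := by
    ext i j; rw [CStarMatrix.add_apply]; by_cases h : i = j <;> simp [h, dgf_apply]
  commutes' r := by
    ext i j
    rw [CStarMatrix.algebraMap_apply]
    simp [dgf_apply]
  map_star' a := by
    ext i j
    rw [CStarMatrix.star_apply]
    by_cases h : i = j
    · simp [h, dgf_apply]
    · simp [h, Ne.symm h, dgf_apply]

lemma dgh_apply (d : κ → D) (i j : κ) : dgh d i j = if i = j then d i else 0 := rfl

lemma norm_dgh_le {d : κ → D} {c : ℝ} (hc : 0 ≤ c) (h : ∀ i, ‖d i‖ ≤ c) : ‖dgh d‖ ≤ c :=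
  (NonUnitalStarAlgHom.norm_apply_le dgh d).trans ((pi_norm_le_iff_of_nonneg hc).2 h)

/-- constant diagonal -/
noncomputable def iot (κ : Type) [Fintype κ] [DecidableEq κ] {D : Type*} [CStarAlgebra D] :
    D →⋆ₐ[ℂ] CStarMatrix κ κ D where
  toFun d := dgh (fun _ => d)
  map_one' := by
    have : (fun _ : κ => (1 : D)) = 1 := rfl
    rw [this, map_one]
  map_mul' a b := by
    rw [← map_mul]; rfl
  map_zero' := by
    have : (fun _ : κ => (0 : D)) = 0 := rfl
    rw [this, map_zero]
  map_add' a b := by rw [← map_add]; rfl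
  commutes' r := by
    rw [← (dgh (κ := κ) (D := D)).toAlgHom.commutes r]; rfl
  map_star' a := by rw [← map_star]; rfl

lemma iot_apply (d : D) (i j : κ) : iot κ d i j = if i = j then d else 0 := rfl

lemma norm_iot_le (d : D) : ‖iot κ d‖ ≤ ‖d‖ := NonUnitalStarAlgHom.norm_apply_le (iot κ) d

noncomputable def muf (M : CStarMatrix κ κ ℂ) : CStarMatrix κ κ D :=
  CStarMatrix.ofMatrix (fun i j => algebraMap ℂ D (M i j))

lemma muf_apply (M : CStarMatrix κ κ ℂ) (i j : κ) :
    (muf M : CStarMatrix κ κ D) i j = algebraMap ℂ D (M i j) := rfl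

/-- scalar matrices -/
noncomputable def mu {κ : Type} [Fintype κ] [DecidableEq κ] {D : Type*} [CStarAlgebra D] :
    CStarMatrix κ κ ℂ →⋆ₐ[ℂ] CStarMatrix κ κ D where
  toFun := muf
  map_one' := by
    ext i j; by_cases h : i = j <;> simp [CStarMatrix.one_apply, h, muf_apply]
  map_mul' a b := by
    ext i j
    rw [CStarMatrix.mul_apply, muf_apply, CStarMatrix.mul_apply]
    simp [muf_apply]
  map_zero' := by ext i j; simp [muf_apply]
  map_add' a b := by ext i j; simp [muf_apply]
  commutes' r := by
    ext i j
    rw [CStarMatrix.algebraMap_apply, muf_apply, CStarMatrix.algebraMap_apply]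
    by_cases h : i = j <;> simp [h]
  map_star' a := by
    ext i j
    rw [CStarMatrix.star_apply, muf_apply, CStarMatrix.star_apply, muf_apply]
    exact algebraMap_star_comm (a j i)

lemma mu_apply (M : CStarMatrix κ κ ℂ) (i j : κ) : (mu M : CStarMatrix κ κ D) i j = algebraMap ℂ D (M i j) := rfl

lemma norm_mu_le (M : CStarMatrix κ κ ℂ) : ‖(mu M : CStarMatrix κ κ D)‖ ≤ ‖M‖ :=
  NonUnitalStarAlgHom.norm_apply_le mu M

lemma mu_iot_apply (M : CStarMatrix κ κ ℂ) (d : D) (i j : κ) : (mu M * iot κ d : CStarMatrix κ κ D) i j = M i j • d := by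
  rw [CStarMatrix.mul_apply]
  simp [mu_apply, iot_apply, Algebra.smul_def]

lemma mu_iot (M : CStarMatrix κ κ ℂ) (d : D) :
    (mu M * iot κ d : CStarMatrix κ κ D) = iot κ d * mu M := by
  ext i j
  rw [mu_iot_apply, CStarMatrix.mul_apply]
  simp [mu_apply, iot_apply, Algebra.smul_def, Algebra.commutes]

lemma mu_comm (M : CStarMatrix κ κ ℂ) (d : D) : Commute (mu M) (iot κ d) := mu_iot M d

/-- matrix units -/
noncomputable def eu (i j : κ) : CStarMatrix κ κ ℂ :=
  CStarMatrix.ofMatrix (fun a b => if a = i ∧ b = j then 1 else 0)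

lemma eu_apply (i j a b : κ) : eu i j a b = if a = i ∧ b = j then 1 else 0 := rfl

lemma eu_mul_same (i j k : κ) : eu i j * eu j k = eu i k := by
  ext a b
  rw [CStarMatrix.mul_apply, Finset.sum_eq_single j]
  · simp only [eu_apply]; by_cases h : a = i <;> by_cases h' : b = k <;> simp [h, h']
  · intro c _ hc; simp [eu_apply, hc]
  · simp

lemma eu_mul_ne (i : κ) {j j' : κ} (h : j ≠ j') (k : κ) : eu i j * eu j' k = 0 := by
  ext a b
  rw [CStarMatrix.mul_apply]
  apply Finset.sum_eq_zero
  intro c _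
  simp only [eu_apply]
  by_cases h1 : c = j
  · subst h1; simp [h]
  · simp [h1]

lemma eu_mul (i j j' k : κ) : eu i j * eu j' k = if j = j' then eu i k else 0 := by
  split_ifs with h
  · subst h; exact eu_mul_same _ _ _
  · exact eu_mul_ne _ h _

lemma star_eu (i j : κ) : star (eu i j) = eu j i := by
  ext a b
  simp only [CStarMatrix.star_apply, eu_apply]
  by_cases h : a = j <;> by_cases h' : b = i <;> simp [h, h']

lemma sum_eu : ∑ i : κ, eu i i = (1 : CStarMatrix κ κ ℂ) := by
  ext a b
  rw [cm_sum_apply, CStarMatrix.one_apply]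
  simp only [eu_apply]
  by_cases h : a = b
  · subst h; simp
  · rw [if_neg h]; apply Finset.sum_eq_zero; intro c _
    rw [if_neg]; rintro ⟨rfl, rfl⟩; exact h rfl

lemma eu_proj (i : κ) : IsStarProjection (eu i i) :=
  ⟨eu_mul_same i i i, star_eu i i⟩

lemma norm_eu_le (i j : κ) : ‖eu i j‖ ≤ 1 :=
  norm_le_one_of_proj (eu_proj j) (by rw [star_eu, eu_mul_same])

lemma cm_decomp (M : CStarMatrix κ κ D) : M = ∑ i, ∑ j, mu (eu i j) * iot κ (M i j) := by
  ext a b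
  simp only [cm_sum_apply, mu_iot_apply, eu_apply]
  rw [Finset.sum_eq_single a, Finset.sum_eq_single b]
  · simp
  · intro c _ hc; simp [Ne.symm hc]
  · simp
  · intro c _ hc; apply Finset.sum_eq_zero; intro d _; simp [Ne.symm hc]
  · simp

lemma norm_cm_le_sum (M : CStarMatrix κ κ D) : ‖M‖ ≤ ∑ i, ∑ j, ‖M i j‖ := by
  conv_lhs => rw [cm_decomp M]
  refine (norm_sum_le _ _).trans (Finset.sum_le_sum fun i _ => ?_)
  refine (norm_sum_le _ _).trans (Finset.sum_le_sum fun j _ => ?_)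
  exact nmulL ((norm_mu_le _).trans (norm_eu_le i j)) (norm_iot_le _)

lemma dgh_eu_comm (f : κ → ℂ) (i : κ) : Commute (dgh f) (eu i i) := by
  ext a b
  rw [CStarMatrix.mul_apply, CStarMatrix.mul_apply]
  simp only [dgh_apply, eu_apply]
  by_cases h : a = i <;> by_cases h' : b = i <;> simp [h, h', Finset.sum_ite_eq]

end Mat

section Phi
variable {κ : Type} [Fintype κ] [DecidableEq κ] {D : Type*} [CStarAlgebra D]
variable {Z : Type} [Fintype Z] [DecidableEq Z]

/-- orthogonal partition of unity by projections -/
structure OP (p : Z → D) : Prop where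
  sa : ∀ z, star (p z) = p z
  mul : ∀ z w, p z * p w = if z = w then p z else 0
  sum : ∑ z, p z = 1

noncomputable def Phi (κ : Type) [Fintype κ] [DecidableEq κ] {p : Z → D} (hp : OP p) :
    (Z → CStarMatrix κ κ ℂ) →⋆ₐ[ℂ] CStarMatrix κ κ D where
  toFun M := ∑ z, mu (M z) * iot κ (p z)
  map_one' := by
    simp only [Pi.one_apply, map_one, one_mul, ← map_sum, hp.sum]
  map_mul' M N := by
    rw [Finset.sum_mul_sum]
    refine Finset.sum_congr rfl fun z _ => ?_
    rw [Finset.sum_eq_single z]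
    · rw [Pi.mul_apply, map_mul]
      calc mu (M z) * mu (N z) * iot κ (p z)
          = mu (M z) * mu (N z) * iot κ (p z * p z) := by rw [hp.mul, if_pos rfl]
        _ = _ := by
          rw [map_mul]
          simp only [mul_assoc]
          rw [← mul_assoc (mu (N z)), mu_iot, mul_assoc, ← mu_iot]
    · intro w _ hw
      rw [mu_iot (N w), mul_assoc, ← mul_assoc (iot κ (p z)), ← map_mul, hp.mul,
        if_neg (Ne.symm hw)]
      simp
    · simp
  map_zero' := by simp
  map_add' M N := by
    rw [← Finset.sum_add_distrib]
    refine Finset.sum_congr rfl fun z _ => ?_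
    rw [Pi.add_apply, map_add, add_mul]
  commutes' r := by
    simp only [Pi.algebraMap_apply, AlgHomClass.commutes]
    rw [← Finset.mul_sum, ← map_sum, hp.sum, map_one, mul_one]
  map_star' M := by
    rw [star_sum]
    refine Finset.sum_congr rfl fun z _ => ?_
    rw [star_mul, ← map_star, ← map_star, hp.sa, mu_iot, Pi.star_apply]

lemma Phi_apply {p : Z → D} (hp : OP p) (M : Z → CStarMatrix κ κ ℂ) :
    Phi κ hp M = ∑ z, mu (M z) * iot κ (p z) := rfl

lemma norm_Phi_le {p : Z → D} (hp : OP p) {M : Z → CStarMatrix κ κ ℂ} {c : ℝ} (hc : 0 ≤ c)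
    (h : ∀ z, ‖M z‖ ≤ c) : ‖Phi κ hp M‖ ≤ c :=
  (NonUnitalStarAlgHom.norm_apply_le (Phi κ hp) M).trans ((pi_norm_le_iff_of_nonneg hc).2 h)

lemma Phi_const {p : Z → D} (hp : OP p) (M : CStarMatrix κ κ ℂ) :
    Phi κ hp (fun _ => M) = mu M := by
  rw [Phi_apply, ← Finset.mul_sum, ← map_sum, hp.sum, map_one, mul_one]

lemma Phi_comm {p : Z → D} (hp : OP p) (M : Z → CStarMatrix κ κ ℂ) {b : D}
    (hb : ∀ z, Commute (p z) b) : Commute (Phi κ hp M) (iot κ b) := by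
  rw [Phi_apply]
  refine Commute.sum_left _ _ _ fun z _ => Commute.mul_left (mu_comm _ _) ?_
  exact (hb z).map (iot κ)

lemma Phi_scalar {p : Z → D} (hp : OP p) (f : Z → ℂ) :
    Phi κ hp (fun z => f z • 1) = iot κ (∑ z, f z • p z) := by
  rw [Phi_apply, map_sum]
  refine Finset.sum_congr rfl fun z _ => ?_
  rw [map_smul, map_smul, map_one, smul_mul_assoc, one_mul]

end Phi

section Spec
variable {D : Type*} [CStarAlgebra D]

/-- spectral projection -/
noncomputable def spr (a : D) (z : ℂ) : D := cfc (fun w : ℂ => if w = z then (1 : ℂ) else 0) a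

variable {a : D} (ha : a ∈ unitary D) {Z : Finset ℂ} (hZ : spectrum ℂ a ⊆ Z)
include ha hZ

lemma spr_cont (f : ℂ → ℂ) : ContinuousOn f (spectrum ℂ a) := by
  have hfin : (spectrum ℂ a).Finite := Z.finite_toSet.subset hZ
  have : DiscreteTopology (spectrum ℂ a) := by
    have : Finite (spectrum ℂ a) := hfin
    infer_instance
  rw [continuousOn_iff_continuous_domRestrict]
  exact continuous_of_discreteTopology

lemma spr_sum (f : ℂ → ℂ) : cfc f a = ∑ z : Z, f z • spr a z := by
  have := normal_of_unitary ha
  have h1 : ∀ z : Z, f z • spr a z = cfc (fun w : ℂ => f z • (if w = (z : ℂ) then (1 : ℂ) else 0)) a := by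
    intro z
    rw [spr, cfc_smul (f z) _ a (spr_cont ha hZ _)]
  simp only [h1]
  rw [← cfc_sum _ a Finset.univ (fun z _ => spr_cont ha hZ _)]
  apply cfc_congr
  intro w hw
  have hwZ : w ∈ Z := hZ hw
  simp only [Finset.sum_apply]
  rw [Finset.sum_eq_single (⟨w, hwZ⟩ : Z)]
  · simp
  · intro b _ hb
    have : w ≠ b := fun h => hb (Subtype.ext h.symm)
    simp [this]
  · simp

lemma spr_OP : OP (fun z : Z => spr a z) := by
  have := normal_of_unitary ha
  refine ⟨?_, ?_, ?_⟩
  · intro z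
    rw [spr, ← cfc_star]
    apply cfc_congr
    intro w _
    by_cases h : w = z <;> simp [h]
  · intro z w
    rw [spr, spr, ← cfc_mul _ _ a (spr_cont ha hZ _) (spr_cont ha hZ _)]
    by_cases h : z = w
    · subst h
      rw [if_pos rfl]
      apply cfc_congr
      intro x _
      by_cases h : x = z <;> simp [h]
    · rw [if_neg h, ← cfc_const_zero ℂ a]
      apply cfc_congr
      intro x _
      by_cases h1 : x = z
      · have : (z : ℂ) ≠ w := fun h' => h (Subtype.ext h')
        simp [h1, this]
      · simp [h1]
  · have := spr_sum ha hZ (fun _ => 1)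
    rw [cfc_const_one ℂ a] at this
    simp only [one_smul] at this
    exact this.symm

omit hZ in
lemma spr_comm {b : D} (hb : Commute a b) (z : ℂ) : Commute (spr a z) b := by
  have := normal_of_unitary ha
  have h2 : Commute (star a) b := by
    have e1 := (Unitary.mem_iff.1 ha).1
    have e2 := (Unitary.mem_iff.1 ha).2
    have : star a * b = star a * (b * a) * star a := by
      rw [mul_assoc, mul_assoc, e2, mul_one]
    rw [Commute, SemiconjBy, this, ← hb.eq, ← mul_assoc, e1, one_mul]
  exact Commute.cfc hb h2 _

end Spec

/-- finite order implies finite spectrum -/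
lemma spec_finite_order {D : Type*} [CStarAlgebra D] {a : D} {N : ℕ} (hN : 0 < N) (h : a ^ N = 1) :
    ∃ Z : Finset ℂ, spectrum ℂ a ⊆ Z ∧ ∀ z ∈ Z, z ^ N = 1 := by
  refine ⟨(Polynomial.nthRoots N (1 : ℂ)).toFinset, ?_, ?_⟩
  · intro z hz
    simp only [Finset.mem_coe, Multiset.mem_toFinset]
    rw [Polynomial.mem_nthRoots hN]
    have h1 := spectrum.pow_image_subset (𝕜 := ℂ) a N ⟨z, hz, rfl⟩
    rw [h] at h1
    have : Nontrivial D := by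
      by_contra hn
      rw [not_nontrivial_iff_subsingleton] at hn
      have : spectrum ℂ a = ∅ := spectrum.of_subsingleton a
      rw [this] at hz; exact hz
    simpa using h1
  · intro z hz
    rw [Multiset.mem_toFinset, Polynomial.mem_nthRoots hN] at hz
    exact hz

lemma sphere_of_pow {z : ℂ} {N : ℕ} (hN : 0 < N) (h : z ^ N = 1) : z ∈ Metric.sphere (0 : ℂ) 1 := by
  rw [mem_sphere_zero_iff_norm]
  exact Complex.norm_eq_one_of_pow_eq_one h hN.ne'

lemma EQ {mesh e : ℝ} (hm : 0 < mesh) (he : 0 < e) : ∃ c > (0 : ℝ),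
    ∀ (D : Type u) [CStarAlgebra D] (a P : D) (ha : a ∈ unitary D) (_ : ‖P‖ ≤ 1)
      (_ : ‖a * P - P * a‖ ≤ c) (Z : Finset ℂ) (hZ : spectrum ℂ a ⊆ Z)
      (_ : ∀ z ∈ Z, z ∈ Metric.sphere (0 : ℂ) 1)
      (κ : Type) [Fintype κ] [DecidableEq κ] (M : ℂ → CStarMatrix κ κ ℂ)
      (_ : ∀ z, ‖M z‖ ≤ 1)
      (_ : ∀ z ∈ Metric.sphere (0 : ℂ) 1, ∀ w ∈ Metric.sphere (0 : ℂ) 1, ‖z - w‖ < mesh →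
        ‖M z - M w‖ ≤ e),
      ‖iot κ P * Phi κ (spr_OP ha hZ) (fun z => M z) - Phi κ (spr_OP ha hZ) (fun z => M z) * iot κ P‖
        ≤ 3 * e := by
  obtain ⟨G, N, h, hN, hG, hcont, hpos, hsum, hsupp⟩ := PU hm
  have hc : ∀ w ∈ G, ContinuousOn (fun z => (h w z : ℂ)) (Metric.sphere (0 : ℂ) 1) := fun w hw =>
    Complex.continuous_ofReal.comp_continuousOn (hcont w hw)
  obtain ⟨c, c0, hIL⟩ := IL_finset.{u} G hc (show 0 < e / (G.card + 1) by positivity)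
  refine ⟨c, c0, ?_⟩
  intro D _ a P ha hP haP Z hZ hZs κ _ _ M hM1 hM
  set Φ := Phi κ (spr_OP ha hZ)
  set X := Φ (fun z => M z) with hX
  let Y : CStarMatrix κ κ D := ∑ w ∈ G, mu (M w) * iot κ (cfc (fun z => (h w z : ℂ)) a)
  have hY : Y = Φ (fun z : Z => ∑ w ∈ G, (h w z : ℂ) • M w) := by
    have : (fun z : Z => ∑ w ∈ G, (h w z : ℂ) • M w)
        = ∑ w ∈ G, (fun _ : Z => M w) * (fun z : Z => (h w z : ℂ) • (1 : CStarMatrix κ κ ℂ)) := by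
      ext1 z
      simp [Finset.sum_apply]
    rw [this, map_sum]
    refine Finset.sum_congr rfl fun w _ => ?_
    rw [map_mul, Phi_const, Phi_scalar (spr_OP ha hZ) (fun z : Z => (h w z : ℂ)), spr_sum ha hZ]
  have hXY : ‖X - Y‖ ≤ e := by
    rw [hY, hX, ← map_sub]
    apply norm_Phi_le _ he.le
    intro z
    have hz := hZs z z.2
    have h1 : M z = ∑ w ∈ G, (h w z : ℂ) • M z := by
      rw [← Finset.sum_smul, ← Complex.ofReal_sum, hsum z hz]; simp
    rw [Pi.sub_apply, h1, ← Finset.sum_sub_distrib]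
    calc ‖∑ w ∈ G, ((h w z : ℂ) • M z - (h w z : ℂ) • M w)‖ ≤ ∑ w ∈ G, h w z * e := by
          refine (norm_sum_le _ _).trans (Finset.sum_le_sum fun w hw => ?_)
          rw [← smul_sub, norm_smul, Complex.norm_real, Real.norm_of_nonneg (hpos w z)]
          by_cases h0 : h w z = 0
          · rw [h0]; simp
          · exact mul_le_mul_of_nonneg_left
              (hM z hz w (sphere_of_pow hN (hG w hw)) (hsupp w z h0)) (hpos w z)
      _ = e := by rw [← Finset.sum_mul, hsum z hz, one_mul]
  have hPY : ‖iot κ P * Y - Y * iot κ P‖ ≤ e := by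
    have : iot κ P * Y - Y * iot κ P = ∑ w ∈ G, - (mu (M w) *
        iot κ (cfc (fun z => (h w z : ℂ)) a * P - P * cfc (fun z => (h w z : ℂ)) a)) := by
      rw [Finset.mul_sum, Finset.sum_mul, ← Finset.sum_sub_distrib]
      refine Finset.sum_congr rfl fun w _ => ?_
      rw [← mul_assoc, ← mu_iot, map_sub, map_mul, map_mul]
      noncomm_ring
    rw [this]
    refine (norm_sum_le _ _).trans ?_
    calc _ ≤ ∑ w ∈ G, e / (G.card + 1) := by
          refine Finset.sum_le_sum fun w hw => ?_
          rw [norm_neg]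
          exact nmulL ((norm_mu_le _).trans (hM1 w))
            ((norm_iot_le _).trans (hIL D a a P ha ha hP haP w hw))
      _ = e * (G.card / (G.card + 1)) := by
          rw [Finset.sum_const, nsmul_eq_mul]; field_simp
      _ ≤ e * 1 := by
          apply mul_le_mul_of_nonneg_left _ he.le
          rw [div_le_one (by positivity)]; linarith
      _ = e := mul_one e
  have hP' : ‖iot κ P‖ ≤ 1 := (norm_iot_le P).trans hP
  have : iot κ P * X - X * iot κ P = iot κ P * (X - Y) + (iot κ P * Y - Y * iot κ P)
      - (X - Y) * iot κ P := by noncomm_ring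
  rw [this]
  exact (nsub (nadd (nmulL hP' hXY) hPY) (nmulR hXY hP')).trans (by linarith)

end PIS

namespace PIS
universe u
set_option linter.all false

section Perm
variable {κ : Type} [Fintype κ] [DecidableEq κ]

noncomputable def pm (ρ : Equiv.Perm κ) : CStarMatrix κ κ ℂ :=
  CStarMatrix.ofMatrix (fun i j => if i = ρ j then 1 else 0)

lemma pm_apply (ρ : Equiv.Perm κ) (i j : κ) : pm ρ i j = if i = ρ j then 1 else 0 := rfl

lemma pm_mul (ρ σ : Equiv.Perm κ) : pm (ρ * σ) = pm ρ * pm σ := by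
  ext i j
  rw [CStarMatrix.mul_apply, Finset.sum_eq_single (σ j)]
  · by_cases h : i = ρ (σ j) <;> simp [pm_apply, h]
  · intro c _ hc; simp [pm_apply, hc]
  · simp

lemma pm_one : pm (1 : Equiv.Perm κ) = 1 := by
  ext i j
  by_cases h : i = j <;> simp [pm_apply, CStarMatrix.one_apply, h]

lemma star_pm (ρ : Equiv.Perm κ) : star (pm ρ) = pm ρ⁻¹ := by
  ext i j
  rw [CStarMatrix.star_apply, pm_apply, pm_apply]
  by_cases h : j = ρ i
  · rw [if_pos h, if_pos (by rw [h]; simp)]; simp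
  · rw [if_neg h, if_neg (by rintro rfl; exact h (by simp))]; simp

lemma pm_unitary (ρ : Equiv.Perm κ) : pm ρ ∈ unitary (CStarMatrix κ κ ℂ) := by
  rw [Unitary.mem_iff, star_pm, ← pm_mul, ← pm_mul]
  simp [pm_one]

lemma pm_dgh (ρ : Equiv.Perm κ) (f : κ → ℂ) : pm ρ * dgh (fun k => f (ρ k)) = dgh f * pm ρ := by
  ext i j
  rw [CStarMatrix.mul_apply, CStarMatrix.mul_apply, Finset.sum_eq_single j, Finset.sum_eq_single i]
  · by_cases h : i = ρ j <;> simp [pm_apply, dgh_apply, h]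
  · intro c _ hc; simp [dgh_apply, Ne.symm hc]
  · simp
  · intro c _ hc; simp [dgh_apply, hc]
  · simp

lemma pm_eu {ρ : Equiv.Perm κ} {k : κ} (h : ρ k = k) : pm ρ * eu k k = eu k k := by
  ext i j
  rw [CStarMatrix.mul_apply, Finset.sum_eq_single k]
  · by_cases h1 : i = k <;> by_cases h2 : j = k <;> simp [pm_apply, eu_apply, h, h1, h2]
  · intro c _ hc; simp [eu_apply, hc]
  · simp

/-- path from one to an involution -/
noncomputable def br (t : ℝ) (ρ : Equiv.Perm κ) : CStarMatrix κ κ ℂ :=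
  ((1 + Complex.exp ((π * t : ℝ) * Complex.I)) / 2) • 1
    + ((1 - Complex.exp ((π * t : ℝ) * Complex.I)) / 2) • pm ρ

lemma br_zero (ρ : Equiv.Perm κ) : br 0 ρ = 1 := by
  simp [br]

lemma br_one (ρ : Equiv.Perm κ) : br 1 ρ = pm ρ := by
  simp [br, Complex.exp_pi_mul_I]

lemma br_unitary (t : ℝ) {ρ : Equiv.Perm κ} (h : ρ * ρ = 1) :
    br t ρ ∈ unitary (CStarMatrix κ κ ℂ) := by
  have hi : ρ⁻¹ = ρ := inv_eq_of_mul_eq_one_left h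
  have hp : pm ρ * pm ρ = 1 := by rw [← pm_mul, h, pm_one]
  set E := Complex.exp ((π * t : ℝ) * Complex.I) with hE
  have hn : star E * E = 1 := by
    have : ‖E‖ = 1 := Complex.norm_exp_ofReal_mul_I _
    rw [Complex.star_def, ← Complex.normSq_eq_conj_mul_self, Complex.normSq_eq_norm_sq, this]; simp
  have hn' : (starRingEnd ℂ) E * E = 1 := hn
  rw [Unitary.mem_iff]
  have hs : star (br t ρ) = ((1 + star E) / 2) • 1 + ((1 - star E) / 2) • pm ρ := by
    rw [br, star_add, star_smul, star_smul, star_pm, hi, star_one]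
    rw [← hE]
    simp only [star_div₀, star_add, star_sub, star_one, star_ofNat]
  have e1 : (1 + star E) / 2 * ((1 + E) / 2) + (1 - star E) / 2 * ((1 - E) / 2) = 1 := by
    linear_combination (1 / 2) * hn
  have e2 : (1 + star E) / 2 * ((1 - E) / 2) + (1 - star E) / 2 * ((1 + E) / 2) = 0 := by
    linear_combination (-1 / 2) * hn
  have e3 : (1 + E) / 2 * ((1 + star E) / 2) + (1 - E) / 2 * ((1 - star E) / 2) = 1 := by
    linear_combination (1 / 2) * hn
  have e4 : (1 + E) / 2 * ((1 - star E) / 2) + (1 - E) / 2 * ((1 + star E) / 2) = 0 := by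
    linear_combination (-1 / 2) * hn
  have key : ∀ a b c d : ℂ, (a • (1 : CStarMatrix κ κ ℂ) + b • pm ρ) * (c • 1 + d • pm ρ)
      = (a * c + b * d) • 1 + (a * d + b * c) • pm ρ := by
    intro a b c d
    rw [add_mul, mul_add, mul_add]
    simp only [smul_mul_assoc, mul_smul_comm, one_mul, mul_one, hp, smul_smul, add_smul]
    rw [mul_comm c a, mul_comm d a, mul_comm c b, mul_comm d b]
    abel
  constructor
  · rw [hs, br, ← hE, key, e1, e2]; simp
  · rw [hs, br, ← hE, key, e3, e4]; simp

lemma br_lip (t t' : ℝ) (ρ : Equiv.Perm κ) : ‖br t ρ - br t' ρ‖ ≤ π * |t - t'| := by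
  set E := Complex.exp ((π * t : ℝ) * Complex.I) with hE
  set E' := Complex.exp ((π * t' : ℝ) * Complex.I) with hE'
  have : br t ρ - br t' ρ = ((E - E') / 2) • (1 - pm ρ) := by
    rw [br, br, ← hE, ← hE', smul_sub]
    module
  rw [this, norm_smul]
  have h1 : ‖E - E'‖ ≤ π * |t - t'| := by
    refine (exp_I_sub_le _ _).trans_eq ?_
    rw [← mul_sub, abs_mul, abs_of_pos Real.pi_pos]
  have h2 : ‖(1 : CStarMatrix κ κ ℂ) - pm ρ‖ ≤ 1 + 1 :=
    nsub norm_one_le (norm_unitary_le (pm_unitary ρ))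
  rw [norm_div, Complex.norm_ofNat]
  nlinarith [norm_nonneg (E - E')]

lemma br_eu {ρ : Equiv.Perm κ} {k : κ} (h : ρ k = k) (t : ℝ) : br t ρ * eu k k = eu k k := by
  rw [br, add_mul, smul_mul_assoc, smul_mul_assoc, pm_eu h, one_mul, ← add_smul]
  have : (1 + Complex.exp ((π * t : ℝ) * Complex.I)) / 2 + (1 - Complex.exp ((π * t : ℝ) * Complex.I)) / 2
    = 1 := by ring
  rw [this, one_smul]

lemma br_comm {ρ : Equiv.Perm κ} {f : κ → ℂ} (h : ∀ k, f (ρ k) = f k) (t : ℝ) :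
    Commute (br t ρ) (dgh f) := by
  have := pm_dgh ρ f
  simp only [h] at this
  exact ((Commute.one_left _).smul_left _).add_left (Commute.smul_left this _)

lemma br_comm_norm {ρ : Equiv.Perm κ} {f : κ → ℂ} {c : ℝ} (hc : 0 ≤ c) (h : ∀ k, ‖f (ρ k) - f k‖ ≤ c)
    (t : ℝ) : ‖br t ρ * dgh f - dgh f * br t ρ‖ ≤ c := by
  have e : br t ρ * dgh f - dgh f * br t ρ = - (((1 - Complex.exp ((π * t : ℝ) * Complex.I)) / 2) •
      (pm ρ * dgh (fun k => f (ρ k) - f k))) := by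
    have : (dgh (fun k => f (ρ k) - f k) : CStarMatrix κ κ ℂ) = dgh (fun k => f (ρ k)) - dgh f := by
      rw [← map_sub]; rfl
    rw [this, mul_sub, pm_dgh, br]
    simp only [add_mul, mul_add, smul_mul_assoc, mul_smul_comm, one_mul, mul_one, smul_sub]
    abel
  rw [e, norm_neg, norm_smul]
  have h1 : ‖(1 - Complex.exp ((π * t : ℝ) * Complex.I)) / 2‖ ≤ 1 := by
    rw [norm_div, Complex.norm_ofNat, div_le_one (by norm_num)]
    refine (norm_sub_le _ _).trans ?_
    rw [Complex.norm_exp_ofReal_mul_I, norm_one]; norm_num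
  have h2 : ‖pm ρ * dgh (fun k => f (ρ k) - f k)‖ ≤ c :=
    nmulL (norm_unitary_le (pm_unitary ρ)) (norm_dgh_le hc h)
  nlinarith [norm_nonneg (pm ρ * dgh (fun k => f (ρ k) - f k))]

lemma perm_comm {ρ : Equiv.Perm κ} {f : κ → ℂ} (h : ∀ k, f (ρ k) = f k) :
    Commute (pm ρ) (dgh f) := by
  have := pm_dgh ρ f
  simp only [h] at this
  exact this

end Perm
end PIS

namespace PIS
universe u
set_option linter.all false

section Pump
/-- sites -/
abbrev Kp (s M : ℕ) : Type := Option (ZMod s × Bool × ZMod (M + 1))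

variable {s M : ℕ}

def fA (k : ZMod s) : Kp s M → Kp s M
  | none => none
  | some (l, b, i) => if l = k ∧ i ≠ 0 then some (l, !b, i) else some (l, b, i)

def fB (k : ZMod s) : Kp s M → Kp s M
  | none => none
  | some (l, true, j) => if l = k ∧ j + 1 ≠ 0 then some (l, false, j + 1) else some (l, true, j)
  | some (l, false, i) => if l = k ∧ i ≠ 0 then some (l, true, i - 1) else some (l, false, i)

def f1 (k : ZMod s) : Kp s M → Kp s M
  | none => none
  | some (l, b, i) => if l = k then some (l, b, -i) else some (l, b, i)

def f2 (k : ZMod s) : Kp s M → Kp s M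
  | none => some (k, false, -1)
  | some (l, true, j) => if l = k then some (l, true, 1 - j) else some (l, true, j)
  | some (l, false, i) => if l = k ∧ i ≠ 0 then
      (if i = -1 then none else some (l, false, -1 - i)) else some (l, false, i)

lemma fA_inv (k : ZMod s) : Function.Involutive (fA (M := M) k) := by
  rintro (_ | ⟨l, b, i⟩)
  · rfl
  · by_cases h : l = k ∧ i ≠ 0 <;> simp [fA, h]

lemma fB_inv (k : ZMod s) : Function.Involutive (fB (M := M) k) := by
  rintro (_ | ⟨l, b | b, i⟩)
  · rfl
  · by_cases h : l = k ∧ i ≠ 0 <;> simp [fB, h]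
  · by_cases h : l = k ∧ i + 1 ≠ 0 <;> simp [fB, h]

lemma f1_inv (k : ZMod s) : Function.Involutive (f1 (M := M) k) := by
  rintro (_ | ⟨l, b, i⟩)
  · rfl
  · by_cases h : l = k <;> simp [f1, h]


lemma neg_one_ne  (hM : 1 ≤ M) : (-1 : ZMod (M + 1)) ≠ 0 := by
  have : Fact (1 < M + 1) := ⟨by omega⟩
  exact neg_ne_zero.2 one_ne_zero

lemma f2_inv  (hM : 1 ≤ M) (k : ZMod s) : Function.Involutive (f2 (M := M) k) := by
  have h1 := neg_one_ne hM
  rintro (_ | ⟨l, b | b, i⟩)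
  · simp [f2, h1]
  · by_cases h : l = k ∧ i ≠ 0
    · by_cases h2 : i = -1
      · simp [f2, h, h2, h1]
      · have h3 : -1 - i ≠ 0 := fun h => h2 (by linear_combination -h)
        have h4 : -1 - i ≠ -1 := fun h' => h.2 (by linear_combination -h')
        simp [f2, h, h2, h3]
    · simp [f2, h]
  · by_cases h : l = k <;> simp [f2, h]

def rA (k : ZMod s) : Equiv.Perm (Kp s M) := (fA_inv k).toPerm
def rB (k : ZMod s) : Equiv.Perm (Kp s M) := (fB_inv k).toPerm
def r1 (k : ZMod s) : Equiv.Perm (Kp s M) := (f1_inv k).toPerm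
def r2 (hM : 1 ≤ M) (k : ZMod s) : Equiv.Perm (Kp s M) := (f2_inv hM k).toPerm
def sg (k : ZMod s) : Equiv.Perm (Kp s M) := Equiv.swap none (some (k, true, 0))
def ta (k : ZMod s) : Equiv.Perm (Kp s M) := Equiv.swap (some (k, true, -1)) (some (k + 1, true, 0))

lemma rA_sq (k : ZMod s) : rA (M := M) k * rA k = 1 := Equiv.ext (fA_inv k)
lemma rB_sq (k : ZMod s) : rB (M := M) k * rB k = 1 := Equiv.ext (fB_inv k)
lemma r1_sq (k : ZMod s) : r1 (M := M) k * r1 k = 1 := Equiv.ext (f1_inv k)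
lemma r2_sq  (hM : 1 ≤ M) (k : ZMod s) : r2 (M := M) hM k * r2 hM k = 1 := Equiv.ext (f2_inv hM k)
lemma sg_sq (k : ZMod s) : sg (M := M) k * sg k = 1 := Equiv.swap_mul_self _ _
lemma ta_sq (k : ZMod s) : ta (M := M) k * ta k = 1 := Equiv.swap_mul_self _ _

lemma pump_id  (hM : 1 ≤ M) (k : ZMod s) :
    rB (M := M) k * (rA k * (sg k * (r2 hM k * r1 k))) = Equiv.swap none (some (k, true, -1)) := by
  have h1 := neg_one_ne hM
  apply Equiv.ext
  intro p
  simp only [Equiv.Perm.mul_apply]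
  show fB k (fA k (Equiv.swap none (some (k, true, 0)) (f2 k (f1 k p)))) = _
  rcases p with (_ | ⟨l, b | b, i⟩)
  · simp only [f1, f2, Equiv.swap_apply_left]
    rw [Equiv.swap_apply_of_ne_of_ne (by simp) (by simp)]
    simp [fA, fB, h1]
  · rw [Equiv.swap_apply_of_ne_of_ne (a := none) (b := some (k, true, -1)) (by simp) (by simp)]
    by_cases h : l = k
    · subst h
      by_cases h2 : i = 0
      · subst h2
        simp only [f1, f2, if_true]
        rw [if_neg (by simp), Equiv.swap_apply_of_ne_of_ne (by simp) (by simp)]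
        simp [fA, fB]
      · by_cases h3 : i = 1
        · subst h3
          simp [f1, f2, h2, fA, fB]
        · have h4 : -i ≠ -1 := fun h => h3 (neg_injective h)
          simp only [f1, f2, if_true]
          rw [if_pos ⟨trivial, neg_ne_zero.2 h2⟩, if_neg h4,
            Equiv.swap_apply_of_ne_of_ne (by simp) (by simp)]
          have h5 : -1 - -i ≠ 0 := fun h => h3 (by linear_combination h)
          have h6 : -1 - -i + 1 = i := by ring
          simp only [fA]
          rw [if_pos ⟨trivial, h5⟩]
          simp only [Bool.not_false, fB]
          rw [h6, if_pos ⟨trivial, h2⟩]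
    · simp only [f1, f2, h, if_false, false_and]
      rw [Equiv.swap_apply_of_ne_of_ne (by simp) (by simp)]
      simp [fA, fB, h]
  · by_cases h : l = k
    · subst h
      by_cases h2 : i = -1
      · subst h2
        rw [Equiv.swap_apply_right]
        simp [f1, f2, fA, fB]
      · rw [Equiv.swap_apply_of_ne_of_ne (a := none) (b := some (l, true, -1)) (by simp) (by simp [h2])]
        have h3 : 1 - -i ≠ 0 := fun h => h2 (by linear_combination h)
        simp only [f1, f2, if_true]
        rw [Equiv.swap_apply_of_ne_of_ne (by simp) (by simp only [ne_eq, Option.some.injEq, Prod.mk.injEq, true_and]; exact h3)]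
        simp only [fA]
        rw [if_pos ⟨trivial, h3⟩]
        simp only [Bool.not_true, fB]
        rw [if_pos ⟨trivial, h3⟩]
        congr 3; ring
    · rw [Equiv.swap_apply_of_ne_of_ne (a := none) (b := some (k, true, -1)) (by simp) (by simp [h])]
      simp only [f1, f2, h, if_false]
      rw [Equiv.swap_apply_of_ne_of_ne (by simp) (by simp [h])]
      simp [fA, fB, h]

lemma tau_conj (k : ZMod s) (hs : 2 ≤ s) :
    ta (M := M) k * (Equiv.swap none (some (k, true, -1)) * ta k) = sg (k + 1) := by
  have h1 : (some (k, true, -1) : Kp s M) ≠ some (k + 1, true, 0) := by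
    have : Fact (1 < s) := ⟨hs⟩
    intro h
    simp at h
  have := Equiv.swap_apply_apply (ta k) (none : Kp s M) (some (k, true, -1))
  rw [← mul_assoc]
  have h2 : (ta (M := M) k)⁻¹ = ta k := inv_eq_of_mul_eq_one_left (ta_sq k)
  rw [h2] at this
  rw [← this, sg, ta, Equiv.swap_apply_left, Equiv.swap_apply_of_ne_of_ne (by simp) (by simp)]

def Cs : Kp s M → Prop
  | none => False
  | some (l, b, i) => b = false ∧ i ≠ 0

instance : DecidablePred (Cs (s := s) (M := M)) := by
  rintro (_ | ⟨l, b, i⟩)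
  · exact instDecidableFalse
  · exact (inferInstance : Decidable (b = false ∧ i ≠ 0))

noncomputable def ch : Kp s M → ℂ := fun p => if p = none ∨ Cs p then 1 else 0

lemma r1_ch (k : ZMod s) (p : Kp s M) : ch (r1 k p) = ch p := by
  show ch (f1 k p) = ch p
  rcases p with (_ | ⟨l, b, i⟩)
  · rfl
  · by_cases h : l = k <;> simp [f1, h, ch, Cs]

lemma r2_ch  (hM : 1 ≤ M) (k : ZMod s) (p : Kp s M) : ch (r2 hM k p) = ch p := by
  have h1 := neg_one_ne hM
  show ch (f2 k p) = ch p
  rcases p with (_ | ⟨l, b | b, i⟩)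
  · simp [f2, ch, Cs, h1]
  · by_cases h : l = k ∧ i ≠ 0
    · by_cases h2 : i = -1
      · simp [f2, h, h2, h1, ch, Cs]
      · have h3 : -1 - i ≠ 0 := fun h => h2 (by linear_combination -h)
        simp only [f2, h, h2, if_false]
        simp [ch, Cs, h3, h]
    · simp only [f2, h, if_false]
  · by_cases h : l = k <;> simp [f2, h, ch, Cs]

noncomputable def xs [NeZero s] : Kp s M → ℂ
  | none => 1
  | some (l, b, i) => (ZMod.toCircle l : ℂ) * Complex.exp ((2 * π * (i.val / (s * M)) : ℝ) * Complex.I)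

lemma toCirc [NeZero s] (j : ℤ) : ((ZMod.toCircle (j : ZMod s) : Circle) : ℂ) = Complex.exp ((2 * π * (j / s) : ℝ) * Complex.I) := by
  rw [ZMod.toCircle_intCast]
  congr 1
  push_cast
  ring

lemma rA_xs [NeZero s] (k : ZMod s) (p : Kp s M) : xs (rA k p) = xs p := by
  show xs (fA k p) = xs p
  rcases p with (_ | ⟨l, b, i⟩)
  · rfl
  · by_cases h : l = k ∧ i ≠ 0 <;> simp [fA, h, xs]

lemma ta_xs [NeZero s] (hM : 1 ≤ M) (k : ZMod s) (p : Kp s M) : xs (ta k p) = xs p := by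
  have hs : (s : ℝ) ≠ 0 := by exact_mod_cast NeZero.ne s
  have hM' : (M : ℝ) ≠ 0 := by exact_mod_cast (by omega : M ≠ 0)
  have key : xs (some (k, true, -1) : Kp s M) = xs (some (k + 1, true, 0) : Kp s M) := by
    simp only [xs]
    rw [AddChar.map_add_eq_mul]
    have e1 : ((-1 : ZMod (M + 1)).val) = M := ZMod.val_neg_one M
    have e2 : ((ZMod.toCircle (1 : ZMod s) : Circle) : ℂ) = Complex.exp ((2 * π * (1 / s) : ℝ) * Complex.I) := by
      have := toCirc (s := s) 1
      simpa using this
    rw [e1, Circle.coe_mul, e2, ZMod.val_zero]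
    have e3 : (M : ℝ) / (s * M) = 1 / s := by field_simp
    rw [e3]; simp
  rw [ta]
  by_cases h1 : p = some (k, true, -1)
  · rw [h1, Equiv.swap_apply_left, key]
  · by_cases h2 : p = some (k + 1, true, 0)
    · rw [h2, Equiv.swap_apply_right, key]
    · rw [Equiv.swap_apply_of_ne_of_ne h1 h2]

lemma rB_xs [NeZero s] (hM : 1 ≤ M) (k : ZMod s) (p : Kp s M) : ‖xs (rB k p) - xs p‖ ≤ 2 * π / (s * M) := by
  have hs : (0 : ℝ) < s := by exact_mod_cast NeZero.pos s
  have hM' : (0 : ℝ) < M := by exact_mod_cast (by omega : 0 < M)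
  have pp := Real.pi_pos
  have h0 : 0 ≤ 2 * π / (s * M) := by positivity
  show ‖xs (fB k p) - xs p‖ ≤ _
  have key : ∀ (l : ZMod s) (b b' : Bool) (j : ZMod (M + 1)), j + 1 ≠ 0 →
      ‖xs (some (l, b, j + 1) : Kp s M) - xs (some (l, b', j))‖ ≤ 2 * π / (s * M) := by
    intro l b b' j hj
    simp only [xs]
    have hv : (j + 1).val = j.val + 1 := by
      have : Fact (1 < M + 1) := ⟨by omega⟩
      rw [ZMod.val_add_of_lt]
      · rw [ZMod.val_one]
      · rw [ZMod.val_one]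
        rcases Nat.lt_or_ge (j.val + 1) (M + 1) with h | h
        · exact h
        · exfalso
          have h2 := ZMod.val_lt j
          have h3 : j.val + 1 = M + 1 := by omega
          apply hj
          have : ((j.val + 1 : ℕ) : ZMod (M + 1)) = 0 := by rw [h3]; exact ZMod.natCast_self _
          push_cast at this
          rwa [ZMod.natCast_zmod_val] at this
    rw [← mul_sub, norm_mul, Circle.norm_coe, one_mul, hv]
    refine (exp_I_sub_le _ _).trans_eq ?_
    rw [← mul_sub, ← sub_div, abs_of_nonneg]
    · push_cast; field_simp; ring
    · push_cast; ring_nf; positivity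
  rcases p with (_ | ⟨l, b | b, i⟩)
  · simp [fB]; positivity
  · by_cases h : l = k ∧ i ≠ 0
    · simp only [fB, h]
      rw [if_pos (by simp [h])]
      have := key k false true (i - 1) (by simp [h])
      rwa [sub_add_cancel, norm_sub_rev] at this
    · simp only [fB, h, if_false]; simpa using h0
  · by_cases h : l = k ∧ i + 1 ≠ 0
    · simp only [fB, h]
      rw [if_pos (by simp [h])]
      exact key k _ _ i h.2
    · simp only [fB, h, if_false]; simpa using h0

lemma xs_pow [NeZero s] (hM : 1 ≤ M) (p : Kp s M) : xs p ^ (s * M) = 1 := by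
  have hs : (s : ℝ) ≠ 0 := by exact_mod_cast NeZero.ne s
  have hM' : (M : ℝ) ≠ 0 := by exact_mod_cast (by omega : M ≠ 0)
  rcases p with (_ | ⟨l, b, i⟩)
  · simp [xs]
  · simp only [xs]
    rw [mul_pow, ← Circle.coe_pow]
    have e1 : ZMod.toCircle l ^ (s * M) = 1 := by
      rw [← AddChar.map_nsmul_eq_pow, mul_comm, mul_nsmul]
      simp [AddChar.map_zero_eq_one]
    rw [e1, ← Complex.exp_nat_mul]
    have e2 : ((s * M : ℕ) : ℂ) * (((2 * π * (i.val / (s * M)) : ℝ) : ℂ) * Complex.I) = (i.val : ℕ) * (2 * π * Complex.I) := by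
      have hs : (s : ℂ) ≠ 0 := by exact_mod_cast NeZero.ne s
      have hM' : (M : ℂ) ≠ 0 := by exact_mod_cast (by omega : M ≠ 0)
      push_cast
      field_simp
    rw [e2, Complex.exp_nat_mul_two_pi_mul_I]
    simp

end Pump
end PIS

namespace PIS
universe u
set_option linter.all false

def cl (t : ℝ) : ℝ := max 0 (min 1 t)

lemma cl_lip (t t' : ℝ) : |cl t - cl t'| ≤ |t - t'| := by
  unfold cl
  calc _ ≤ |min 1 t - min 1 t'| := by
        have := abs_max_sub_max_le_abs (min 1 t) (min 1 t') 0
        rwa [max_comm _ 0, max_comm _ 0] at this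
    _ ≤ _ := by
        have := abs_min_sub_min_le_max 1 t 1 t'
        simpa using this

lemma cl_of_nonpos {t : ℝ} (h : t ≤ 0) : cl t = 0 := by
  unfold cl; rw [min_eq_right (by linarith), max_eq_left h]
lemma cl_of_one_le {t : ℝ} (h : 1 ≤ t) : cl t = 1 := by
  unfold cl; rw [min_eq_left h, max_eq_right (by norm_num)]

lemma mul_lip {D : Type*} [CStarAlgebra D] {a a' b b' : D} {s t : ℝ} (h1 : ‖a - a'‖ ≤ s) (h2 : ‖b - b'‖ ≤ t)
    (hb : ‖b‖ ≤ 1) (ha : ‖a'‖ ≤ 1) : ‖a * b - a' * b'‖ ≤ s + t := by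
  have : a * b - a' * b' = (a - a') * b + a' * (b - b') := by noncomm_ring
  rw [this]
  exact nadd (nmulR h1 hb) (nmulL ha h2)

section Path
variable {s M : ℕ} [NeZero s] (hM : 1 ≤ M)

/-- part to the left of the fixed diagonal -/
noncomputable def WL (k : ZMod s) (t : ℝ) : CStarMatrix (Kp s M) (Kp s M) ℂ :=
  br (cl (4 * t - 3)) (ta k) * (br (cl (4 * t - 1)) (rB k) * br (cl (4 * t)) (rA k))

noncomputable def WR (k : ZMod s) (t : ℝ) : CStarMatrix (Kp s M) (Kp s M) ℂ :=
  br (cl (4 * t - 2)) (r2 hM k) * (br (cl (4 * t - 2)) (r1 k) * star (br (cl (4 * t - 3)) (ta k)))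

noncomputable def gam (k : ZMod s) (t : ℝ) : CStarMatrix (Kp s M) (Kp s M) ℂ :=
  WL k t * (pm (sg k) * WR hM k t)

lemma star_unit {D : Type*} [CStarAlgebra D] {a : D} (h : a ∈ unitary D) : star a ∈ unitary D :=
  Unitary.star_mem h

lemma WL_unitary (k : ZMod s) (t : ℝ) : WL (M := M) k t ∈ unitary _ :=
  mul_mem (br_unitary _ (ta_sq k)) (mul_mem (br_unitary _ (rB_sq k)) (br_unitary _ (rA_sq k)))

lemma WR_unitary (k : ZMod s) (t : ℝ) : WR hM k t ∈ unitary _ :=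
  mul_mem (br_unitary _ (r2_sq hM k)) (mul_mem (br_unitary _ (r1_sq k)) (star_unit (br_unitary _ (ta_sq k))))

lemma gam_unitary (k : ZMod s) (t : ℝ) : gam hM k t ∈ unitary _ :=
  mul_mem (WL_unitary k t) (mul_mem (pm_unitary _) (WR_unitary hM k t))

lemma gam_zero (k : ZMod s) : gam hM k 0 = pm (sg k) := by
  rw [gam, WL, WR, cl_of_nonpos (by norm_num), cl_of_nonpos (by norm_num), cl_of_nonpos (by norm_num),
    cl_of_nonpos (by norm_num)]
  simp [br_zero]

lemma gam_one (hs : 2 ≤ s) (k : ZMod s) : gam hM k 1 = pm (sg (k + 1)) := by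
  rw [gam, WL, WR, cl_of_one_le (by norm_num), cl_of_one_le (by norm_num), cl_of_one_le (by norm_num),
    cl_of_one_le (by norm_num)]
  simp only [br_one, star_pm]
  have h2 : (ta (M := M) k)⁻¹ = ta k := inv_eq_of_mul_eq_one_left (ta_sq k)
  rw [h2, ← tau_conj k hs, ← pump_id hM k]
  simp only [← pm_mul, mul_assoc]

lemma gam_lip (k : ZMod s) (t t' : ℝ) : ‖gam hM k t - gam hM k t'‖ ≤ 80 * |t - t'| := by
  have hpi : π ≤ 3.15 := Real.pi_lt_d2.le
  have key : ∀ (c : ℝ) (ρ : Equiv.Perm (Kp s M)), ‖br (cl (4 * t - c)) ρ - br (cl (4 * t' - c)) ρ‖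
      ≤ 4 * π * |t - t'| := by
    intro c ρ
    refine (br_lip _ _ _).trans ?_
    have := cl_lip (4 * t - c) (4 * t' - c)
    have e : |4 * t - c - (4 * t' - c)| = 4 * |t - t'| := by
      rw [show 4 * t - c - (4 * t' - c) = 4 * (t - t') by ring, abs_mul]; norm_num
    rw [e] at this
    nlinarith [Real.pi_pos]
  have key0 : ∀ (ρ : Equiv.Perm (Kp s M)), ‖br (cl (4 * t)) ρ - br (cl (4 * t')) ρ‖
      ≤ 4 * π * |t - t'| := by
    intro ρ; simpa using key 0 ρ
  have u1 : ∀ r, ‖br r (rA (M := M) k)‖ ≤ 1 := fun r => norm_unitary_le (br_unitary _ (rA_sq k))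
  have u2 : ∀ r, ‖br r (rB (M := M) k)‖ ≤ 1 := fun r => norm_unitary_le (br_unitary _ (rB_sq k))
  have u3 : ∀ r, ‖br r (ta (M := M) k)‖ ≤ 1 := fun r => norm_unitary_le (br_unitary _ (ta_sq k))
  have u4 : ∀ r, ‖br r (r1 (M := M) k)‖ ≤ 1 := fun r => norm_unitary_le (br_unitary _ (r1_sq k))
  have u5 : ∀ r, ‖br r (r2 (M := M) hM k)‖ ≤ 1 := fun r => norm_unitary_le (br_unitary _ (r2_sq hM k))
  have u3' : ∀ r, ‖star (br r (ta (M := M) k))‖ ≤ 1 := fun r => by rw [norm_star]; exact u3 r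
  have hL : ‖WL (M := M) k t - WL k t'‖ ≤ _ :=
    mul_lip (key 3 _) (mul_lip (key 1 _) (key0 _) (u1 _) (u2 _)) (nmulL (u2 _) (u1 _)) (u3 _)
  have hst : ‖star (br (cl (4 * t - 3)) (ta (M := M) k)) - star (br (cl (4 * t' - 3)) (ta k))‖
      ≤ 4 * π * |t - t'| := by rw [← star_sub, norm_star]; exact key 3 _
  have hR : ‖WR hM k t - WR hM k t'‖ ≤ _ :=
    mul_lip (key 2 _) (mul_lip (key 2 _) hst (u3' _) (u4 _)) (nmulL (u4 _) (u3' _)) (u5 _)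
  have h3 : ‖pm (sg k) * WR hM k t - pm (sg k) * WR hM k t'‖
      ≤ 4 * π * |t - t'| + (4 * π * |t - t'| + 4 * π * |t - t'|) := by
    rw [← mul_sub]; exact nmulL (norm_unitary_le (pm_unitary _)) hR
  refine (mul_lip hL h3 (nmulL (norm_unitary_le (pm_unitary _)) (norm_unitary_le (WR_unitary hM k t)))
    (norm_unitary_le (WL_unitary k t'))).trans ?_
  nlinarith [abs_nonneg (t - t')]

noncomputable def Gam (y : ℝ) : CStarMatrix (Kp s M) (Kp s M) ℂ := gam hM ((⌊y⌋ : ℤ) : ZMod s) (Int.fract y)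

lemma Gam_near (hs : 2 ≤ s) {y : ℝ} {m : ℤ} (h1 : (m : ℝ) ≤ y) (h2 : y ≤ m + 1) :
    Gam hM y = gam hM ((m : ℤ) : ZMod s) (y - m) := by
  rcases h2.lt_or_eq with h | h
  · have : ⌊y⌋ = m := Int.floor_eq_iff.2 ⟨h1, h⟩
    rw [Gam, Int.fract, this]
  · have : ⌊y⌋ = m + 1 := Int.floor_eq_iff.2 ⟨by push_cast; linarith, by push_cast; linarith⟩
    rw [Gam, Int.fract, this, h]
    push_cast
    rw [sub_self, gam_zero, add_sub_cancel_left, gam_one _ hs]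

lemma Gam_lip (hs : 2 ≤ s) {y y' : ℝ} (h : |y - y'| ≤ 1) : ‖Gam (s := s) hM y - Gam hM y'‖ ≤ 160 * |y - y'| := by
  wlog hle : y ≤ y' generalizing y y'
  · rw [norm_sub_rev, abs_sub_comm]; exact this (by rwa [abs_sub_comm]) (by linarith)
  have ha : |y - y'| = y' - y := by rw [abs_sub_comm, abs_of_nonneg (by linarith)]
  rw [ha] at h ⊢
  set m := ⌊y⌋ with hm
  have m1 : (m : ℝ) ≤ y := Int.floor_le y
  have m2 : y ≤ m + 1 := (Int.lt_floor_add_one y).le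
  by_cases hc : y' ≤ m + 1
  · rw [Gam_near hM hs m1 m2, Gam_near hM hs (m1.trans hle) hc]
    refine (gam_lip hM _ _ _).trans ?_
    rw [show y - m - (y' - m) = -(y' - y) by ring, abs_neg, abs_of_nonneg (by linarith)]
    linarith
  · push Not at hc
    have e1 : Gam (s := s) hM ((m : ℝ) + 1) = gam hM ((m : ℤ) : ZMod s) 1 := by
      rw [Gam_near hM hs (m := m) (by linarith) (by linarith)]; congr 1; ring
    have e2 : Gam (s := s) hM ((m : ℝ) + 1) = gam hM ((m + 1 : ℤ) : ZMod s) 0 := by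
      rw [Gam_near hM hs (m := m + 1) (by push_cast; linarith) (by push_cast; linarith)]
      congr 1; push_cast; ring
    have a1 : ‖Gam (s := s) hM y - Gam hM ((m : ℝ) + 1)‖ ≤ 80 * (m + 1 - y) := by
      rw [Gam_near hM hs m1 m2, e1]
      refine (gam_lip hM _ _ _).trans_eq ?_
      rw [show y - m - 1 = -(m + 1 - y) by ring, abs_neg, abs_of_nonneg (by linarith)]
    have a2 : ‖Gam (s := s) hM ((m : ℝ) + 1) - Gam hM y'‖ ≤ 80 * (y' - (m + 1)) := by
      rw [Gam_near hM hs (m := m + 1) (y := y') (by push_cast; linarith) (by push_cast; linarith), e2]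
      refine (gam_lip hM _ _ _).trans_eq ?_
      push_cast
      rw [show 0 - (y' - (m + 1 : ℝ)) = -(y' - (m + 1)) by ring, abs_neg, abs_of_nonneg (by linarith)]
    have := norm_sub_le_norm_sub_add_norm_sub (Gam (s := s) hM y) (Gam hM ((m : ℝ) + 1)) (Gam hM y')
    linarith

lemma Gam_period (y : ℝ) (m : ℤ) : Gam (s := s) hM (y + m * s) = Gam hM y := by
  have : y + m * s = y + ((m * s : ℤ) : ℝ) := by push_cast; ring
  rw [this, Gam, Gam, Int.floor_add_intCast, Int.fract_add_intCast]
  push_cast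
  simp

noncomputable def Uz (z : ℂ) : CStarMatrix (Kp s M) (Kp s M) ℂ := Gam hM (s * Complex.arg z / (2 * π))

lemma Uz_exp (α : ℝ) : Uz (s := s) hM (Complex.exp (α * Complex.I)) = Gam hM (s * α / (2 * π)) := by
  rw [Uz, Complex.arg_exp_mul_I]
  have pp := Real.pi_pos
  have h := toIocMod_add_toIocDiv_zsmul Real.two_pi_pos (-π) α
  conv_rhs => rw [← h]
  rw [← Gam_period hM _ (toIocDiv Real.two_pi_pos (-π) α)]
  congr 1
  simp only [zsmul_eq_mul]
  field_simp

/-- the projection -/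
lemma proj_eq (k : ZMod s) (t : ℝ) : gam hM k t * dgh ch * star (gam hM k t) =
    WL k t * (dgh (fun p => ch (sg k p))) * star (WL (M := M) k t) := by
  have hR : Commute (WR hM k t) (dgh ch) := by
    refine (br_comm (r2_ch hM k) _).mul_left ((br_comm (r1_ch k) _).mul_left ?_)
    have : Commute (br (cl (4 * t - 3)) (ta k)) (dgh (ch (s := s) (M := M))) := by
      apply br_comm
      intro p
      rw [ta]
      by_cases h1 : p = some (k, true, -1)
      · rw [h1, Equiv.swap_apply_left]; simp [ch, Cs]
      · by_cases h2 : p = some (k + 1, true, 0)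
        · rw [h2, Equiv.swap_apply_right]; simp [ch, Cs]
        · rw [Equiv.swap_apply_of_ne_of_ne h1 h2]
    have h2 := this.star_star
    rwa [← map_star, show star (ch (s := s) (M := M)) = ch from ?_] at h2
    ext1 p
    by_cases h : p = none ∨ Cs p <;> simp [ch, h]
  have h1 : WR hM k t * dgh ch * star (WR hM k t) = dgh ch := by
    rw [hR.eq, mul_assoc, (Unitary.mem_iff.1 (WR_unitary hM k t)).2, mul_one]
  have hsi : (sg (M := M) k)⁻¹ = sg k := inv_eq_of_mul_eq_one_left (sg_sq k)
  have h2 : pm (sg k) * dgh ch * star (pm (sg k)) = dgh (fun p => ch (sg (M := M) k p)) := by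
    have e := pm_dgh (sg (M := M) k) (fun p => ch (sg k p))
    have e3 : ∀ p, sg (M := M) k (sg k p) = p := fun p => by
      rw [← Equiv.Perm.mul_apply, sg_sq]; rfl
    simp only [e3] at e
    rw [e, mul_assoc, star_pm, hsi, ← pm_mul, sg_sq, pm_one, mul_one]
  calc _ = WL k t * (pm (sg k) * (WR hM k t * dgh ch * star (WR hM k t)) * star (pm (sg k))) * star (WL (M := M) k t) := by
        rw [gam]; simp only [star_mul, mul_assoc]
    _ = _ := by rw [h1, h2]

lemma proj_comm (k : ZMod s) (t : ℝ) :
    ‖gam hM k t * dgh ch * star (gam hM k t) * dgh xs - dgh xs * (gam hM k t * dgh ch * star (gam hM k t))‖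
      ≤ 2 * (2 * π / (s * M)) := by
  rw [proj_eq]
  set W := WL (M := M) k t with hW
  set X : CStarMatrix (Kp s M) (Kp s M) ℂ := dgh xs with hX
  set Q : CStarMatrix (Kp s M) (Kp s M) ℂ := dgh (fun p => ch (sg k p)) with hQ
  have pp := Real.pi_pos
  have h0 : 0 ≤ 2 * π / (s * M) := by positivity
  have hWX : ‖W * X - X * W‖ ≤ 2 * π / (s * M) := by
    have c1 := (br_comm (ta_xs hM k) (cl (4 * t - 3))).eq
    have c2 := (br_comm (f := xs) (rA_xs (M := M) k) (cl (4 * t))).eq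
    have c3 := br_comm_norm h0 (rB_xs hM k) (cl (4 * t - 1))
    rw [← hX] at c1 c2 c3
    have : W * X - X * W = br (cl (4 * t - 3)) (ta k) * ((br (cl (4 * t - 1)) (rB k) * X - X * br (cl (4 * t - 1)) (rB k)) * br (cl (4 * t)) (rA k)) := by
      rw [hW, WL]
      generalize br (cl (4 * t - 3)) (ta k) = a at *
      generalize br (cl (4 * t - 1)) (rB k) = b at *
      generalize br (cl (4 * t)) (rA k) = c at *
      have e1 : a * (b * c) * X = a * (b * (X * c)) := by rw [← c2]; noncomm_ring
      have e2 : X * (a * (b * c)) = a * X * (b * c) := by rw [c1]; noncomm_ring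
      rw [e1, e2]; noncomm_ring
    rw [this]
    exact nmulL (norm_unitary_le (br_unitary _ (ta_sq k))) (nmulR c3 (norm_unitary_le (br_unitary _ (rA_sq k))))
  have hXs : star X = dgh (star xs) := by rw [hX, ← map_star]
  have hXu : star X * X = 1 ∧ X * star X = 1 := by
    have hh : ∀ p : Kp s M, star (xs p) * xs p = 1 := by
      intro p
      have : ‖xs p‖ = 1 := Complex.norm_eq_one_of_pow_eq_one (xs_pow hM p)
        (by have := NeZero.ne s; positivity)
      rw [Complex.star_def, ← Complex.normSq_eq_conj_mul_self, Complex.normSq_eq_norm_sq, this]; simp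
    constructor
    · rw [hXs, hX, ← map_mul, show star xs * xs = (1 : Kp s M → ℂ) from funext hh, map_one]
    · rw [hXs, hX, ← map_mul, show xs * star xs = (1 : Kp s M → ℂ) from funext fun p => (mul_comm _ _).trans (hh p), map_one]
  have hWs : ‖star W * X - X * star W‖ ≤ 2 * π / (s * M) := by
    have hu := WL_unitary (M := M) k t
    have : star W * X - X * star W = - (star W * ((W * X - X * W) * star W)) := by
      have e1 := (Unitary.mem_iff.1 hu).1
      have e2 := (Unitary.mem_iff.1 hu).2
      rw [← hW] at e1 e2
      have a1 : star W * ((W * X - X * W) * star W) = (star W * W) * X * star W - star W * X * (W * star W) := by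
        noncomm_ring
      rw [a1, e1, e2]; noncomm_ring
    rw [this, norm_neg]
    have hsu : ‖star W‖ ≤ 1 := norm_unitary_le (star_unit hu)
    exact nmulL hsu (nmulR hWX hsu)
  have hQX : Q * X = X * Q := by rw [hQ, hX, ← map_mul, ← map_mul, mul_comm]
  have hQ1 : ‖Q‖ ≤ 1 := norm_dgh_le zero_le_one fun p => by
    by_cases h : sg k p = none ∨ Cs (sg k p) <;> simp [ch, h]
  have : W * Q * star W * X - X * (W * Q * star W) = W * (Q * (star W * X - X * star W)) + (W * X - X * W) * (Q * star W) := by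
    have e1 : W * (Q * (star W * X - X * star W)) = W * Q * star W * X - W * (Q * X) * star W := by noncomm_ring
    rw [e1, hQX]; noncomm_ring
  rw [this, two_mul]
  have hu := WL_unitary (M := M) k t
  exact nadd (nmulL (norm_unitary_le hu) (nmulL hQ1 hWs)) (nmulR hWX (nmulL hQ1 (norm_unitary_le (star_unit hu))))


lemma unit_fix {D : Type*} [CStarAlgebra D] {u p : D} (hu : u ∈ unitary D) (hp : star p = p)
    (h : u * p = p) : star u * p = p ∧ p * u = p := by
  have h1 : star u * p = p := by
    conv_lhs => rw [← h]
    rw [← mul_assoc, (Unitary.mem_iff.1 hu).1, one_mul]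
  refine ⟨h1, ?_⟩
  have := congrArg star h1
  rwa [star_mul, star_star, hp] at this

lemma WL_none (k : ZMod s) (t : ℝ) : WL (M := M) k t * eu none none = eu none none := by
  rw [WL, mul_assoc, mul_assoc, br_eu rfl, br_eu rfl, br_eu]
  rw [ta, Equiv.swap_apply_of_ne_of_ne (by simp) (by simp)]

lemma dgh_eu {κ : Type} [Fintype κ] [DecidableEq κ] (f : κ → ℂ) (k : κ) :
    dgh f * eu k k = f k • eu k k := by
  ext i j
  rw [CStarMatrix.mul_apply, CStarMatrix.smul_apply, Finset.sum_eq_single i]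
  · by_cases h : i = k
    · subst h; simp [dgh_apply]
    · simp [dgh_apply, eu_apply, h]
  · intro c _ hc; simp [dgh_apply, Ne.symm hc]
  · simp

lemma eu_dgh {κ : Type} [Fintype κ] [DecidableEq κ] (f : κ → ℂ) (k : κ) :
    eu k k * dgh f = f k • eu k k := by
  rw [← (dgh_eu_comm f k).eq, dgh_eu]

lemma proj_none (k : ZMod s) (t : ℝ) :
    eu none none * (gam hM k t * dgh ch * star (gam hM k t)) = 0 := by
  rw [proj_eq, ← mul_assoc, ← mul_assoc,
    (unit_fix (WL_unitary k t) (star_eu _ _) (WL_none k t)).2, eu_dgh]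
  have : ch (sg k (none : Kp s M)) = 0 := by
    rw [sg, Equiv.swap_apply_left]; simp [ch, Cs]
  rw [this]; simp

lemma gam_fix (k l : ZMod s) (hl : l ≠ k) (b : Bool) (i : ZMod (M + 1))
    (h : (some (l, b, i) : Kp s M) ≠ some (k + 1, true, 0)) (t : ℝ) :
    gam hM k t * eu (some (l, b, i)) (some (l, b, i)) = eu (some (l, b, i)) (some (l, b, i)) := by
  have hA : rA k (some (l, b, i) : Kp s M) = some (l, b, i) := by
    show fA k (some (l, b, i)) = some (l, b, i)
    simp [fA, hl]
  have hB : rB k (some (l, b, i) : Kp s M) = some (l, b, i) := by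
    show fB k _ = _
    cases b <;> simp [fB, hl]
  have h1 : r1 k (some (l, b, i) : Kp s M) = some (l, b, i) := by
    show f1 k (some (l, b, i)) = some (l, b, i)
    simp [f1, hl]
  have h2 : r2 hM k (some (l, b, i) : Kp s M) = some (l, b, i) := by
    show f2 k _ = _
    cases b <;> simp [f2, hl]
  have hsg : sg k (some (l, b, i) : Kp s M) = some (l, b, i) := by
    rw [sg, Equiv.swap_apply_of_ne_of_ne (by simp) (by simp [hl])]
  have hta : ta k (some (l, b, i) : Kp s M) = some (l, b, i) := by
    rw [ta, Equiv.swap_apply_of_ne_of_ne (by simp [hl]) h]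
  have hst := (unit_fix (br_unitary (cl (4 * t - 3)) (ta_sq k)) (star_eu _ _) (br_eu hta (cl (4 * t - 3)))).1
  rw [gam, WL, WR]
  simp only [mul_assoc]
  rw [hst, br_eu h1, br_eu h2, pm_eu hsg, br_eu hA, br_eu hB, br_eu hta]

end Path

lemma near_site {s M : ℕ} [NeZero s] (hM : 1 ≤ M) (α : ℝ) (m : ℤ) (hm : m = ⌊s * α / (2 * π)⌋)
    (b : Bool) (i : ZMod (M + 1)) : ‖xs (some ((m : ZMod s), b, i) : Kp s M) - Complex.exp (α * Complex.I)‖ ≤ 2 * π / s := by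
  have hs : (0 : ℝ) < s := by exact_mod_cast NeZero.pos s
  have hM' : (0 : ℝ) < M := by exact_mod_cast (by omega : 0 < M)
  have pp := Real.pi_pos
  simp only [xs]
  rw [toCirc, ← Complex.exp_add, ← add_mul, ← Complex.ofReal_add]
  refine (exp_I_sub_le _ _).trans ?_
  have h1 : (m : ℝ) ≤ s * α / (2 * π) := by rw [hm]; exact Int.floor_le _
  have h2 : s * α / (2 * π) < m + 1 := by rw [hm]; exact Int.lt_floor_add_one _
  rw [le_div_iff₀ (by positivity)] at h1
  rw [div_lt_iff₀ (by positivity)] at h2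
  have hi : (i.val : ℝ) ≤ M := by exact_mod_cast Nat.lt_succ_iff.1 (ZMod.val_lt i)
  have hi0 : (0 : ℝ) ≤ i.val := by positivity
  have h3 : 2 * π * (i.val / (s * M)) ≤ 2 * π / s := by
    rw [div_eq_mul_one_div (2 * π)]
    apply mul_le_mul_of_nonneg_left _ (by positivity)
    rw [div_le_div_iff₀ (by positivity) hs]; nlinarith
  have h4 : 0 ≤ 2 * π * (i.val / (s * M)) := by positivity
  have h5 : 2 * π * (m / s) ≤ α := by
    rw [show 2 * π * (m / s) = (m * (2 * π)) / s by ring, div_le_iff₀ hs]; linarith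
  have h6 : α ≤ 2 * π * (m / s) + 2 * π / s := by
    rw [show 2 * π * (m / s) + 2 * π / s = ((m + 1) * (2 * π)) / s by ring, le_div_iff₀ hs]; linarith
  rw [abs_le]; constructor <;> linarith

lemma near_site2 {s M : ℕ} [NeZero s] (hM : 1 ≤ M) (α : ℝ) (m : ℤ) (hm : m = ⌊s * α / (2 * π)⌋) :
    ‖xs (some ((m : ZMod s) + 1, true, 0) : Kp s M) - Complex.exp (α * Complex.I)‖ ≤ 2 * π / s := by
  have := ta_xs hM (m : ZMod s) (some ((m : ZMod s), true, -1))
  rw [ta, Equiv.swap_apply_left] at this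
  rw [this]
  exact near_site hM α m hm true (-1)

theorem SL {η e : ℝ} (hη : 0 < η) (he : 0 < e) : ∃ mesh > (0 : ℝ), ∀ δ' > (0 : ℝ),
    ∃ (κ : Type) (_ : Fintype κ) (_ : DecidableEq κ) (o : κ) (x : κ → ℂ) (C : κ → ℂ)
      (U : ℂ → CStarMatrix κ κ ℂ) (N : ℕ), 0 < N ∧ (∀ k, x k ^ N = 1) ∧ (∀ k, C k = 0 ∨ C k = 1) ∧
      C o = 0 ∧ (∀ z, U z ∈ unitary (CStarMatrix κ κ ℂ)) ∧
      (∀ z ∈ Metric.sphere (0 : ℂ) 1, ∀ w ∈ Metric.sphere (0 : ℂ) 1, ‖z - w‖ < mesh → ‖U z - U w‖ ≤ e) ∧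
      (∀ z, ‖U z * (eu o o + dgh C) * star (U z) * dgh x - dgh x * (U z * (eu o o + dgh C) * star (U z))‖ ≤ δ') ∧
      (∀ z, eu o o * (U z * (eu o o + dgh C) * star (U z)) = 0) ∧
      (∀ z ∈ Metric.sphere (0 : ℂ) 1, ∀ k, k ≠ o → η ≤ ‖x k - z‖ →
        U z * eu k k = eu k k ∧ eu k k * U z = eu k k) := by
  have pp := Real.pi_pos
  obtain ⟨s, hs⟩ := exists_nat_gt (2 * π / η + 2)
  have hs2 : (2 : ℝ) < s := by have : 0 < 2 * π / η := by positivity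
                               linarith
  have hs2' : 2 ≤ s := by exact_mod_cast hs2.le
  have : NeZero s := ⟨by omega⟩
  have hsη : 2 * π / s < η := by
    rw [div_lt_iff₀ (by linarith), mul_comm η, ← div_lt_iff₀ hη]; linarith
  refine ⟨min (1 / s) (e / (40 * s)), by positivity, ?_⟩
  intro δ' hδ
  obtain ⟨M, hMδ⟩ := exists_nat_gt (4 * π / δ' + 1)
  have hM1 : (1 : ℝ) < M := by have : 0 < 4 * π / δ' := by positivity
                               linarith
  have hM : 1 ≤ M := by exact_mod_cast hM1.le
  have hch : (dgh (ch (s := s) (M := M)) : CStarMatrix _ _ ℂ)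
      = eu none none + dgh (fun p => if Cs p then (1 : ℂ) else 0) := by
    ext i j
    rw [CStarMatrix.add_apply]
    simp only [dgh_apply, eu_apply, ch]
    by_cases h : i = j
    · subst h
      by_cases h1 : i = none
      · subst h1; simp [Cs]
      · simp [h1]
    · by_cases h1 : i = none
      · have h2 : j ≠ none := fun h3 => h (h1.trans h3.symm)
        rw [if_neg h, if_neg h, if_neg (by simp [h2]), add_zero]
      · simp [h, h1]
  refine ⟨Kp s M, inferInstance, inferInstance, none, xs, fun p => if Cs p then 1 else 0,
    Uz hM, s * M, by positivity, xs_pow hM, ?_, ?_, ?_, ?_, ?_, ?_, ?_⟩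
  · intro k; by_cases h : Cs k <;> simp [h]
  · simp [Cs]
  · intro z; exact gam_unitary hM _ _
  · intro z hz w hw hzw
    rw [mem_sphere_zero_iff_norm] at hz hw
    have hz0 : z ≠ 0 := by rintro rfl; simp at hz
    set β := Complex.arg (w / z) with hβ
    have hwz : Complex.exp (β * Complex.I) = w / z := by
      have := Complex.norm_mul_exp_arg_mul_I (w / z)
      rwa [norm_div, hz, hw, div_one, Complex.ofReal_one, one_mul] at this
    have hz' : Complex.exp (Complex.arg z * Complex.I) = z := by
      have := Complex.norm_mul_exp_arg_mul_I z
      rwa [hz, Complex.ofReal_one, one_mul] at this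
    have hw' : Complex.exp ((Complex.arg z + β : ℝ) * Complex.I) = w := by
      rw [Complex.ofReal_add, add_mul, Complex.exp_add, hz', hwz]; field_simp
    have hb : |β| ≤ π / 2 * ‖z - w‖ := by
      have h1 : ‖Complex.exp (β * Complex.I) - 1‖ = ‖z - w‖ := by
        rw [hwz, ← mul_one ‖w / z - 1‖, ← hz, ← norm_mul, sub_mul, div_mul_cancel₀ _ hz0, one_mul, norm_sub_rev]
      rw [← h1]
      have h2 : ‖Complex.exp (β * Complex.I) - 1‖ = ‖2 * Real.sin (β / 2)‖ := by
        rw [mul_comm, Complex.norm_exp_I_mul_ofReal_sub_one]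
      rw [h2, norm_mul, Real.norm_eq_abs, Real.norm_eq_abs, abs_two]
      have h3 := Real.mul_abs_le_abs_sin (x := β / 2) (by rw [abs_div, abs_two]; linarith [Complex.abs_arg_le_pi (w / z)])
      rw [abs_div, abs_two] at h3
      calc |β| = π / 2 * (2 * (2 / π * (|β| / 2))) := by field_simp
        _ ≤ _ := by gcongr
    have hUz : Uz hM z = Gam (s := s) hM (s * Complex.arg z / (2 * π)) := rfl
    have hUw : Uz hM w = Gam (s := s) hM (s * (Complex.arg z + β) / (2 * π)) := by
      rw [← Uz_exp, hw']
    rw [hUz, hUw]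
    have hd : |s * Complex.arg z / (2 * π) - s * (Complex.arg z + β) / (2 * π)| ≤ s * ‖z - w‖ / 4 := by
      rw [show s * Complex.arg z / (2 * π) - s * (Complex.arg z + β) / (2 * π) = -(s * β / (2 * π)) by ring,
        abs_neg, abs_div, abs_mul, abs_of_pos (show (0 : ℝ) < s by linarith), abs_of_pos (show 0 < 2 * π by linarith),
        div_le_iff₀ (by positivity)]
      calc s * |β| ≤ s * (π / 2 * ‖z - w‖) := by gcongr
        _ = _ := by ring
    have m1 : ‖z - w‖ < 1 / s := hzw.trans_le (min_le_left _ _)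
    have m2 : ‖z - w‖ < e / (40 * s) := hzw.trans_le (min_le_right _ _)
    rw [lt_div_iff₀ (by linarith)] at m1
    rw [lt_div_iff₀ (by linarith)] at m2
    refine (Gam_lip hM hs2' (by linarith)).trans ?_
    linarith
  · intro z
    rw [← hch]
    refine (proj_comm hM _ _).trans ?_
    have hs0 : (0 : ℝ) < s := by linarith
    rw [← mul_div_assoc, div_le_iff₀ (by positivity)]
    have := (div_lt_iff₀ hδ).1 (show 4 * π / δ' < M by linarith)
    nlinarith [mul_pos hδ (show (0 : ℝ) < M by linarith)]
  · intro z
    rw [← hch]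
    exact proj_none hM _ _
  · intro z hz k hk hkz
    rw [mem_sphere_zero_iff_norm] at hz
    have hz' : Complex.exp (Complex.arg z * Complex.I) = z := by
      have := Complex.norm_mul_exp_arg_mul_I z
      rwa [hz, Complex.ofReal_one, one_mul] at this
    set m := ⌊s * Complex.arg z / (2 * π)⌋ with hm
    have h1 : Uz hM z * eu k k = eu k k := by
      rcases k with (_ | ⟨l, b, i⟩)
      · exact absurd rfl hk
      · apply gam_fix
        · intro hl
          rw [← hm] at hl
          subst hl
          have := near_site hM (Complex.arg z) m hm b i
          rw [hz'] at this
          linarith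
        · intro hl
          rw [hl] at hkz
          have := near_site2 (M := M) hM (Complex.arg z) m hm
          rw [hz'] at this
          linarith
    have hu : Uz (s := s) hM z ∈ unitary _ := gam_unitary hM _ _
    exact ⟨h1, (unit_fix hu (star_eu k k) h1).2⟩

end PIS

namespace PIS
universe u
set_option linter.all false

section CoreAlg
variable {B : Type*} [CStarAlgebra B]

lemma proj_sub {p : B} (hp : IsStarProjection p) : IsStarProjection (1 - p) := hp.one_sub

lemma proj_mul {p q : B} (hp : IsStarProjection p) (hq : IsStarProjection q) (h : p * q = q * p) :
    IsStarProjection (p * q) := by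
  refine ⟨?_, ?_⟩
  · show p * q * (p * q) = p * q
    rw [mul_assoc, ← mul_assoc q, ← h, ← mul_assoc, ← mul_assoc, hp.isIdempotentElem.eq, mul_assoc,
      hq.isIdempotentElem.eq]
  · show star (p * q) = p * q
    rw [star_mul, hp.isSelfAdjoint.star_eq, hq.isSelfAdjoint.star_eq, h]

lemma proj_add {p q : B} (hp : IsStarProjection p) (hq : IsStarProjection q) (h : p * q = 0) :
    IsStarProjection (p + q) := by
  have h' : q * p = 0 := by
    have := congrArg star h
    rwa [star_mul, hp.isSelfAdjoint.star_eq, hq.isSelfAdjoint.star_eq, star_zero] at this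
  refine ⟨?_, ?_⟩
  · show (p + q) * (p + q) = p + q
    rw [mul_add, add_mul, add_mul, h, h', hp.isIdempotentElem.eq, hq.isIdempotentElem.eq]; simp
  · show star (p + q) = p + q
    rw [star_add, hp.isSelfAdjoint.star_eq, hq.isSelfAdjoint.star_eq]

lemma cc {a b c : B} (h : a * b = c) (d : B) : a * (b * d) = c * d := by rw [← mul_assoc, h]

variable {p U C eo N' m n' : B} {e : ℝ}
  (hp : IsStarProjection p) (hC : IsStarProjection C) (heo : IsStarProjection eo)
  (hN : IsStarProjection N') (hn : IsStarProjection n') (hU : U ∈ unitary B)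
  (hCp : C * p = p * C) (heop : eo * p = p * eo) (heoC : eo * C = 0) (hCN : C * N' = N' * C)
  (hnC : n' * C = C * n') (hnN : n' * N' = N' * n') (hnp : n' * p = p)
  (hUC : U * (C * (1 - N')) = C * (1 - N'))
  (hUp : ‖U * p - p * U‖ ≤ e)
  (hm : N' * m = m) (hpm : ‖p * m - m * p‖ ≤ e)
  (hmD : m * (U * (eo + C) * star U - C) = U * (eo + C) * star U - C)

section
include hp hC heo hN hn hU hCp heop heoC hCN hnC hnN hnp hUC hUp

lemma core_a : IsStarProjection (eo * p + C * (N' * n')) := by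
  have hNn : IsStarProjection (N' * n') := proj_mul hN hn hnN.symm
  apply proj_add (proj_mul heo hp heop) (proj_mul hC hNn _)
  · rw [heop, mul_assoc, cc heoC]; simp
  · rw [← mul_assoc, hCN, mul_assoc, ← hnC, mul_assoc]

lemma core_BB : ‖star (U * p + (1 - p)) * (U * p + (1 - p)) - 1‖ ≤ 2 * e := by
  have pp := hp.isIdempotentElem.eq
  have ps := hp.isSelfAdjoint.star_eq
  have uu := (Unitary.mem_iff.1 hU).1
  have h1 : ‖(1 - p) * U * p‖ ≤ e := by
    have : (1 - p) * U * p = (1 - p) * (U * p - p * U) := by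
      have : (1 - p) * (U * p - p * U) = (1 - p) * U * p - (p - p * p) * U := by noncomm_ring
      rw [this, pp]; noncomm_ring
    rw [this]
    exact nmulL (hp.one_sub).norm_le hUp
  have h2 : star (U * p + (1 - p)) * (U * p + (1 - p)) - 1 = star ((1 - p) * U * p) + (1 - p) * U * p := by
    simp only [star_add, star_mul, star_sub, star_one, ps]
    have : (p * star U + (1 - p)) * (U * p + (1 - p)) - 1 - (p * (star U * (1 - p)) + (1 - p) * U * p)
      = p * (star U * U) * p + (p * p - p) - p := by noncomm_ring
    rw [uu, mul_one, pp, sub_self, add_zero, sub_self] at this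
    exact sub_eq_zero.1 this
  rw [h2, two_mul]
  exact nadd (by rwa [norm_star]) h1

lemma core_normB : ‖U * p + (1 - p)‖ ≤ 2 := by
  have h1 : ‖U * p‖ ≤ 1 := nmulL (norm_unitary_le hU) hp.norm_le
  exact (nadd h1 hp.one_sub.norm_le).trans (by norm_num)

lemma core_YsY (Y : B) (hY : Y = (U * p + (1 - p)) * (eo * p + C * (N' * n'))) :
    Y * (eo * p + C * (N' * n')) = Y ∧ ‖star Y * Y - (eo * p + C * (N' * n'))‖ ≤ 2 * e := by
  have ha := core_a hp hC heo hN hn hU hCp heop heoC hCN hnC hnN hnp hUC hUp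
  have hB := core_BB hp hC heo hN hn hU hCp heop heoC hCN hnC hnN hnp hUC hUp
  set a := eo * p + C * (N' * n')
  set Bm := U * p + (1 - p)
  have aa := ha.isIdempotentElem.eq
  have as := ha.isSelfAdjoint.star_eq
  constructor
  · rw [hY, mul_assoc, aa]
  · have : star Y * Y - a = a * ((star Bm * Bm - 1) * a) := by
      rw [hY, star_mul, as]
      have : a * ((star Bm * Bm - 1) * a) = a * star Bm * (Bm * a) - a * a := by noncomm_ring
      rw [this, aa]
    rw [this]
    exact nmulL ha.norm_le (nmulR hB ha.norm_le)

lemma core_Q : IsStarProjection (eo + C) := proj_add heo hC heoC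

lemma core_pK : p * (C * (1 - N' * n')) = p * (C * (1 - N')) := by
  have : p * (N' * n') = p * N' := by
    have h1 : p * n' = p := by
      have := congrArg star hnp
      rwa [star_mul, hp.isSelfAdjoint.star_eq, hn.isSelfAdjoint.star_eq] at this
    rw [← hnN, ← mul_assoc, h1]
  rw [← mul_assoc p C, ← hCp, ← mul_assoc p C, ← hCp, mul_assoc, mul_assoc, mul_sub p, mul_sub p, this]

lemma core_YYs1 (Y : B) (hY : Y = (U * p + (1 - p)) * (eo * p + C * (N' * n'))) :
    ‖Y * star Y - (C * (N' * n') + p * (U * (eo + C) * star U - C) * p)‖ ≤ 5 * e := by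
  have ha := core_a hp hC heo hN hn hU hCp heop heoC hCN hnC hnN hnp hUC hUp
  have hnB := core_normB hp hC heo hN hn hU hCp heop heoC hCN hnC hnN hnp hUC hUp
  have hQ := core_Q hp hC heo hN hn hU hCp heop heoC hCN hnC hnN hnp hUC hUp
  have hpK := core_pK hp hC heo hN hn hU hCp heop heoC hCN hnC hnN hnp hUC hUp
  have pp := hp.isIdempotentElem.eq
  have ps := hp.isSelfAdjoint.star_eq
  have hNn : IsStarProjection (N' * n') := proj_mul hN hn hnN.symm
  have hK : IsStarProjection (C * (1 - N' * n')) := by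
    apply proj_mul hC hNn.one_sub
    have : C * (N' * n') = N' * n' * C := by rw [← mul_assoc, hCN, mul_assoc, ← hnC, mul_assoc]
    rw [mul_sub, sub_mul, this]; simp
  set K := C * (1 - N' * n') with hKd
  set Bm := U * p + (1 - p) with hBm
  set Q := eo + C with hQd
  have hQp : Q * p = p * Q := by rw [hQd, add_mul, mul_add, heop, hCp]
  have haK : eo * p + C * (N' * n') = eo * p + C - K := by rw [hKd]; noncomm_ring
  -- first part
  have e1 : Bm * (eo * p + C) * star Bm = U * p * Q * (p * star U) + (1 - p) * C * (1 - p) := by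
    have hs : star Bm = p * star U + (1 - p) := by simp [hBm, ps]
    have h1 : Bm * (eo * p + C) = U * p * Q + (1 - p) * C := by
      have h0 : (U * p + (1 - p)) * (eo * p + C) = U * (p * eo * p) + U * p * C + (eo * p - p * eo * p) + (1 - p) * C := by
        noncomm_ring
      have h00 : p * eo * p = p * eo := by rw [mul_assoc, heop, cc pp]
      rw [hBm, h0, h00, heop, sub_self, hQd]; noncomm_ring
    have h2 : (1 - p) * C * p = 0 := by
      rw [mul_assoc, hCp, ← mul_assoc, sub_mul, one_mul, pp]; simp
    have h3 : U * p * Q * (1 - p) = 0 := by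
      have : U * p * Q * (1 - p) = U * (p * Q - p * (Q * p)) := by noncomm_ring
      rw [this, hQp, cc pp]; simp
    rw [h1, hs]
    have h5 : ∀ Q' : B, (U * p * Q' + (1 - p) * C) * (p * star U + (1 - p))
      = U * p * Q' * (p * star U) + U * p * Q' * (1 - p) + (1 - p) * C * p * star U + (1 - p) * C * (1 - p) := by
      intro Q'; noncomm_ring
    rw [h5, h3, h2]; simp
  have e2 : ‖U * p * Q * (p * star U) - p * (U * Q * star U) * p‖ ≤ e + e := by
    have : U * p * Q * (p * star U) - p * (U * Q * star U) * p
        = (U * p - p * U) * (Q * (p * star U)) + p * U * Q * star (U * p - p * U) := by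
      simp only [star_sub, star_mul, ps]; noncomm_ring
    rw [this]
    have us : ‖star U‖ ≤ 1 := by rw [norm_star]; exact norm_unitary_le hU
    exact nadd (nmulR hUp (nmulL hQ.norm_le (nmulL hp.norm_le us)))
      (nmulL (nmulL (nmulL hp.norm_le (norm_unitary_le hU)) hQ.norm_le) (by rwa [norm_star]))
  -- second part
  have e3 : ‖Bm * K - K‖ ≤ e := by
    have : Bm * K - K = (U * p - p * U) * (C * (1 - N')) := by
      have h0 : Bm * K - K = U * (p * K) - p * K := by rw [hBm]; noncomm_ring
      rw [h0, hpK]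
      conv_lhs => rw [← hUC]
      rw [hUC]
      have : U * (p * (C * (1 - N'))) - p * (U * (C * (1 - N'))) = (U * p - p * U) * (C * (1 - N')) := by
        noncomm_ring
      rw [← this, hUC]
    rw [this]
    exact nmulR hUp (nmulL hC.norm_le hN.one_sub.norm_le)
  have e4 : ‖Bm * K * star Bm - K‖ ≤ e * 2 + e := by
    have : Bm * K * star Bm - K = (Bm * K - K) * star Bm + star (Bm * K - K) := by
      rw [star_sub, star_mul, hK.isSelfAdjoint.star_eq]; noncomm_ring
    rw [this]
    exact nadd (nmul e3 (by rwa [norm_star])) (by rwa [norm_star])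
  have e5 : Y * star Y = Bm * (eo * p + C) * star Bm - Bm * K * star Bm := by
    have aa := ha.isIdempotentElem.eq
    rw [hY, star_mul, ha.isSelfAdjoint.star_eq]
    have : Bm * (eo * p + C * (N' * n')) * ((eo * p + C * (N' * n')) * star Bm)
       = Bm * ((eo * p + C * (N' * n')) * (eo * p + C * (N' * n'))) * star Bm := by noncomm_ring
    rw [this, aa, haK]; noncomm_ring
  have e6 : Y * star Y - (C * (N' * n') + p * (U * Q * star U - C) * p)
      = (U * p * Q * (p * star U) - p * (U * Q * star U) * p) - (Bm * K * star Bm - K) := by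
    rw [e5, e1]
    have : p * C * p = p * C := by rw [mul_assoc, hCp, cc pp]
    have h2 : (1 - p) * C * (1 - p) = C - p * C - C * p + p * C * p := by noncomm_ring
    have h3 : p * (U * Q * star U - C) * p = p * (U * Q * star U) * p - p * C * p := by noncomm_ring
    have h4 : C * (N' * n') = C - K := by rw [hKd]; noncomm_ring
    rw [h2, h3, this, h4, hCp]; abel
  rw [e6]
  exact (nsub e2 e4).trans (by linarith)

include hm hpm hmD

lemma core_Dnorm : ‖U * (eo + C) * star U - C‖ ≤ 2 := by
  have hQ := core_Q hp hC heo hN hn hU hCp heop heoC hCN hnC hnN hnp hUC hUp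
  have us : ‖star U‖ ≤ 1 := by rw [norm_star]; exact norm_unitary_le hU
  exact (nsub (nmulR (nmulL (norm_unitary_le hU) hQ.norm_le) us) hC.norm_le).trans (by norm_num)

lemma core_Dsa : star (U * (eo + C) * star U - C) = U * (eo + C) * star U - C := by
  have hQ := core_Q hp hC heo hN hn hU hCp heop heoC hCN hnC hnN hnp hUC hUp
  simp only [star_sub, star_mul, star_star, hQ.isSelfAdjoint.star_eq, hC.isSelfAdjoint.star_eq, mul_assoc]

lemma core_YYs (Y : B) (hY : Y = (U * p + (1 - p)) * (eo * p + C * (N' * n'))) :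
    ‖Y * star Y - (C * (N' * n') + N' * (p * (U * (eo + C) * star U - C) * p) * N')‖ ≤ 9 * e := by
  have h1 := core_YYs1 hp hC heo hN hn hU hCp heop heoC hCN hnC hnN hnp hUC hUp Y hY
  have hD := core_Dnorm hp hC heo hN hn hU hCp heop heoC hCN hnC hnN hnp hUC hUp hm hpm hmD
  have hDs := core_Dsa hp hC heo hN hn hU hCp heop heoC hCN hnC hnN hnp hUC hUp hm hpm hmD
  set Δ := U * (eo + C) * star U - C with hΔ
  have h2 : ‖(1 - N') * (p * Δ * p)‖ ≤ e * 2 := by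
    have : (1 - N') * (p * Δ * p) = (1 - N') * ((p * m - m * p) * (Δ * p)) := by
      have h0 : (1 - N') * ((p * m - m * p) * (Δ * p)) = (1 - N') * (p * (m * Δ) * p) - (m - N' * m) * p * Δ * p := by
        noncomm_ring
      rw [h0, hmD, hm]; simp
    rw [this]
    exact nmulL hN.one_sub.norm_le (nmul hpm (nmulR hD hp.norm_le))
  have h3 : p * Δ * p - N' * (p * Δ * p) * N' = (1 - N') * (p * Δ * p) + N' * star ((1 - N') * (p * Δ * p)) := by
    simp only [star_mul, star_sub, star_one, hp.isSelfAdjoint.star_eq, hN.isSelfAdjoint.star_eq, hDs]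
    noncomm_ring
  have h4 : ‖p * Δ * p - N' * (p * Δ * p) * N'‖ ≤ e * 2 + e * 2 := by
    rw [h3]; exact nadd h2 (nmulL hN.norm_le (by rwa [norm_star]))
  have h5 : Y * star Y - (C * (N' * n') + N' * (p * Δ * p) * N')
    = Y * star Y - (C * (N' * n') + p * Δ * p) + (p * Δ * p - N' * (p * Δ * p) * N') := by abel
  rw [h5]
  exact (nadd h1 h4).trans (by linarith)

lemma core_G0n : ‖C * (N' * n') + N' * (p * (U * (eo + C) * star U - C) * p) * N'‖ ≤ 3 := by
  have hD := core_Dnorm hp hC heo hN hn hU hCp heop heoC hCN hnC hnN hnp hUC hUp hm hpm hmD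
  exact (nadd (nmulL hC.norm_le (nmulL hN.norm_le hn.norm_le))
    (nmulR (nmulL hN.norm_le (nmulR (nmulL hp.norm_le hD) hp.norm_le)) hN.norm_le)).trans (by norm_num)

lemma core_G0sq (he : 0 ≤ e) (G : B) (hG : G = C * (N' * n') + N' * (p * (U * (eo + C) * star U - C) * p) * N') :
    ‖G * G - G‖ ≤ 80 * e := by
  have hn3 := core_G0n hp hC heo hN hn hU hCp heop heoC hCN hnC hnN hnp hUC hUp hm hpm hmD
  have hB := core_BB hp hC heo hN hn hU hCp heop heoC hCN hnC hnN hnp hUC hUp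
  have hnB := core_normB hp hC heo hN hn hU hCp heop heoC hCN hnC hnN hnp hUC hUp
  have ha := core_a hp hC heo hN hn hU hCp heop heoC hCN hnC hnN hnp hUC hUp
  have hY := core_YYs hp hC heo hN hn hU hCp heop heoC hCN hnC hnN hnp hUC hUp hm hpm hmD _ rfl
  rw [← hG] at hn3 hY
  set a := eo * p + C * (N' * n')
  set Bm := U * p + (1 - p)
  have aa := ha.isIdempotentElem.eq
  have hs : star (Bm * a) = a * star Bm := by rw [star_mul, ha.isSelfAdjoint.star_eq]
  set Z := Bm * a * star (Bm * a) with hZ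
  have hZ' : Z = Bm * a * star Bm := by rw [hZ, hs, mul_assoc, cc aa, mul_assoc]
  have hBs : ‖star Bm‖ ≤ 2 := by rwa [norm_star]
  have hZn : ‖Z‖ ≤ 4 := by
    rw [hZ']; exact (nmul (nmulR hnB ha.norm_le) hBs).trans (by norm_num)
  have h1 : Z * Z - Z = Bm * (a * ((star Bm * Bm - 1) * (a * star Bm))) := by
    have : Bm * (a * ((star Bm * Bm - 1) * (a * star Bm))) = Bm * a * star Bm * (Bm * a * star Bm) - Bm * (a * a) * star Bm := by
      noncomm_ring
    rw [this, aa, hZ']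
  have h2 : ‖Z * Z - Z‖ ≤ 2 * ((2 * e) * 2) := by
    rw [h1]; exact nmul hnB (nmulL ha.norm_le (nmul hB (nmulL ha.norm_le hBs)))
  have h3 : G * G - G = (Z * Z - Z) - (Z - G) * Z - G * (Z - G) + (Z - G) := by noncomm_ring
  rw [h3]
  refine (nadd (nsub (nsub h2 (nmul hY hZn)) (nmul hn3 hY)) hY).trans ?_
  linarith

end
end CoreAlg

section Avg
variable {B : Type*} [CStarAlgebra B]

noncomputable def avg (q : ℕ) (w G : B) : B := (1 / q : ℝ) • ∑ k ∈ Finset.range q, w ^ k * G * star w ^ k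

variable {q : ℕ} (hq : 0 < q) {w G : B} (hw : w ∈ unitary B)

lemma avg_sa (hG : star G = G) : star (avg q w G) = avg q w G := by
  simp only [avg, star_smul, star_sum, star_mul, star_pow, star_star, hG, star_trivial, mul_assoc]

lemma pow_comm_norm {w G : B} {s : ℝ} (hw : ‖w‖ ≤ 1) (h : ‖w * G - G * w‖ ≤ s) (k : ℕ) :
    ‖w ^ k * G - G * w ^ k‖ ≤ k * s := by
  induction k with
  | zero => simp
  | succ k ih =>
    have hk : ‖w ^ k‖ ≤ 1 := by
      clear ih
      induction k with
      | zero => simpa using norm_one_le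
      | succ k ih => rw [pow_succ]; exact nmulL ih hw
    have : w ^ (k + 1) * G - G * w ^ (k + 1) = w ^ k * (w * G - G * w) + (w ^ k * G - G * w ^ k) * w := by
      rw [pow_succ]; noncomm_ring
    rw [this]
    refine (nadd (nmulL hk h) (nmulR ih hw)).trans ?_
    push_cast; linarith

lemma unitary_pow_mul (hw : w ∈ unitary B) (k : ℕ) : w ^ k * star w ^ k = 1 := by
  rw [← star_pow]; exact (Unitary.mem_iff.1 (pow_mem hw k)).2

lemma unitary_pow_mul' (hw : w ∈ unitary B) (k : ℕ) : star w ^ k * w ^ k = 1 := by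
  rw [← star_pow]; exact (Unitary.mem_iff.1 (pow_mem hw k)).1

lemma norm_avg_le {f : ℕ → B} {s : ℝ} (hq : 0 < q) (h : ∀ k < q, ‖f k‖ ≤ s) :
    ‖(1 / q : ℝ) • ∑ k ∈ Finset.range q, f k‖ ≤ s := by
  have hq' : (0 : ℝ) < q := by exact_mod_cast hq
  rw [norm_smul, Real.norm_of_nonneg (by positivity)]
  have : ‖∑ k ∈ Finset.range q, f k‖ ≤ q * s := by
    refine (norm_sum_le _ _).trans ?_
    refine (Finset.sum_le_sum fun k hk => h k (Finset.mem_range.1 hk)).trans_eq ?_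
    simp
  calc 1 / (q : ℝ) * ‖∑ k ∈ Finset.range q, f k‖ ≤ 1 / q * (q * s) := by gcongr
    _ = s := by field_simp

lemma avg_const (hq : 0 < q) (G : B) : (1 / q : ℝ) • ∑ _k ∈ Finset.range q, G = G := by
  have hq' : (q : ℝ) ≠ 0 := by exact_mod_cast hq.ne'
  rw [Finset.sum_const, Finset.card_range, ← Nat.cast_smul_eq_nsmul ℝ, smul_smul]
  field_simp; simp

include hq hw in
lemma avg_near {s : ℝ} (hs : 0 ≤ s) (h : ‖w * G - G * w‖ ≤ s) : ‖avg q w G - G‖ ≤ q * s := by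
  have : avg q w G - G = (1 / q : ℝ) • ∑ k ∈ Finset.range q, (w ^ k * G * star w ^ k - G) := by
    rw [Finset.sum_sub_distrib, smul_sub, avg_const hq, avg]
  rw [this]
  apply norm_avg_le hq
  intro k hk
  have h2 : w ^ k * G * star w ^ k - G = (w ^ k * G - G * w ^ k) * star w ^ k := by
    rw [sub_mul, mul_assoc G, unitary_pow_mul hw, mul_one]
  rw [h2]
  refine (nmulR (pow_comm_norm (norm_unitary_le hw) h k) ?_).trans ?_
  · rw [← star_pow, norm_star]; exact norm_unitary_le (pow_mem hw k)
  · have : (k : ℝ) ≤ q := by exact_mod_cast hk.le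
    gcongr

include hq hw in
lemma avg_w {s : ℝ} (h : ‖w ^ q * G - G * w ^ q‖ ≤ s) : ‖w * avg q w G - avg q w G * w‖ ≤ s := by
  have hs : 0 ≤ s := (norm_nonneg _).trans h
  have hq' : (1 : ℝ) ≤ q := by exact_mod_cast hq
  have e0 : w * avg q w G * star w - avg q w G = (1 / q : ℝ) • (w ^ q * G * star w ^ q - G) := by
    have := Finset.sum_range_succ_sub_sum (f := fun k => w ^ k * G * star w ^ k) (n := q)
    have h2 := Finset.sum_range_succ' (fun k => w ^ k * G * star w ^ k) q
    have h3 : ∑ k ∈ Finset.range q, w ^ (k + 1) * G * star w ^ (k + 1)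
       = w * (∑ k ∈ Finset.range q, w ^ k * G * star w ^ k) * star w := by
      rw [Finset.mul_sum, Finset.sum_mul]
      refine Finset.sum_congr rfl fun k _ => ?_
      rw [pow_succ', pow_succ]; noncomm_ring
    rw [avg, mul_smul_comm, smul_mul_assoc, ← smul_sub]
    congr 1
    rw [← h3]
    have h4 := Finset.sum_range_succ (fun k => w ^ k * G * star w ^ k) q
    rw [h2] at h4
    simp only [pow_zero, one_mul, mul_one] at h4
    rw [sub_eq_sub_iff_add_eq_add, h4, add_comm]
  have e1 : w * avg q w G - avg q w G * w = (w * avg q w G * star w - avg q w G) * w := by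
    rw [sub_mul, mul_assoc (w * _), (Unitary.mem_iff.1 hw).1, mul_one]
  rw [e1, e0]
  refine nmulR ?_ (norm_unitary_le hw)
  have e2 : w ^ q * G * star w ^ q - G = (w ^ q * G - G * w ^ q) * star w ^ q := by
    rw [sub_mul, mul_assoc G, unitary_pow_mul hw, mul_one]
  rw [norm_smul, Real.norm_of_nonneg (by positivity), e2]
  have e3 : ‖(w ^ q * G - G * w ^ q) * star w ^ q‖ ≤ s := by
    refine nmulR h ?_
    rw [← star_pow, norm_star]; exact norm_unitary_le (pow_mem hw q)
  calc 1 / (q : ℝ) * _ ≤ 1 * s := by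
        apply mul_le_mul _ e3 (norm_nonneg _) zero_le_one
        rw [div_le_one (by positivity)]; exact hq'
    _ = s := one_mul s

include hq hw in
lemma avg_y {y : B} {l : ℂ} (hl : ‖l‖ = 1) (hy : y * w = l • (w * y)) {s : ℝ} (h : ‖y * G - G * y‖ ≤ s) :
    ‖y * avg q w G - avg q w G * y‖ ≤ s := by
  have hy' : star w * y = l • (y * star w) := by
    have := congrArg (fun x => star w * x * star w) hy
    simp only [mul_smul_comm, smul_mul_assoc] at this
    rw [← mul_assoc (star w) w, (Unitary.mem_iff.1 hw).1, one_mul, mul_assoc, mul_assoc, (Unitary.mem_iff.1 hw).2, mul_one] at this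
    exact this
  have h1 : ∀ k : ℕ, y * w ^ k = l ^ k • (w ^ k * y) := by
    intro k
    induction k with
    | zero => simp
    | succ k ih =>
      rw [pow_succ, ← mul_assoc, ih, smul_mul_assoc, mul_assoc, hy, mul_smul_comm, smul_smul, ← pow_succ, mul_assoc]
  have h2 : ∀ k : ℕ, star w ^ k * y = l ^ k • (y * star w ^ k) := by
    intro k
    induction k with
    | zero => simp
    | succ k ih =>
      rw [pow_succ', mul_assoc, ih, mul_smul_comm, ← mul_assoc, hy', smul_mul_assoc, smul_smul, ← pow_succ, mul_assoc]
  have : y * avg q w G - avg q w G * y = (1 / q : ℝ) • ∑ k ∈ Finset.range q, l ^ k • (w ^ k * (y * G - G * y) * star w ^ k) := by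
    rw [avg, mul_smul_comm, smul_mul_assoc, ← smul_sub, Finset.mul_sum, Finset.sum_mul, ← Finset.sum_sub_distrib]
    congr 1
    refine Finset.sum_congr rfl fun k _ => ?_
    rw [mul_assoc _ (star w ^ k), h2, ← mul_assoc, ← mul_assoc, h1]
    simp only [smul_mul_assoc, mul_smul_comm, ← smul_sub]
    congr 1
    noncomm_ring
  rw [this]
  apply norm_avg_le hq
  intro k _
  rw [norm_smul, norm_pow, hl, one_pow, one_mul]
  refine nmulR (nmulL (norm_unitary_le (pow_mem hw k)) h) ?_
  rw [← star_pow, norm_star]; exact norm_unitary_le (pow_mem hw k)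

lemma avg_nu {ν : B} (h : ν * w = w * ν) (hG : ν * G = G) : ν * avg q w G = avg q w G := by
  rw [avg, mul_smul_comm, Finset.mul_sum]
  congr 1
  refine Finset.sum_congr rfl fun k _ => ?_
  have : ν * w ^ k = w ^ k * ν := (show Commute ν w from h).pow_right k
  rw [← mul_assoc, ← mul_assoc, this, mul_assoc _ ν, hG]

end Avg
end PIS

namespace PIS
universe u
set_option linter.all false

section CoreAbs
variable {B : Type*} [CStarAlgebra B]

structure CoreHyp (p U C eo N' m n' : B) (e : ℝ) : Prop where
  hp : IsStarProjection p
  hC : IsStarProjection C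
  heo : IsStarProjection eo
  hN : IsStarProjection N'
  hn : IsStarProjection n'
  hU : U ∈ unitary B
  hCp : C * p = p * C
  heop : eo * p = p * eo
  heoC : eo * C = 0
  hCN : C * N' = N' * C
  hnC : n' * C = C * n'
  hnN : n' * N' = N' * n'
  hnp : n' * p = p
  hUC : U * (C * (1 - N')) = C * (1 - N')
  hUp : ‖U * p - p * U‖ ≤ e
  hm : N' * m = m
  hpm : ‖p * m - m * p‖ ≤ e
  hmD : m * (U * (eo + C) * star U - C) = U * (eo + C) * star U - C

/-- commutator estimate for products -/
lemma comm_mul_le {a b y : B} {s t α β : ℝ} (ha : ‖a‖ ≤ α) (hb : ‖b‖ ≤ β)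
    (h1 : ‖a * y - y * a‖ ≤ s) (h2 : ‖b * y - y * b‖ ≤ t) :
    ‖a * b * y - y * (a * b)‖ ≤ α * t + s * β := by
  have : a * b * y - y * (a * b) = a * (b * y - y * b) + (a * y - y * a) * b := by noncomm_ring
  rw [this]
  exact nadd (nmul ha h2) (nmul h1 hb)

lemma comm_zero {a y : B} (h : Commute a y) : ‖a * y - y * a‖ ≤ 0 := by
  rw [h.eq, sub_self, norm_zero]

theorem coreAbs {p U C eo N' m n' w' wi xh : B} {e t η5 c0 d : ℝ} {q : ℕ}
    (H : CoreHyp p U C eo N' m n' e) (hq : 0 < q) (he : 0 ≤ e) (ht : 0 ≤ t) (ht' : t ≤ 1 / 50)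
    (h5 : 0 ≤ η5) (hc0 : 0 ≤ c0)
    (he2 : 400 * e ≤ t ^ 2) (hr : 40 * (q * (6 * η5 + 4 * c0)) ≤ t ^ 2)
    (hw' : w' ∈ unitary B) (hwi : wi ∈ unitary B)
    (hw'C : Commute C w') (hw'e : Commute eo w') (hw'N : Commute N' w') (hw'n : Commute n' w')
    (hiU : Commute U wi) (hiC : Commute C wi) (hie : Commute eo wi) (hiN : Commute N' wi) (hin : Commute n' wi)
    (hip : ‖p * wi - wi * p‖ ≤ c0)
    (hwN : ‖N' * (w' - wi)‖ ≤ η5) (hweo : eo * w' = eo * wi)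
    (hxp : Commute p xh) (hxN : Commute N' xh) (hxC : Commute C xh)
    (hNx : N' * w' ^ q = N' * xh)
    (hd : ‖U * (eo + C) * star U * xh - xh * (U * (eo + C) * star U)‖ ≤ d) :
    ∃ G R : B, IsStarProjection G ∧ N' * n' * G = G ∧ ‖G * w' - w' * G‖ ≤ 4 * d ∧
      star R * R = eo * p + C * (N' * n') ∧ R * star R = G ∧ ‖R * w' - w' * R‖ ≤ 2 * η5 + 18 * t + 4 * c0 ∧
      ∀ (y : B) (l : ℂ) (c : ℝ), ‖y‖ ≤ 1 → ‖l‖ = 1 → Commute U y → Commute C y → Commute eo y → Commute N' y →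
        Commute n' y → y * w' = l • (w' * y) → ‖p * y - y * p‖ ≤ c →
        ‖G * y - y * G‖ ≤ 16 * c ∧ ‖R * y - y * R‖ ≤ 18 * t + 4 * c := by
  obtain ⟨hp, hC, heo, hN, hn, hU, hCp, heop, heoC, hCN, hnC, hnN, hnp, hUC, hUp, hm, hpm, hmD⟩ := H
  have ha := core_a hp hC heo hN hn hU hCp heop heoC hCN hnC hnN hnp hUC hUp
  have hYY := core_YsY hp hC heo hN hn hU hCp heop heoC hCN hnC hnN hnp hUC hUp _ rfl
  have hYYs := core_YYs hp hC heo hN hn hU hCp heop heoC hCN hnC hnN hnp hUC hUp hm hpm hmD _ rfl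
  have hDn := core_Dnorm hp hC heo hN hn hU hCp heop heoC hCN hnC hnN hnp hUC hUp hm hpm hmD
  have hDs := core_Dsa hp hC heo hN hn hU hCp heop heoC hCN hnC hnN hnp hUC hUp hm hpm hmD
  have hG3 := core_G0n hp hC heo hN hn hU hCp heop heoC hCN hnC hnN hnp hUC hUp hm hpm hmD
  have hGsq := core_G0sq hp hC heo hN hn hU hCp heop heoC hCN hnC hnN hnp hUC hUp hm hpm hmD he _ rfl
  have hnB := core_normB hp hC heo hN hn hU hCp heop heoC hCN hnC hnN hnp hUC hUp
  have hν : IsStarProjection (N' * n') := proj_mul hN hn hnN.symm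
  set Y := (U * p + (1 - p)) * (eo * p + C * (N' * n')) with hYd
  set G0 := C * (N' * n') + N' * (p * (U * (eo + C) * star U - C) * p) * N' with hG0
  have hpn : p * n' = p := by
    have := congrArg star hnp
    rwa [star_mul, hp.isSelfAdjoint.star_eq, hn.isSelfAdjoint.star_eq] at this
  have hCν : C * (N' * n') = N' * n' * C := by rw [← mul_assoc, hCN, mul_assoc, ← hnC, mul_assoc]
  have hG0sa : star G0 = G0 := by
    have h1 : star (C * (N' * n')) = C * (N' * n') := by
      rw [star_mul, hν.isSelfAdjoint.star_eq, hC.isSelfAdjoint.star_eq, hCν]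
    have h2 : ∀ Δ : B, star Δ = Δ → star (N' * (p * Δ * p) * N') = N' * (p * Δ * p) * N' := by
      intro Δ h
      simp only [star_mul, h, hN.isSelfAdjoint.star_eq, hp.isSelfAdjoint.star_eq, mul_assoc]
    rw [hG0, star_add, h1, h2 _ hDs]
  have NN := hN.isIdempotentElem.eq
  have nn := hn.isIdempotentElem.eq
  have νν := hν.isIdempotentElem.eq
  have hνG0 : N' * n' * G0 = G0 := by
    rw [hG0, mul_add, hCν, ← mul_assoc, νν]
    congr 1
    have : ∀ Δ : B, N' * n' * (N' * (p * Δ * p) * N') = N' * (n' * N') * p * Δ * p * N' := by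
      intro Δ; noncomm_ring
    rw [this, hnN, ← mul_assoc, NN, mul_assoc N' n' p, hnp]
    noncomm_ring
  have hNG0 : N' * G0 = G0 := by rw [← hνG0, ← mul_assoc, ← mul_assoc, NN]
  have hG0N : G0 * N' = G0 := by
    have := congrArg star hNG0
    rwa [star_mul, hG0sa, hN.isSelfAdjoint.star_eq] at this
  -- commutators with y
  have hUs : ∀ y : B, Commute U y → Commute (star U) y := by
    intro y hy
    have e1 := (Unitary.mem_iff.1 hU).1
    have e2 := (Unitary.mem_iff.1 hU).2
    show star U * y = y * star U
    calc star U * y = star U * (y * U) * star U := by rw [mul_assoc, mul_assoc, e2, mul_one]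
      _ = star U * (U * y) * star U := by rw [hy.eq]
      _ = y * star U := by rw [← mul_assoc, e1, one_mul]
  have key : ∀ (y : B) (c : ℝ), Commute U y → Commute C y → Commute eo y → Commute N' y →
        Commute n' y → ‖p * y - y * p‖ ≤ c → ‖G0 * y - y * G0‖ ≤ 4 * c := by
    intro y c h1 h2 h3 h4 h5 h6
    have hΔ : Commute (U * (eo + C) * star U - C) y :=
      ((h1.mul_left (h3.add_left h2)).mul_left (hUs y h1)).sub_left h2
    set Δ := U * (eo + C) * star U - C
    clear_value Δ
    have a1 : G0 * y - y * G0 = N' * (p * Δ * p * y - y * (p * Δ * p)) * N' := by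
      have c1 : Commute (C * (N' * n')) y := h2.mul_left (h4.mul_left h5)
      rw [hG0, add_mul, mul_add, c1.eq, add_sub_add_left_eq_sub, mul_sub, sub_mul]
      congr 1
      · rw [mul_assoc, h4.eq]; noncomm_ring
      · simp only [← mul_assoc]; rw [← h4.eq]
    rw [a1]
    refine nmulR (nmulL hN.norm_le ?_) hN.norm_le
    refine (comm_mul_le (a := p * Δ) (α := 2) (β := 1) (nmulL hp.norm_le hDn) hp.norm_le
      (comm_mul_le (α := 1) (β := 2) hp.norm_le hDn h6 (comm_zero hΔ)) h6).trans ?_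
    linarith
  have hGi := key wi c0 hiU hiC hie hiN hin hip
  have hGw : ‖w' * G0 - G0 * w'‖ ≤ 6 * η5 + 4 * c0 := by
    have hwN' : ‖(w' - wi) * N'‖ ≤ η5 := by
      rw [sub_mul, ← hw'N.eq, ← hiN.eq, ← mul_sub]; exact hwN
    have : w' * G0 - G0 * w' = (w' - wi) * N' * G0 - G0 * (N' * (w' - wi)) - (G0 * wi - wi * G0) := by
      rw [mul_assoc, hNG0, ← mul_assoc, hG0N]; noncomm_ring
    rw [this]
    exact (nsub (nsub (nmul hwN' hG3) (nmul hG3 hwN)) hGi).trans (by linarith)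
  set r := (q : ℝ) * (6 * η5 + 4 * c0) with hrd
  have hr0 : 0 ≤ r := by positivity
  have hav := avg_near hq hw' (by positivity) hGw
  rw [← hrd] at hav
  have havsa := avg_sa (q := q) (w := w') hG0sa
  have hdw : ‖w' ^ q * G0 - G0 * w' ^ q‖ ≤ d := by
    set Δ := U * (eo + C) * star U - C with hΔ
    have hwqN : w' ^ q * N' = xh * N' := by
      rw [← (hw'N.pow_right q).eq, hNx, hxN.eq]
    have a1 : G0 * w' ^ q - w' ^ q * G0 = N' * (p * (Δ * xh - xh * Δ) * p) * N' := by
      have c1 : Commute (C * (N' * n')) (w' ^ q) := (hw'C.mul_left (hw'N.mul_left hw'n)).pow_right q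
      have b1 : N' * (p * Δ * p) * N' * w' ^ q = N' * (p * (Δ * xh) * p) * N' := by
        rw [mul_assoc _ N', hNx, hxN.eq]
        have : N' * (p * Δ * p) * (xh * N') = N' * (p * Δ * (p * xh)) * N' := by noncomm_ring
        rw [this, hxp.eq]; noncomm_ring
      have b2 : w' ^ q * (N' * (p * Δ * p) * N') = N' * (p * (xh * Δ) * p) * N' := by
        have : w' ^ q * (N' * (p * Δ * p) * N') = (w' ^ q * N') * (p * Δ * p) * N' := by noncomm_ring
        rw [this, hwqN, ← hxN.eq]
        have : N' * xh * (p * Δ * p) * N' = N' * ((xh * p) * Δ * p) * N' := by noncomm_ring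
        rw [this, ← hxp.eq]; noncomm_ring
      rw [hG0, add_mul, mul_add, c1.eq, add_sub_add_left_eq_sub, b1, b2]; noncomm_ring
    have a2 : Δ * xh - xh * Δ = U * (eo + C) * star U * xh - xh * (U * (eo + C) * star U) := by
      rw [hΔ, sub_mul, mul_sub, hxC.eq]; abel
    rw [← norm_neg, neg_sub, a1, a2]
    exact nmulR (nmulL hN.norm_le (nmulR (nmulL hp.norm_le hd) hp.norm_le)) hN.norm_le
  have havw := avg_w hq hw' hdw
  set Gb := avg q w' G0 with hGb
  have hνw : N' * n' * w' = w' * (N' * n') := (hw'N.mul_left hw'n).eq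
  have hνGb : N' * n' * Gb = Gb := avg_nu hνw hνG0
  have ht2 : t ^ 2 ≤ 1 / 2500 := by nlinarith
  have hGbn : ‖Gb‖ ≤ 4 := by
    have : Gb = (Gb - G0) + G0 := by abel
    rw [this]; exact (nadd hav hG3).trans (by linarith)
  have hGb2 : ‖Gb * Gb - Gb‖ ≤ 80 * e + 8 * r := by
    have : Gb * Gb - Gb = (G0 * G0 - G0) + (Gb - G0) * Gb + G0 * (Gb - G0) - (Gb - G0) := by noncomm_ring
    rw [this]
    exact (nsub (nadd (nadd hGsq (nmul hav hGbn)) (nmul hG3 hav)) hav).trans (by linarith)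
  obtain ⟨G, hG, hGn, hGy, k, hk⟩ := near_proj havsa (by linarith) hGb2
  have hνG : N' * n' * G = G := by rw [hk, ← mul_assoc, hνGb]
  have hYG : ‖Y * star Y - G‖ ≤ t ^ 2 := by
    have : Y * star Y - G = (Y * star Y - G0) - (Gb - G0) - (G - Gb) := by abel
    rw [this]
    exact (nsub (nsub hYYs hav) hGn).trans (by linarith)
  obtain ⟨R, hR1, hR2, hRY⟩ := polar2 ha hG hYY.1 ht ht' (hYY.2.trans (by linarith)) hYG
  have keyR : ∀ (y : B) (c : ℝ), ‖y‖ ≤ 1 → Commute U y → Commute C y → Commute eo y → Commute N' y →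
        Commute n' y → ‖p * y - y * p‖ ≤ c → ‖R * y - y * R‖ ≤ 18 * t + 4 * c := by
    intro y c h0 h1 h2 h3 h4 h5 h6
    have hY : ‖Y * y - y * Y‖ ≤ 2 * c + 2 * c * 1 := by
      rw [hYd]
      apply comm_mul_le hnB ha.norm_le
      · have : (U * p + (1 - p)) * y - y * (U * p + (1 - p)) = U * (p * y - y * p) - (p * y - y * p) := by
          have b : U * p * y - y * (U * p) = U * (p * y - y * p) := by
            rw [mul_sub, ← mul_assoc, ← mul_assoc, ← mul_assoc, h1.eq]
          have : (U * p + (1 - p)) * y - y * (U * p + (1 - p)) = (U * p * y - y * (U * p)) - (p * y - y * p) := by noncomm_ring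
          rw [this, b]
        rw [this]
        exact (nsub (nmulL (norm_unitary_le hU) h6) h6).trans (by linarith)
      · have : (eo * p + C * (N' * n')) * y - y * (eo * p + C * (N' * n')) = eo * (p * y - y * p) := by
          have b : y * (eo * p) = eo * (y * p) := by rw [← mul_assoc, ← h3.eq, mul_assoc]
          rw [add_mul, mul_add, (h2.mul_left (h4.mul_left h5)).eq, b]; noncomm_ring
        rw [this]
        exact nmulL heo.norm_le h6
    have : R * y - y * R = (R - Y) * y - y * (R - Y) + (Y * y - y * Y) := by noncomm_ring
    rw [this]
    exact (nadd (nsub (nmulR hRY h0) (nmulL h0 hRY)) hY).trans (by linarith)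
  refine ⟨G, R, hG, hνG, ?_, hR1, hR2, ?_, ?_⟩
  · refine (hGy w').trans ?_
    have : ‖Gb * w' - w' * Gb‖ ≤ d := by rw [← norm_neg, neg_sub]; exact havw
    linarith
  · have hRi := keyR wi c0 (norm_unitary_le hwi) hiU hiC hie hiN hin hip
    have hRa : R * (eo * p + C * (N' * n')) = R := mul_proj_of_star_mul ha hR1
    have haN : (eo * p + C * (N' * n')) * (w' - wi) = C * n' * (N' * (w' - wi)) := by
      have e3 : eo * p * (w' - wi) = 0 := by rw [heop, mul_assoc, mul_sub, hweo, sub_self, mul_zero]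
      rw [add_mul, e3, zero_add, ← hnN]; noncomm_ring
    have e1 : ‖R * (w' - wi)‖ ≤ η5 := by
      rw [← hRa, mul_assoc, haN]
      have hRn : ‖R‖ ≤ 1 := norm_le_one_of_proj ha hR1
      exact nmulL hRn (nmulL (nmulL hC.norm_le hn.norm_le) hwN)
    have hRn : ‖R‖ ≤ 1 := norm_le_one_of_proj ha hR1
    have hGR : N' * n' * R = R := by
      have h1 : R * star R * R = R := by rw [mul_assoc, hR1, hRa]
      rw [hR2] at h1
      rw [← h1, ← mul_assoc, hνG]
    have e2 : ‖(w' - wi) * R‖ ≤ η5 := by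
      have : (w' - wi) * R = N' * (w' - wi) * (n' * R) := by
        rw [mul_sub, hw'N.eq, hiN.eq, ← sub_mul, mul_assoc, ← mul_assoc N' n', hGR]
      rw [this]; exact nmulR hwN (nmulL hn.norm_le hRn)
    have : R * w' - w' * R = R * (w' - wi) - (w' - wi) * R + (R * wi - wi * R) := by noncomm_ring
    rw [this]
    exact (nadd (nsub e1 e2) hRi).trans (by linarith)
  · intro y l c h0 hl h1 h2 h3 h4 h5 hy h6
    refine ⟨?_, keyR y c h0 h1 h2 h3 h4 h5 h6⟩
    have h7 : ‖y * G0 - G0 * y‖ ≤ 4 * c := by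
      rw [← norm_neg, neg_sub]; exact key y c h1 h2 h3 h4 h5 h6
    have h8 := avg_y hq hw' hl hy h7
    refine (hGy y).trans ?_
    have : ‖Gb * y - y * Gb‖ ≤ 4 * c := by rw [← norm_neg, neg_sub]; exact h8
    linarith

end CoreAbs
end PIS

namespace PIS
universe u
set_option linter.all false

section PD
variable {κ : Type} [Fintype κ] [DecidableEq κ] {D : Type*} [CStarAlgebra D] {Z : Type} [Fintype Z] [DecidableEq Z]
  {p : Z → D} (hp : OP p)

noncomputable def PD (κ : Type) [Fintype κ] [DecidableEq κ] {D : Type*} [CStarAlgebra D] {Z : Type} [Fintype Z] [DecidableEq Z]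
  {p : Z → D} (hp : OP p) (f : Z → κ → ℂ) : CStarMatrix κ κ D := Phi κ hp (fun z => dgh (f z))

lemma PD_mul (f g : Z → κ → ℂ) : PD κ hp f * PD κ hp g = PD κ hp (f * g) := by
  rw [PD, PD, PD, ← map_mul]; congr 1; funext z; rw [Pi.mul_apply, ← map_mul]; rfl

lemma PD_one : PD κ hp (1 : Z → κ → ℂ) = 1 := by
  unfold PD; exact map_one (Phi κ hp) ▸ congrArg _ (funext fun z => map_one dgh)

lemma PD_sub (f g : Z → κ → ℂ) : PD κ hp f - PD κ hp g = PD κ hp (f - g) := by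
  rw [PD, PD, PD, ← map_sub]; congr 1; funext z; rw [Pi.sub_apply, ← map_sub]; rfl

lemma PD_add (f g : Z → κ → ℂ) : PD κ hp f + PD κ hp g = PD κ hp (f + g) := by
  rw [PD, PD, PD, ← map_add]; congr 1; funext z; rw [Pi.add_apply, ← map_add]; rfl

lemma PD_zero : PD κ hp (0 : Z → κ → ℂ) = 0 := by
  rw [PD, ← map_zero (Phi κ hp)]; congr 1; funext z; rw [Pi.zero_apply, map_zero]; rfl

lemma PD_star (f : Z → κ → ℂ) : star (PD κ hp f) = PD κ hp (star f) := by
  rw [PD, PD, ← map_star]; congr 1; funext z; rw [Pi.star_apply, ← map_star]; rfl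

lemma PD_pow (f : Z → κ → ℂ) (n : ℕ) : PD κ hp f ^ n = PD κ hp (f ^ n) := by
  rw [PD, PD, ← map_pow]; congr 1; funext z; rw [Pi.pow_apply, ← map_pow]; rfl

lemma PD_comm (f g : Z → κ → ℂ) : Commute (PD κ hp f) (PD κ hp g) := by
  show _ * _ = _ * _
  rw [PD_mul, PD_mul, mul_comm]

lemma PD_iot (f : Z → κ → ℂ) {b : D} (hb : ∀ z, Commute (p z) b) : Commute (PD κ hp f) (iot κ b) :=
  Phi_comm hp _ hb

lemma PD_norm {f : Z → κ → ℂ} {c : ℝ} (hc : 0 ≤ c) (h : ∀ z k, ‖f z k‖ ≤ c) : ‖PD κ hp f‖ ≤ c :=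
  norm_Phi_le hp hc fun z => norm_dgh_le hc (h z)

lemma PD_proj {f : Z → κ → ℂ} (h : ∀ z k, f z k = 0 ∨ f z k = 1) : IsStarProjection (PD κ hp f) := by
  refine ⟨?_, ?_⟩
  · show _ * _ = _
    rw [PD_mul]; congr 1; funext z k
    rcases h z k with h | h <;> simp [h]
  · show star _ = _
    rw [PD_star]; congr 1; funext z k
    rcases h z k with h | h <;> simp [h]

lemma PD_const (f : κ → ℂ) : PD κ hp (fun _ => f) = mu (dgh f) := Phi_const hp _

lemma eu_eq_dgh (o : κ) : eu o o = dgh (fun k => if k = o then (1 : ℂ) else 0) := by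
  ext a b
  simp only [eu_apply, dgh_apply]
  by_cases h : a = b
  · subst h; simp
  · by_cases h' : a = o
    · subst h'; simp [h]; exact fun h2 => h h2.symm
    · simp [h, h']

lemma dgh_eq_sum (f : κ → ℂ) : (dgh f : CStarMatrix κ κ ℂ) = ∑ k, f k • eu k k := by
  ext a b
  rw [cm_sum_apply]
  simp only [dgh_apply, CStarMatrix.smul_apply, eu_apply]
  by_cases h : a = b
  · subst h; simp
  · rw [if_neg h]; symm; apply Finset.sum_eq_zero; intro c _
    have : ¬ (a = c ∧ b = c) := fun h2 => h (h2.1.trans h2.2.symm)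
    simp [this]

lemma dgh_mul_of (f : κ → ℂ) (M : CStarMatrix κ κ ℂ) (h : ∀ k, f k ≠ 1 → eu k k * M = 0) : dgh f * M = M := by
  have : dgh f * M = ∑ k, f k • (eu k k * M) := by
    rw [dgh_eq_sum, Finset.sum_mul]; simp only [smul_mul_assoc]
  rw [this]
  have h2 : ∀ k, f k • (eu k k * M) = eu k k * M := by
    intro k
    by_cases hk : f k = 1
    · rw [hk, one_smul]
    · rw [h k hk, smul_zero]
  simp only [h2]
  rw [← Finset.sum_mul, sum_eu, one_mul]

lemma mul_dgh_of (f : κ → ℂ) (M : CStarMatrix κ κ ℂ) (h : ∀ k, f k ≠ 0 → M * eu k k = eu k k) : M * dgh f = dgh f := by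
  rw [dgh_eq_sum, Finset.mul_sum]
  refine Finset.sum_congr rfl fun k _ => ?_
  rw [mul_smul_comm]
  by_cases hk : f k = 0
  · rw [hk, zero_smul, zero_smul]
  · rw [h k hk]
end PD

structure CoreOut {D : Type u} [CStarAlgebra D] (κ : Type) [Fintype κ] [DecidableEq κ] (o : κ) (q : ℕ)
    (w Nn P : D) (η c0 δ' : ℝ) (w' Nw W G R : CStarMatrix κ κ D) : Prop where
  uw : w' ∈ unitary (CStarMatrix κ κ D)
  ord : ∃ N : ℕ, 0 < N ∧ w' ^ N = 1
  pNw : IsStarProjection Nw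
  pW : IsStarProjection W
  NwW : Nw * W = W
  eoW : mu (eu o o) * W = 0
  cNw : Commute Nw w'
  cW : Commute W w'
  iNw : iot κ Nn * Nw = Nw
  Nweo : Nw * mu (eu o o) = mu (eu o o) * iot κ Nn
  pG : IsStarProjection G
  NwG : Nw * G = G
  cG : ‖G * w' - w' * G‖ ≤ δ'
  RR : star R * R = mu (eu o o) * iot κ P + W
  RR' : R * star R = G
  cR : ‖R * w' - w' * R‖ ≤ η
  w'eo : w' * mu (eu o o) = mu (eu o o) * iot κ w
  eow' : mu (eu o o) * w' = mu (eu o o) * iot κ w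
  wNw : ‖(w' - iot κ w) * Nw‖ ≤ η
  c6 : ∀ y : D, Commute y (w ^ q) → Commute y Nn → Commute (iot κ y) Nw ∧ Commute (iot κ y) W
  c7 : ∀ (y : D) (l : ℂ), y ∈ unitary D → l ^ q = 1 → y * w = l • (w * y) → Commute y Nn →
    iot κ y * w' = l • (w' * iot κ y) ∧
    ∀ c : ℝ, c ≤ c0 → ‖P * y - y * P‖ ≤ c → ‖G * iot κ y - iot κ y * G‖ ≤ 16 * c ∧ ‖R * iot κ y - iot κ y * R‖ ≤ η
  c8 : ∀ d : D, Commute d w → Commute (iot κ d) w'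

lemma g_exists {q : ℕ} (hq : 0 < q) {η5 : ℝ} (h5 : 0 < η5) : ∃ (g : ℂ → ℂ) (η1 : ℝ), 0 < η1 ∧ (∀ s, g s ^ q = s) ∧
    (∀ s, ‖s‖ = 1 → ‖g s‖ = 1) ∧ ∀ s, ‖s - 1‖ < η1 → ‖g s - 1‖ ≤ η5 := by
  have hg : ∀ s : ℂ, (s ^ ((q : ℂ)⁻¹)) ^ q = s := fun s => Complex.cpow_nat_inv_pow s hq.ne'
  have hc : ContinuousAt (fun s : ℂ => s ^ ((q : ℂ)⁻¹)) 1 := by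
    exact continuousAt_cpow_const (by simp [Complex.slitPlane])
  rw [Metric.continuousAt_iff] at hc
  obtain ⟨η1, h1, h2⟩ := hc η5 h5
  refine ⟨fun s => s ^ ((q : ℂ)⁻¹), η1, h1, hg, ?_, ?_⟩
  · intro s hs
    have h3 := congrArg norm (hg s)
    rw [norm_pow, hs] at h3
    exact (pow_eq_one_iff_of_nonneg (norm_nonneg _) hq.ne').1 h3
  · intro s hs
    have := h2 (x := s) (by rwa [dist_eq_norm])
    rw [dist_eq_norm] at this
    simpa using this.le

theorem core {q : ℕ} (hq : 0 < q) {η : ℝ} (hη : 0 < η) : ∃ c0 > (0 : ℝ), ∀ δ' > (0 : ℝ),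
    ∀ (D : Type u) [CStarAlgebra D] (w Nn P : D), w ∈ unitary D → (∃ N : ℕ, 0 < N ∧ w ^ N = 1) →
    IsStarProjection Nn → Commute Nn w → IsStarProjection P → Nn * P = P → ‖P * w - w * P‖ ≤ c0 →
    ∃ (κ : Type) (_ : Fintype κ) (_ : DecidableEq κ) (o : κ) (w' Nw W G R : CStarMatrix κ κ D),
      CoreOut κ o q w Nn P η c0 δ' w' Nw W G R := by
  have hq' : (1 : ℝ) ≤ q := by exact_mod_cast hq
  obtain ⟨t, htd⟩ : ∃ t, t = min (1 / 50) (η / 100) := ⟨_, rfl⟩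
  have ht : 0 < t := by rw [htd]; positivity
  have ht1 : t ≤ 1 / 50 := by rw [htd]; exact min_le_left _ _
  have ht2 : t ≤ η / 100 := by rw [htd]; exact min_le_right _ _
  have htt : t ^ 2 ≤ t := by nlinarith
  obtain ⟨η5, h5d⟩ : ∃ x, x = t ^ 2 / (1000 * q) := ⟨_, rfl⟩
  have h5 : 0 < η5 := by rw [h5d]; positivity
  have h5q : q * η5 = t ^ 2 / 1000 := by rw [h5d]; field_simp
  have h5' : η5 ≤ t := by nlinarith
  obtain ⟨g, η1, hη1, hgq, hgn, hg1⟩ := g_exists hq h5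
  obtain ⟨e, hed⟩ : ∃ x, x = t ^ 2 / 1200 := ⟨_, rfl⟩
  have he : 0 < e := by rw [hed]; positivity
  obtain ⟨mesh0, hmesh0, hSL⟩ := SL (half_pos hη1) he
  obtain ⟨mesh, hmd⟩ : ∃ x, x = min mesh0 (e * η1 / 2) := ⟨_, rfl⟩
  have hmesh : 0 < mesh := by rw [hmd]; positivity
  obtain ⟨cE, hcE, hEQ⟩ := EQ.{u} hmesh he
  obtain ⟨c0, hcd⟩ : ∃ x, x = min (cE / q) η5 := ⟨_, rfl⟩
  have hc0 : 0 < c0 := by rw [hcd]; positivity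
  have hc1 : q * c0 ≤ cE := by
    have : c0 ≤ cE / q := by rw [hcd]; exact min_le_left _ _
    rw [le_div_iff₀ (by positivity)] at this; linarith
  have hc2 : c0 ≤ η5 := by rw [hcd]; exact min_le_right _ _
  refine ⟨c0, hc0, ?_⟩
  intro δ' hδ D _ w Nn P hw hwN hNn hNw hP hNP hPw
  obtain ⟨N, hN0, hwN⟩ := hwN
  obtain ⟨κ, fκ, dκ, o, x, C, U, Nx, hNx0, hxN, hC01, hCo, hU, hUmesh, hUx, hUo, hUfix⟩ := hSL (δ' / 4) (by positivity)
  have hu : w ^ q ∈ unitary D := pow_mem hw q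
  have huN : (w ^ q) ^ N = 1 := by rw [← pow_mul, mul_comm, pow_mul, hwN, one_pow]
  obtain ⟨Z, hZ, hZN⟩ := spec_finite_order hN0 huN
  have hZs : ∀ z ∈ Z, z ∈ Metric.sphere (0 : ℂ) 1 := fun z hz => sphere_of_pow hN0 (hZN z hz)
  have hEQ1 := hEQ D (w ^ q) P hu hP.norm_le (by
    have h1 : ‖w * P - P * w‖ ≤ c0 := by rw [← norm_neg, neg_sub]; exact hPw
    exact (pow_comm_norm (norm_unitary_le hw) h1 q).trans hc1) Z hZ hZs κ
  have hOP := spr_OP hu hZ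
  have hzn : ∀ z : Z, ‖(z : ℂ)‖ = 1 := fun z => by simpa using hZs z z.2
  have hxn : ∀ k, ‖x k‖ = 1 := fun k => Complex.norm_eq_one_of_pow_eq_one (hxN k) hNx0.ne'
  have hzc : ∀ z : Z, star (z : ℂ) * z = 1 := fun z => by
    have := Complex.conj_mul' (z : ℂ); rw [hzn z] at this; simpa using this
  have hcomm : ∀ y : D, Commute (w ^ q) y → ∀ z : Z, Commute (spr (w ^ q) (z : ℂ)) y := fun y hy z => spr_comm hu hy z
  obtain ⟨nf, hnf⟩ : ∃ f : Z → κ → ℂ, f = fun (z : Z) k => if k ≠ o ∧ ‖x k - z‖ < η1 then 1 else 0 := ⟨_, rfl⟩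
  obtain ⟨mf, hmf⟩ : ∃ f : ℂ → κ → ℂ, f = fun z k => if k = o then 0 else ((cl (2 - 2 * ‖x k - z‖ / η1) : ℝ) : ℂ) := ⟨_, rfl⟩
  obtain ⟨of, hof⟩ : ∃ f : κ → ℂ, f = fun k => if k = o then 1 else 0 := ⟨_, rfl⟩
  obtain ⟨tf, htf⟩ : ∃ f : Z → κ → ℂ, f = fun (z : Z) k => if k = o then 1 else g (x k * star (z : ℂ)) := ⟨_, rfl⟩
  have htn : ∀ z k, ‖tf z k‖ = 1 := by
    intro z k; rw [htf]; dsimp only; split_ifs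
    · simp
    · apply hgn; rw [norm_mul, norm_star, hzn, hxn, one_mul]
  have hnf01 : ∀ z k, nf z k = 0 ∨ nf z k = 1 := by
    intro z k; rw [hnf]; dsimp only; split_ifs <;> simp
  have hof01 : ∀ k, of k = 0 ∨ of k = 1 := by
    intro k; rw [hof]; dsimp only; split_ifs <;> simp
  have heuof : eu o o = dgh of := by rw [hof]; exact eu_eq_dgh o
  obtain ⟨T, hT⟩ : ∃ T, T = PD κ hOP tf := ⟨_, rfl⟩
  obtain ⟨N', hN'⟩ : ∃ T, T = PD κ hOP nf := ⟨_, rfl⟩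
  obtain ⟨m, hm⟩ : ∃ T, T = PD κ hOP (fun z => mf z) := ⟨_, rfl⟩
  obtain ⟨eo, heo⟩ : ∃ T : CStarMatrix κ κ D, T = mu (eu o o) := ⟨_, rfl⟩
  obtain ⟨Cm, hCm⟩ : ∃ T : CStarMatrix κ κ D, T = mu (dgh C) := ⟨_, rfl⟩
  obtain ⟨xh, hxh⟩ : ∃ T : CStarMatrix κ κ D, T = mu (dgh x) := ⟨_, rfl⟩
  obtain ⟨Um, hUm⟩ : ∃ T : CStarMatrix κ κ D, T = Phi κ hOP (fun z => U z) := ⟨_, rfl⟩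
  have heo' : eo = PD κ hOP (fun _ => of) := by rw [PD_const, heo, heuof]
  have hCm' : Cm = PD κ hOP (fun _ => C) := by rw [PD_const, hCm]
  have hxh' : xh = PD κ hOP (fun _ => x) := by rw [PD_const, hxh]
  have hTu : T ∈ unitary (CStarMatrix κ κ D) := by
    rw [Unitary.mem_iff, hT, PD_star, PD_mul, PD_mul, ← PD_one hOP]
    have h1 : star tf * tf = 1 := by
      funext z k
      have := Complex.conj_mul' (tf z k)
      rw [htn] at this; simpa using this
    rw [mul_comm tf, h1]; exact ⟨rfl, rfl⟩
  have hiw : iot κ w ∈ unitary (CStarMatrix κ κ D) := by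
    rw [Unitary.mem_iff, ← map_star, ← map_mul, ← map_mul, (Unitary.mem_iff.1 hw).1, (Unitary.mem_iff.1 hw).2, map_one]
    exact ⟨rfl, rfl⟩
  have cw : ∀ f : Z → κ → ℂ, ∀ y : D, Commute (w ^ q) y → Commute (PD κ hOP f) (iot κ y) := fun f y hy => PD_iot hOP f (hcomm y hy)
  have cUy : ∀ y : D, Commute (w ^ q) y → Commute Um (iot κ y) := fun y hy => by
    rw [hUm]; exact Phi_comm hOP _ (hcomm y hy)
  have cww : Commute (w ^ q) w := (Commute.refl w).pow_left q
  have cwN : Commute (w ^ q) Nn := hNw.symm.pow_left q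
  obtain ⟨w', hw'⟩ : ∃ T' : CStarMatrix κ κ D, T' = iot κ w * T := ⟨_, rfl⟩
  have hw'u : w' ∈ unitary (CStarMatrix κ κ D) := by rw [hw']; exact mul_mem hiw hTu
  have hiTc : Commute (iot κ w) T := by rw [hT]; exact (cw tf w cww).symm
  have cPw' : ∀ f, Commute (PD κ hOP f) w' := fun f => by
    rw [hw']; exact (cw f w cww).mul_right (by rw [hT]; exact PD_comm hOP _ _)
  obtain ⟨xz, hxz⟩ : ∃ f : Z → κ → ℂ, f = fun (z : Z) k => if k = o then (z : ℂ) else x k := ⟨_, rfl⟩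
  have hw'q : w' ^ q = PD κ hOP xz := by
    have h1 : iot κ (w ^ q) = PD κ hOP (fun z _ => (z : ℂ)) := by
      have h2 := Phi_scalar (κ := κ) hOP (fun z : Z => (z : ℂ))
      have h3 := spr_sum hu hZ (fun z => z)
      have := normal_of_unitary hu
      rw [cfc_id' ℂ (w ^ q)] at h3
      refine (congrArg (iot κ) h3).trans (h2.symm.trans ?_)
      rw [PD]
      congr 1; funext z
      ext a b
      simp [dgh_apply, CStarMatrix.smul_apply, CStarMatrix.one_apply]
    rw [hw', hiTc.mul_pow, ← map_pow, h1, hT, PD_pow, PD_mul]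
    congr 1; funext z k
    rw [Pi.mul_apply, Pi.mul_apply, Pi.pow_apply, Pi.pow_apply, htf, hxz]
    dsimp only
    split_ifs
    · simp
    · rw [hgq, mul_comm, mul_assoc, hzc, mul_one]
  have hp : IsStarProjection (iot κ P) := hP.map (iot κ)
  have hn : IsStarProjection (iot κ Nn) := hNn.map (iot κ)
  have hmuc : ∀ (M : CStarMatrix κ κ ℂ) (y : D), Commute (mu M) (iot κ y) := fun M y => mu_comm M y
  have hUu : ∀ z : Z, ‖U z‖ ≤ 1 := fun z => norm_unitary_le (hU z)
  have hclb : ∀ r, 0 ≤ cl r ∧ cl r ≤ 1 := fun r => by unfold cl; exact ⟨le_max_left _ _, max_le zero_le_one (min_le_left _ _)⟩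
  have H : CoreHyp (iot κ P) Um Cm eo N' m (iot κ Nn) (3 * e) := by
    refine ⟨hp, ?_, ?_, ?_, hn, ?_, ?_, ?_, ?_, ?_, ?_, ?_, ?_, ?_, ?_, ?_, ?_, ?_⟩
    · rw [hCm']; exact PD_proj hOP fun z k => hC01 k
    · rw [heo']; exact PD_proj hOP fun z k => hof01 k
    · rw [hN']; exact PD_proj hOP hnf01
    · rw [Unitary.mem_iff, hUm, ← map_star, ← map_mul, ← map_mul]
      constructor
      · rw [← map_one (Phi κ hOP)]; congr 1; funext z; exact (Unitary.mem_iff.1 (hU z)).1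
      · rw [← map_one (Phi κ hOP)]; congr 1; funext z; exact (Unitary.mem_iff.1 (hU z)).2
    · rw [hCm]; exact hmuc _ _
    · rw [heo]; exact hmuc _ _
    · rw [heo', hCm', PD_mul, ← PD_zero hOP]; congr 1; funext z k
      rw [hof]; simp only [Pi.mul_apply, Pi.zero_apply]
      split_ifs with h
      · rw [h, hCo]; simp
      · simp
    · rw [hCm', hN']; exact PD_comm hOP _ _
    · rw [hCm]; exact (hmuc _ _).symm
    · rw [hN']; exact (cw _ _ cwN).symm
    · rw [← map_mul, hNP]
    · rw [hCm', hN', ← PD_one hOP, PD_sub, PD_mul, PD, hUm, ← map_mul]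
      congr 1; funext z
      apply mul_dgh_of
      intro k hk
      have hk1 : k ≠ o := by rintro rfl; apply hk; simp [hCo]
      have hk2 : η1 ≤ ‖x k - z‖ := by
        by_contra h
        apply hk
        have : nf z k = 1 := by rw [hnf]; simp [hk1, not_le.1 h]
        simp [this]
      exact (hUfix z (hZs z z.2) k hk1 (by linarith)).1
    · rw [← norm_neg, neg_sub, hUm]
      refine hEQ1 U (fun z => norm_unitary_le (hU z)) (fun z hz w hw h => hUmesh z hz w hw (h.trans_le ?_))
      rw [hmd]; exact min_le_left _ _
    · rw [hN', hm, PD_mul]; congr 1; funext z k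
      simp only [Pi.mul_apply]
      rw [hnf, hmf]; dsimp only
      by_cases hk : k = o
      · simp [hk]
      · by_cases h : ‖x k - z‖ < η1
        · simp [hk, h]
        · simp only [hk, h, ne_eq, not_false_eq_true, and_false, if_false, zero_mul]
          rw [cl_of_nonpos]; · simp
          have : 2 ≤ 2 * ‖x k - z‖ / η1 := by
            rw [le_div_iff₀ hη1]; linarith
          linarith
    · rw [hm, PD]
      refine hEQ1 (fun z => dgh (mf z)) ?_ ?_
      · intro z; apply norm_dgh_le zero_le_one
        intro k; rw [hmf]; dsimp only; split_ifs
        · simp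
        · rw [Complex.norm_real, Real.norm_of_nonneg (hclb _).1]; exact (hclb _).2
      · intro z hz w hw h
        rw [← map_sub]; apply norm_dgh_le he.le
        intro k
        rw [Pi.sub_apply, hmf]; dsimp only; split_ifs
        · simpa using he.le
        · rw [← Complex.ofReal_sub, Complex.norm_real]
          refine (cl_lip _ _).trans ?_
          have h3 : (2 - 2 * ‖x k - z‖ / η1) - (2 - 2 * ‖x k - w‖ / η1) = 2 / η1 * (‖x k - w‖ - ‖x k - z‖) := by ring
          rw [h3, abs_mul, abs_of_pos (by positivity)]
          have h4 : |‖x k - w‖ - ‖x k - z‖| ≤ ‖z - w‖ := by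
            refine (abs_norm_sub_norm_le _ _).trans_eq ?_
            congr 1; ring
          have h5 : ‖z - w‖ ≤ e * η1 / 2 := h.le.trans (by rw [hmd]; exact min_le_right _ _)
          calc 2 / η1 * |‖x k - w‖ - ‖x k - z‖| ≤ 2 / η1 * (e * η1 / 2) := by gcongr; exact h4.trans h5
            _ = e := by field_simp
    · have : Um * (eo + Cm) * star Um - Cm = Phi κ hOP (fun z => U z * (eu o o + dgh C) * star (U z) - dgh C) := by
        rw [hUm, heo, hCm, ← Phi_const hOP (eu o o), ← Phi_const hOP (dgh C), ← map_star, ← map_add, ← map_mul, ← map_mul, ← map_sub]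
        rfl
      rw [this, hm, PD, ← map_mul]
      congr 1; funext z
      rw [Pi.mul_apply]
      apply dgh_mul_of
      intro k hk
      by_cases hko : k = o
      · subst hko
        rw [mul_sub, hUo, eu_dgh, hCo]; simp
      · have hk2 : η1 / 2 ≤ ‖x k - z‖ := by
          by_contra h
          apply hk
          rw [hmf]; simp only [hko, if_false]
          rw [cl_of_one_le]; · simp
          have : 2 * ‖x k - z‖ / η1 ≤ 1 := by rw [div_le_one hη1]; linarith [not_le.1 h]
          linarith
        obtain ⟨f1, f2⟩ := hUfix z (hZs z z.2) k hko hk2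
        have f3 : eu k k * star (U z) = eu k k := by
          have := congrArg star f1; rwa [star_mul, star_eu] at this
        rw [mul_sub, ← mul_assoc, ← mul_assoc, f2, mul_add, eu_mul_ne _ hko, zero_add, eu_dgh, smul_mul_assoc, f3, sub_self]
  have hd : ‖Um * (eo + Cm) * star Um * xh - xh * (Um * (eo + Cm) * star Um)‖ ≤ δ' / 4 := by
    have : Um * (eo + Cm) * star Um * xh - xh * (Um * (eo + Cm) * star Um)
        = Phi κ hOP (fun z => U z * (eu o o + dgh C) * star (U z) * dgh x - dgh x * (U z * (eu o o + dgh C) * star (U z))) := by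
      rw [hUm, heo, hCm, hxh, ← Phi_const hOP (eu o o), ← Phi_const hOP (dgh C), ← Phi_const hOP (dgh x), ← map_star, ← map_add, ← map_mul, ← map_mul, ← map_mul, ← map_mul, ← map_sub]
      rfl
    rw [this]
    exact norm_Phi_le hOP (by positivity) fun z => hUx z
  have hN'Nw : IsStarProjection N' := H.hN
  have hwN' : ‖N' * (w' - iot κ w)‖ ≤ η5 := by
    have : N' * (w' - iot κ w) = iot κ w * PD κ hOP (nf * (tf - 1)) := by
      rw [← PD_mul, ← PD_sub, PD_one, ← hT, ← hN', hw', ← mul_assoc (iot κ w)]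
      rw [show iot κ w * N' = N' * iot κ w by rw [hN']; exact (cw nf w cww).symm.eq]
      noncomm_ring
    rw [this]
    refine nmulL (norm_unitary_le hiw) (PD_norm hOP h5.le fun z k => ?_)
    rw [hnf, htf]; simp only [Pi.mul_apply, Pi.sub_apply, Pi.one_apply]
    by_cases hk : k = o
    · simp [hk, h5.le]
    · by_cases h : ‖x k - z‖ < η1
      · simp only [hk, h, ne_eq, not_false_eq_true, and_self, if_true, if_false, one_mul]
        apply hg1
        have : x k * star (z : ℂ) - 1 = (x k - z) * star (z : ℂ) := by
          rw [sub_mul, mul_comm (z : ℂ), hzc]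
        rw [this, norm_mul, norm_star, hzn, mul_one]; exact h
      · simp [hk, h, h5.le]
  have heow' : eo * w' = eo * iot κ w := by
    have : eo * T = eo := by
      rw [heo', hT, PD_mul]; congr 1; funext z k
      rw [hof, htf]; simp only [Pi.mul_apply]; split_ifs <;> simp
    have h2 : eo * iot κ w = iot κ w * eo := by rw [heo]; exact mu_iot _ _
    rw [hw', ← mul_assoc, h2, mul_assoc, this]
  have heoN' : eo * N' = 0 := by
    rw [heo', hN', PD_mul, ← PD_zero hOP]; congr 1; funext z k
    rw [hof, hnf]; simp only [Pi.mul_apply, Pi.zero_apply]; by_cases hk : k = o <;> simp [hk]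
  have cwn : Commute (iot κ Nn) w' := by
    rw [hw']
    exact (hNw.map (iot κ)).mul_right (by rw [hT]; exact (cw _ _ cwN).symm)
  obtain ⟨G, R, hG, hνG, hGw, hRR, hRR', hRw, hy⟩ := coreAbs (w' := w') (wi := iot κ w) (xh := xh) (t := t) (η5 := η5) (c0 := c0)
    (d := δ' / 4) (q := q) H hq (by positivity) ht.le ht1 h5.le hc0.le (by rw [hed]; linarith)
    (by nlinarith) hw'u hiw (by rw [hCm']; exact cPw' _) (by rw [heo']; exact cPw' _) (by rw [hN']; exact cPw' _) cwn
    (cUy w cww) (by rw [hCm]; exact hmuc _ _) (by rw [heo]; exact hmuc _ _) (by rw [hN']; exact cw _ _ cww)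
    (hNw.map (iot κ)) (by rw [← map_mul, ← map_mul, ← map_sub]; exact (norm_iot_le _).trans hPw) hwN' heow'
    (by rw [hxh]; exact (hmuc _ _).symm) (by rw [hxh', hN']; exact PD_comm hOP _ _) (by rw [hxh', hCm']; exact PD_comm hOP _ _)
    (by
      rw [hw'q, hN', hxh', PD_mul, PD_mul]; congr 1; funext z k
      rw [hnf, hxz]; simp only [Pi.mul_apply]
      by_cases hk : k = o <;> simp [hk]) hd
  have hν : IsStarProjection (N' * iot κ Nn) := proj_mul H.hN hn H.hnN.symm
  have hNeo : N' * eo = 0 := by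
    have := congrArg star heoN'
    rwa [star_mul, star_zero, H.hN.isSelfAdjoint.star_eq, H.heo.isSelfAdjoint.star_eq] at this
  have heon : eo * iot κ Nn = iot κ Nn * eo := by rw [heo]; exact mu_iot _ _
  have NN := H.hN.isIdempotentElem.eq
  have nn := hn.isIdempotentElem.eq
  have νν := hν.isIdempotentElem.eq
  have hCν : Cm * (N' * iot κ Nn) = N' * iot κ Nn * Cm := by rw [← mul_assoc, H.hCN, mul_assoc, ← H.hnC, mul_assoc]
  have hW : IsStarProjection (Cm * (N' * iot κ Nn)) := proj_mul H.hC hν hCν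
  have hNwp : IsStarProjection (eo * iot κ Nn + N' * iot κ Nn) := by
    apply proj_add (proj_mul H.heo hn heon) hν
    rw [heon, mul_assoc, ← mul_assoc eo, heoN', zero_mul, mul_zero]
  have hνNw : (eo * iot κ Nn + N' * iot κ Nn) * (N' * iot κ Nn) = N' * iot κ Nn := by
    rw [add_mul, νν, heon, mul_assoc, ← mul_assoc eo, heoN', zero_mul, mul_zero, zero_add]
  have cC : ∀ {y : D}, Commute y (w ^ q) → Commute y Nn → Commute (iot κ y) (N' * iot κ Nn) := by
    intro y h1 h2
    exact Commute.mul_right (by rw [hN']; exact (cw _ _ h1.symm).symm) (h2.map (iot κ))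
  refine ⟨κ, fκ, dκ, o, w', eo * iot κ Nn + N' * iot κ Nn, Cm * (N' * iot κ Nn), G, R, ?_⟩
  refine ⟨hw'u, ⟨q * (N * Nx), by positivity, ?_⟩, hNwp, hW, ?_, ?_, ?_, ?_, ?_, ?_, hG, ?_, ?_, ?_, hRR', ?_, ?_, ?_, ?_, ?_, ?_, ?_⟩
  · rw [pow_mul, hw'q, PD_pow, ← PD_one hOP]; congr 1; funext z k
    rw [Pi.pow_apply, Pi.pow_apply, hxz]; dsimp only; split_ifs
    · rw [pow_mul, hZN z z.2, one_pow]; rfl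
    · rw [mul_comm, pow_mul, hxN, one_pow]; rfl
  · rw [hCν, ← mul_assoc, hνNw]
  · rw [← heo, ← mul_assoc, H.heoC, zero_mul]
  · exact (Commute.mul_left (by rw [heo']; exact cPw' _) cwn).add_left (Commute.mul_left (by rw [hN']; exact cPw' _) cwn)
  · exact (Commute.mul_left (by rw [hCm']; exact cPw' _) (Commute.mul_left (by rw [hN']; exact cPw' _) cwn))
  · rw [mul_add, heon, ← mul_assoc, nn, ← mul_assoc, H.hnN, mul_assoc N', nn]
  · rw [← heo, add_mul, mul_assoc, ← heon, ← mul_assoc, H.heo.isIdempotentElem.eq, mul_assoc N', ← heon, ← mul_assoc, hNeo]; simp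
  · rw [← hνG, ← mul_assoc, hνNw]
  · exact hGw.trans (by linarith)
  · rw [hRR, heo]
  · exact hRw.trans (by linarith)
  · rw [← heo, ← heow']
    have : Commute eo w' := by rw [heo']; exact cPw' _
    exact this.symm.eq
  · rw [← heo, ← heow']
  · have h1 : (w' - iot κ w) * (eo * iot κ Nn + N' * iot κ Nn) = N' * (w' - iot κ w) * iot κ Nn := by
      have a1 : w' * eo = eo * w' := by rw [heo']; exact (cPw' _).symm.eq
      have a2 : iot κ w * eo = eo * iot κ w := by rw [heo]; exact (mu_iot _ _).symm
      have a3 : w' * N' = N' * w' := by rw [hN']; exact (cPw' _).symm.eq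
      have a4 : iot κ w * N' = N' * iot κ w := by rw [hN']; exact (cw nf w cww).symm.eq
      rw [mul_add, ← mul_assoc, ← mul_assoc, sub_mul, a1, a2, heow', sub_self, zero_mul, zero_add, sub_mul w', a3, a4, mul_sub]
    rw [h1]
    exact (nmulR hwN' hn.norm_le).trans (by linarith)
  · intro y h1 h2
    refine ⟨?_, ?_⟩
    · exact Commute.add_right (Commute.mul_right (by rw [heo]; exact (hmuc _ _).symm) (h2.map (iot κ))) (cC h1 h2)
    · exact Commute.mul_right (by rw [hCm]; exact (hmuc _ _).symm) (cC h1 h2)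
  · intro y l hyu hl hyw hyN
    have hyq : Commute (w ^ q) y := by
      have h1 : ∀ k : ℕ, y * w ^ k = l ^ k • (w ^ k * y) := by
        intro k
        induction k with
        | zero => simp
        | succ k ih =>
          rw [pow_succ, ← mul_assoc, ih, smul_mul_assoc, mul_assoc, hyw, mul_smul_comm, smul_smul, ← pow_succ, mul_assoc]
      have := h1 q
      rw [hl, one_smul] at this
      exact this.symm
    have hyw' : iot κ y * w' = l • (w' * iot κ y) := by
      have : T * iot κ y = iot κ y * T := by rw [hT]; exact (cw tf y hyq).eq
      rw [hw', ← mul_assoc, ← map_mul, hyw, map_smul, map_mul, smul_mul_assoc, mul_assoc, ← this, ← mul_assoc]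
    refine ⟨hyw', ?_⟩
    intro c hc hPy
    have := hy (iot κ y) l c ((norm_iot_le y).trans (norm_unitary_le hyu)) (Complex.norm_eq_one_of_pow_eq_one hl hq.ne')
      (cUy y hyq) (by rw [hCm]; exact hmuc _ _) (by rw [heo]; exact hmuc _ _) (by rw [hN']; exact cw _ _ hyq) (hyN.symm.map (iot κ)) hyw'
      (by rw [← map_mul, ← map_mul, ← map_sub]; exact (norm_iot_le _).trans hPy)
    exact ⟨this.1, this.2.trans (by linarith)⟩
  · intro d hdw
    rw [hw']
    exact (hdw.map (iot κ)).mul_right (by rw [hT]; exact (cw _ _ (hdw.symm.pow_left q)).symm)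
end PIS

namespace PIS
universe u
set_option linter.all false

structure Cz {D : Type u} [CStarAlgebra D] (eh T1 T2 X : D) : Prop where
  pe : IsStarProjection eh
  t11 : star T1 * T1 = eh
  t22 : star T2 * T2 = eh
  t12 : star T1 * T2 = 0
  ts : T1 * star T1 + T2 * star T2 = eh
  xx : star X * X = 1
  ex : eh * X = X

namespace Cz
variable {D : Type u} [CStarAlgebra D] {eh T1 T2 X : D} (h : Cz eh T1 T2 X)
include h

lemma t21 : star T2 * T1 = 0 := by
  have := congrArg star h.t12
  rwa [star_mul, star_star, star_zero] at this
lemma T1e : T1 * eh = T1 := mul_proj_of_star_mul h.pe h.t11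
lemma T2e : T2 * eh = T2 := mul_proj_of_star_mul h.pe h.t22
lemma eT1 : eh * T1 = T1 := by
  rw [← h.ts, add_mul, mul_assoc, mul_assoc, h.t11, h.t21, mul_zero, add_zero, h.T1e]
lemma eT2 : eh * T2 = T2 := by
  rw [← h.ts, add_mul, mul_assoc, mul_assoc, h.t22, h.t12, mul_zero, zero_add, h.T2e]

lemma map {D' : Type u} [CStarAlgebra D'] (f : D →⋆ₐ[ℂ] D') : Cz (f eh) (f T1) (f T2) (f X) := by
  refine ⟨h.pe.map f, ?_, ?_, ?_, ?_, ?_, ?_⟩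
  · rw [← map_star, ← map_mul, h.t11]
  · rw [← map_star, ← map_mul, h.t22]
  · rw [← map_star, ← map_mul, h.t12, map_zero]
  · rw [← map_star, ← map_star, ← map_mul, ← map_mul, ← map_add, h.ts]
  · rw [← map_star, ← map_mul, h.xx, map_one]
  · rw [← map_mul, h.ex]

lemma et (m : ℕ) : eh * (T1 ^ m * T2) = T1 ^ m * T2 := by
  cases m with
  | zero => simpa using h.eT2
  | succ m => rw [pow_succ', mul_assoc, ← mul_assoc, h.eT1]

lemma tt (m l : ℕ) : star (T1 ^ m * T2) * (T1 ^ l * T2) = if m = l then eh else 0 := by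
  induction m generalizing l with
  | zero =>
    cases l with
    | zero => simpa using h.t22
    | succ l => rw [pow_zero, one_mul, pow_succ', mul_assoc, ← mul_assoc, h.t21]; simp
  | succ m ih =>
    cases l with
    | zero =>
      have : star (T1 ^ (m + 1) * T2) * (T1 ^ 0 * T2) = star (T1 ^ m * T2) * (star T1 * T2) := by
        rw [pow_succ', mul_assoc, star_mul T1, pow_zero, one_mul, mul_assoc]
      rw [this, h.t12]; simp
    | succ l =>
      rw [pow_succ', pow_succ', mul_assoc T1, mul_assoc T1, star_mul T1, mul_assoc, ← mul_assoc (star T1), h.t11, h.et, ih]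
      simp
end Cz

structure Sys {A : Type u} [CStarAlgebra A] {n : ℕ} (lam : Fin n → Fin n → ℂ) (v : Fin n → A) (η : ℝ) (c : Fin n → ℝ) where
  D : Type u
  [inst : CStarAlgebra D]
  θ : A →⋆ₙₐ[ℂ] D
  iso : ∀ a, ‖θ a‖ = ‖a‖
  corner : ∀ d, ∃ a, θ a = θ 1 * d * θ 1
  pr : Fin n → D
  pru : ∀ j, pr j ∈ unitary D
  prrel : ∀ j k, pr k * pr j = lam j k • (pr j * pr k)
  prord : ∀ j, ∃ N : ℕ, 0 < N ∧ pr j ^ N = 1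
  Nn : D
  pN : IsStarProjection Nn
  cN : ∀ j, Commute Nn (pr j)
  P : D
  pP : IsStarProjection P
  NP : Nn * P = P
  cP : ∀ j, ‖P * pr j - pr j * P‖ ≤ c j
  qq : D
  pq : IsStarProjection qq
  cq : ∀ j, Commute qq (pr j)
  Nq : Nn * qq = qq
  R1 : D
  R2 : D
  r11 : star R1 * R1 = θ 1
  r22 : star R2 * R2 = qq
  r12 : star R1 * R2 = 0
  rs : R1 * star R1 + R2 * star R2 = P
  e1 : ∀ j, ‖R1 * θ (v j) - pr j * R1‖ ≤ η
  e2 : ∀ j, ‖R2 * pr j - pr j * R2‖ ≤ η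
  eh : D
  T1 : D
  T2 : D
  X : D
  cz : Cz eh T1 T2 X
  ct : ∀ t, (t = T1 ∨ t = T2 ∨ t = X ∨ t = eh) → (∀ j, Commute t (pr j)) ∧ Commute t Nn ∧ Commute t qq
  S : D
  pS : θ 1 * S = S
  sS : star S * S = Nn * eh
  e3 : ∀ j, ‖θ (v j) * S - S * pr j‖ ≤ η

attribute [instance] Sys.inst

section
variable {κ : Type} [Fintype κ] [DecidableEq κ] {D : Type u} [CStarAlgebra D]

lemma eo_mul_eo (o : κ) (d : CStarMatrix κ κ D) : mu (eu o o) * d * mu (eu o o) = mu (eu o o) * iot κ (d o o) := by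
  ext a b
  rw [mu_iot_apply, CStarMatrix.mul_apply]
  simp only [mu_apply, CStarMatrix.mul_apply, eu_apply]
  by_cases ha : a = o
  · subst ha
    by_cases hb : b = a
    · subst hb; simp
    · simp [hb]
  · simp [ha]

lemma muo_idem (o : κ) : (mu (eu o o) : CStarMatrix κ κ D) * mu (eu o o) = mu (eu o o) := by
  rw [← map_mul, eu_mul_same]

noncomputable def crn {A : Type u} [CStarAlgebra A] (θ : A →⋆ₙₐ[ℂ] D) (o : κ) : A →⋆ₙₐ[ℂ] CStarMatrix κ κ D where
  toFun a := mu (eu o o) * iot κ (θ a)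
  map_smul' c a := by rw [map_smul, map_smul, mul_smul_comm]; rfl
  map_zero' := by simp
  map_add' a b := by rw [map_add, map_add, mul_add]
  map_mul' a b := by
    rw [map_mul, map_mul, ← mul_assoc _ (mu (eu o o)), mul_assoc _ _ (mu (eu o o)), ← mu_iot, ← mul_assoc (mu (eu o o)) (mu (eu o o)), muo_idem, mul_assoc]
  map_star' a := by
    rw [star_mul, ← map_star, ← map_star, ← map_star, star_eu, mu_iot]

lemma crn_apply {A : Type u} [CStarAlgebra A] (θ : A →⋆ₙₐ[ℂ] D) (o : κ) (a : A) :
    crn θ o a = mu (eu o o) * iot κ (θ a) := rfl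

lemma crn_iso {A : Type u} [CStarAlgebra A] (θ : A →⋆ₙₐ[ℂ] D) (o : κ) (h : ∀ a, ‖θ a‖ = ‖a‖) (a : A) :
    ‖crn θ o a‖ = ‖a‖ := by
  apply le_antisymm
  · rw [crn_apply, ← h a]
    exact nmulL ((norm_mu_le _).trans (norm_eu_le o o)) (norm_iot_le _)
  · rw [← h a]
    have := cm_entry (mu (eu o o) * iot κ (θ a)) o o
    rw [mu_iot_apply] at this
    rw [crn_apply]
    simpa [eu_apply] using this

lemma crn_corner {A : Type u} [CStarAlgebra A] (θ : A →⋆ₙₐ[ℂ] D) (o : κ) (h : ∀ d, ∃ a, θ a = θ 1 * d * θ 1)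
    (d : CStarMatrix κ κ D) : ∃ a, crn θ o a = crn θ o 1 * d * crn θ o 1 := by
  obtain ⟨a, ha⟩ := h (d o o)
  refine ⟨a, ?_⟩
  simp only [crn_apply, ha]
  have h2 : ∀ (E x d y : CStarMatrix κ κ D), E * x = x * E → E * y = y * E → E * (x * d * y) = x * (E * d) * y := by
    intro E x d y h1 h2
    rw [← mul_assoc, ← mul_assoc, h1]; simp only [mul_assoc]
  rw [map_mul, map_mul, h2 _ _ _ _ (mu_iot _ _) (mu_iot _ _), ← eo_mul_eo]
  have h3 : ∀ (E x d y : CStarMatrix κ κ D), E * x = x * E → x * (E * d * E) * y = E * x * d * (E * y) := by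
    intro E x d y h1
    rw [h1]; simp only [mul_assoc]
  exact h3 _ _ _ _ (mu_iot _ _)

/-- the isometry-like row -/
noncomputable def TT (o : κ) (T1 T2 : D) : CStarMatrix κ κ D :=
  ∑ k, mu (eu o k) * iot κ (T1 ^ (Fintype.equivFin κ k : ℕ) * T2)

lemma TT_sq (o : κ) {eh T1 T2 X : D} (h : Cz eh T1 T2 X) : star (TT o T1 T2) * TT o T1 T2 = iot κ eh := by
  rw [TT, star_sum, Finset.sum_mul_sum]
  have : ∀ k l : κ, star (mu (eu o k) * iot κ (T1 ^ (Fintype.equivFin κ k : ℕ) * T2)) *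
      (mu (eu o l) * iot κ (T1 ^ (Fintype.equivFin κ l : ℕ) * T2)) = if k = l then mu (eu k k) * iot κ eh else 0 := by
    intro k l
    rw [star_mul, ← map_star, ← map_star, star_eu, ← mu_iot, mul_assoc, ← mul_assoc _ (mu (eu o l)), ← mu_iot, ← mul_assoc, ← mul_assoc,
      ← map_mul, eu_mul_same, mul_assoc, ← map_mul, h.tt]
    by_cases hk : k = l
    · subst hk; simp
    · have : (Fintype.equivFin κ k : ℕ) ≠ (Fintype.equivFin κ l : ℕ) := fun h2 =>
        hk ((Fintype.equivFin κ).injective (Fin.ext h2))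
      rw [if_neg this, if_neg hk]; simp
  simp only [this, Finset.sum_ite_eq, Finset.mem_univ, if_true]
  rw [← Finset.sum_mul, ← map_sum, sum_eu, map_one, one_mul]

lemma TT_eo (o : κ) (T1 T2 : D) : mu (eu o o) * TT o T1 T2 = TT o T1 T2 := by
  rw [TT, Finset.mul_sum]
  refine Finset.sum_congr rfl fun k _ => ?_
  rw [← mul_assoc, ← map_mul, eu_mul_same]

lemma TT_e (o : κ) {eh T1 T2 X : D} (h : Cz eh T1 T2 X) : iot κ eh * TT o T1 T2 = TT o T1 T2 := by
  rw [TT, Finset.mul_sum]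
  refine Finset.sum_congr rfl fun k _ => ?_
  rw [← mul_assoc, ← mu_iot, mul_assoc, ← map_mul, h.et]

lemma TT_comm (o : κ) {T1 T2 d : D} (h1 : Commute T1 d) (h2 : Commute T2 d) : Commute (TT o T1 T2) (iot κ d) := by
  rw [TT]
  refine Commute.sum_left _ _ _ fun k _ => Commute.mul_left (mu_comm _ _) ?_
  exact ((h1.pow_left _).mul_left h2).map (iot κ)
end

lemma sys_PR {A : Type u} [CStarAlgebra A] {n : ℕ} {lam : Fin n → Fin n → ℂ} {v : Fin n → A} {η : ℝ} {c : Fin n → ℝ}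
    (s : Sys lam v η c) : s.P * s.R1 = s.R1 ∧ s.P * s.R2 = s.R2 ∧ star s.R2 * s.R1 = 0 := by
  have h21 : star s.R2 * s.R1 = 0 := by
    have := congrArg star s.r12; rwa [star_mul, star_star, star_zero] at this
  have hp : IsStarProjection (s.θ 1) := (IsStarProjection.one (R := A)).map s.θ
  refine ⟨?_, ?_, h21⟩
  · rw [← s.rs, add_mul, mul_assoc, mul_assoc, h21, mul_zero, add_zero, s.r11]; exact mul_proj_of_star_mul hp s.r11
  · rw [← s.rs, add_mul, mul_assoc, mul_assoc, s.r12, mul_zero, zero_add, s.r22]; exact mul_proj_of_star_mul s.pq s.r22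

theorem squeeze {n : ℕ} {lam : Fin n → Fin n → ℂ} {q : ℕ} (hq : 0 < q) (hl : ∀ j k, lam j k ^ q = 1)
    (hl2 : ∀ j k, lam j k * lam k j = 1) (hl1 : ∀ j, lam j j = 1) (i : Fin n) {η : ℝ} (hη : 0 < η) :
    ∃ c0 > (0 : ℝ), ∀ δ' > (0 : ℝ), ∀ (A : Type u) [CStarAlgebra A] (v : Fin n → A) (η0 : ℝ) (c : Fin n → ℝ),
      (∀ j, c j ≤ c0) → ∀ s : Sys lam v η0 c,
      Nonempty (Sys lam v (η0 + η) (fun j => if j = i then δ' else 16 * c j)) := by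
  obtain ⟨c0, hc0, hcore⟩ := core.{u} hq hη
  refine ⟨c0, hc0, ?_⟩
  intro δ' hδ A _ v η0 c hc s
  obtain ⟨κ, fκ, dκ, o, w', Nw, W, G, R, K⟩ := hcore δ' hδ s.D (s.pr i) s.Nn s.P (s.pru i) (s.prord i) s.pN (s.cN i) s.pP s.NP
    ((s.cP i).trans (hc i))
  obtain ⟨PR1, PR2, r21⟩ := sys_PR s
  have cwq : ∀ j, Commute (s.pr j) (s.pr i ^ q) := by
    intro j
    have h1 : ∀ k : ℕ, s.pr j * s.pr i ^ k = lam i j ^ k • (s.pr i ^ k * s.pr j) := by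
      intro k
      induction k with
      | zero => simp
      | succ k ih =>
        rw [pow_succ, ← mul_assoc, ih, smul_mul_assoc, mul_assoc, s.prrel, mul_smul_comm, smul_smul, ← pow_succ, mul_assoc]
    have := h1 q
    rw [hl, one_smul] at this
    exact this
  have c6 := fun j => K.c6 (s.pr j) (cwq j) (s.cN j).symm
  have c7 := fun j => K.c7 (s.pr j) (lam i j) (s.pru j) (hl i j) (s.prrel i j) (s.cN j).symm
  obtain ⟨E, hE⟩ : ∃ E : CStarMatrix κ κ s.D, E = mu (eu o o) := ⟨_, rfl⟩
  obtain ⟨ι, hι⟩ : ∃ ι : s.D →⋆ₐ[ℂ] CStarMatrix κ κ s.D, ι = iot κ := ⟨_, rfl⟩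
  have hEp : IsStarProjection E := by rw [hE]; exact (eu_proj o).map mu
  have EE := hEp.isIdempotentElem.eq
  have Es := hEp.isSelfAdjoint.star_eq
  have Eι : ∀ d, E * ι d = ι d * E := by intro d; rw [hE, hι]; exact mu_iot _ _
  have hEι : ∀ d e, E * ι d * (E * ι e) = E * ι (d * e) := by
    intro d e
    rw [mul_assoc, ← mul_assoc (ι d), ← Eι, ← mul_assoc, ← mul_assoc, EE, mul_assoc, ← map_mul]
  have hιn : ∀ d, ‖ι d‖ ≤ ‖d‖ := by intro d; rw [hι]; exact norm_iot_le _
  have KeoW : E * W = 0 := by rw [hE]; exact K.eoW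
  have KWe : W * E = 0 := by
    have := congrArg star KeoW
    rwa [star_mul, Es, K.pW.isSelfAdjoint.star_eq, star_zero] at this
  have KRR : star R * R = E * ι s.P + W := by rw [hE, hι]; exact K.RR
  have WW := K.pW.isIdempotentElem.eq
  have Ws := K.pW.isSelfAdjoint.star_eq
  have hEW : ∀ d, E * ι d * W = 0 := by intro d; rw [Eι, mul_assoc, KeoW, mul_zero]
  have hWE : ∀ d, W * (E * ι d) = 0 := by intro d; rw [← mul_assoc, KWe, zero_mul]
  have hap : IsStarProjection (E * ι s.P + W) := by
    refine proj_add (proj_mul hEp (s.pP.map ι) (Eι _)) K.pW (hEW _)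
  have hRa := mul_proj_of_star_mul hap KRR
  have hRn : ‖R‖ ≤ 1 := norm_le_one_of_proj hap KRR
  obtain ⟨pr', hprd⟩ : ∃ f : Fin n → CStarMatrix κ κ s.D, f = fun j => if j = i then w' else ι (s.pr j) := ⟨_, rfl⟩
  have hpri : pr' i = w' := by rw [hprd]; simp
  have hprj : ∀ j, j ≠ i → pr' j = ι (s.pr j) := by intro j hj; rw [hprd]; simp [hj]
  have hpru : ∀ j, pr' j ∈ unitary (CStarMatrix κ κ s.D) := by
    intro j
    by_cases h : j = i
    · rw [h, hpri]; exact K.uw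
    · rw [hprj j h, Unitary.mem_iff, ← map_star, ← map_mul, ← map_mul, (Unitary.mem_iff.1 (s.pru j)).1, (Unitary.mem_iff.1 (s.pru j)).2, map_one]
      exact ⟨rfl, rfl⟩
  have hEpr : ∀ j, E * pr' j = E * ι (s.pr j) := by
    intro j
    by_cases h : j = i
    · rw [h, hpri, hE, hι]; exact K.eow'
    · rw [hprj j h]
  have hprE : ∀ j, pr' j * E = E * ι (s.pr j) := by
    intro j
    by_cases h : j = i
    · rw [h, hpri, hE, hι]; exact K.w'eo
    · rw [hprj j h, Eι]
  have hWpr : ∀ j, Commute W (pr' j) := by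
    intro j
    by_cases h : j = i
    · rw [h, hpri]; exact K.cW
    · rw [hprj j h, hι]; exact (c6 j).2.symm
  have hNpr : ∀ j, Commute Nw (pr' j) := by
    intro j
    by_cases h : j = i
    · rw [h, hpri]; exact K.cNw
    · rw [hprj j h, hι]; exact (c6 j).1.symm
  have hRpr : ∀ j, ‖R * pr' j - pr' j * R‖ ≤ η := by
    intro j
    by_cases h : j = i
    · rw [h, hpri]; exact K.cR
    · rw [hprj j h, hι]; exact ((c7 j).2 c0 le_rfl ((s.cP j).trans (hc j))).2
  have hqp : IsStarProjection (E * ι s.qq + W) := proj_add (proj_mul hEp (s.pq.map ι) (Eι _)) K.pW (hEW _)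
  have hstar : ∀ d, star (E * ι d) = E * ι (star d) := by
    intro d; rw [star_mul, Es, ← map_star, Eι]
  have hr22 : star (E * ι s.R2 + W) * (E * ι s.R2 + W) = E * ι s.qq + W := by
    rw [star_add, hstar, Ws, mul_add, add_mul, add_mul, hEι, hWE, hEW, WW, s.r22]; simp
  have hr2n : ‖E * ι s.R2 + W‖ ≤ 1 := norm_le_one_of_proj hqp hr22
  have haR1 : (E * ι s.P + W) * (E * ι s.R1) = E * ι s.R1 := by
    rw [add_mul, hEι, hWE, PR1, add_zero]
  have haR2 : (E * ι s.P + W) * (E * ι s.R2 + W) = E * ι s.R2 + W := by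
    rw [add_mul, mul_add, mul_add, hEι, hWE, hEW, WW, PR2]; simp
  have hιt : ∀ t, (t = s.T1 ∨ t = s.T2 ∨ t = s.X ∨ t = s.eh) → (∀ j, Commute (ι t) (pr' j)) ∧ Commute (ι t) Nw ∧ Commute (ι t) (E * ι s.qq + W) := by
    intro t ht
    obtain ⟨h1, h2, h3⟩ := s.ct t ht
    have h6 := K.c6 t ((h1 i).pow_right q) h2
    rw [← hι] at h6
    refine ⟨?_, h6.1, ?_⟩
    · intro j
      by_cases h : j = i
      · rw [h, hpri, hι]; exact K.c8 t (h1 i)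
      · rw [hprj j h]; exact (h1 j).map ι
    · exact Commute.add_right (Commute.mul_right (Eι t).symm (h3.map ι)) h6.2
  obtain ⟨TTo, hTT⟩ : ∃ T, T = TT o s.T1 s.T2 := ⟨_, rfl⟩
  have TTs : star TTo * TTo = ι s.eh := by rw [hTT, hι]; exact TT_sq o s.cz
  have TTE : E * TTo = TTo := by rw [hTT, hE]; exact TT_eo _ _ _
  have TTe : ι s.eh * TTo = TTo := by rw [hTT, hι]; exact TT_e o s.cz
  have TTc : ∀ d, Commute s.T1 d → Commute s.T2 d → Commute TTo (ι d) := by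
    intro d h1 h2; rw [hTT, hι]; exact TT_comm o h1 h2
  have hTTn : ‖TTo‖ ≤ 1 := norm_le_one_of_proj (s.cz.pe.map ι) TTs
  have t1 := s.ct s.T1 (Or.inl rfl)
  have t2 := s.ct s.T2 (Or.inr (Or.inl rfl))
  have te := s.ct s.eh (Or.inr (Or.inr (Or.inr rfl)))
  have hSn : ‖s.S‖ ≤ 1 := norm_le_one_of_proj (proj_mul s.pN s.cz.pe te.2.1.symm) s.sS
  have hNwn : ‖Nw‖ ≤ 1 := K.pNw.norm_le
  refine ⟨{
    D := CStarMatrix κ κ s.D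
    θ := crn s.θ o
    iso := crn_iso s.θ o s.iso
    corner := crn_corner s.θ o s.corner
    pr := pr'
    pru := hpru
    prrel := ?_
    prord := ?_
    Nn := Nw
    pN := K.pNw
    cN := hNpr
    P := G
    pP := K.pG
    NP := K.NwG
    cP := ?_
    qq := E * ι s.qq + W
    pq := hqp
    cq := ?_
    Nq := ?_
    R1 := R * (E * ι s.R1)
    R2 := R * (E * ι s.R2 + W)
    r11 := ?_
    r22 := ?_
    r12 := ?_
    rs := ?_
    e1 := ?_
    e2 := ?_
    eh := ι s.eh
    T1 := ι s.T1
    T2 := ι s.T2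
    X := ι s.X
    cz := s.cz.map ι
    ct := ?_
    S := ι s.S * TTo * Nw
    pS := ?_
    sS := ?_
    e3 := ?_ }⟩
  · intro j k
    by_cases hj : j = i <;> by_cases hk : k = i
    · rw [hj, hk, hl1, one_smul]
    · rw [hj, hpri, hprj k hk, hι]; exact (c7 k).1
    · rw [hk, hpri, hprj j hj, hι, (c7 j).1, smul_smul, hl2, one_smul]
    · rw [hprj j hj, hprj k hk, ← map_mul, s.prrel, map_smul, map_mul]
  · intro j
    by_cases h : j = i
    · rw [h, hpri]; exact K.ord
    · obtain ⟨N, h1, h2⟩ := s.prord j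
      exact ⟨N, h1, by rw [hprj j h, ← map_pow, h2, map_one]⟩
  · intro j
    by_cases h : j = i
    · rw [h, hpri]; simpa using K.cG
    · rw [hprj j h, if_neg h, hι]; exact ((c7 j).2 (c j) (hc j) (s.cP j)).1
  · intro j
    refine Commute.add_left ?_ (hWpr j)
    show E * ι s.qq * pr' j = pr' j * (E * ι s.qq)
    have a1 : E * ι s.qq * pr' j = E * ι (s.qq * s.pr j) := by
      rw [Eι, mul_assoc, hEpr, ← mul_assoc, ← Eι, mul_assoc, ← map_mul]
    have a2 : pr' j * (E * ι s.qq) = E * ι (s.pr j * s.qq) := by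
      rw [← mul_assoc, hprE, mul_assoc, ← map_mul]
    rw [a1, a2, (s.cq j).eq]
  · rw [mul_add, K.NwW, ← mul_assoc]
    congr 1
    have := K.Nweo
    rw [← hE, ← hι] at this
    rw [this, mul_assoc, ← map_mul, s.Nq]
  · rw [star_mul, mul_assoc, ← mul_assoc (star R), KRR, haR1, hstar, hEι, s.r11, crn_apply, hE, hι]
  · rw [star_mul, mul_assoc, ← mul_assoc (star R), KRR, haR2, hr22]
  · rw [star_mul, mul_assoc, ← mul_assoc (star R), KRR, haR2, hstar, mul_add, hEι, hEW, s.r12]; simp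
  · have e0 : E * ι s.R1 * star (E * ι s.R1) + (E * ι s.R2 + W) * star (E * ι s.R2 + W) = E * ι s.P + W := by
      rw [star_add, hstar, hstar, Ws, mul_add, add_mul, add_mul, hEι, hEι, hWE, hEW, WW, ← s.rs, map_add, mul_add]; simp [add_assoc]
    have : R * (E * ι s.R1) * star (R * (E * ι s.R1)) + R * (E * ι s.R2 + W) * star (R * (E * ι s.R2 + W))
      = R * (E * ι s.R1 * star (E * ι s.R1) + (E * ι s.R2 + W) * star (E * ι s.R2 + W)) * star R := by
      simp only [star_mul]; noncomm_ring
    rw [this, e0, hRa, K.RR']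
  · intro j
    have h1 : R * (E * ι s.R1) * crn s.θ o (v j) - pr' j * (R * (E * ι s.R1))
      = R * (E * ι (s.R1 * s.θ (v j) - s.pr j * s.R1)) + (R * pr' j - pr' j * R) * (E * ι s.R1) := by
      rw [crn_apply, ← hE, ← hι, mul_assoc R, hEι, map_sub, mul_sub, mul_sub, sub_mul, ← hEι, ← hEι (s.pr j), ← hprE]
      have : R * (pr' j * E * (E * ι s.R1)) = R * pr' j * (E * E * ι s.R1) := by noncomm_ring
      rw [this, EE]; noncomm_ring
    rw [h1]
    have hR1n : ‖s.R1‖ ≤ 1 := norm_le_one_of_proj ((IsStarProjection.one (R := A)).map s.θ) s.r11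
    refine nadd (nmulL hRn (nmulL hEp.norm_le ((hιn _).trans (s.e1 j)))) (nmulR (hRpr j) (nmulL hEp.norm_le ((hιn _).trans hR1n)))
  · intro j
    have h1 : R * (E * ι s.R2 + W) * pr' j - pr' j * (R * (E * ι s.R2 + W))
      = R * (E * ι (s.R2 * s.pr j - s.pr j * s.R2)) + (R * pr' j - pr' j * R) * (E * ι s.R2 + W) := by
      have a1 : E * ι s.R2 * pr' j = E * ι (s.R2 * s.pr j) := by
        rw [Eι, mul_assoc, hEpr, ← mul_assoc, ← Eι, mul_assoc, ← map_mul]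
      have a2 : pr' j * (E * ι s.R2) = E * ι (s.pr j * s.R2) := by
        rw [← mul_assoc, hprE, mul_assoc, ← map_mul]
      have a3 := (hWpr j).eq
      have : R * (E * ι s.R2 + W) * pr' j - pr' j * (R * (E * ι s.R2 + W))
        = R * (E * ι s.R2 * pr' j - pr' j * (E * ι s.R2)) + R * (W * pr' j - pr' j * W) + (R * pr' j - pr' j * R) * (E * ι s.R2 + W) := by
        noncomm_ring
      rw [this, a1, a2, a3, sub_self, mul_zero, add_zero, map_sub, mul_sub E]
    rw [h1]
    exact nadd (nmulL hRn (nmulL hEp.norm_le ((hιn _).trans (s.e2 j)))) (nmulR (hRpr j) hr2n)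
  · rintro t (h | h | h | h)
    · rw [h]; exact hιt s.T1 (Or.inl rfl)
    · rw [h]; exact hιt s.T2 (Or.inr (Or.inl rfl))
    · rw [h]; exact hιt s.X (Or.inr (Or.inr (Or.inl rfl)))
    · rw [h]; exact hιt s.eh (Or.inr (Or.inr (Or.inr rfl)))
  · rw [crn_apply, ← hE, ← hι, ← mul_assoc, ← mul_assoc, mul_assoc E, ← map_mul, s.pS, Eι, mul_assoc (ι s.S), TTE]
  · have h1 := TTc s.Nn t1.2.1 t2.2.1
    have : star (ι s.S * TTo * Nw) * (ι s.S * TTo * Nw) = Nw * (star TTo * (ι (star s.S * s.S) * TTo)) * Nw := by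
      rw [map_mul, star_mul, star_mul, K.pNw.isSelfAdjoint.star_eq, map_star]; noncomm_ring
    have hin : ι s.Nn * Nw = Nw := by rw [hι]; exact K.iNw
    rw [this, s.sS, map_mul, mul_assoc (ι s.Nn), TTe, ← h1.eq, ← mul_assoc (star TTo), TTs, mul_assoc, mul_assoc (ι s.eh), hin,
      (hιt s.eh (Or.inr (Or.inr (Or.inr rfl)))).2.1.eq, ← mul_assoc, K.pNw.isIdempotentElem.eq]
  · intro j
    have h1 : crn s.θ o (v j) * (ι s.S * TTo * Nw) = ι (s.θ (v j) * s.S) * TTo * Nw := by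
      rw [crn_apply, ← hE, ← hι, ← mul_assoc, ← mul_assoc, mul_assoc E, ← map_mul, Eι, mul_assoc (ι _) E, TTE]
    have h2 : TTo * ι (s.pr j) = ι (s.pr j) * TTo := TTc _ (t1.1 j) (t2.1 j)
    have h3 : ‖(pr' j - ι (s.pr j)) * Nw‖ ≤ η := by
      by_cases h : j = i
      · rw [h, hpri, hι]; exact K.wNw
      · rw [hprj j h]; simpa using hη.le
    have h4 : crn s.θ o (v j) * (ι s.S * TTo * Nw) - ι s.S * TTo * Nw * pr' j
      = ι (s.θ (v j) * s.S - s.S * s.pr j) * TTo * Nw - ι s.S * TTo * ((pr' j - ι (s.pr j)) * Nw) := by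
      rw [h1, mul_assoc _ Nw, (hNpr j).eq, map_sub, map_mul ι s.S]
      have : ι s.S * TTo * ((pr' j - ι (s.pr j)) * Nw) = ι s.S * TTo * (pr' j * Nw) - ι s.S * (TTo * ι (s.pr j)) * Nw := by noncomm_ring
      rw [this, h2]; noncomm_ring
    rw [h4]
    exact nsub (nmulR (nmulR ((hιn _).trans (s.e3 j)) hTTn) hNwn) (nmulL (nmulL ((hιn _).trans hSn) hTTn) h3)
end PIS

namespace PIS
universe u
set_option linter.all false

section
variable {D : Type u} [CStarAlgebra D]

lemma star_comm {t y : D} (hy : y ∈ unitary D) (h : Commute t y) : Commute (star t) y := by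
  have h1 : Commute t (star y) := by
    show t * star y = star y * t
    have e : star y * (t * y) * star y = star y * t := by
      rw [mul_assoc, mul_assoc, (Unitary.mem_iff.1 hy).2, mul_one]
    rw [← e, h.eq, ← mul_assoc, (Unitary.mem_iff.1 hy).1, one_mul]
  have := h1.star_star
  rwa [star_star] at this

/-- all algebraic identities for the final assembly -/
theorem asm {n : ℕ} {p a0 a1 a2 a3 S P qq R1 R2 : D} (hp : IsStarProjection p) (hP : IsStarProjection P)
    (h0 : IsStarProjection a0) (hq : IsStarProjection qq)
    (pS : p * S = S) (hS : ‖S‖ ≤ 1)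
    (u0 : star S * S * a0 = a0) (u1 : star S * S * a1 = a1) (u2 : star S * S * a2 = a2) (u3 : star S * S * a3 = a3)
    (a11 : star a1 * a1 = a0) (a12 : star a1 * a2 = 0) (a13 : star a1 * a3 = 0) (a23 : star a2 * a3 = 0)
    (a22 : star a2 * a2 = qq) (a01 : a0 * a1 = a1) (a02 : a0 * a2 = a2) (a03 : a0 * a3 = a3)
    {f : D} (hf : IsStarProjection f) (a33 : star a3 * a3 = f) (as : a1 * star a1 + a2 * star a2 + a3 * star a3 = a0)
    (r11 : star R1 * R1 = p) (r22 : star R2 * R2 = qq) (r12 : star R1 * R2 = 0) (rs : R1 * star R1 + R2 * star R2 = P)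
    {η δ : ℝ} (V pr : Fin n → D) (lam : Fin n → Fin n → ℂ) (hl : ∀ j k, ‖lam j k‖ ≤ 1)
    (hV : ∀ j, p * V j = V j ∧ V j * p = V j ∧ star (V j) * V j = p)
    (hpr : ∀ j, pr j ∈ unitary D) (rel : ∀ j k, pr k * pr j = lam j k • (pr j * pr k))
    (c0 : ∀ j, Commute a0 (pr j)) (c1 : ∀ j, Commute a1 (pr j)) (c2 : ∀ j, Commute a2 (pr j)) (c3 : ∀ j, Commute a3 (pr j))
    (cP : ∀ j, ‖P * pr j - pr j * P‖ ≤ δ)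
    (e1 : ∀ j, ‖R1 * V j - pr j * R1‖ ≤ η) (e2 : ∀ j, ‖R2 * pr j - pr j * R2‖ ≤ η) (e3 : ∀ j, ‖V j * S - S * pr j‖ ≤ η) :
    ∃ y : Fin n → D, (∀ j, p * y j = y j ∧ y j * p = y j ∧ ‖y j - V j‖ ≤ 8 * η ∧ ‖star (y j) * y j - p‖ ≤ δ ∧ ‖y j * star (y j) - p‖ ≤ δ) ∧
      ∀ j k, ‖y k * y j - lam j k • (y j * y k)‖ ≤ δ + δ := by
  have sp := hp.isSelfAdjoint.star_eq
  have pp := hp.isIdempotentElem.eq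
  have s0 := h0.isSelfAdjoint.star_eq
  have z0 := h0.isIdempotentElem.eq
  have a21 : star a2 * a1 = 0 := by have := congrArg star a12; rwa [star_mul, star_star, star_zero] at this
  have a31 : star a3 * a1 = 0 := by have := congrArg star a13; rwa [star_mul, star_star, star_zero] at this
  have a32 : star a3 * a2 = 0 := by have := congrArg star a23; rwa [star_mul, star_star, star_zero] at this
  have r21 : star R2 * R1 = 0 := by have := congrArg star r12; rwa [star_mul, star_star, star_zero] at this
  have Sp : star S * p = star S := by have := congrArg star pS; rwa [star_mul, sp] at this
  have R1p := mul_proj_of_star_mul hp r11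
  have R2q := mul_proj_of_star_mul hq r22
  have a10 := mul_proj_of_star_mul h0 a11
  have a2q := mul_proj_of_star_mul hq a22
  have a3f := mul_proj_of_star_mul hf a33
  have pR1 : p * star R1 = star R1 := by have := congrArg star R1p; rwa [star_mul, sp] at this
  have qR2 : qq * star R2 = star R2 := by have := congrArg star R2q; rwa [star_mul, hq.isSelfAdjoint.star_eq] at this
  -- products
  have key : ∀ x y z : D, star S * S * y = y → S * x * star S * (S * y * z) = S * (x * y) * z := by
    intro x y z h
    have : S * x * star S * (S * y * z) = S * x * (star S * S * y) * z := by noncomm_ring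
    rw [this, h]; noncomm_ring
  have key2 : ∀ x y : D, star S * S * y = y → star (S * x) * (S * y) = star x * y := by
    intro x y h
    have : star (S * x) * (S * y) = star x * (star S * S * y) := by rw [star_mul]; noncomm_ring
    rw [this, h]
  obtain ⟨g, hg⟩ : ∃ g, g = S * a0 * star S := ⟨_, rfl⟩
  obtain ⟨G, hG⟩ : ∃ G, G = S * a1 * star S := ⟨_, rfl⟩
  obtain ⟨M, hM⟩ : ∃ M, M = S * a2 := ⟨_, rfl⟩
  obtain ⟨K, hK⟩ : ∃ K, K = S * a3 := ⟨_, rfl⟩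
  have sg : star g = g := by rw [hg, star_mul, star_mul, star_star, s0, mul_assoc]
  have sG : star G = S * star a1 * star S := by rw [hG, star_mul, star_mul, star_star, mul_assoc]
  have gg : g * g = g := by
    have := key a0 a0 (star S) u0; rw [z0] at this; rw [hg]; exact this
  have gG : g * G = G := by
    have := key a0 a1 (star S) u1; rw [a01] at this; rw [hg, hG]; exact this
  have gM : g * M = M := by
    have := key a0 a2 1 u2; rw [a02] at this; simp only [mul_one] at this; rw [hg, hM]; exact this
  have gK : g * K = K := by
    have := key a0 a3 1 u3; rw [a03] at this; simp only [mul_one] at this; rw [hg, hK]; exact this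
  have GG : star G * G = g := by
    have := key (star a1) a1 (star S) u1; rw [a11] at this; rw [sG, hg, hG]; exact this
  have GM : star G * M = 0 := by
    have := key (star a1) a2 1 u2; rw [a12, mul_one, mul_one] at this; rw [sG, hM]; rw [this]; simp
  have GK : star G * K = 0 := by
    have := key (star a1) a3 1 u3; rw [a13, mul_one, mul_one] at this; rw [sG, hK]; rw [this]; simp
  have MM : star M * M = qq := by rw [hM, key2 _ _ u2, a22]
  have MK : star M * K = 0 := by rw [hM, hK, key2 _ _ u3, a23]
  have KK : star K * K = f := by rw [hK, key2 _ _ u3, a33]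
  have GG' : G * star G = S * (a1 * star a1) * star S := by
    rw [sG]
    have h5 : star S * S * star a1 = star a1 * (star S * S) ∨ True := Or.inr trivial
    have h6 : a1 * (star S * S) = a1 := by
      have h7 : a0 * (star S * S) = a0 := by
        have := congrArg star u0; rwa [star_mul, s0, star_mul, star_star] at this
      rw [← a10, mul_assoc, h7]
    have : S * a1 * star S * (S * star a1 * star S) = S * (a1 * (star S * S) * star a1) * star S := by noncomm_ring
    rw [hG, this, h6]
  have tot : G * star G + M * star M + K * star K = g := by
    rw [GG', hM, hK, hg, ← as, star_mul, star_mul]; noncomm_ring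
  have pg : p * g = g := by rw [hg, ← mul_assoc, ← mul_assoc, pS]
  have pG : p * G = G := by rw [hG, ← mul_assoc, ← mul_assoc, pS]
  have pM : p * M = M := by rw [hM, ← mul_assoc, pS]
  have pK : p * K = K := by rw [hK, ← mul_assoc, pS]
  have gp : g * p = g := by have := congrArg star pg; rwa [star_mul, sp, sg] at this
  have Gp : G * p = G := by rw [hG, mul_assoc, Sp]
  have Gg : G * g = G := mul_proj_of_star_mul ⟨gg, sg⟩ GG
  have sGg : star G * g = star G := by have := congrArg star gG; rwa [star_mul, sg] at this
  have gsG : g * star G = star G := by have := congrArg star Gg; rwa [star_mul, sg] at this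
  obtain ⟨L, hL⟩ : ∃ L, L = p - g + G := ⟨_, rfl⟩
  have sL : star L = p - g + star G := by rw [hL, star_add, star_sub, sp, sg]
  have psG : p * star G = star G := by have := congrArg star Gp; rwa [star_mul, sp] at this
  have sGp : star G * p = star G := by have := congrArg star pG; rwa [star_mul, sp] at this
  have LL : star L * L = p := by
    rw [sL, hL]; simp only [mul_add, add_mul, mul_sub, sub_mul, pp, gg, pg, gp, pG, gG, GG, sGp, sGg]; abel
  have LL' : L * star L = p - g + G * star G := by
    rw [sL, hL]; simp only [mul_add, add_mul, mul_sub, sub_mul, pp, gg, pg, gp, Gp, Gg, psG, gsG]; abel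
  have LM : star L * M = 0 := by
    rw [sL]; simp only [add_mul, sub_mul, pM, gM, GM]; abel
  have LK : star L * K = 0 := by
    rw [sL]; simp only [add_mul, sub_mul, pK, gK, GK]; abel
  have pL : p * L = L := by rw [hL]; simp only [mul_add, mul_sub, pp, pg, pG]
  have Lp : L * p = L := mul_proj_of_star_mul hp LL
  have sLp : star L * p = star L := by have := congrArg star pL; rwa [star_mul, sp] at this
  have psL : p * star L = star L := by have := congrArg star Lp; rwa [star_mul, sp] at this
  have ML : star M * L = 0 := by have := congrArg star LM; rwa [star_mul, star_star, star_zero] at this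
  have Mq : M * qq = M := mul_proj_of_star_mul hq MM
  have Kf : K * f = K := mul_proj_of_star_mul hf KK
  have sMp : star M * p = star M := by have := congrArg star pM; rwa [star_mul, sp] at this
  have sKp : star K * p = star K := by have := congrArg star pK; rwa [star_mul, sp] at this
  have tot2 : L * star L + M * star M + K * star K = p := by
    rw [LL']; rw [← tot] ; abel
  have Ln : ‖L‖ ≤ 1 := norm_le_one_of_proj hp LL
  have Mn : ‖M‖ ≤ 1 := norm_le_one_of_proj hq MM
  have Kn : ‖K‖ ≤ 1 := norm_le_one_of_proj hf KK
  have R1n : ‖R1‖ ≤ 1 := norm_le_one_of_proj hp r11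
  have R2n : ‖R2‖ ≤ 1 := norm_le_one_of_proj hq r22
  have a1n : ‖a1‖ ≤ 1 := norm_le_one_of_proj h0 a11
  have a2n : ‖a2‖ ≤ 1 := norm_le_one_of_proj hq a22
  have a3n : ‖a3‖ ≤ 1 := norm_le_one_of_proj hf a33
  have sn : ∀ x : D, ‖x‖ ≤ 1 → ‖star x‖ ≤ 1 := fun x h => by rwa [norm_star]
  obtain ⟨Z, hZ⟩ : ∃ Z, Z = R1 * star L + R2 * star M := ⟨_, rfl⟩
  have sZ : star Z = L * star R1 + M * star R2 := by rw [hZ]; simp [star_mul]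
  have ZZ' : Z * star Z = P := by
    have : Z * star Z = R1 * (star L * L) * star R1 + R1 * (star L * M) * star R2 + R2 * (star M * L) * star R1 + R2 * (star M * M) * star R2 := by
      rw [sZ, hZ]; noncomm_ring
    rw [this, LL, LM, ML, MM, R1p, R2q, ← rs]; simp
  have ZZ : star Z * Z = L * star L + M * star M := by
    have : star Z * Z = L * (star R1 * R1) * star L + L * (star R1 * R2) * star M + M * (star R2 * R1) * star L + M * (star R2 * R2) * star M := by
      rw [sZ, hZ]; noncomm_ring
    rw [this, r11, r12, r21, r22, Lp, Mq]; simp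
  have ZK : Z * K = 0 := by
    have : Z * K = R1 * (star L * K) + R2 * (star M * K) := by rw [hZ]; noncomm_ring
    rw [this, LK, MK]; simp
  have KZ : star K * star Z = 0 := by rw [← star_mul, ZK, star_zero]
  have Zp : Z * p = Z := by rw [hZ, add_mul, mul_assoc, mul_assoc, sLp, sMp]
  have pZ : p * star Z = star Z := by have := congrArg star Zp; rwa [star_mul, sp] at this
  have ZPn : ‖Z‖ ≤ 1 := by
    have : ‖star Z‖ ≤ 1 := norm_le_one_of_proj hP (by rw [star_star]; exact ZZ')
    rwa [norm_star] at this
  have PZ : P * Z = Z := by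
    have := mul_proj_of_star_mul hP (show star (star Z) * star Z = P by rw [star_star]; exact ZZ')
    have := congrArg star this; rwa [star_mul, star_star, hP.isSelfAdjoint.star_eq] at this
  have ZP : star Z * P = star Z := by have := congrArg star PZ; rwa [star_mul, hP.isSelfAdjoint.star_eq] at this
  have cf : ∀ j, Commute f (pr j) := by
    intro j; rw [← a33]; exact (star_comm (hpr j) (c3 j)).mul_left (c3 j)
  have cSf : ∀ j, Commute f (star (pr j)) := by
    intro j
    have := (cf j).star_star; rwa [hf.isSelfAdjoint.star_eq] at this
  -- general product estimate
  have prod : ∀ x z : D, Commute f x → ‖x‖ ≤ 1 → ‖z‖ ≤ 1 → ∀ t : ℝ, ‖P * z - z * P‖ ≤ t →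
      ‖(star Z * x * Z + K * x * star K) * (star Z * z * Z + K * z * star K) - (star Z * (x * z) * Z + K * (x * z) * star K)‖ ≤ t := by
    intro x z hx hxn hzn t ht
    have e : (star Z * x * Z + K * x * star K) * (star Z * z * Z + K * z * star K)
      = star Z * x * (Z * star Z) * z * Z + star Z * x * (Z * K) * z * star K + K * x * (star K * star Z) * z * Z
        + K * x * (star K * K) * z * star K := by noncomm_ring
    have e5 : K * x * f = K * x := by rw [mul_assoc, ← hx.eq, ← mul_assoc, Kf]
    rw [e, ZK, KZ, ZZ', KK, e5]
    have e6 : star Z * x * P * z * Z + star Z * x * 0 * z * star K + K * x * 0 * z * Z + K * x * z * star K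
      - (star Z * (x * z) * Z + K * (x * z) * star K) = star Z * x * (P * z - z * P) * Z + star Z * x * z * (P * Z - Z) := by noncomm_ring
    rw [e6, PZ, sub_self, mul_zero, add_zero]
    exact nmulR (nmulL (nmulL (sn _ ZPn) hxn) ht) ZPn
  have prn := fun j => norm_unitary_le (hpr j)
  have hone : star Z * 1 * Z + K * 1 * star K = p := by rw [mul_one, mul_one, ZZ, tot2]
  have cPs : ∀ j, ‖P * star (pr j) - star (pr j) * P‖ ≤ δ := by
    intro j
    have : P * star (pr j) - star (pr j) * P = star (pr j * P - P * pr j) := by simp [hP.isSelfAdjoint.star_eq]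
    rw [this, norm_star, norm_sub_rev]; exact cP j
  have e3' : ∀ j, ‖star S * V j - pr j * star S‖ ≤ η := by
    intro j
    have h1 : ‖star (V j) * S - S * star (pr j)‖ ≤ η := by
      have : star (V j) * S - S * star (pr j) = - (star (V j) * (V j * S - S * pr j) * star (pr j)) := by
        have e : star (V j) * (V j * S - S * pr j) * star (pr j) = (star (V j) * V j) * S * star (pr j) - star (V j) * S * (pr j * star (pr j)) := by noncomm_ring
        rw [e, (hV j).2.2, pS, (Unitary.mem_iff.1 (hpr j)).2, mul_one]; abel
      rw [this, norm_neg]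
      have hVn : ‖V j‖ ≤ 1 := norm_le_one_of_proj hp (hV j).2.2
      exact nmulR (nmulL (sn _ hVn) (e3 j)) (sn _ (prn j))
    have : star S * V j - pr j * star S = star (star (V j) * S - S * star (pr j)) := by simp
    rw [this, norm_star]; exact h1
  refine ⟨fun j => star Z * pr j * Z + K * pr j * star K, ?_, ?_⟩
  · intro j
    have hst : star (star Z * pr j * Z + K * pr j * star K) = star Z * star (pr j) * Z + K * star (pr j) * star K := by
      simp [star_mul, mul_assoc]
    refine ⟨?_, ?_, ?_, ?_, ?_⟩
    · rw [mul_add, ← mul_assoc, ← mul_assoc, ← mul_assoc, ← mul_assoc, pZ, pK]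
    · rw [add_mul, mul_assoc, mul_assoc, mul_assoc _ (star K), Zp, sKp, ← mul_assoc]
    · have hVn : ‖V j‖ ≤ 1 := norm_le_one_of_proj hp (hV j).2.2
      have hSx : ∀ x, ‖x‖ ≤ 1 → Commute x (pr j) → ‖S * x * pr j - V j * (S * x)‖ ≤ η := by
        intro x hx hc
        have : S * x * pr j - V j * (S * x) = - ((V j * S - S * pr j) * x) + S * (x * pr j - pr j * x) := by noncomm_ring
        rw [this, hc.eq, sub_self, mul_zero, add_zero, norm_neg]
        exact nmulR (e3 j) hx
      have hM1 : ‖M * pr j - V j * M‖ ≤ η := by rw [hM]; exact hSx _ a2n (c2 j)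
      have hK1 : ‖K * pr j - V j * K‖ ≤ η := by rw [hK]; exact hSx _ a3n (c3 j)
      have hSS : ∀ x, ‖x‖ ≤ 1 → Commute x (pr j) → ‖S * x * star S * V j - V j * (S * x * star S)‖ ≤ η + η := by
        intro x hx hc
        have : S * x * star S * V j - V j * (S * x * star S) = S * x * (star S * V j - pr j * star S) + (S * x * pr j - V j * (S * x)) * star S := by noncomm_ring
        rw [this]
        exact nadd (nmulL (nmulL hS hx) (e3' j)) (nmulR (hSx x hx hc) (sn _ hS))
      have hL1 : ‖L * V j - V j * L‖ ≤ η + η + (η + η) := by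
        have : L * V j - V j * L = (G * V j - V j * G) - (g * V j - V j * g) + (p * V j - V j * p) := by rw [hL]; noncomm_ring
        rw [this, (hV j).1, (hV j).2.1, sub_self, add_zero]
        refine nsub ?_ ?_
        · rw [hG]; exact hSS _ a1n (c1 j)
        · rw [hg]; exact hSS _ h0.norm_le (c0 j)
      have d1 : star Z * pr j * Z = L * V j * star L + M * pr j * star M - star Z * (R1 * V j - pr j * R1) * star L
          - star Z * (R2 * pr j - pr j * R2) * star M := by
        have q1 : star Z * R1 = L := by rw [sZ, add_mul, mul_assoc, mul_assoc, r11, r21, Lp, mul_zero, add_zero]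
        have q2 : star Z * R2 = M := by rw [sZ, add_mul, mul_assoc, mul_assoc, r22, r12, Mq, mul_zero, zero_add]
        have : star Z * pr j * Z = star Z * pr j * (R1 * star L + R2 * star M) := by rw [← hZ]
        have t2 : star Z * (R1 * V j - pr j * R1) * star L = star Z * R1 * V j * star L - star Z * pr j * R1 * star L := by noncomm_ring
        have t3 : star Z * (R2 * pr j - pr j * R2) * star M = star Z * R2 * pr j * star M - star Z * pr j * R2 * star M := by noncomm_ring
        rw [this, t2, t3, q1, q2]; noncomm_ring
      have d2 : star Z * pr j * Z + K * pr j * star K - V j = (L * V j - V j * L) * star L + (M * pr j - V j * M) * star M + (K * pr j - V j * K) * star K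
          - star Z * (R1 * V j - pr j * R1) * star L - star Z * (R2 * pr j - pr j * R2) * star M := by
        have : V j = V j * (L * star L + M * star M + K * star K) := by rw [tot2, (hV j).2.1]
        rw [d1]
        have h9 : V j = V j * L * star L + V j * M * star M + V j * K * star K := by
          rw [mul_assoc, mul_assoc, mul_assoc, ← mul_add, ← mul_add]; exact this
        have h10 : ∀ a b c d e f g : D, a = e + f + g → b + c + d - a = (b - e) + (c - f) + (d - g) := by
          intro a b c d e f g h; rw [h]; abel
        rw [sub_mul (L * V j), sub_mul (M * pr j), sub_mul (K * pr j), ← h10 _ _ _ _ _ _ _ h9]; abel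
      rw [d2]
      refine (nsub (nsub (nadd (nadd (nmulR hL1 (sn _ Ln)) (nmulR hM1 (sn _ Mn))) (nmulR hK1 (sn _ Kn)))
        (nmulR (nmulL (sn _ ZPn) (e1 j)) (sn _ Ln))) (nmulR (nmulL (sn _ ZPn) (e2 j)) (sn _ Mn))).trans (by linarith)
    · rw [hst]
      have := prod (star (pr j)) (pr j) (cSf j) (sn _ (prn j)) (prn j) δ (cP j)
      rwa [(Unitary.mem_iff.1 (hpr j)).1, hone] at this
    · rw [hst]
      have := prod (pr j) (star (pr j)) (cf j) (prn j) (sn _ (prn j)) δ (cPs j)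
      rwa [(Unitary.mem_iff.1 (hpr j)).2, hone] at this
  · intro j k
    have h1 := prod (pr k) (pr j) (cf k) (prn k) (prn j) δ (cP j)
    have h2 := prod (pr j) (pr k) (cf j) (prn j) (prn k) δ (cP k)
    have h3 : star Z * (pr k * pr j) * Z + K * (pr k * pr j) * star K = lam j k • (star Z * (pr j * pr k) * Z + K * (pr j * pr k) * star K) := by
      rw [rel]; simp only [mul_smul_comm, smul_mul_assoc, smul_add]
    rw [h3] at h1
    have h4 := nsub h1 (show ‖lam j k • _‖ ≤ δ from (norm_smul_le _ _).trans ((mul_le_of_le_one_left (norm_nonneg _) (hl j k)).trans h2))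
    refine le_trans (le_of_eq ?_) h4
    rw [smul_sub]; congr 1; abel
end

theorem final {A : Type u} [CStarAlgebra A] {n : ℕ} {lam : Fin n → Fin n → ℂ} {v : Fin n → A} {η : ℝ} {c : Fin n → ℝ} {t : ℝ}
    (hl : ∀ j k, ‖lam j k‖ ≤ 1) (hv : ∀ j, v j ∈ unitary A)
    (ht : 0 ≤ t) (ht1 : t ≤ 1 / 50) (hc : ∀ j, c j ≤ t ^ 2) (s : Sys lam v η c) :
    ∃ w : Fin n → A, (∀ j, w j ∈ unitary A) ∧ (∀ j, ‖w j - v j‖ ≤ 8 * η + 9 * t) ∧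
      ∀ j k, ‖w k * w j - lam j k • (w j * w k)‖ ≤ 60 * t := by
  have hz := s.cz
  have c1 := s.ct s.T1 (Or.inl rfl)
  have c2 := s.ct s.T2 (Or.inr (Or.inl rfl))
  have cx := s.ct s.X (Or.inr (Or.inr (Or.inl rfl)))
  have ce := s.ct s.eh (Or.inr (Or.inr (Or.inr rfl)))
  have ee := hz.pe.isIdempotentElem.eq
  have es := hz.pe.isSelfAdjoint.star_eq
  have qs := s.pq.isSelfAdjoint.star_eq
  have q2 := s.pq.isIdempotentElem.eq
  have sq : ∀ t, Commute t s.qq → Commute (star t) s.qq := by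
    intro t h; have := h.star_star; rwa [qs] at this
  have sN : ∀ t, Commute t s.Nn → Commute (star t) s.Nn := by
    intro t h; have := h.star_star; rwa [s.pN.isSelfAdjoint.star_eq] at this
  have hp : IsStarProjection (s.θ 1) := (IsStarProjection.one (R := A)).map s.θ
  obtain ⟨fh, hfh⟩ : ∃ fh, fh = s.eh - s.X * star s.X := ⟨_, rfl⟩
  have Xe : star s.X * s.eh = star s.X := by have := congrArg star hz.ex; rwa [star_mul, es] at this
  have xx : s.X * star s.X * (s.X * star s.X) = s.X * star s.X := by
    rw [mul_assoc, ← mul_assoc (star s.X), hz.xx, one_mul]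
  have pf : IsStarProjection fh := by
    rw [hfh]
    refine ⟨?_, ?_⟩
    · show (s.eh - s.X * star s.X) * (s.eh - s.X * star s.X) = _
      rw [mul_sub, sub_mul, sub_mul, ee, xx, mul_assoc _ _ s.eh, Xe, ← mul_assoc s.eh, hz.ex]; abel
    · show star _ = _
      rw [star_sub, es, star_mul, star_star]
  have ef : s.eh * fh = fh := by rw [hfh, mul_sub, ee, ← mul_assoc, hz.ex]
  have fX : fh * s.X = 0 := by rw [hfh, sub_mul, mul_assoc, hz.xx, mul_one, hz.ex, sub_self]
  have cfp : ∀ j, Commute fh (s.pr j) := by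
    intro j; rw [hfh]; exact (ce.1 j).sub_left ((cx.1 j).mul_left (star_comm (s.pru j) (cx.1 j)))
  have cfN : Commute fh s.Nn := by rw [hfh]; exact ce.2.1.sub_left (cx.2.1.mul_left (sN _ cx.2.1))
  have cfq : Commute fh s.qq := by rw [hfh]; exact ce.2.2.sub_left (cx.2.2.mul_left (sq _ cx.2.2))
  have uu : ∀ y, s.eh * y = y → Commute y s.Nn → star s.S * s.S * (y * s.qq) = y * s.qq := by
    intro y h1 h2
    rw [s.sS, mul_assoc, ← mul_assoc s.eh, h1, ← mul_assoc, ← h2.eq, mul_assoc, s.Nq]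
  have sqq : ∀ x y, Commute (star x * y) s.qq → star (x * s.qq) * (y * s.qq) = star x * y * s.qq := by
    intro x y h
    rw [star_mul, qs, mul_assoc, ← mul_assoc (star x), ← mul_assoc, ← h.eq, mul_assoc, q2]
  have e21 : star (s.T2 * s.X) * (s.T2 * s.X) = 1 := by
    rw [star_mul, mul_assoc, ← mul_assoc (star s.T2), hz.t22, hz.ex, hz.xx]
  have e33 : star (s.T2 * fh) * (s.T2 * fh) = fh := by
    rw [star_mul, mul_assoc, ← mul_assoc (star s.T2), hz.t22, ef, pf.isSelfAdjoint.star_eq, pf.isIdempotentElem.eq]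
  have hS1 : ‖s.S‖ ≤ 1 := norm_le_one_of_proj (proj_mul s.pN hz.pe ce.2.1.symm) s.sS
  have c0q : Commute (0 : s.D) s.qq := Commute.zero_left _
  have e12 : star s.T1 * (s.T2 * s.X) = 0 := by rw [← mul_assoc, hz.t12, zero_mul]
  have e13 : star s.T1 * (s.T2 * fh) = 0 := by rw [← mul_assoc, hz.t12, zero_mul]
  have e23 : star (s.T2 * s.X) * (s.T2 * fh) = 0 := by
    rw [star_mul, mul_assoc, ← mul_assoc (star s.T2), hz.t22, ef]
    have := congrArg star fX; rwa [star_mul, pf.isSelfAdjoint.star_eq, star_zero] at this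
  have et2x : s.eh * (s.T2 * s.X) = s.T2 * s.X := by rw [← mul_assoc, hz.eT2]
  have et2f : s.eh * (s.T2 * fh) = s.T2 * fh := by rw [← mul_assoc, hz.eT2]
  have eqq : ∀ y, s.eh * y = y → Commute y s.qq → s.eh * s.qq * (y * s.qq) = y * s.qq := by
    intro y h1 h2
    rw [mul_assoc, h2.eq, ← mul_assoc s.qq, q2, ← h2.eq, ← mul_assoc, h1]
  obtain ⟨y, hy1, hy2⟩ := asm (n := n) (p := s.θ 1) (a0 := s.eh * s.qq) (a1 := s.T1 * s.qq) (a2 := s.T2 * s.X * s.qq) (a3 := s.T2 * fh * s.qq)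
    (S := s.S) (P := s.P) (qq := s.qq) (R1 := s.R1) (R2 := s.R2) hp s.pP (proj_mul hz.pe s.pq ce.2.2) s.pq s.pS hS1
    (uu _ ee ce.2.1) (uu _ hz.eT1 c1.2.1) (uu _ et2x (c2.2.1.mul_left cx.2.1)) (uu _ et2f (c2.2.1.mul_left cfN))
    (by rw [sqq _ _ (by rw [hz.t11]; exact ce.2.2), hz.t11])
    (by rw [sqq _ _ (by rw [e12]; exact c0q), e12, zero_mul])
    (by rw [sqq _ _ (by rw [e13]; exact c0q), e13, zero_mul])
    (by rw [sqq _ _ (by rw [e23]; exact c0q), e23, zero_mul])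
    (by rw [sqq _ _ (by rw [e21]; exact Commute.one_left _), e21, one_mul])
    (eqq _ hz.eT1 c1.2.2) (eqq _ et2x (c2.2.2.mul_left cx.2.2)) (eqq _ et2f (c2.2.2.mul_left cfq))
    (f := fh * s.qq) (proj_mul pf s.pq cfq)
    (by rw [sqq _ _ (by rw [e33]; exact cfq), e33])
    (by
      have e : ∀ x, Commute x s.qq → x * s.qq * star (x * s.qq) = x * star x * s.qq := by
        intro x h
        rw [star_mul, qs, mul_assoc, ← mul_assoc s.qq, q2, ← (sq _ h).eq, mul_assoc]
      rw [e _ c1.2.2, e _ (c2.2.2.mul_left cx.2.2), e _ (c2.2.2.mul_left cfq), ← add_mul, ← add_mul]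
      congr 1
      have : s.T2 * s.X * star (s.T2 * s.X) + s.T2 * fh * star (s.T2 * fh) = s.T2 * star s.T2 := by
        have h1 : s.T2 * fh * star (s.T2 * fh) = s.T2 * (s.eh - s.X * star s.X) * star s.T2 := by
          rw [star_mul, pf.isSelfAdjoint.star_eq, mul_assoc, ← mul_assoc fh, pf.isIdempotentElem.eq, ← mul_assoc, hfh]
        rw [h1, mul_sub, hz.T2e, star_mul]; noncomm_ring
      rw [add_assoc, this, hz.ts])
    s.r11 s.r22 s.r12 s.rs (η := η) (δ := t ^ 2) (fun j => s.θ (v j)) s.pr lam hl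
    (fun j => ⟨by rw [← map_mul, one_mul], by rw [← map_mul, mul_one], by rw [← map_star, ← map_mul, (Unitary.mem_iff.1 (hv j)).1]⟩)
    s.pru s.prrel
    (fun j => (ce.1 j).mul_left (s.cq j)) (fun j => (c1.1 j).mul_left (s.cq j)) (fun j => ((c2.1 j).mul_left (cx.1 j)).mul_left (s.cq j))
    (fun j => ((c2.1 j).mul_left (cfp j)).mul_left (s.cq j)) (fun j => (s.cP j).trans (hc j)) s.e1 s.e2 s.e3
  have iso' : ∀ a b : A, ‖s.θ a - s.θ b‖ = ‖a - b‖ := by intro a b; rw [← map_sub, s.iso]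
  have : ∀ j, ∃ a, s.θ a = y j := by
    intro j
    obtain ⟨a, ha⟩ := s.corner (y j)
    refine ⟨a, ?_⟩
    rw [ha, (hy1 j).1, (hy1 j).2.1]
  choose a ha using this
  have ha1 : ∀ j, ‖a j - v j‖ ≤ 8 * η := by intro j; rw [← iso', ha]; exact (hy1 j).2.2.1
  have ha2 : ∀ j, ‖star (a j) * a j - 1‖ ≤ t ^ 2 := by intro j; rw [← iso', map_mul, map_star, ha]; exact (hy1 j).2.2.2.1
  have ha3 : ∀ j, ‖a j * star (a j) - 1‖ ≤ t ^ 2 := by intro j; rw [← iso', map_mul, map_star, ha]; exact (hy1 j).2.2.2.2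
  have ha4 : ∀ j k, ‖a k * a j - lam j k • (a j * a k)‖ ≤ t ^ 2 + t ^ 2 := by
    intro j k; rw [← iso', map_smul, map_mul, map_mul, ha, ha]; exact hy2 j k
  have : ∀ j, ∃ w, w ∈ unitary A ∧ ‖w - a j‖ ≤ 9 * t := by
    intro j
    obtain ⟨R, h1, h2, h3⟩ := polar2 (IsStarProjection.one (R := A)) (IsStarProjection.one (R := A)) (mul_one (a j)) ht ht1 (ha2 j) (ha3 j)
    exact ⟨R, Unitary.mem_iff.2 ⟨h1, h2⟩, h3⟩
  choose w hw1 hw2 using this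
  refine ⟨w, hw1, ?_, ?_⟩
  · intro j
    have := nadd (hw2 j) (ha1 j)
    rw [sub_add_sub_cancel] at this; linarith
  · have hwn := fun j => norm_unitary_le (hw1 j)
    have han : ∀ j, ‖a j‖ ≤ 1 + 9 * t := by
      intro j
      have := nsub (hwn j) (hw2 j)
      rwa [sub_sub_cancel] at this
    have hd : ∀ j k, ‖w j * w k - a j * a k‖ ≤ 9 * t + 11 * t := by
      intro j k
      have : w j * w k - a j * a k = (w j - a j) * w k + a j * (w k - a k) := by noncomm_ring
      rw [this]
      refine nadd (nmulR (hw2 j) (hwn k)) ((nmul (han j) (hw2 k)).trans ?_)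
      nlinarith
    intro j k
    have h4 := nsub (nadd (ha4 j k) (hd k j)) (show ‖lam j k • _‖ ≤ _ from (norm_smul_le _ _).trans ((mul_le_of_le_one_left (norm_nonneg _) (hl j k)).trans (hd j k)))
    have e : w k * w j - lam j k • (w j * w k) = a k * a j - lam j k • (a j * a k) + (w k * w j - a k * a j) - lam j k • (w j * w k - a j * a k) := by
      rw [smul_sub]; abel
    rw [e]
    refine h4.trans ?_
    nlinarith
end PIS

namespace PIS
universe u
set_option linter.all false

section
variable {A : Type u} [CStarAlgebra A]

lemma unit_of_left_inv {y w : A} (h : y * w = 1) : IsUnit (star w * w) := by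
  letI := CStarAlgebra.spectralOrder A
  letI := CStarAlgebra.spectralOrderedRing A
  have h1 : star y * y ≤ algebraMap ℝ A (‖y‖ ^ 2) := CStarAlgebra.star_mul_le_algebraMap_norm_sq
  have h2 := star_left_conjugate_le_conjugate h1 w
  have h3 : star w * (star y * y) * w = 1 := by
    rw [← mul_assoc, ← star_mul, mul_assoc, h]; simp
  have h4 : star w * algebraMap ℝ A (‖y‖ ^ 2) * w = (‖y‖ ^ 2) • (star w * w) := by
    rw [← Algebra.commutes, mul_assoc, ← Algebra.smul_def]
  rw [h3, h4] at h2
  have h5 := CStarAlgebra.isUnit_of_le (1 : A) h2 (by simp [IsStrictlyPositive.iff_of_unital])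
  have h6 : star w * w * algebraMap ℝ A (‖y‖ ^ 2) = ‖y‖ ^ 2 • (star w * w) := by
    rw [Algebra.smul_def, Algebra.commutes]
  rw [← h6] at h5
  have hc : Commute (star w * w) (algebraMap ℝ A (‖y‖ ^ 2)) := (Algebra.commutes _ _).symm
  exact (hc.isUnit_mul_iff.1 h5).1

lemma inv_sqrt_of_unit {w : A} (h : IsUnit (star w * w)) : ∃ c : A, star (w * c) * (w * c) = 1 := by
  have hb : IsSelfAdjoint (star w * w) := IsSelfAdjoint.star_mul_self w
  have hpos : ∀ t ∈ spectrum ℝ (star w * w), 0 < t := by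
    intro t ht
    rcases lt_or_eq_of_le (spectrum_star_mul_self_nonneg t ht) with h1 | h1
    · exact h1
    · exact absurd (h1 ▸ ht) (spectrum.zero_notMem ℝ h)
  have hcont : ContinuousOn (fun t : ℝ => (√t)⁻¹) (spectrum ℝ (star w * w)) :=
    ContinuousOn.inv₀ Real.continuous_sqrt.continuousOn fun t ht => (Real.sqrt_pos.2 (hpos t ht)).ne'
  refine ⟨cfc (fun t : ℝ => (√t)⁻¹) (star w * w), ?_⟩
  have hs : star (cfc (fun t : ℝ => (√t)⁻¹) (star w * w)) = cfc (fun t : ℝ => (√t)⁻¹) (star w * w) := IsSelfAdjoint.star_eq (cfc_predicate _ _)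
  rw [star_mul, hs, mul_assoc, ← mul_assoc (star w)]
  have h1 : star w * w = cfc (fun t : ℝ => t) (star w * w) := (cfc_id' ℝ _).symm
  have h2 : (star w * w) * cfc (fun t : ℝ => (√t)⁻¹) (star w * w) = cfc (fun t : ℝ => t * (√t)⁻¹) (star w * w) := by
    conv_lhs => enter [1]; rw [h1]
    rw [← cfc_mul (fun t : ℝ => t) (fun t : ℝ => (√t)⁻¹) (star w * w) continuousOn_id hcont]
  rw [h2, ← cfc_mul (fun t : ℝ => (√t)⁻¹) (fun t : ℝ => t * (√t)⁻¹) (star w * w) hcont (continuousOn_id.mul hcont),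
    ← cfc_const_one ℝ (star w * w)]
  refine cfc_congr fun t ht => ?_
  have h3 := Real.sqrt_pos.2 (hpos t ht)
  have h4 := Real.mul_self_sqrt (hpos t ht).le
  try simp only
  field_simp
  nlinarith

theorem PI1 (hA : IsPurelyInfiniteSimple A) {x : A} {ν : ℝ} (hν : 0 < ν) (hx : ν ≤ ‖x‖) :
    ∃ d : A, star d * (star x * x) * d = 1 ∧ ‖d‖ ≤ 2 / ν := by
  obtain ⟨b, hb⟩ : ∃ b, b = star x * x := ⟨_, rfl⟩
  have hbs : IsSelfAdjoint b := hb ▸ IsSelfAdjoint.star_mul_self x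
  have hnn : ∀ t ∈ spectrum ℝ b, 0 ≤ t := by rw [hb]; exact fun t ht => spectrum_star_mul_self_nonneg t ht
  have hbn : ν ^ 2 ≤ ‖b‖ := by
    rw [hb, CStarRing.norm_star_mul_self]; nlinarith
  have hh : Continuous (fun t : ℝ => max 0 (t - ν ^ 2 / 2)) := by fun_prop
  have hl : Continuous (fun t : ℝ => (√(max t (ν ^ 2 / 2)))⁻¹) := by
    refine Continuous.inv₀ (by fun_prop) fun t => ?_
    exact (Real.sqrt_pos.2 (lt_max_of_lt_right (by positivity))).ne'
  obtain ⟨a, ha⟩ : ∃ a, a = cfc (fun t : ℝ => max 0 (t - ν ^ 2 / 2)) b := ⟨_, rfl⟩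
  obtain ⟨l, hld⟩ : ∃ a, a = cfc (fun t : ℝ => (√(max t (ν ^ 2 / 2)))⁻¹) b := ⟨_, rfl⟩
  have ha0 : a ≠ 0 := by
    intro h0
    have : ‖b‖ ≤ ν ^ 2 / 2 := by
      rw [← cfc_id' ℝ b]
      refine norm_cfc_le (by positivity) fun t ht => ?_
      have h1 := norm_apply_le_norm_cfc (fun t : ℝ => max 0 (t - ν ^ 2 / 2)) b ht hh.continuousOn
      rw [← ha, h0, norm_zero] at h1
      have h2 := norm_le_zero_iff.1 h1
      have h3 := le_max_right 0 (t - ν ^ 2 / 2)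
      rw [Real.norm_of_nonneg (hnn t ht)]
      try simp only at h2
      linarith
    nlinarith [sq_nonneg ν, pow_pos hν 2]
  obtain ⟨y, z, hyz⟩ := hA.2 a ha0
  rw [mul_assoc] at hyz
  obtain ⟨c, hc⟩ := inv_sqrt_of_unit (unit_of_left_inv hyz)
  have hls : star l = l := by rw [hld]; exact IsSelfAdjoint.star_eq (cfc_predicate _ _)
  have hlb : l * b * l * a = a := by
    have h1 : b = cfc (fun t : ℝ => t) b := (cfc_id' ℝ b).symm
    have h2 : l * b = cfc (fun t : ℝ => (√(max t (ν ^ 2 / 2)))⁻¹ * t) b := by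
      conv_lhs => rw [h1, hld]
      rw [cfc_id' ℝ b]
      rw [cfc_mul (fun t : ℝ => (√(max t (ν ^ 2 / 2)))⁻¹) (fun t : ℝ => t) b hl.continuousOn continuousOn_id, cfc_id' ℝ b]
    rw [h2, hld, ha, ← cfc_mul (fun t : ℝ => (√(max t (ν ^ 2 / 2)))⁻¹ * t) (fun t : ℝ => (√(max t (ν ^ 2 / 2)))⁻¹) b (by fun_prop) hl.continuousOn,
      ← cfc_mul (fun t : ℝ => (√(max t (ν ^ 2 / 2)))⁻¹ * t * (√(max t (ν ^ 2 / 2)))⁻¹) (fun t : ℝ => max 0 (t - ν ^ 2 / 2)) b (by fun_prop) hh.continuousOn]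
    refine cfc_congr fun t ht => ?_
    try simp only
    rcases le_total t (ν ^ 2 / 2) with h | h
    · rw [max_eq_left (by linarith : t - ν ^ 2 / 2 ≤ 0), mul_zero]
    · rw [max_eq_left h]
      have ht0 : 0 < t := lt_of_lt_of_le (by positivity) h
      have h3 := Real.sqrt_pos.2 ht0
      have h4 := Real.mul_self_sqrt ht0.le
      have : (√t)⁻¹ * t * (√t)⁻¹ = 1 := by field_simp; nlinarith
      rw [this, one_mul]
  refine ⟨l * (a * z * c), ?_, ?_⟩
  · rw [← hb, star_mul, hls]
    have : star (a * z * c) * l * b * (l * (a * z * c)) = star (a * z * c) * (l * b * l * a * (z * c)) := by noncomm_ring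
    rw [mul_assoc _ l b] at this
    rw [mul_assoc _ l b, this, hlb, ← mul_assoc a, hc]
  · have h1 : ‖l‖ ≤ 2 / ν := by
      rw [hld]
      refine norm_cfc_le (by positivity) fun t ht => ?_
      have h5 : ν / 2 ≤ √(max t (ν ^ 2 / 2)) := by
        apply Real.le_sqrt_of_sq_le
        exact le_trans (by nlinarith [pow_pos hν 2]) (le_max_right _ _)
      rw [norm_inv, Real.norm_of_nonneg (Real.sqrt_nonneg _)]
      calc (√(max t (ν ^ 2 / 2)))⁻¹ ≤ (ν / 2)⁻¹ := inv_anti₀ (by positivity) h5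
        _ = 2 / ν := by rw [inv_div]
    refine nmulR h1 ?_
    exact norm_le_one_of_proj (IsStarProjection.one (R := A)) hc

lemma exists_sa (hA : IsPurelyInfiniteSimple A) : ∃ b : A, IsSelfAdjoint b ∧ ∀ r : ℝ, b ≠ algebraMap ℝ A r := by
  by_contra! hcon
  obtain ⟨⟨a, ha⟩, -⟩ := hA
  obtain ⟨r, hr⟩ := hcon _ (realPart a).2
  obtain ⟨r', hr'⟩ := hcon _ (imaginaryPart a).2
  apply ha
  refine ⟨r + Complex.I * r', ?_⟩
  rw [← realPart_add_I_smul_imaginaryPart a, hr, hr', map_add, map_mul, Algebra.smul_def, IsScalarTower.algebraMap_apply ℝ ℂ A,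
    IsScalarTower.algebraMap_apply ℝ ℂ A]
  rfl

theorem PI2 (hA : IsPurelyInfiniteSimple A) : ∃ a b : A, star a * a = 1 ∧ star b * b = 1 ∧ star a * b = 0 := by
  obtain ⟨b, hb, hne⟩ := exists_sa hA
  have h2 : ∃ s ∈ spectrum ℝ b, ∃ t ∈ spectrum ℝ b, s < t := by
    by_contra! hcon
    have : ∃ r, ∀ s ∈ spectrum ℝ b, s = r := by
      rcases (spectrum ℝ b).eq_empty_or_nonempty with h | ⟨r, hr⟩
      · exact ⟨0, by rw [h]; simp⟩
      · exact ⟨r, fun s hs => le_antisymm (hcon _ hr _ hs) (hcon _ hs _ hr)⟩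
    obtain ⟨r, hr⟩ := this
    apply hne r
    rw [← cfc_const r b, ← cfc_id' ℝ b]
    rw [cfc_id' ℝ b]
    conv_lhs => rw [← cfc_id' ℝ b]
    exact cfc_congr fun s hs => hr s hs
  obtain ⟨s, hs, t, ht, hst⟩ := h2
  have c1 : Continuous (fun x : ℝ => max 0 ((s + t) / 2 - x)) := by fun_prop
  have c2 : Continuous (fun x : ℝ => max 0 (x - (s + t) / 2)) := by fun_prop
  obtain ⟨x1, h1⟩ : ∃ x, x = cfc (fun x : ℝ => max 0 ((s + t) / 2 - x)) b := ⟨_, rfl⟩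
  obtain ⟨x2, h2⟩ : ∃ x, x = cfc (fun x : ℝ => max 0 (x - (s + t) / 2)) b := ⟨_, rfl⟩
  have n1 : 0 < ‖x1‖ := by
    have := norm_apply_le_norm_cfc (fun x : ℝ => max 0 ((s + t) / 2 - x)) b hs c1.continuousOn
    rw [← h1] at this
    refine lt_of_lt_of_le ?_ this
    rw [norm_pos_iff]; try simp only
    exact (lt_max_of_lt_right (by linarith)).ne'
  have n2 : 0 < ‖x2‖ := by
    have := norm_apply_le_norm_cfc (fun x : ℝ => max 0 (x - (s + t) / 2)) b ht c2.continuousOn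
    rw [← h2] at this
    refine lt_of_lt_of_le ?_ this
    rw [norm_pos_iff]; try simp only
    exact (lt_max_of_lt_right (by linarith)).ne'
  have s1 : star x1 = x1 := by rw [h1]; exact IsSelfAdjoint.star_eq (cfc_predicate _ _)
  have h12 : x1 * x2 = 0 := by
    rw [h1, h2, ← cfc_mul _ _ b c1.continuousOn c2.continuousOn, ← cfc_const_zero ℝ b]
    refine cfc_congr fun x _ => ?_
    try simp only
    rcases le_total x ((s + t) / 2) with h | h
    · rw [max_eq_left (by linarith : x - (s + t) / 2 ≤ 0), mul_zero]
    · rw [max_eq_left (by linarith : (s + t) / 2 - x ≤ 0), zero_mul]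
  obtain ⟨d1, e1, -⟩ := PI1 hA n1 le_rfl
  obtain ⟨d2, e2, -⟩ := PI1 hA n2 le_rfl
  refine ⟨x1 * d1, x2 * d2, ?_, ?_, ?_⟩
  · rw [star_mul, ← e1]; noncomm_ring
  · rw [star_mul, ← e2]; noncomm_ring
  · rw [star_mul, s1, mul_assoc, ← mul_assoc x1, h12]; simp

theorem PI3 (hA : IsPurelyInfiniteSimple A) : ∃ eh T1 T2 X : A, Cz eh T1 T2 X := by
  obtain ⟨a, b, aa, bb, ab⟩ := PI2 hA
  have ba : star b * a = 0 := by have := congrArg star ab; rwa [star_mul, star_star, star_zero] at this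
  obtain ⟨e, he⟩ : ∃ e, e = 1 - a * star a := ⟨_, rfl⟩
  have es : star e = e := by rw [he]; simp
  have ea : e * a = 0 := by rw [he, sub_mul, mul_assoc, aa]; simp
  have ae : star a * e = 0 := by have := congrArg star ea; rwa [star_mul, es, star_zero] at this
  have ee : e * e = e := by
    conv_lhs => enter [2]; rw [he]
    rw [mul_sub, ← mul_assoc, ea]; simp
  have eb : e * b = b := by rw [he, sub_mul, mul_assoc, ab]; simp
  have be : star b * e = star b := by have := congrArg star eb; rwa [star_mul, es] at this
  obtain ⟨f, hf⟩ : ∃ f, f = e - b * star b := ⟨_, rfl⟩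
  have fs : star f = f := by rw [hf]; simp [es]
  have fb : f * b = 0 := by rw [hf, sub_mul, mul_assoc, bb, eb]; simp
  have bf : star b * f = 0 := by have := congrArg star fb; rwa [star_mul, fs, star_zero] at this
  have ef : e * f = f := by rw [hf, mul_sub, ee, ← mul_assoc, eb]
  have fe : f * e = f := by have := congrArg star ef; rwa [star_mul, es, fs] at this
  have ff : f * f = f := by
    conv_lhs => enter [2]; rw [hf]
    rw [mul_sub, fe, ← mul_assoc, fb]; simp
  refine ⟨e, b * e, b * a * star b + f, b, ⟨ee, es⟩, ?_, ?_, ?_, ?_, bb, eb⟩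
  · rw [star_mul, es, mul_assoc, ← mul_assoc (star b), bb, one_mul, ee]
  · have : star (b * a * star b + f) * (b * a * star b + f) = b * (star a * (star b * b) * a) * star b + b * star a * (star b * f) + f * b * a * star b + f * f := by
      simp only [star_add, star_mul, star_star, fs]; noncomm_ring
    rw [this, bb, mul_one, aa, bf, fb, ff, hf]; simp
  · have : star (b * e) * (b * a * star b + f) = e * (star b * b) * a * star b + e * (star b * f) := by
      simp only [star_mul, es]; noncomm_ring
    rw [this, bb, mul_one, ea, bf]; simp
  · have h1 : (b * a * star b + f) * star (b * a * star b + f) = b * a * (star b * b) * star a * star b + b * a * (star b * f) + f * b * star a * star b + f * f := by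
      simp only [star_add, star_mul, star_star, fs]; noncomm_ring
    have h2 : b * e * star (b * e) = b * (e * e) * star b := by rw [star_mul, es]; noncomm_ring
    rw [h1, h2, bb, mul_one, bf, fb, ff, ee, hf, he]; noncomm_ring
end
end PIS

namespace PIS
universe u
set_option linter.all false

/-- finite dimensional unitary projective representation -/
def IsRep {n : ℕ} (L : Fin n → Fin n → ℂ) (q : ℕ) {E : Type} [NormedAddCommGroup E] [InnerProductSpace ℂ E]
    (ω : Fin n → E →ₗ[ℂ] E) : Prop :=
  (∀ j x, ‖ω j x‖ = ‖x‖) ∧ (∀ j, ω j ^ q = 1) ∧ ∀ j k, ω k * ω j = L k j • (ω j * ω k)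

def HasRep {n : ℕ} (L : Fin n → Fin n → ℂ) (q : ℕ) (d : ℕ) : Prop :=
  0 < d ∧ ∃ ω : Fin n → EuclideanSpace ℂ (Fin d) →ₗ[ℂ] EuclideanSpace ℂ (Fin d), IsRep L q ω

lemma hasRep_of {n : ℕ} {L : Fin n → Fin n → ℂ} {q : ℕ} {E : Type} [NormedAddCommGroup E] [InnerProductSpace ℂ E]
    [FiniteDimensional ℂ E] [Nontrivial E] {ω : Fin n → E →ₗ[ℂ] E} (h : IsRep L q ω) :
    HasRep L q (Module.finrank ℂ E) := by
  obtain ⟨h1, h2, h3⟩ := h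
  refine ⟨Module.finrank_pos, ?_⟩
  let e := (stdOrthonormalBasis ℂ E).repr
  let C := (e.toLinearEquiv).conjAlgEquiv ℂ
  have hC : ∀ f x, C f x = e (f (e.symm x)) := fun f x => rfl
  refine ⟨fun j => C (ω j), ?_, ?_, ?_⟩
  · intro j x
    rw [hC, e.norm_map, h1, e.symm.norm_map]
  · intro j; simp only; rw [← map_pow, h2, map_one]
  · intro j k; simp only; rw [← map_mul, h3, map_smul, map_mul]

section exist
variable {n q : ℕ} [NeZero q] (L : Fin n → Fin n → ℂ)

noncomputable def chiL (j : Fin n) (x : Fin n → ZMod q) : ℂ :=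
  ∏ l, if l < j then L l j ^ (x l).val else 1

variable {L}
lemma chiL_pow (hq : ∀ j k, L j k ^ q = 1) (j : Fin n) (x : Fin n → ZMod q) : chiL L j x ^ q = 1 := by
  unfold chiL
  rw [← Finset.prod_pow]
  apply Finset.prod_eq_one
  intro l _
  split_ifs
  · rw [← pow_mul, mul_comm, pow_mul, hq, one_pow]
  · simp

lemma chiL_norm (hq : ∀ j k, L j k ^ q = 1) (j : Fin n) (x : Fin n → ZMod q) : ‖chiL L j x‖ = 1 :=
  Complex.norm_eq_one_of_pow_eq_one (chiL_pow hq j x) (NeZero.ne q)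

lemma chiL_add (hq : ∀ j k, L j k ^ q = 1) (j k : Fin n) (x : Fin n → ZMod q) :
    chiL L j (x + Pi.single k 1) = (if k < j then L k j else 1) * chiL L j x := by
  unfold chiL
  rw [← Finset.prod_erase_mul _ _ (Finset.mem_univ k), ← Finset.prod_erase_mul (a := k) Finset.univ (fun l => if l < j then L l j ^ (x l).val else 1) (Finset.mem_univ k)]
  have : ∏ l ∈ Finset.univ.erase k, (if l < j then L l j ^ ((x + Pi.single k 1 : Fin n → ZMod q) l).val else 1) = ∏ l ∈ Finset.univ.erase k, (if l < j then L l j ^ (x l).val else 1) := by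
    apply Finset.prod_congr rfl
    intro l hl
    simp [Finset.ne_of_mem_erase hl]
  rw [this]
  split_ifs with hk
  · have : L k j ^ ((x + Pi.single k 1 : Fin n → ZMod q) k).val = L k j ^ (x k).val * L k j := by
      rw [Pi.add_apply, Pi.single_eq_same, ZMod.val_add, ZMod.val_one_eq_one_mod, Nat.add_mod_mod, ← pow_eq_pow_mod _ (hq k j), pow_succ]
    rw [this]; ring
  · ring

variable (L) in
noncomputable def omL (j : Fin n) : EuclideanSpace ℂ (Fin n → ZMod q) →ₗ[ℂ] EuclideanSpace ℂ (Fin n → ZMod q) where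
  toFun f := WithLp.toLp 2 (fun x => chiL L j x * f (x + Pi.single j 1))
  map_add' f g := by ext x; simp [mul_add]
  map_smul' c f := by ext x; simp; ring

lemma omL_apply (j : Fin n) (f) (x : Fin n → ZMod q) : omL L j f x = chiL L j x * f (x + Pi.single j 1) := rfl

lemma omL_rep (hq : ∀ j k, L j k ^ q = 1) (hd : ∀ j, L j j = 1) (hs : ∀ j k, L j k * L k j = 1) :
    IsRep L q (omL (q := q) L) := by
  refine ⟨?_, ?_, ?_⟩
  · intro j f
    rw [EuclideanSpace.norm_eq, EuclideanSpace.norm_eq]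
    congr 1
    simp only [omL_apply, norm_mul, chiL_norm hq, one_mul]
    exact Equiv.sum_comp (Equiv.addRight (Pi.single j (1 : ZMod q))) (fun x => ‖f x‖ ^ 2)
  · intro j
    have key : ∀ m : ℕ, ∀ f x, (omL (q := q) L j ^ m) f x = chiL L j x ^ m * f (x + m • Pi.single j 1) := by
      intro m
      induction m with
      | zero => intro f x; simp
      | succ m ih =>
        intro f x
        rw [pow_succ, Module.End.mul_apply, ih, omL_apply]
        have : ∀ m : ℕ, chiL L j (x + m • Pi.single j 1) = chiL L j x := by
          intro m
          induction m with
          | zero => simp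
          | succ m ih => rw [succ_nsmul, ← add_assoc, chiL_add hq, ih]; simp
        rw [this, succ_nsmul, ← add_assoc]; ring
    ext1 f
    ext x
    rw [key, chiL_pow hq]
    simp [← Pi.single_smul]
  · intro j k
    ext1 f
    ext x
    rw [Module.End.mul_apply, LinearMap.smul_apply, Module.End.mul_apply, PiLp.smul_apply, omL_apply, omL_apply, omL_apply, omL_apply,
      chiL_add hq, chiL_add hq, add_right_comm x]
    rcases lt_trichotomy j k with h | h | h
    · rw [if_neg (by omega), if_pos h, smul_eq_mul]
      linear_combination -(chiL L k x * chiL L j x * f (x + Pi.single j 1 + Pi.single k 1)) * hs k j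
    · subst h; simp [hd]
    · rw [if_pos h, if_neg (by omega), smul_eq_mul]; ring

end exist

theorem rep_exists {n q : ℕ} (hq0 : 0 < q) {L : Fin n → Fin n → ℂ} (hq : ∀ j k, L j k ^ q = 1) (hd : ∀ j, L j j = 1)
    (hs : ∀ j k, L j k * L k j = 1) :
    ∃ d, 0 < d ∧ ∃ ω : Fin n → CStarMatrix (Fin d) (Fin d) ℂ, (∀ j, ω j ∈ unitary (CStarMatrix (Fin d) (Fin d) ℂ)) ∧ (∀ j, ω j ^ q = 1) ∧
      (∀ j k, ω k * ω j = L k j • (ω j * ω k)) ∧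
      ∀ M : CStarMatrix (Fin d) (Fin d) ℂ, (∀ j, M * ω j = ω j * M) → ∃ c : ℂ, M = c • 1 := by
  classical
  haveI : NeZero q := ⟨hq0.ne'⟩
  have hex : ∃ d, HasRep L q d := ⟨_, hasRep_of (omL_rep hq hd hs)⟩
  obtain ⟨hd0, ω, h1, h2, h3⟩ := Nat.find_spec hex
  have hmin := fun m hm => Nat.find_min hex (m := m) hm
  generalize Nat.find hex = d at *
  haveI : NeZero d := ⟨hd0.ne'⟩
  let C := LinearMap.toMatrixOrthonormal (EuclideanSpace.basisFun (Fin d) ℂ)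
  have hU : ∀ j, C (ω j) ∈ unitary (Matrix (Fin d) (Fin d) ℂ) := by
    intro j
    have : star (C (ω j)) * C (ω j) = 1 := by
      rw [← map_star, ← map_mul]
      have : star (ω j) * ω j = 1 := by
        ext1 x
        refine ext_inner_left ℂ fun y => ?_
        rw [Module.End.mul_apply, LinearMap.star_eq_adjoint, LinearMap.adjoint_inner_right,
          (LinearMap.norm_map_iff_inner_map_map (ω j)).1 (h1 j)]
        rfl
      rw [this, map_one]
    exact ⟨this, mul_eq_one_comm.1 this⟩
  refine ⟨d, hd0, fun j => CStarMatrix.ofMatrix (C (ω j)), ?_, ?_, ?_, ?_⟩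
  · intro j; exact hU j
  · intro j
    have : C (ω j) ^ q = 1 := by rw [← map_pow, h2, map_one]
    exact this
  · intro j k
    have : C (ω k) * C (ω j) = L k j • (C (ω j) * C (ω k)) := by
      rw [← map_mul, h3, map_smul, map_mul]
    exact this
  · intro M hM
    let T := C.symm (CStarMatrix.ofMatrix.symm M)
    have hT : ∀ j, T * ω j = ω j * T := by
      intro j
      apply C.injective
      have e1 : C T = CStarMatrix.ofMatrix.symm M := StarAlgEquiv.apply_symm_apply C _
      have e2 : C (T * ω j) = C T * C (ω j) := map_mul C _ _
      have e3 : C (ω j * T) = C (ω j) * C T := map_mul C _ _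
      exact (e2.trans (by rw [e1]; exact hM j)).trans e3.symm
    obtain ⟨c, hc⟩ := Module.End.exists_eigenvalue T
    let K := Module.End.eigenspace T c
    have hinv : ∀ j, ∀ x ∈ K, ω j x ∈ K := by
      intro j x hx
      rw [Module.End.mem_eigenspace_iff] at hx ⊢
      have := LinearMap.congr_fun (hT j) x
      simp only [Module.End.mul_apply] at this
      rw [this, hx, map_smul]
    haveI : Nontrivial K := (Submodule.nontrivial_iff_ne_bot).2 hc
    have hrep : IsRep L q (fun j => (ω j).restrict (hinv j)) := by
      refine ⟨fun j x => h1 j x, ?_, ?_⟩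
      · intro j
        have key : ∀ m : ℕ, ∀ x : K, ((((ω j).restrict (hinv j)) ^ m) x : EuclideanSpace ℂ (Fin d)) = (ω j ^ m) x := by
          intro m
          induction m with
          | zero => intro x; rfl
          | succ m ih => intro x; rw [pow_succ, pow_succ, Module.End.mul_apply, Module.End.mul_apply, ih]; rfl
        ext1 x
        apply Subtype.ext
        rw [key, h2]; rfl
      · intro j k
        ext1 x
        apply Subtype.ext
        exact LinearMap.congr_fun (h3 j k) x
    have hfr := hasRep_of hrep
    have hge : d ≤ Module.finrank ℂ K := by
      by_contra hlt
      exact hmin _ (not_le.1 hlt) hfr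
    have hKtop : K = ⊤ := by
      apply Submodule.eq_top_of_finrank_eq
      apply le_antisymm (Submodule.finrank_le K)
      simpa using hge
    refine ⟨c, ?_⟩
    have hTc : T = c • 1 := by
      ext1 x
      have : x ∈ K := by rw [hKtop]; trivial
      rw [Module.End.mem_eigenspace_iff] at this
      rw [this]; rfl
    have : CStarMatrix.ofMatrix.symm M = c • (1 : Matrix (Fin d) (Fin d) ℂ) := by
      have h := congrArg C hTc
      simp only [T, StarAlgEquiv.apply_symm_apply, map_smul, map_one] at h
      exact h
    exact this
end PIS

namespace PIS
universe u
set_option linter.all false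

section hom
variable {n q d : ℕ} 

/-- homogeneous unitaries -/
def Hom (q : ℕ) (ω : Fin n → CStarMatrix (Fin d) (Fin d) ℂ) (U : CStarMatrix (Fin d) (Fin d) ℂ) (χ : Fin n → ℂ) : Prop :=
  U ∈ unitary (CStarMatrix (Fin d) (Fin d) ℂ) ∧ (∀ j, χ j ^ q = 1) ∧ ∀ j, ω j * U = χ j • (U * ω j)

instance cmfd : FiniteDimensional ℂ (CStarMatrix (Fin d) (Fin d) ℂ) :=
  inferInstanceAs (FiniteDimensional ℂ (Matrix (Fin d) (Fin d) ℂ))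

lemma cm_comm_one {a b : CStarMatrix (Fin d) (Fin d) ℂ} (h : a * b = 1) : b * a = 1 := by
  have h' : (CStarMatrix.ofMatrix.symm a) * (CStarMatrix.ofMatrix.symm b) = (1 : Matrix (Fin d) (Fin d) ℂ) := h
  have h2 : (CStarMatrix.ofMatrix.symm b) * (CStarMatrix.ofMatrix.symm a) = (1 : Matrix (Fin d) (Fin d) ℂ) := mul_eq_one_comm.1 h'
  exact h2

/-- trace -/
noncomputable def trc : CStarMatrix (Fin d) (Fin d) ℂ →ₗ[ℂ] ℂ where
  toFun M := ∑ i, M i i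
  map_add' a b := by simp [Finset.sum_add_distrib]
  map_smul' c a := by simp [Finset.mul_sum]

lemma trc_apply (M : CStarMatrix (Fin d) (Fin d) ℂ) : trc M = ∑ i, M i i := rfl

lemma trc_comm (a b : CStarMatrix (Fin d) (Fin d) ℂ) : trc (a * b) = trc (b * a) := by
  simp only [trc_apply, CStarMatrix.mul_apply]
  rw [Finset.sum_comm]
  simp only [mul_comm]

lemma trc_one : trc (1 : CStarMatrix (Fin d) (Fin d) ℂ) = d := by
  simp [trc_apply, CStarMatrix.one_apply]

variable {ω : Fin n → CStarMatrix (Fin d) (Fin d) ℂ}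

/-- conjugation by a unitary -/
noncomputable def adj (w : CStarMatrix (Fin d) (Fin d) ℂ) : Module.End ℂ (CStarMatrix (Fin d) (Fin d) ℂ) where
  toFun M := w * M * star w
  map_add' a b := by rw [mul_add, add_mul]
  map_smul' c a := by simp [mul_smul_comm, smul_mul_assoc]

lemma adj_apply (w M : CStarMatrix (Fin d) (Fin d) ℂ) : adj w M = w * M * star w := rfl

lemma Hom.trz {U : CStarMatrix (Fin d) (Fin d) ℂ} {χ : Fin n → ℂ} (hω : ∀ j, ω j ∈ unitary (CStarMatrix (Fin d) (Fin d) ℂ))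
    (h : Hom q ω U χ) {j : Fin n} (hj : χ j ≠ 1) : trc U = 0 := by
  have h1 : trc U = χ j * trc U := by
    calc trc U = trc (star (ω j) * ω j * U) := by rw [(hω j).1, one_mul]
      _ = χ j * trc (star (ω j) * (U * ω j)) := by rw [mul_assoc, h.2.2, mul_smul_comm, map_smul, smul_eq_mul]
      _ = χ j * trc U := by rw [trc_comm, mul_assoc, (hω j).2, mul_one]
  have : (1 - χ j) * trc U = 0 := by linear_combination h1
  rcases mul_eq_zero.1 this with h | h
  · exact absurd (by linear_combination -h) hj
  · exact h

lemma Hom.star {U : CStarMatrix (Fin d) (Fin d) ℂ} {χ : Fin n → ℂ} (hq : 0 < q) (hω : ∀ j, ω j ∈ unitary (CStarMatrix (Fin d) (Fin d) ℂ))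
    (h : Hom q ω U χ) : Hom q ω (star U) (fun j => star (χ j)) := by
  refine ⟨Unitary.star_mem h.1, fun j => by rw [← star_pow, h.2.1, star_one], fun j => ?_⟩
  have h0 := congrArg Star.star (h.2.2 j)
  rw [star_mul, star_smul, star_mul] at h0
  calc ω j * Star.star U = ω j * (Star.star U * Star.star (ω j)) * ω j := by
        rw [mul_assoc, mul_assoc, (hω j).1, mul_one]
    _ = _ := by rw [h0, mul_smul_comm, ← mul_assoc, (hω j).2, one_mul, smul_mul_assoc]

theorem hom_span [NeZero d] {L : Fin n → Fin n → ℂ} (hq0 : 0 < q) (hω : ∀ j, ω j ∈ unitary (CStarMatrix (Fin d) (Fin d) ℂ)) (hωq : ∀ j, ω j ^ q = 1)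
    (hL : ∀ j k, ω k * ω j = L k j • (ω j * ω k)) (hLn : ∀ j k, ‖L j k‖ = 1)
    (hsch : ∀ M : CStarMatrix (Fin d) (Fin d) ℂ, (∀ j, M * ω j = ω j * M) → ∃ c : ℂ, M = c • 1)
    (m : CStarMatrix (Fin d) (Fin d) ℂ) :
    ∃ c : ℂ, m - c • 1 ∈ Submodule.span ℂ {U | ∃ χ, Hom q ω U χ ∧ ∃ j, χ j ≠ 1} := by
  have hpow : ∀ j, ∀ k : ℕ, ∀ M, (adj (ω j) ^ k) M = ω j ^ k * M * star (ω j ^ k) := by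
    intro j k
    induction k with
    | zero => intro M; simp
    | succ k ih =>
      intro M
      rw [pow_succ, Module.End.mul_apply, ih, adj_apply, pow_succ, star_mul]
      simp only [mul_assoc]
  have hTq : ∀ j, adj (ω j) ^ q = 1 := by
    intro j
    ext1 M
    rw [hpow, hωq]; simp
  have hss : ∀ j, (adj (ω j)).IsSemisimple := by
    intro j
    have hsep : (Polynomial.X ^ q - Polynomial.C (1 : ℂ)).Separable :=
      Polynomial.separable_X_pow_sub_C 1 (by exact_mod_cast hq0.ne') one_ne_zero
    apply Module.End.isSemisimple_of_squarefree_aeval_eq_zero hsep.squarefree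
    simp [hTq]
  have hcomm : Pairwise fun i j => Commute (adj (ω i)) (adj (ω j)) := by
    intro j k _
    show adj (ω j) * adj (ω k) = adj (ω k) * adj (ω j)
    ext1 M
    rw [Module.End.mul_apply, Module.End.mul_apply, adj_apply, adj_apply, adj_apply, adj_apply]
    have e1 : ω k * (ω j * M * star (ω j)) * star (ω k) = (ω k * ω j) * M * star (ω k * ω j) := by
      rw [star_mul]; simp only [mul_assoc]
    have e2 : ω j * (ω k * M * star (ω k)) * star (ω j) = (ω j * ω k) * M * star (ω j * ω k) := by
      rw [star_mul]; simp only [mul_assoc]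
    rw [e1, e2, hL, star_smul, smul_mul_assoc, smul_mul_assoc, mul_smul_comm, smul_smul]
    have : L j k * star (L j k) = 1 := by
      rw [Complex.star_def, Complex.mul_conj, Complex.normSq_eq_norm_sq, hLn]; simp
    rw [this, one_smul]
  have htop := Module.End.iSup_iInf_maxGenEigenspace_eq_top_of_iSup_maxGenEigenspace_eq_top_of_commute (fun j => adj (ω j)) hcomm
    (fun j => Module.End.iSup_maxGenEigenspace_eq_top _)
  have hm : m ∈ ⨆ χ : Fin n → ℂ, ⨅ i, (adj (ω i)).maxGenEigenspace (χ i) := by rw [htop]; trivial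
  induction hm using Submodule.iSup_induction' with
  | zero => exact ⟨0, by simp⟩
  | add x y hx hy h1 h2 =>
    obtain ⟨c1, h1⟩ := h1
    obtain ⟨c2, h2⟩ := h2
    refine ⟨c1 + c2, ?_⟩
    have : x + y - (c1 + c2) • (1 : CStarMatrix (Fin d) (Fin d) ℂ) = (x - c1 • 1) + (y - c2 • 1) := by
      rw [add_smul]; abel
    rw [this]
    exact Submodule.add_mem _ h1 h2
  | mem χ X hX =>
    have hXj : ∀ j, ω j * X = χ j • (X * ω j) := by
      intro j
      have := (Submodule.mem_iInf _).1 hX j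
      rw [(hss j).isFinitelySemisimple.maxGenEigenspace_eq_eigenspace, Module.End.mem_eigenspace_iff, adj_apply] at this
      calc ω j * X = ω j * X * star (ω j) * ω j := by rw [mul_assoc _ (star _), (hω j).1, mul_one]
        _ = _ := by rw [this, smul_mul_assoc]
    by_cases hX0 : X = 0
    · exact ⟨0, by simp [hX0]⟩
    have hχ : ∀ j, χ j ^ q = 1 := by
      intro j
      have key : ∀ k : ℕ, ω j ^ k * X = χ j ^ k • (X * ω j ^ k) := by
        intro k
        induction k with
        | zero => simp
        | succ k ih =>
          rw [pow_succ, mul_assoc, hXj, mul_smul_comm, ← mul_assoc, ih, smul_mul_assoc, smul_smul, mul_assoc, ← pow_succ, ← pow_succ']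
      have := key q
      rw [hωq, one_mul, mul_one] at this
      by_contra hne
      have h0 : (χ j ^ q - 1) • X = 0 := by rw [sub_smul, one_smul, ← this, sub_self]
      rcases smul_eq_zero.1 h0 with h | h
      · exact hne (sub_eq_zero.1 h)
      · exact hX0 h
    have hχn : ∀ j, ‖χ j‖ = 1 := fun j => Complex.norm_eq_one_of_pow_eq_one (hχ j) hq0.ne'
    have hχs : ∀ j, star (χ j) * χ j = 1 := by
      intro j; rw [mul_comm, Complex.star_def, Complex.mul_conj, Complex.normSq_eq_norm_sq, hχn]; simp
    have hsX : ∀ j, ω j * star X = star (χ j) • (star X * ω j) := by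
      intro j
      have h0 := congrArg Star.star (hXj j)
      rw [star_mul, star_smul, star_mul] at h0
      calc ω j * Star.star X = ω j * (Star.star X * Star.star (ω j)) * ω j := by
            rw [mul_assoc, mul_assoc, (hω j).1, mul_one]
        _ = _ := by rw [h0, mul_smul_comm, ← mul_assoc, (hω j).2, one_mul, smul_mul_assoc]
    obtain ⟨c, hc⟩ := hsch (star X * X) (by
      intro j
      rw [← mul_assoc, hsX, smul_mul_assoc, mul_assoc _ (ω j), hXj, mul_smul_comm, smul_smul, hχs, one_smul, mul_assoc])
    have hc00 : c = ((∑ a, ‖X a 0‖ ^ 2 : ℝ) : ℂ) := by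
      have h1 : (star X * X) 0 0 = c := by rw [hc]; simp [CStarMatrix.one_apply]
      rw [← h1, CStarMatrix.mul_apply]
      push_cast
      apply Finset.sum_congr rfl
      intro a _
      rw [CStarMatrix.star_apply, Complex.star_def, mul_comm, Complex.mul_conj, Complex.normSq_eq_norm_sq]; push_cast; rfl
    obtain ⟨r, hr⟩ : ∃ r : ℝ, r = ∑ a, ‖X a 0‖ ^ 2 := ⟨_, rfl⟩
    rw [← hr] at hc00
    have hr0 : 0 ≤ r := by rw [hr]; positivity
    have hrne : r ≠ 0 := by
      intro h0
      rw [hc00, h0] at hc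
      simp at hc
      exact hX0 hc
    have hrp : 0 < r := lt_of_le_of_ne hr0 (Ne.symm hrne)
    have hsr : (((Real.sqrt r : ℝ) : ℂ)) ≠ 0 := by
      exact_mod_cast (Real.sqrt_pos.2 hrp).ne'
    have hsr2 : (((Real.sqrt r : ℝ) : ℂ)) * (Real.sqrt r : ℝ) = r := by
      exact_mod_cast Real.mul_self_sqrt hr0
    by_cases hall : ∀ j, χ j = 1
    · obtain ⟨c, hc⟩ := hsch X (by intro j; rw [hXj, hall, one_smul])
      exact ⟨c, by rw [hc, sub_self]; exact Submodule.zero_mem _⟩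
    · push Not at hall
      refine ⟨0, ?_⟩
      rw [zero_smul, sub_zero]
      have hXe : X = (Real.sqrt r : ℂ) • ((Real.sqrt r : ℂ)⁻¹ • X) := by
        rw [smul_smul, mul_inv_cancel₀ hsr, one_smul]
      rw [hXe]
      apply Submodule.smul_mem
      apply Submodule.subset_span
      refine ⟨χ, ⟨?_, hχ, ?_⟩, hall⟩
      · have h1 : star ((Real.sqrt r : ℂ)⁻¹ • X) * ((Real.sqrt r : ℂ)⁻¹ • X) = 1 := by
          rw [star_smul, smul_mul_assoc, mul_smul_comm, smul_smul, hc, smul_smul, hc00, ← hsr2]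
          have : star ((Real.sqrt r : ℂ)⁻¹) = (Real.sqrt r : ℂ)⁻¹ := by
            rw [Complex.star_def, map_inv₀, Complex.conj_ofReal]
          rw [this]
          have : (Real.sqrt r : ℂ)⁻¹ * (Real.sqrt r : ℂ)⁻¹ * (Real.sqrt r * Real.sqrt r) = 1 := by
            field_simp
          rw [this, one_smul]
        exact ⟨h1, cm_comm_one h1⟩
      · intro j
        rw [mul_smul_comm, hXj, smul_mul_assoc, smul_comm]

end hom

section cj
variable {κ : Type} [Fintype κ] [DecidableEq κ]
/-- entrywise conjugate -/
noncomputable def cj (M : CStarMatrix κ κ ℂ) : CStarMatrix κ κ ℂ := CStarMatrix.ofMatrix (fun a b => star (M a b))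

lemma cj_apply (M : CStarMatrix κ κ ℂ) (a b : κ) : cj M a b = star (M a b) := rfl
lemma cj_mul (M N : CStarMatrix κ κ ℂ) : cj (M * N) = cj M * cj N := by
  ext a b
  simp only [cj_apply, CStarMatrix.mul_apply, star_sum, star_mul']
lemma cj_smul (c : ℂ) (M : CStarMatrix κ κ ℂ) : cj (c • M) = star c • cj M := by
  ext a b
  simp only [cj_apply, CStarMatrix.smul_apply, smul_eq_mul, star_mul']
lemma cj_one : cj (1 : CStarMatrix κ κ ℂ) = 1 := by
  ext a b
  by_cases h : a = b <;> simp [cj_apply, CStarMatrix.one_apply, h]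
lemma cj_star (M : CStarMatrix κ κ ℂ) : cj (star M) = star (cj M) := by
  ext a b
  simp only [cj_apply, CStarMatrix.star_apply]
lemma cj_unitary {M : CStarMatrix κ κ ℂ} (h : M ∈ unitary (CStarMatrix κ κ ℂ)) : cj M ∈ unitary (CStarMatrix κ κ ℂ) :=
  ⟨by rw [← cj_star, ← cj_mul, h.1, cj_one], by rw [← cj_star, ← cj_mul, h.2, cj_one]⟩
lemma cj_pow (M : CStarMatrix κ κ ℂ) (k : ℕ) : cj (M ^ k) = cj M ^ k := by
  induction k with
  | zero => simp [cj_one]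
  | succ k ih => rw [pow_succ, cj_mul, ih, pow_succ]
end cj
end PIS

namespace PIS
universe u
set_option linter.all false

section colrow
variable {κ : Type} [Fintype κ] [DecidableEq κ] {D : Type u} [CStarAlgebra D]

/-- column matrix -/
noncomputable def colm (o : κ) (V : κ → D) : CStarMatrix κ κ D :=
  CStarMatrix.ofMatrix (fun a b => if b = o then V a else 0)
/-- row matrix -/
noncomputable def rowm (o : κ) (V : κ → D) : CStarMatrix κ κ D :=
  CStarMatrix.ofMatrix (fun a b => if a = o then V b else 0)

lemma colm_apply (o : κ) (V : κ → D) (a b : κ) : colm o V a b = if b = o then V a else 0 := rfl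
lemma rowm_apply (o : κ) (V : κ → D) (a b : κ) : rowm o V a b = if a = o then V b else 0 := rfl

lemma star_colm (o : κ) (V : κ → D) : star (colm o V) = rowm o (fun i => star (V i)) := by
  ext a b
  rw [CStarMatrix.star_apply, colm_apply, rowm_apply]
  split_ifs <;> simp

lemma star_rowm (o : κ) (V : κ → D) : star (rowm o V) = colm o (fun i => star (V i)) := by
  rw [← star_star (colm o _), star_colm]; simp

lemma rowm_mul_colm (o : κ) (V W : κ → D) : rowm o V * colm o W = mu (eu o o) * iot κ (∑ i, V i * W i) := by
  ext a b
  rw [mu_iot_apply, CStarMatrix.mul_apply]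
  simp only [colm_apply, rowm_apply, eu_apply]
  by_cases ha : a = o <;> by_cases hb : b = o <;> simp [ha, hb]

lemma colm_mul_crn (o : κ) (V : κ → D) (x : D) : colm o V * (mu (eu o o) * iot κ x) = colm o (fun i => V i * x) := by
  ext a b
  rw [CStarMatrix.mul_apply, colm_apply, Finset.sum_eq_single o]
  · rw [mu_iot_apply, colm_apply, eu_apply]
    by_cases hb : b = o <;> simp [hb]
  · intro c _ hc; simp [colm_apply, hc]
  · simp

lemma dgh_mul_colm (o : κ) (V : κ → D) (g : κ → D) : dgh g * colm o V = colm o (fun i => g i * V i) := by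
  ext a b
  rw [CStarMatrix.mul_apply, colm_apply, Finset.sum_eq_single a]
  · rw [colm_apply, dgh_apply]; by_cases hb : b = o <;> simp [hb]
  · intro c _ hc; rw [dgh_apply, if_neg (Ne.symm hc), zero_mul]
  · simp

lemma colm_sub (o : κ) (V W : κ → D) : colm o V - colm o W = colm o (fun i => V i - W i) := by
  ext a b
  rw [CStarMatrix.sub_apply]
  simp only [colm_apply]
  split_ifs <;> simp

lemma norm_colm_le (o : κ) {V : κ → D} {c : ℝ} (hc : 0 ≤ c) (h : ‖∑ i, star (V i) * V i‖ ≤ c ^ 2) : ‖colm o V‖ ≤ c := by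
  apply norm_le_of_sq hc
  rw [star_colm, rowm_mul_colm]
  exact nmulL ((norm_mu_le _).trans (norm_eu_le _ _)) ((norm_iot_le _).trans h)

lemma crn_mul_rowm (o : κ) (V : κ → D) (x : D) : (mu (eu o o) * iot κ x) * rowm o V = rowm o (fun i => x * V i) := by
  ext a b
  rw [CStarMatrix.mul_apply, rowm_apply, Finset.sum_eq_single o]
  · rw [mu_iot_apply, rowm_apply, eu_apply]
    by_cases hb : a = o <;> simp [hb]
  · intro c _ hc; simp [rowm_apply, hc]
  · simp

lemma rowm_mul_dgh (o : κ) (V : κ → D) (g : κ → D) : rowm o V * dgh g = rowm o (fun i => V i * g i) := by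
  ext a b
  rw [CStarMatrix.mul_apply, rowm_apply, Finset.sum_eq_single b]
  · rw [rowm_apply, dgh_apply]; by_cases hb : a = o <;> simp [hb]
  · intro c _ hc; rw [dgh_apply, if_neg hc, mul_zero]
  · simp

lemma rowm_sub (o : κ) (V W : κ → D) : rowm o V - rowm o W = rowm o (fun i => V i - W i) := by
  ext a b
  rw [CStarMatrix.sub_apply]
  simp only [rowm_apply]
  split_ifs <;> simp

lemma rowm_gram (o : κ) (V : κ → D) (a b : κ) : (star (rowm o V) * rowm o V) a b = star (V a) * V b := by
  rw [star_rowm, CStarMatrix.mul_apply, Finset.sum_eq_single o]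
  · simp [colm_apply, rowm_apply]
  · intro c _ hc; simp [colm_apply, hc]
  · simp

lemma dgh_commute {t : D} {g : κ → D} (h : ∀ i, Commute t (g i)) : Commute (iot κ t) (dgh g) := by
  show dgh (fun _ => t) * dgh g = dgh g * dgh (fun _ => t)
  rw [← map_mul, ← map_mul]
  congr 1
  ext i
  exact h i

end colrow

theorem init_sys {n : ℕ} {lam : Fin n → Fin n → ℂ} {A B : Type u} [CStarAlgebra A] [CStarAlgebra B]
    {v : Fin n → A} (hv : ∀ j, v j ∈ unitary A)
    (θ : A →⋆ₙₐ[ℂ] B) (hiso : ∀ a, ‖θ a‖ = ‖a‖) (hcor : ∀ d, ∃ a, θ a = θ 1 * d * θ 1)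
    {ζ : Type} [Fintype ζ] [DecidableEq ζ] (o : ζ) (g : Fin n → ζ → B) (gu : ∀ j i, g j i ∈ unitary B)
    (grel : ∀ j k i, g k i * g j i = lam j k • (g j i * g k i)) {N : ℕ} (hN : 0 < N) (gN : ∀ j i, g j i ^ N = 1)
    (V : ζ → B) (hV : ∀ i, V i * θ 1 = V i) {τ1 τ2 η1 η3 η : ℝ} (ht1 : τ1 ≤ 1 / 2) (ht2 : τ2 ≤ 1 / 2)
    (hVV : ‖∑ i, star (V i) * V i - θ 1‖ ≤ τ1) (hη1 : 0 ≤ η1)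
    (hVE : ∀ j, ‖∑ i, star (V i * θ (v j) - g j i * V i) * (V i * θ (v j) - g j i * V i)‖ ≤ η1 ^ 2)
    {eh T1 T2 X : B} (cz : Cz eh T1 T2 X) (ct : ∀ t, (t = T1 ∨ t = T2 ∨ t = X ∨ t = eh) → ∀ j i, Commute t (g j i))
    (S : ζ → B) (hS : ∀ i, θ 1 * S i = S i) (hSe : ∀ i, S i * eh = S i)
    (hSS : ‖star (rowm o S) * rowm o S - iot ζ eh‖ ≤ τ2)
    (hS3 : ∀ j, ‖rowm o (fun i => θ (v j) * S i - S i * g j i)‖ ≤ η3)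
    (h1 : η1 + 8 * τ1 ≤ η) (h3 : η3 + 8 * τ2 ≤ η) :
    Nonempty (Sys lam v η (fun _ => 2 * η)) := by
  have pθ : IsStarProjection (θ 1) := ⟨by show θ 1 * θ 1 = θ 1; rw [← map_mul, one_mul], by show star (θ 1) = θ 1; rw [← map_star, star_one]⟩
  have pa : IsStarProjection (crn θ o (1 : A)) := ⟨by show crn θ o 1 * crn θ o 1 = crn θ o 1; rw [← map_mul, one_mul], by show star (crn θ o 1) = crn θ o 1; rw [← map_star, star_one]⟩
  have hY : colm o V * crn θ o 1 = colm o V := by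
    rw [crn_apply, colm_mul_crn]; simp only [hV]
  obtain ⟨c, hc1, hc2⟩ := polar pa hY ht1 (by
    rw [star_colm, rowm_mul_colm, crn_apply, ← mul_sub, ← map_sub]
    exact nmulL ((norm_mu_le _).trans (norm_eu_le _ _)) ((norm_iot_le _).trans hVV))
  have pe : IsStarProjection (iot ζ eh) := (cz.map (iot ζ)).pe
  have hYS : rowm o S * iot ζ eh = rowm o S := by
    show rowm o S * dgh (fun _ => eh) = _
    rw [rowm_mul_dgh]; simp only [hSe]
  obtain ⟨c', hd1, hd2⟩ := polar pe hYS ht2 hSS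
  obtain ⟨R1, hR1⟩ : ∃ R1, R1 = colm o V * c := ⟨_, rfl⟩
  obtain ⟨S1, hS1⟩ : ∃ S1, S1 = rowm o S * c' := ⟨_, rfl⟩
  rw [← hR1] at hc1 hc2
  rw [← hS1] at hd1 hd2
  obtain ⟨pr, hpr⟩ : ∃ pr : Fin n → CStarMatrix ζ ζ B, ∀ j, pr j = dgh (g j) := ⟨_, fun _ => rfl⟩
  have pru : ∀ j, pr j ∈ unitary (CStarMatrix ζ ζ B) := by
    intro j
    rw [hpr]
    apply Unitary.map_mem (dgh (κ := ζ) (D := B))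
    rw [Unitary.mem_iff]
    exact ⟨by ext i; exact (gu j i).1, by ext i; exact (gu j i).2⟩
  have hθv : ∀ j, ‖crn θ o (v j)‖ ≤ 1 := fun j => by rw [crn_iso θ o hiso]; exact norm_unitary_le (hv j)
  have hR1a : R1 * crn θ o 1 = R1 := mul_proj_of_star_mul pa hc1
  have e1 : ∀ j, ‖R1 * crn θ o (v j) - pr j * R1‖ ≤ η := by
    intro j
    have h0 : ‖colm o V * crn θ o (v j) - pr j * colm o V‖ ≤ η1 := by
      rw [crn_apply, colm_mul_crn, hpr, dgh_mul_colm, colm_sub]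
      exact norm_colm_le o hη1 (hVE j)
    have : R1 * crn θ o (v j) - pr j * R1 = (colm o V * crn θ o (v j) - pr j * colm o V) + ((R1 - colm o V) * crn θ o (v j) - pr j * (R1 - colm o V)) := by
      noncomm_ring
    rw [this]
    refine (nadd h0 (nsub (nmulR hc2 (hθv j)) (nmulL (norm_unitary_le (pru j)) hc2))).trans ?_
    linarith
  have e3 : ∀ j, ‖crn θ o (v j) * S1 - S1 * pr j‖ ≤ η := by
    intro j
    have h0 : ‖crn θ o (v j) * rowm o S - rowm o S * pr j‖ ≤ η3 := by
      rw [crn_apply, crn_mul_rowm, hpr, rowm_mul_dgh, rowm_sub]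
      exact hS3 j
    have : crn θ o (v j) * S1 - S1 * pr j = (crn θ o (v j) * rowm o S - rowm o S * pr j) + (crn θ o (v j) * (S1 - rowm o S) - (S1 - rowm o S) * pr j) := by
      noncomm_ring
    rw [this]
    refine (nadd h0 (nsub (nmulL (hθv j) hd2) (nmulR hd2 (norm_unitary_le (pru j))))).trans ?_
    linarith
  have hR1n : ‖R1‖ ≤ 1 := norm_le_one_of_proj pa hc1
  have cP : ∀ j, ‖R1 * star R1 * pr j - pr j * (R1 * star R1)‖ ≤ 2 * η := by
    intro j
    obtain ⟨x, hx⟩ : ∃ x, x = R1 * crn θ o (v j) - pr j * R1 := ⟨_, rfl⟩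
    have hxn : ‖x‖ ≤ η := by rw [hx]; exact e1 j
    have hs : star R1 * pr j = crn θ o (v j) * star R1 + crn θ o (v j) * star x * pr j := by
      rw [hx, star_sub, star_mul, star_mul, ← map_star, mul_sub, sub_mul, ← mul_assoc (crn θ o (v j)), ← map_mul, (hv j).2]
      have : star (R1 * crn θ o 1) = crn θ o 1 * star R1 := by rw [star_mul, ← map_star, star_one]
      rw [← this, hR1a, mul_assoc (crn θ o (v j)) _ (pr j), mul_assoc _ (star (pr j)), (pru j).1, mul_one]
      abel
    have : R1 * star R1 * pr j - pr j * (R1 * star R1) = x * star R1 + R1 * (crn θ o (v j) * star x * pr j) := by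
      rw [mul_assoc, hs, mul_add, hx]
      noncomm_ring
    rw [this]
    have hxs : ‖star x‖ ≤ η := by rw [norm_star]; exact hxn
    refine (nadd (nmulR hxn (by rw [norm_star]; exact hR1n)) (nmulL hR1n (nmulR (nmulL (hθv j) hxs) (norm_unitary_le (pru j))))).trans ?_
    linarith
  have ct' : ∀ t : B, (t = T1 ∨ t = T2 ∨ t = X ∨ t = eh) → ∀ j, Commute (iot ζ t) (pr j) := by
    intro t ht j
    rw [hpr]
    exact dgh_commute (ct t ht j)
  exact ⟨{
    D := CStarMatrix ζ ζ B
    inst := inferInstance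
    θ := crn θ o
    iso := crn_iso θ o hiso
    corner := crn_corner θ o hcor
    pr := pr
    pru := pru
    prrel := by
      intro j k
      rw [hpr, hpr, ← map_mul, ← map_mul, ← map_smul]
      congr 1
      ext i
      exact grel j k i
    prord := fun j => ⟨N, hN, by
      rw [hpr, ← map_pow]
      have : g j ^ N = 1 := by ext i; exact gN j i
      rw [this, map_one]⟩
    Nn := 1
    pN := IsStarProjection.one (R := CStarMatrix ζ ζ B)
    cN := fun j => Commute.one_left _
    P := R1 * star R1
    pP := by
      refine ⟨?_, ?_⟩
      · show R1 * star R1 * (R1 * star R1) = R1 * star R1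
        rw [mul_assoc, ← mul_assoc (star R1), hc1, ← mul_assoc, hR1a]
      · show star (R1 * star R1) = R1 * star R1
        rw [star_mul, star_star]
    NP := one_mul _
    cP := cP
    qq := 0
    pq := IsStarProjection.zero (R := CStarMatrix ζ ζ B)
    cq := fun j => Commute.zero_left _
    Nq := by simp
    R1 := R1
    R2 := 0
    r11 := hc1
    r22 := by simp
    r12 := by simp
    rs := by simp
    e1 := e1
    e2 := fun j => by simpa using (norm_nonneg _).trans (e1 j)
    eh := iot ζ eh
    T1 := iot ζ T1
    T2 := iot ζ T2
    X := iot ζ X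
    cz := cz.map (iot ζ)
    ct := by
      rintro t (rfl | rfl | rfl | rfl)
      · exact ⟨ct' T1 (by simp), Commute.one_right _, Commute.zero_right _⟩
      · exact ⟨ct' T2 (by simp), Commute.one_right _, Commute.zero_right _⟩
      · exact ⟨ct' X (by simp), Commute.one_right _, Commute.zero_right _⟩
      · exact ⟨ct' eh (by simp), Commute.one_right _, Commute.zero_right _⟩
    S := S1
    pS := by
      rw [hS1, ← mul_assoc, crn_apply, crn_mul_rowm]; simp only [hS]
    sS := by rw [hd1, one_mul]
    e3 := e3 }⟩
end PIS

namespace PIS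
universe u
set_option linter.all false

section pavg
variable {κ : Type} [Fintype κ] [DecidableEq κ] {D : Type u} [CStarAlgebra D]

/-- normalised partial trace -/
noncomputable def pavg (M : CStarMatrix κ κ D) : D := ((Fintype.card κ : ℂ))⁻¹ • ∑ b, M b b

lemma pavg_one [Nonempty κ] : pavg (1 : CStarMatrix κ κ D) = 1 := by
  unfold pavg
  simp only [CStarMatrix.one_apply, if_true, Finset.sum_const, Finset.card_univ]
  rw [← Nat.cast_smul_eq_nsmul ℂ, smul_smul, inv_mul_cancel₀ (by exact_mod_cast Fintype.card_ne_zero), one_smul]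

lemma pavg_sub (M N : CStarMatrix κ κ D) : pavg (M - N) = pavg M - pavg N := by
  unfold pavg
  simp only [CStarMatrix.sub_apply, Finset.sum_sub_distrib, smul_sub]

lemma pavg_sum {ι : Type*} (s : Finset ι) (M : ι → CStarMatrix κ κ D) : pavg (∑ i ∈ s, M i) = ∑ i ∈ s, pavg (M i) := by
  unfold pavg
  simp only [cm_sum_apply]
  rw [Finset.sum_comm, Finset.smul_sum]

lemma norm_pavg_le [Nonempty κ] (M : CStarMatrix κ κ D) : ‖pavg M‖ ≤ ‖M‖ := by
  unfold pavg
  have h0 : (0 : ℝ) < Fintype.card κ := by exact_mod_cast Fintype.card_pos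
  have h1 : ‖∑ b, M b b‖ ≤ Fintype.card κ * ‖M‖ := by
    refine (norm_sum_le _ _).trans ?_
    refine (Finset.sum_le_sum (g := fun _ => ‖M‖) fun b _ => cm_entry M b b).trans ?_
    simp
  rw [norm_smul, norm_inv, Complex.norm_natCast, inv_mul_le_iff₀ h0]
  exact h1

/-- column vector from a row of a matrix -/
noncomputable def Vm (o : κ) (Y : CStarMatrix κ κ D) (a : κ) : CStarMatrix κ κ D :=
  colm o (fun b => ((Real.sqrt (Fintype.card κ) : ℝ) : ℂ)⁻¹ • Y a b)

lemma Vm_gram [Nonempty κ] (o : κ) (Y : CStarMatrix κ κ D) :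
    ∑ a, star (Vm o Y a) * Vm o Y a = mu (eu o o) * iot κ (pavg (star Y * Y)) := by
  have h0 : (((Real.sqrt (Fintype.card κ) : ℝ) : ℂ)⁻¹) * ((Real.sqrt (Fintype.card κ) : ℝ) : ℂ)⁻¹ = (Fintype.card κ : ℂ)⁻¹ := by
    rw [← mul_inv]
    congr 1
    exact_mod_cast Real.mul_self_sqrt (Nat.cast_nonneg _)
  simp only [Vm, star_colm, rowm_mul_colm]
  rw [← Finset.mul_sum, ← map_sum]
  congr 2
  unfold pavg
  rw [Finset.sum_comm, Finset.smul_sum]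
  apply Finset.sum_congr rfl
  intro b _
  rw [CStarMatrix.mul_apply, Finset.smul_sum]
  apply Finset.sum_congr rfl
  intro a _
  rw [star_smul, smul_mul_assoc, mul_smul_comm, smul_smul, CStarMatrix.star_apply, ← h0]
  congr 2
  rw [Complex.star_def, map_inv₀, Complex.conj_ofReal]

lemma Vm_sub (o : κ) (Y Y' : CStarMatrix κ κ D) (a : κ) : Vm o Y a - Vm o Y' a = Vm o (Y - Y') a := by
  unfold Vm
  rw [colm_sub]
  congr 1
  ext b
  rw [CStarMatrix.sub_apply, smul_sub]

lemma Vm_crn (o : κ) (Y : CStarMatrix κ κ D) (x : D) (a : κ) : Vm o Y a * (mu (eu o o) * iot κ x) = Vm o (Y * iot κ x) a := by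
  unfold Vm
  rw [colm_mul_crn]
  congr 1
  ext b
  rw [CStarMatrix.mul_apply, Finset.sum_eq_single b, iot_apply, if_pos rfl, smul_mul_assoc]
  · intro c _ hc; rw [iot_apply, if_neg hc, mul_zero]
  · simp

lemma mu_Vm (o : κ) (Y : CStarMatrix κ κ D) (w : CStarMatrix κ κ ℂ) (a : κ) : mu (cj w) * Vm o Y a = Vm o (Y * mu (star w)) a := by
  ext b c
  unfold Vm
  rw [CStarMatrix.mul_apply, colm_apply, CStarMatrix.mul_apply]
  by_cases hc : c = o
  · subst hc
    simp only [colm_apply, if_true, Finset.smul_sum, mu_apply, cj_apply, CStarMatrix.star_apply]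
    apply Finset.sum_congr rfl
    intro i _
    rw [← Algebra.commutes (star (w b i)) (Y a i), mul_smul_comm]
  · simp [colm_apply, hc]

lemma Vm_smul (o : κ) (Y : CStarMatrix κ κ D) (c : ℂ) (a : κ) : c • Vm o Y a = Vm o (c • Y) a := by
  ext b e
  unfold Vm
  rw [CStarMatrix.smul_apply, colm_apply, colm_apply]
  split_ifs
  · rw [CStarMatrix.smul_apply, smul_comm]
  · simp
end pavg

theorem init_sys2 {n d : ℕ} [NeZero d] {lam : Fin n → Fin n → ℂ} {A : Type u} [CStarAlgebra A]
    {v : Fin n → A} (hv : ∀ j, v j ∈ unitary A) (o : Fin d) {q : ℕ} (hq : 0 < q)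
    {ω : Fin n → CStarMatrix (Fin d) (Fin d) ℂ} (hω : ∀ j, ω j ∈ unitary (CStarMatrix (Fin d) (Fin d) ℂ))
    (hωq : ∀ j, ω j ^ q = 1) (hrel : ∀ j k, cj (ω k) * cj (ω j) = lam j k • (cj (ω j) * cj (ω k)))
    {Zt : Type} [Fintype Zt] [DecidableEq Zt] (z0 : Zt) (zz : Zt → Fin n → ℂ) {N : ℕ} (hN : 0 < N) (hzN : ∀ z j, zz z j ^ N = 1)
    (F : Zt → CStarMatrix (Fin d) (Fin d) A) {τ1 τ2 τ' ε' η1 η : ℝ} (ht1 : τ1 ≤ 1 / 2)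
    (hF : ‖∑ z, star (F z) * F z - 1‖ ≤ τ1) (hη1 : 0 ≤ η1)
    (hFE : ∀ j, ‖∑ z, star (F z * (iot (Fin d) (v j) * mu (ω j) - zz z j • 1)) * (F z * (iot (Fin d) (v j) * mu (ω j) - zz z j • 1))‖ ≤ η1 ^ 2)
    {e T1 T2 X : A} (cz : Cz e T1 T2 X)
    {Y : Type} [Fintype Y] [DecidableEq Y] (yy : Y → Fin n → ℂ) (ys : Zt → Y) (r : Y → CStarMatrix (Fin d) (Fin d) A)
    (hr : ∀ y, mu (eu o o) * r y = r y) (hrr : ∀ y y', ‖star (r y) * r y' - (if y = y' then 1 else 0)‖ ≤ τ2)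
    (hrv : ∀ y j, ‖mu (eu o o) * iot (Fin d) (v j) * r y - yy y j • (r y * mu (cj (ω j)))‖ ≤ τ')
    (M : Zt → CStarMatrix (Fin d) (Fin d) ℂ) (hM : ∀ z, M z ∈ unitary (CStarMatrix (Fin d) (Fin d) ℂ)) (χ : Zt → Fin n → ℂ)
    (hMχ : ∀ z j, cj (ω j) * M z = χ z j • (M z * cj (ω j))) (hε' : 0 ≤ ε') (hχ : ∀ z j, ‖yy (ys z) j * χ z j - zz z j‖ ≤ ε')
    (ht2 : (Fintype.card Zt * d : ℝ) ^ 2 * τ2 ≤ 1 / 2)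
    (h1 : η1 + 8 * τ1 ≤ η) (h3 : Fintype.card Y * τ' + 2 * ε' + 8 * ((Fintype.card Zt * d : ℝ) ^ 2 * τ2) ≤ η) :
    Nonempty (Sys lam v η (fun _ => 2 * η)) := by
  classical
  have hρu : ∀ j, cj (ω j) ∈ unitary (CStarMatrix (Fin d) (Fin d) ℂ) := fun j => cj_unitary (hω j)
  have hzn : ∀ z j, ‖zz z j‖ = 1 := fun z j => Complex.norm_eq_one_of_pow_eq_one (hzN z j) hN.ne'
  have hzs : ∀ z j, star (zz z j) * zz z j = 1 := by
    intro z j; rw [mul_comm, Complex.star_def, Complex.mul_conj, Complex.normSq_eq_norm_sq, hzn]; simp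
  have hmuU : ∀ W ∈ unitary (CStarMatrix (Fin d) (Fin d) ℂ), (mu W : CStarMatrix (Fin d) (Fin d) A) ∈ unitary (CStarMatrix (Fin d) (Fin d) A) := by
    intro W hW
    exact ⟨by rw [← map_star, ← map_mul, hW.1, map_one], by rw [← map_star, ← map_mul, hW.2, map_one]⟩
  obtain ⟨t, ht⟩ : ∃ t : Zt × Fin d → A, ∀ i, t i = T1 ^ (Fintype.equivFin (Zt × Fin d) i : ℕ) * T2 := ⟨_, fun _ => rfl⟩
  have htt : ∀ i i', star (t i) * t i' = if i = i' then e else 0 := by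
    intro i i'
    rw [ht, ht, cz.tt]
    congr 1
    simp [Fin.val_inj]
  have hte : ∀ i, t i * e = t i := by
    intro i; rw [ht, mul_assoc, cz.T2e]
  -- the elements `M t`
  obtain ⟨m, hm⟩ : ∃ m : Zt × Fin d → CStarMatrix (Fin d) (Fin d) A, ∀ i, m i = mu (M i.1) * iot (Fin d) (t i) := ⟨_, fun _ => rfl⟩
  have hstarm : ∀ i, star (m i) = iot (Fin d) (star (t i)) * mu (star (M i.1)) := by
    intro i; rw [hm, star_mul, map_star, map_star]
  have hmm : ∀ i i', star (m i) * m i' = if i = i' then iot (Fin d) e else 0 := by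
    intro i i'
    have e1 : star (m i) * m i' = mu (star (M i.1) * M i'.1) * iot (Fin d) (star (t i) * t i') := by
      rw [hstarm, hm, map_mul, map_mul, ← mu_iot]
      have := mu_iot (M i'.1) (star (t i))
      calc mu (star (M i.1)) * iot (Fin d) (star (t i)) * (mu (M i'.1) * iot (Fin d) (t i'))
          = mu (star (M i.1)) * (iot (Fin d) (star (t i)) * mu (M i'.1)) * iot (Fin d) (t i') := by simp only [mul_assoc]
        _ = _ := by rw [← this]; simp only [mul_assoc]
    rw [e1, htt]
    split_ifs with h
    · subst h; rw [(hM i.1).1, map_one, one_mul]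
    · rw [map_zero, mul_zero]
  have hpe : IsStarProjection (iot (Fin d) e) := (cz.map (iot (Fin d))).pe
  have hmn : ∀ i, ‖m i‖ ≤ 1 := fun i => norm_le_one_of_proj hpe (by rw [hmm, if_pos rfl])
  obtain ⟨S, hS⟩ : ∃ S : Zt × Fin d → CStarMatrix (Fin d) (Fin d) A, ∀ i, S i = r (ys i.1) * m i := ⟨_, fun _ => rfl⟩
  have hθ : ∀ a, crn (NonUnitalStarAlgHom.id ℂ A) o a = mu (eu o o) * iot (Fin d) a := fun a => rfl
  have hθ1 : crn (NonUnitalStarAlgHom.id ℂ A) o (1 : A) = mu (eu o o) := by rw [hθ, map_one, mul_one]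
  have hSS : ‖star (rowm (z0, o) S) * rowm (z0, o) S - iot (Zt × Fin d) (iot (Fin d) e)‖ ≤ (Fintype.card Zt * d : ℝ) ^ 2 * τ2 := by
    refine (norm_cm_le_sum _).trans ?_
    have hent : ∀ i i', ‖(star (rowm (z0, o) S) * rowm (z0, o) S - iot (Zt × Fin d) (iot (Fin d) e)) i i'‖ ≤ τ2 := by
      intro i i'
      rw [CStarMatrix.sub_apply, rowm_gram, iot_apply, hS, hS, star_mul]
      have : star (m i) * star (r (ys i.1)) * (r (ys i'.1) * m i') - (if i = i' then iot (Fin d) e else 0)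
          = star (m i) * (star (r (ys i.1)) * r (ys i'.1) - (if ys i.1 = ys i'.1 then 1 else 0)) * m i' := by
        rw [mul_sub, sub_mul]
        have : star (m i) * (if ys i.1 = ys i'.1 then 1 else 0) * m i' = if i = i' then iot (Fin d) e else 0 := by
          split_ifs with h1 h2 h2
          · rw [mul_one, hmm, if_pos h2]
          · rw [mul_one, hmm, if_neg h2]
          · exact absurd (by rw [h2]) h1
          · simp
        rw [this]
        simp only [mul_assoc]
      rw [this]
      exact nmulR (nmulL (by rw [norm_star]; exact hmn i) (hrr _ _)) (hmn i')
    refine (Finset.sum_le_sum fun i _ => Finset.sum_le_sum fun i' _ => hent i i').trans ?_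
    simp only [Finset.sum_const, Finset.card_univ, Fintype.card_prod, Fintype.card_fin, nsmul_eq_mul]
    push_cast
    apply le_of_eq; ring
  have hSn : ‖rowm (z0, o) S‖ ≤ 2 := by
    apply norm_le_of_sq (by norm_num)
    have : star (rowm (z0, o) S) * rowm (z0, o) S = (star (rowm (z0, o) S) * rowm (z0, o) S - iot (Zt × Fin d) (iot (Fin d) e)) + iot (Zt × Fin d) (iot (Fin d) e) := by abel
    rw [this]
    refine (nadd hSS ((norm_iot_le _).trans (hpe.norm_le))).trans ?_
    linarith
  have hS3 : ∀ j, ‖rowm (z0, o) (fun i => crn (NonUnitalStarAlgHom.id ℂ A) o (v j) * S i - S i * (zz i.1 j • mu (cj (ω j))))‖ ≤ Fintype.card Y * τ' + 2 * ε' := by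
    intro j
    obtain ⟨x, hx⟩ : ∃ x : Y → CStarMatrix (Fin d) (Fin d) A, ∀ y, x y = mu (eu o o) * iot (Fin d) (v j) * r y - yy y j • (r y * mu (cj (ω j))) := ⟨_, fun _ => rfl⟩
    have hmt : ∀ i, mu (cj (ω j)) * m i = χ i.1 j • (m i * mu (cj (ω j))) := by
      intro i
      rw [hm, ← mul_assoc, ← map_mul, hMχ, map_smul, map_mul, smul_mul_assoc, mul_assoc, mul_assoc, mu_iot]
    have hdec : rowm (z0, o) (fun i => crn (NonUnitalStarAlgHom.id ℂ A) o (v j) * S i - S i * (zz i.1 j • mu (cj (ω j))))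
        = ∑ y, (mu (eu (z0, o) (z0, o)) * iot (Zt × Fin d) (x y)) * rowm (z0, o) (fun i => if ys i.1 = y then m i else 0)
          + rowm (z0, o) S * dgh (fun i => (yy (ys i.1) j * χ i.1 j - zz i.1 j) • mu (cj (ω j))) := by
      have e0 : ∀ i, crn (NonUnitalStarAlgHom.id ℂ A) o (v j) * S i - S i * (zz i.1 j • mu (cj (ω j)))
          = x (ys i.1) * m i + S i * ((yy (ys i.1) j * χ i.1 j - zz i.1 j) • mu (cj (ω j))) := by
        intro i
        rw [hθ, hx, hS, sub_mul, smul_mul_assoc, mul_assoc (r _) (mu _) (m i), hmt, sub_smul, mul_sub, mul_smul_comm, mul_smul_comm, mul_smul_comm, smul_smul]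
        simp only [mul_assoc]
        abel
      ext a b
      rw [CStarMatrix.add_apply, cm_sum_apply, rowm_mul_dgh, rowm_apply, rowm_apply]
      simp only [crn_mul_rowm, rowm_apply]
      by_cases ha : a = (z0, o)
      · simp only [ha, if_true]
        rw [e0]
        simp
      · simp [ha]
    rw [hdec]
    refine (nadd (t := 2 * ε') (s := Fintype.card Y * τ') ?_ ?_)
    · refine (norm_sum_le _ _).trans ?_
      refine (Finset.sum_le_sum (g := fun _ => τ') fun y _ => ?_).trans (by simp)
      have hx' : ‖(mu (eu (z0, o) (z0, o)) * iot (Zt × Fin d) (x y) : CStarMatrix (Zt × Fin d) (Zt × Fin d) _)‖ ≤ τ' :=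
        nmulL ((norm_mu_le _).trans (norm_eu_le _ _)) ((norm_iot_le _).trans (by rw [hx]; exact hrv y j))
      refine nmulR hx' ?_
      apply norm_le_of_sq zero_le_one
      have : star (rowm (z0, o) (fun i : Zt × Fin d => if ys i.1 = y then m i else 0)) * rowm (z0, o) (fun i => if ys i.1 = y then m i else 0) = dgh (fun i => if ys i.1 = y then iot (Fin d) e else 0) := by
        ext a b
        rw [rowm_gram, dgh_apply]
        by_cases h1 : ys a.1 = y
        · by_cases h2 : ys b.1 = y
          · rw [if_pos h1, if_pos h2, hmm, if_pos h1]
          · rw [if_pos h1, if_neg h2, mul_zero, if_neg]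
            rintro rfl; exact h2 h1
        · simp [h1]
      rw [this]
      refine norm_dgh_le (by norm_num) (fun i => ?_)
      split_ifs
      · simpa using hpe.norm_le
      · simp
    · refine nmul hSn (norm_dgh_le hε' fun i => ?_)
      rw [norm_smul]
      have := norm_unitary_le (hmuU _ (hρu j))
      nlinarith [hχ i.1 j, norm_nonneg (yy (ys i.1) j * χ i.1 j - zz i.1 j), norm_nonneg (mu (cj (ω j)) : CStarMatrix (Fin d) (Fin d) A)]
  have hid1 : ∀ a : A, ‖(NonUnitalStarAlgHom.id ℂ A) a‖ = ‖a‖ := fun a => rfl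
  have hid2 : ∀ x : A, ∃ a, (NonUnitalStarAlgHom.id ℂ A) a = (NonUnitalStarAlgHom.id ℂ A) 1 * x * (NonUnitalStarAlgHom.id ℂ A) 1 :=
    fun x => ⟨x, by simp⟩
  refine init_sys hv (crn (NonUnitalStarAlgHom.id ℂ A) o) (crn_iso _ o hid1) (crn_corner _ o hid2) (z0, o)
    (fun j i => zz i.1 j • mu (cj (ω j))) ?_ ?_ (N := N * q) (by positivity) ?_
    (fun i => Vm o (F i.1) i.2) ?_ (τ1 := τ1) (τ2 := (Fintype.card Zt * d : ℝ) ^ 2 * τ2) (η1 := η1) (η3 := Fintype.card Y * τ' + 2 * ε') (η := η) ht1 ht2 ?_ hη1 ?_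
    (cz.map (iot (Fin d))) ?_ S ?_ ?_ hSS hS3 h1 h3
  · intro j i
    have hu := hmuU _ (hρu j)
    refine ⟨?_, ?_⟩
    · rw [star_smul, smul_mul_assoc, mul_smul_comm, smul_smul, hzs, one_smul]; exact hu.1
    · rw [star_smul, smul_mul_assoc, mul_smul_comm, smul_smul, mul_comm (zz _ _), hzs, one_smul]; exact hu.2
  · intro j k i
    simp only [smul_mul_assoc, mul_smul_comm]
    rw [← map_mul, hrel, map_smul, map_mul, smul_smul, smul_smul, smul_smul, smul_smul]
    congr 1
    ring
  · intro j i
    have : (mu (cj (ω j)) : CStarMatrix (Fin d) (Fin d) A) ^ q = 1 := by rw [← map_pow, ← cj_pow, hωq, cj_one, map_one]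
    rw [smul_pow, pow_mul, hzN, one_pow, one_smul, mul_comm N, pow_mul, this, one_pow]
  · intro i
    rw [hθ, Vm_crn, map_one, mul_one]
  · rw [Fintype.sum_prod_type]
    simp only [Vm_gram]
    rw [← Finset.mul_sum, ← map_sum, ← pavg_sum, hθ, ← mul_sub, ← map_sub]
    have : pavg (∑ z, star (F z) * F z) - 1 = pavg (∑ z, star (F z) * F z - 1) := by rw [pavg_sub, pavg_one]
    rw [this]
    exact nmulL ((norm_mu_le _).trans (norm_eu_le _ _)) ((norm_iot_le _).trans ((norm_pavg_le _).trans hF))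
  · intro j
    have e0 : ∀ i : Zt × Fin d, Vm o (F i.1) i.2 * crn (NonUnitalStarAlgHom.id ℂ A) o (v j) - (zz i.1 j • mu (cj (ω j))) * Vm o (F i.1) i.2
        = Vm o (F i.1 * (iot (Fin d) (v j) * mu (ω j) - zz i.1 j • 1) * mu (star (ω j))) i.2 := by
      intro i
      rw [hθ, Vm_crn, smul_mul_assoc, mu_Vm, Vm_smul, Vm_sub]
      congr 1
      rw [mul_assoc (F _) _ (mu _), sub_mul, mul_assoc (iot _ _), ← map_mul, (hω j).2, map_one, mul_one, mul_sub, smul_mul_assoc, one_mul, mul_smul_comm]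
    simp only [e0]
    rw [Fintype.sum_prod_type]
    simp only [Vm_gram]
    rw [← Finset.mul_sum, ← map_sum, ← pavg_sum]
    refine nmulL ((norm_mu_le _).trans (norm_eu_le _ _)) ((norm_iot_le _).trans ((norm_pavg_le _).trans ?_))
    have e1 : ∀ z, star (F z * (iot (Fin d) (v j) * mu (ω j) - zz z j • 1) * mu (star (ω j))) * (F z * (iot (Fin d) (v j) * mu (ω j) - zz z j • 1) * mu (star (ω j)))
        = mu (ω j) * (star (F z * (iot (Fin d) (v j) * mu (ω j) - zz z j • 1)) * (F z * (iot (Fin d) (v j) * mu (ω j) - zz z j • 1))) * mu (star (ω j)) := by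
      intro z
      rw [star_mul _ (mu (star (ω j))), ← map_star mu, star_star]
      simp only [mul_assoc]
    simp only [e1]
    rw [← Finset.sum_mul, ← Finset.mul_sum]
    refine nmulR (nmulL (norm_unitary_le (hmuU _ (hω j))) (hFE j)) (norm_unitary_le (hmuU _ (Unitary.star_mem (hω j))))
  · rintro t' ht' j i
    have : ∃ a : A, t' = iot (Fin d) a := by
      rcases ht' with h | h | h | h <;> exact ⟨_, h⟩
    obtain ⟨a, rfl⟩ := this
    exact ((mu_comm (cj (ω j)) a).symm).smul_right _
  · intro i
    rw [hθ1, hS, ← mul_assoc, hr]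
  · intro i
    rw [hS, mul_assoc, hm, mul_assoc, ← map_mul, hte]
end PIS

namespace PIS
universe u
set_option linter.all false

section lists
variable {D : Type u} [CStarAlgebra D]

lemma list_norm {l : List D} (hl : ∀ x ∈ l, ‖x‖ ≤ 1) : ‖l.prod‖ ≤ 1 := by
  induction l with
  | nil =>
    simp only [List.prod_nil]
    exact norm_unitary_le (one_mem _)
  | cons a l ih =>
    rw [List.prod_cons]
    exact nmulL (hl a (by simp)) (ih fun x hx => hl x (by simp [hx]))

lemma list_comm {l : List D} {y : D} {τ : ℝ} (hl : ∀ x ∈ l, ‖x‖ ≤ 1) (hy : ∀ x ∈ l, ‖y * x - x * y‖ ≤ τ) :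
    ‖y * l.prod - l.prod * y‖ ≤ l.length * τ := by
  induction l with
  | nil => simp
  | cons a l ih =>
    have h1 := ih (fun x hx => hl x (by simp [hx])) (fun x hx => hy x (by simp [hx]))
    have h2 : ‖l.prod‖ ≤ 1 := list_norm (fun x hx => hl x (by simp [hx]))
    rw [List.prod_cons]
    have : y * (a * l.prod) - a * l.prod * y = (y * a - a * y) * l.prod + a * (y * l.prod - l.prod * y) := by noncomm_ring
    rw [this]
    refine (nadd (nmulR (hy a (by simp)) h2) (nmulL (hl a (by simp)) h1)).trans ?_
    rw [List.length_cons]; push_cast; apply le_of_eq; ring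

lemma list_zero {l : List D} {y x0 : D} {τ : ℝ} (hτ : 0 ≤ τ) (hl : ∀ x ∈ l, ‖x‖ ≤ 1) (hy : ∀ x ∈ l, ‖y * x - x * y‖ ≤ τ)
    (hx0 : x0 ∈ l) (h0 : y * x0 = 0) : ‖y * l.prod‖ ≤ l.length * τ := by
  obtain ⟨l1, l2, rfl⟩ := List.append_of_mem hx0
  have h1 := list_comm (l := l1) (fun x hx => hl x (by simp [hx])) (fun x hx => hy x (by simp [hx]))
  have h2 : ‖l2.prod‖ ≤ 1 := list_norm (fun x hx => hl x (by simp [hx]))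
  have h3 : ‖x0‖ ≤ 1 := hl x0 (by simp)
  rw [List.prod_append, List.prod_cons]
  have : y * (l1.prod * (x0 * l2.prod)) = (y * l1.prod - l1.prod * y) * (x0 * l2.prod) + l1.prod * (y * x0) * l2.prod := by noncomm_ring
  rw [this, h0, mul_zero, zero_mul, add_zero]
  refine (nmulR h1 ((nmulL h3 h2))).trans ?_
  rw [List.length_append]; push_cast
  nlinarith [Nat.cast_nonneg (α := ℝ) (x0 :: l2).length]

lemma list_zero' {l : List D} {y x0 : D} {τ : ℝ} (hτ : 0 ≤ τ) (hl : ∀ x ∈ l, ‖x‖ ≤ 1) (hy : ∀ x ∈ l, ‖y * x - x * y‖ ≤ τ)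
    (hx0 : x0 ∈ l) (h0 : x0 * y = 0) : ‖l.prod * y‖ ≤ l.length * τ := by
  obtain ⟨l1, l2, rfl⟩ := List.append_of_mem hx0
  have h1 := list_comm (l := l2) (fun x hx => hl x (by simp [hx])) (fun x hx => hy x (by simp [hx]))
  have h2 : ‖l1.prod‖ ≤ 1 := list_norm (fun x hx => hl x (by simp [hx]))
  have h3 : ‖x0‖ ≤ 1 := hl x0 (by simp)
  rw [List.prod_append, List.prod_cons]
  have : (l1.prod * (x0 * l2.prod)) * y = l1.prod * (x0 * y) * l2.prod - l1.prod * (x0 * (y * l2.prod - l2.prod * y)) := by noncomm_ring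
  rw [this, h0, mul_zero, zero_mul, zero_sub, norm_neg]
  refine (nmulL h2 ((nmulL h3 h1))).trans ?_
  rw [List.length_append, List.length_cons]; push_cast
  nlinarith [Nat.cast_nonneg (α := ℝ) l1.length]

lemma list_zero2 {l l' : List D} {p x0 : D} {τ : ℝ} (hτ : 0 ≤ τ) (hl : ∀ x ∈ l, ‖x‖ ≤ 1) (hl' : ∀ x ∈ l', ‖x‖ ≤ 1)
    (hp : p ∈ l) (hpl : ∀ x ∈ l, ‖p * x - x * p‖ ≤ τ) (hpl' : ∀ x ∈ l', ‖p * x - x * p‖ ≤ τ)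
    (hx0 : x0 ∈ l') (h0 : p * x0 = 0) : ‖l.prod * l'.prod‖ ≤ (l.length + l'.length) * τ := by
  have h4 := list_zero hτ hl' hpl' hx0 h0
  obtain ⟨l1, l2, rfl⟩ := List.append_of_mem hp
  have h1 := list_comm (l := l2) (fun x hx => hl x (by simp [hx])) (fun x hx => hpl x (by simp [hx]))
  have h2 : ‖l1.prod‖ ≤ 1 := list_norm (fun x hx => hl x (by simp [hx]))
  have h3 : ‖l2.prod‖ ≤ 1 := list_norm (fun x hx => hl x (by simp [hx]))
  have h5 : ‖l'.prod‖ ≤ 1 := list_norm hl'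
  rw [List.prod_append, List.prod_cons]
  have : (l1.prod * (p * l2.prod)) * l'.prod = l1.prod * ((p * l2.prod - l2.prod * p) * l'.prod) + l1.prod * (l2.prod * (p * l'.prod)) := by noncomm_ring
  rw [this]
  refine (nadd (nmulL h2 (nmulR h1 h5)) (nmulL h2 (nmulL h3 h4))).trans ?_
  rw [List.length_append, List.length_cons]; push_cast
  nlinarith [Nat.cast_nonneg (α := ℝ) l1.length, Nat.cast_nonneg (α := ℝ) l2.length]

lemma list_conj {W : D} (hW : W ∈ unitary D) {l : List D} : (l.map fun x => star W * x * W).prod = star W * l.prod * W := by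
  induction l with
  | nil => simp [hW.1]
  | cons a l ih =>
    rw [List.map_cons, List.prod_cons, ih, List.prod_cons]
    calc star W * a * W * (star W * l.prod * W) = star W * a * (W * star W) * l.prod * W := by simp only [mul_assoc]
      _ = _ := by rw [hW.2]; simp only [mul_assoc, one_mul]

lemma star_list (l : List D) : star l.prod = (l.map star).reverse.prod := by
  induction l with
  | nil => simp
  | cons a l ih => simp [ih]

lemma sum_ofFn {ι : Type} [Fintype ι] [DecidableEq ι] : ∀ (n : ℕ) (x : Fin n → ι → D), (∀ j, ∑ i, star (x j i) * x j i = 1) →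
    ∑ z : Fin n → ι, star (List.ofFn fun j => x j (z j)).prod * (List.ofFn fun j => x j (z j)).prod = 1
  | 0, x, h => by simp
  | n + 1, x, h => by
    have ih := sum_ofFn n (fun j => x j.succ) (fun j => h j.succ)
    rw [← (Fin.consEquiv (fun _ : Fin (n + 1) => ι)).sum_comp, Fintype.sum_prod_type, Finset.sum_comm, ← ih]
    apply Finset.sum_congr rfl
    intro z _
    have : ∀ i : ι, star (List.ofFn fun j => x j (Fin.consEquiv (fun _ : Fin (n + 1) => ι) (i, z) j)).prod * (List.ofFn fun j => x j (Fin.consEquiv (fun _ : Fin (n + 1) => ι) (i, z) j)).prod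
        = star (List.ofFn fun j => x j.succ (z j)).prod * (star (x 0 i) * x 0 i) * (List.ofFn fun j => x j.succ (z j)).prod := by
      intro i
      rw [List.ofFn_succ, List.prod_cons, star_mul]
      simp [Fin.consEquiv, mul_assoc]
    simp only [this]
    rw [← Finset.sum_mul, ← Finset.mul_sum, h, mul_one]
end lists

/-- commutators of functions of almost commuting unitaries -/
lemma fcomm {ι ι' : Type} [Fintype ι] [Fintype ι'] {f : ι → ℂ → ℂ} {g : ι' → ℂ → ℂ}
    (hf : ∀ i, ContinuousOn (f i) (Metric.sphere (0 : ℂ) 1)) (hf1 : ∀ i, ∀ z ∈ Metric.sphere (0 : ℂ) 1, ‖f i z‖ ≤ 1)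
    (hg : ∀ i, ContinuousOn (g i) (Metric.sphere (0 : ℂ) 1)) {τ : ℝ} (hτ : 0 < τ) :
    ∃ δ > (0 : ℝ), ∀ (D : Type u) [CStarAlgebra D] (a b : D), a ∈ unitary D → b ∈ unitary D → ‖b * a - a * b‖ ≤ δ →
      ∀ i i', ‖cfc (g i') a * cfc (f i) b - cfc (f i) b * cfc (g i') a‖ ≤ τ := by
  obtain ⟨c1, c10, h1⟩ := IL_finset.{u} Finset.univ (fun i _ => hg i) hτ
  obtain ⟨c2, c20, h2⟩ := IL_finset.{u} Finset.univ (fun i _ => hf i) c10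
  refine ⟨c2, c20, ?_⟩
  intro D _ a b ha hb hab i i'
  have h3 := h2 D b b a hb hb (norm_unitary_le ha) hab i (Finset.mem_univ _)
  refine h1 D a a (cfc (f i) b) ha ha ?_ (by rw [norm_sub_rev]; exact h3) i' (Finset.mem_univ _)
  exact norm_cfc_le zero_le_one fun z hz => hf1 i z (spec_sphere hb hz)

lemma grid {rad : ℝ} (hr : 0 < rad) : ∃ (ι : Type) (_ : Fintype ι) (_ : DecidableEq ι) (w : ι → ℂ) (N : ℕ) (f : ι → ℂ → ℂ),
    0 < N ∧ (∀ i, w i ^ N = 1) ∧ (∀ i, ContinuousOn (f i) (Metric.sphere (0 : ℂ) 1)) ∧ (∀ i z, star (f i z) = f i z) ∧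
    (∀ i, ∀ z ∈ Metric.sphere (0 : ℂ) 1, ‖f i z‖ ≤ 1) ∧ (∀ z ∈ Metric.sphere (0 : ℂ) 1, ∑ i, f i z * f i z = 1) ∧
    (∀ i z, f i z ≠ 0 → ‖z - w i‖ < rad) := by
  obtain ⟨G, N, h, N0, hN, hc, hp, hs, hsup⟩ := PU hr
  refine ⟨G, inferInstance, inferInstance, fun i => i, N, fun i z => ((Real.sqrt (h i z) : ℝ) : ℂ), N0, fun i => hN i i.2, ?_, ?_, ?_, ?_, ?_⟩
  · intro i
    exact Complex.continuous_ofReal.comp_continuousOn (Real.continuous_sqrt.comp_continuousOn (hc i i.2))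
  · intro i z; exact Complex.conj_ofReal _
  · intro i z hz
    rw [Complex.norm_real, Real.norm_of_nonneg (Real.sqrt_nonneg _), Real.sqrt_le_iff]
    refine ⟨zero_le_one, ?_⟩
    rw [one_pow, ← hs z hz]
    exact Finset.single_le_sum (f := fun w => h w z) (fun w _ => hp w z) i.2
  · intro z hz
    have : ∀ i : G, (((Real.sqrt (h i z) : ℝ) : ℂ)) * (Real.sqrt (h i z) : ℝ) = (h i z : ℝ) := by
      intro i
      exact_mod_cast Real.mul_self_sqrt (hp i z)
    simp only [this]
    rw [Finset.sum_coe_sort G (fun i => ((h i z : ℝ) : ℂ))]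
    exact_mod_cast hs z hz
  · intro i z hz
    apply hsup
    intro h0
    apply hz
    simp [h0]
end PIS

namespace PIS
universe u
set_option linter.all false

lemma cfc_conj {f : ℂ → ℂ} (hf : ContinuousOn f (Metric.sphere (0 : ℂ) 1)) {D : Type u} [CStarAlgebra D] {a W : D} {χ : ℂ}
    (ha : a ∈ unitary D) (hW : W ∈ unitary D) (hχ : ‖χ‖ = 1) (h : a * W = χ • (W * a)) :
    star W * cfc f a * W = cfc (fun t => f (χ * t)) a := by
  have hn := normal_of_unitary ha
  have hcc : χ * star χ = 1 := by
    rw [Complex.star_def, Complex.mul_conj, Complex.normSq_eq_norm_sq, hχ]; simp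
  have hb : χ • a ∈ unitary D := by
    rw [Unitary.mem_iff] at ha ⊢
    rw [star_smul, smul_mul_smul_comm, smul_mul_smul_comm, ha.1, ha.2, hcc, mul_comm, hcc, one_smul]
    exact ⟨rfl, rfl⟩
  have h1 : cfc f a * W - W * cfc f (χ • a) = 0 := by
    rw [← norm_le_zero_iff]
    apply le_of_forall_pos_le_add
    intro κ hκ
    obtain ⟨c, c0, hc⟩ := IL.{u} hf hκ
    rw [zero_add]
    refine hc D a (χ • a) W ha hb (norm_unitary_le hW) ?_
    rw [h, mul_smul_comm, sub_self, norm_zero]; exact c0.le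
  have h2 : cfc (fun t => f (χ * t)) a = cfc f (χ • a) := by
    refine cfc_comp_const_mul χ f a ?_ hn
    · apply hf.mono
      rintro _ ⟨t, ht, rfl⟩
      have := spec_sphere ha ht
      simp only [mem_sphere_iff_norm, sub_zero] at this ⊢
      rw [norm_mul, this, hχ, mul_one]
  rw [h2, mul_assoc, sub_eq_zero.1 h1, ← mul_assoc, (Unitary.mem_iff.1 hW).1, one_mul]

noncomputable def cw (rad : ℝ) (w : ℂ) (t : ℂ) : ℂ := (t - w) * ((rad / max rad ‖t - w‖ : ℝ) : ℂ)

lemma cw_cont {rad : ℝ} (hr : 0 < rad) (w : ℂ) : Continuous (cw rad w) := by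
  unfold cw
  refine (continuous_id.sub continuous_const).mul (Complex.continuous_ofReal.comp ?_)
  refine Continuous.div continuous_const (by fun_prop) ?_
  intro x; exact (lt_of_lt_of_le hr (le_max_left _ _)).ne'

lemma cw_norm {rad : ℝ} (hr : 0 < rad) (w t : ℂ) : ‖cw rad w t‖ ≤ rad := by
  unfold cw
  have h0 : 0 < max rad ‖t - w‖ := lt_of_lt_of_le hr (le_max_left _ _)
  rw [norm_mul, Complex.norm_real, Real.norm_of_nonneg (div_nonneg hr.le h0.le), ← mul_div_assoc, div_le_iff₀ h0, mul_comm]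
  exact mul_le_mul_of_nonneg_left (le_max_right _ _) hr.le

lemma cw_eq {rad : ℝ} (hr : 0 < rad) {w t : ℂ} (h : ‖t - w‖ ≤ rad) : cw rad w t = t - w := by
  unfold cw
  rw [max_eq_left h, div_self hr.ne']; simp

theorem T2 {n q : ℕ} (hq : 0 < q) {ι : Type} [Fintype ι] [DecidableEq ι] {rad τ : ℝ} (hr : 0 < rad) (hτ : 0 < τ) {w : ι → ℂ} {f : ι → ℂ → ℂ}
    (hf : ∀ i, ContinuousOn (f i) (Metric.sphere (0 : ℂ) 1)) (hfs : ∀ i z, star (f i z) = f i z)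
    (hf1 : ∀ i, ∀ z ∈ Metric.sphere (0 : ℂ) 1, ‖f i z‖ ≤ 1) (hsum : ∀ z ∈ Metric.sphere (0 : ℂ) 1, ∑ i, f i z * f i z = 1)
    (hsup : ∀ i z, f i z ≠ 0 → ‖z - w i‖ < rad) :
    ∃ δ > (0 : ℝ), ∀ (D : Type u) [CStarAlgebra D] (Ω : Fin n → D), (∀ j, Ω j ∈ unitary D) →
      (∀ j k, ‖Ω k * Ω j - Ω j * Ω k‖ ≤ δ) → ∃ F : (Fin n → ι) → D, (∑ z, star (F z) * F z = 1) ∧ (∀ z, ‖F z‖ ≤ 1) ∧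
      (∀ z j, ∃ c : D, ‖c‖ ≤ rad ∧ ‖F z * (Ω j - w (z j) • 1) - c * F z‖ ≤ 2 * n * τ ∧
        ‖(Ω j - w (z j) • 1) * star (F z) - c * star (F z)‖ ≤ n * τ) ∧
      (∀ W ∈ unitary D, ∀ χ : Fin n → ℂ, (∀ j, χ j ^ q = 1) → (∀ j, Ω j * W = χ j • (W * Ω j)) → ∀ z z' : Fin n → ι,
        (∃ j, 2 * rad ≤ ‖w (z j) - χ j * w (z' j)‖) → ‖F z * W * star (F z')‖ ≤ 2 * n * τ) := by
  have hroot : ∀ χ : ℂ, χ ^ q = 1 → ‖χ‖ = 1 := fun χ h => Complex.norm_eq_one_of_pow_eq_one h hq.ne'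
  have hsph : ∀ χ : ℂ, ‖χ‖ = 1 → ∀ t ∈ Metric.sphere (0 : ℂ) 1, χ * t ∈ Metric.sphere (0 : ℂ) 1 := by
    intro χ h t ht
    simp only [mem_sphere_iff_norm, sub_zero] at ht ⊢
    rw [norm_mul, h, ht, mul_one]
  let Z := {ζ : ℂ // ζ ∈ Polynomial.nthRootsFinset q (1 : ℂ)}
  have hZ : ∀ ζ : Z, (ζ : ℂ) ^ q = 1 := fun ζ => (Polynomial.mem_nthRootsFinset hq 1).1 ζ.2
  let fz : ι × Z → ℂ → ℂ := fun p t => f p.1 (p.2 * t)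
  have hfz : ∀ p, ContinuousOn (fz p) (Metric.sphere (0 : ℂ) 1) := by
    intro p
    exact (hf p.1).comp (Continuous.continuousOn (by fun_prop)) (hsph _ (hroot _ (hZ _)))
  have hfz1 : ∀ p, ∀ z ∈ Metric.sphere (0 : ℂ) 1, ‖fz p z‖ ≤ 1 := fun p z hz => hf1 p.1 _ (hsph _ (hroot _ (hZ _)) z hz)
  obtain ⟨δ1, h10, H1⟩ := fcomm.{u} hfz hfz1 hfz hτ
  obtain ⟨δ2, h20, H2⟩ := fcomm.{u} hf hf1 (fun i => (cw_cont hr (w i)).continuousOn (s := Metric.sphere (0 : ℂ) 1)) hτ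
  have hew : ∀ i, Continuous (fun t => t - w i - cw rad (w i) t) := fun i =>
    (continuous_id.sub continuous_const).sub (cw_cont hr (w i))
  obtain ⟨δ3, h30, H3⟩ := fcomm.{u} hf hf1 (fun i => (hew i).continuousOn (s := Metric.sphere (0 : ℂ) 1)) hτ
  refine ⟨min δ1 (min δ2 δ3), lt_min h10 (lt_min h20 h30), ?_⟩
  intro D _ Ω hΩ hcom
  have c1 : ∀ j k, ‖Ω k * Ω j - Ω j * Ω k‖ ≤ δ1 := fun j k => (hcom j k).trans (min_le_left _ _)
  have c2 : ∀ j k, ‖Ω k * Ω j - Ω j * Ω k‖ ≤ δ2 := fun j k => (hcom j k).trans ((min_le_right _ _).trans (min_le_left _ _))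
  have c3 : ∀ j k, ‖Ω k * Ω j - Ω j * Ω k‖ ≤ δ3 := fun j k => (hcom j k).trans ((min_le_right _ _).trans (min_le_right _ _))
  have hnor := fun j => normal_of_unitary (hΩ j)
  have hfc : ∀ i j, ContinuousOn (f i) (spectrum ℂ (Ω j)) := fun i j => (hf i).mono (spec_sphere (hΩ j))
  have hsa : ∀ i j, star (cfc (f i) (Ω j)) = cfc (f i) (Ω j) := by
    intro i j
    rw [← cfc_star]; simp only [hfs]
  have hn1 : ∀ i j, ‖cfc (f i) (Ω j)‖ ≤ 1 := fun i j => norm_cfc_le zero_le_one fun t ht => hf1 i t (spec_sphere (hΩ j) ht)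
  have hfin : ∀ (z : Fin n → ι) (x : D), x ∈ (List.ofFn fun j => cfc (f (z j)) (Ω j)) → ∃ j, x = cfc (f (z j)) (Ω j) := by
    intro z x hx
    obtain ⟨j, rfl⟩ := (List.mem_ofFn' _ _).1 hx
    exact ⟨j, rfl⟩
  have hstarl : ∀ z : Fin n → ι, star (List.ofFn fun j => cfc (f (z j)) (Ω j)).prod = (List.ofFn fun j => cfc (f (z j)) (Ω j)).reverse.prod := by
    intro z
    rw [star_list, List.map_ofFn]
    congr 3
    funext j
    exact hsa _ _
  have hlen : ∀ z : Fin n → ι, ((List.ofFn fun j => cfc (f (z j)) (Ω j)).length : ℝ) = n := by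
    intro z; rw [List.length_ofFn]
  have hln : ∀ (z : Fin n → ι), ∀ x ∈ (List.ofFn fun j => cfc (f (z j)) (Ω j)), ‖x‖ ≤ 1 := by
    intro z x hx
    obtain ⟨j, rfl⟩ := hfin z x hx
    exact hn1 _ _
  refine ⟨fun z => (List.ofFn fun j => cfc (f (z j)) (Ω j)).prod, ?_, ?_, ?_, ?_⟩
  · apply sum_ofFn n (fun j i => cfc (f i) (Ω j))
    intro j
    have : ∀ i, star (cfc (f i) (Ω j)) * cfc (f i) (Ω j) = cfc (fun t => f i t * f i t) (Ω j) := by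
      intro i
      rw [hsa, ← cfc_mul (f i) (f i) (Ω j) (hfc i j) (hfc i j)]
    simp only [this]
    rw [← cfc_sum_univ (fun i t => f i t * f i t) (Ω j) (fun i => (hfc i j).mul (hfc i j)), ← cfc_const_one ℂ (Ω j) (hnor j)]
    apply cfc_congr
    intro t ht
    simp only [Finset.sum_apply]
    exact hsum t (spec_sphere (hΩ j) ht)
  · intro z
    exact list_norm (hln z)
  · intro z j
    have hcc : ContinuousOn (cw rad (w (z j))) (spectrum ℂ (Ω j)) := (cw_cont hr _).continuousOn
    have hec : ContinuousOn (fun t => t - w (z j) - cw rad (w (z j)) t) (spectrum ℂ (Ω j)) := (hew _).continuousOn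
    have hsplit : Ω j - w (z j) • (1 : D) = cfc (fun t => t - w (z j) - cw rad (w (z j)) t) (Ω j) + cfc (cw rad (w (z j))) (Ω j) := by
      rw [← cfc_add _ _ _ hec hcc]
      have : (fun t => t - w (z j) - cw rad (w (z j)) t + cw rad (w (z j)) t) = fun t => t - w (z j) := by
        funext t; ring
      rw [this, cfc_sub (fun t => t) (fun _ => w (z j)) (Ω j), cfc_id' ℂ (Ω j), cfc_const _ _ (hnor j), Algebra.algebraMap_eq_smul_one]
    have hz1 : cfc (f (z j)) (Ω j) * cfc (fun t => t - w (z j) - cw rad (w (z j)) t) (Ω j) = 0 := by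
      rw [← cfc_mul _ _ _ (hfc _ j) hec]
      have : (fun t => f (z j) t * (t - w (z j) - cw rad (w (z j)) t)) = fun _ => 0 := by
        funext t
        by_cases h : f (z j) t = 0
        · rw [h, zero_mul]
        · rw [cw_eq hr (hsup _ _ h).le, sub_self, mul_zero]
      rw [this]
      simp
    have hz2 : cfc (fun t => t - w (z j) - cw rad (w (z j)) t) (Ω j) * cfc (f (z j)) (Ω j) = 0 := by
      rw [(cfc_commute_cfc _ _ _).eq, hz1]
    obtain ⟨c, hc⟩ : ∃ c, c = cfc (cw rad (w (z j))) (Ω j) := ⟨_, rfl⟩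
    obtain ⟨e, he⟩ : ∃ e, e = cfc (fun t => t - w (z j) - cw rad (w (z j)) t) (Ω j) := ⟨_, rfl⟩
    rw [← he] at hz1 hz2
    rw [hsplit, ← hc, ← he]
    have hecom : ∀ x ∈ (List.ofFn fun j => cfc (f (z j)) (Ω j)), ‖e * x - x * e‖ ≤ τ := by
      intro x hx
      obtain ⟨k, rfl⟩ := hfin z x hx
      rw [he]
      exact H3 D (Ω j) (Ω k) (hΩ j) (hΩ k) (c3 _ _) (z k) (z j)
    have hccom : ∀ x ∈ (List.ofFn fun j => cfc (f (z j)) (Ω j)), ‖c * x - x * c‖ ≤ τ := by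
      intro x hx
      obtain ⟨k, rfl⟩ := hfin z x hx
      rw [hc]
      exact H2 D (Ω j) (Ω k) (hΩ j) (hΩ k) (c2 _ _) (z k) (z j)
    have hmem : cfc (f (z j)) (Ω j) ∈ (List.ofFn fun j => cfc (f (z j)) (Ω j)) := (List.mem_ofFn' _ _).2 ⟨j, rfl⟩
    refine ⟨c, ?_, ?_, ?_⟩
    · rw [hc]; exact norm_cfc_le hr.le fun t _ => cw_norm hr _ _
    · have a1 := list_zero' hτ.le (hln z) hecom hmem hz1
      have a2 := list_comm (hln z) hccom
      rw [hlen] at a1 a2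
      dsimp only
      obtain ⟨P, hP⟩ : ∃ P, P = (List.ofFn fun j => cfc (f (z j)) (Ω j)).prod := ⟨_, rfl⟩
      rw [← hP] at a1 a2 ⊢
      have : P * (e + c) - c * P = P * e - (c * P - P * c) := by noncomm_ring
      rw [this]
      exact (nsub a1 a2).trans (by linarith)
    · have a1 := list_zero (l := (List.ofFn fun j => cfc (f (z j)) (Ω j)).reverse) hτ.le (fun x hx => hln z x (List.mem_reverse.1 hx))
        (fun x hx => hecom x (List.mem_reverse.1 hx)) (List.mem_reverse.2 hmem) hz2
      rw [List.length_reverse, hlen] at a1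
      simp only [hstarl]
      rw [add_mul, add_sub_cancel_right]
      exact a1
  · intro W hW χ hχ hWχ z z' ⟨j, hj⟩
    let ζ : Fin n → Z := fun j => ⟨χ j, (Polynomial.mem_nthRootsFinset hq 1).2 (hχ j)⟩
    let ζ1 : Z := ⟨1, (Polynomial.mem_nthRootsFinset hq 1).2 (one_pow _)⟩
    have hfone : ∀ i, fz (i, ζ1) = f i := by
      intro i; funext t; show f i (1 * t) = _; rw [one_mul]
    have hl : (List.ofFn fun j => cfc (fz (z j, ζ j)) (Ω j)).prod = star W * (List.ofFn fun j => cfc (f (z j)) (Ω j)).prod * W := by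
      rw [← list_conj hW, List.map_ofFn]
      congr 2
      funext k
      exact (cfc_conj (hf (z k)) (hΩ k) hW (hroot _ (hχ k)) (hWχ k)).symm
    have hfin2 : ∀ x ∈ (List.ofFn fun j => cfc (fz (z j, ζ j)) (Ω j)), ∃ k, x = cfc (fz (z k, ζ k)) (Ω k) := by
      intro x hx
      obtain ⟨j, rfl⟩ := (List.mem_ofFn' _ _).1 hx
      exact ⟨j, rfl⟩
    have hz : cfc (fz (z j, ζ j)) (Ω j) * cfc (f (z' j)) (Ω j) = 0 := by
      rw [← cfc_mul _ _ _ ((hfz _).mono (spec_sphere (hΩ j))) (hfc _ j)]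
      have : (fun t => fz (z j, ζ j) t * f (z' j) t) = fun _ => 0 := by
        funext t
        by_contra h
        have h1 : ‖χ j * t - w (z j)‖ < rad := hsup _ _ (left_ne_zero_of_mul h)
        have h2 : ‖t - w (z' j)‖ < rad := hsup _ _ (right_ne_zero_of_mul h)
        have h3 : ‖χ j * (t - w (z' j))‖ < rad := by rw [norm_mul, hroot _ (hχ j), one_mul]; exact h2
        have h4 : w (z j) - χ j * w (z' j) = χ j * (t - w (z' j)) - (χ j * t - w (z j)) := by ring
        rw [h4] at hj
        linarith [norm_sub_le (χ j * (t - w (z' j))) (χ j * t - w (z j))]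
      rw [this]
      simp
    have a1 := list_zero2 (l := List.ofFn fun j => cfc (fz (z j, ζ j)) (Ω j)) (l' := (List.ofFn fun j => cfc (f (z' j)) (Ω j)).reverse)
      (p := cfc (fz (z j, ζ j)) (Ω j)) (x0 := cfc (f (z' j)) (Ω j)) hτ.le ?_ ?_ ?_ ?_ ?_ ?_ hz
    · rw [List.length_reverse, hlen, List.length_ofFn, hl] at a1
      simp only [hstarl]
      obtain ⟨P, hP⟩ : ∃ P, P = (List.ofFn fun j => cfc (f (z j)) (Ω j)).prod := ⟨_, rfl⟩
      obtain ⟨P', hP'⟩ : ∃ P, P = (List.ofFn fun j => cfc (f (z' j)) (Ω j)).reverse.prod := ⟨_, rfl⟩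
      rw [← hP, ← hP'] at a1 ⊢
      have : P * W * P' = W * (star W * P * W * P') := by
        simp only [← mul_assoc, (Unitary.mem_iff.1 hW).2, one_mul]
      rw [this]
      exact (nmulL (norm_unitary_le hW) a1).trans (by linarith)
    · intro x hx
      obtain ⟨k, rfl⟩ := hfin2 x hx
      exact norm_cfc_le zero_le_one fun t ht => hfz1 _ t (spec_sphere (hΩ k) ht)
    · exact fun x hx => hln z' x (List.mem_reverse.1 hx)
    · exact (List.mem_ofFn' _ _).2 ⟨j, rfl⟩
    · intro x hx
      obtain ⟨k, rfl⟩ := hfin2 x hx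
      exact H1 D (Ω j) (Ω k) (hΩ j) (hΩ k) (c1 _ _) _ _
    · intro x hx
      obtain ⟨k, rfl⟩ := hfin z' x (List.mem_reverse.1 hx)
      rw [← hfone]
      exact H1 D (Ω j) (Ω k) (hΩ j) (hΩ k) (c1 _ _) _ _
    · exact List.mem_reverse.2 ((List.mem_ofFn' _ _).2 ⟨j, rfl⟩)

end PIS

namespace PIS
universe u
set_option linter.all false

lemma small_of (C : ℝ) {s : ℝ} (hs : 0 < s) : ∃ τ > (0 : ℝ), |C| * τ ≤ s := by
  refine ⟨s / (|C| + 1), by positivity, ?_⟩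
  rw [← mul_div_assoc, div_le_iff₀ (by positivity)]
  nlinarith [abs_nonneg C]

lemma root_gap {q : ℕ} (hq : 0 < q) : ∃ g > (0 : ℝ), ∀ χ : ℂ, χ ^ q = 1 → χ ≠ 1 → g ≤ ‖1 - χ‖ := by
  classical
  by_cases hne : ((Polynomial.nthRootsFinset q (1 : ℂ)).erase 1).Nonempty
  · obtain ⟨χ0, h0, hm⟩ := Finset.exists_min_image _ (fun χ : ℂ => ‖1 - χ‖) hne
    refine ⟨‖1 - χ0‖, ?_, ?_⟩
    · rw [gt_iff_lt, norm_pos_iff, sub_ne_zero]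
      exact (Finset.mem_erase.1 h0).1.symm
    · intro χ h1 h2
      exact hm χ (Finset.mem_erase.2 ⟨h2, (Polynomial.mem_nthRootsFinset hq 1).2 h1⟩)
  · refine ⟨1, one_pos, ?_⟩
    intro χ h1 h2
    exact absurd ⟨χ, Finset.mem_erase.2 ⟨h2, (Polynomial.mem_nthRootsFinset hq 1).2 h1⟩⟩ hne

lemma dominate {Z : Type} [Fintype Z] (R : Z → Z → Prop) (hr : ∀ z, R z z) (hs : ∀ z y, R z y → R y z) :
    ∃ s : Finset Z, (∀ z ∈ s, ∀ y ∈ s, z ≠ y → ¬ R z y) ∧ ∀ z, ∃ y ∈ s, R z y := by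
  classical
  obtain ⟨s, hs1, hs2⟩ := Finset.exists_max_image ((Finset.univ : Finset (Finset Z)).filter fun s => ∀ z ∈ s, ∀ y ∈ s, z ≠ y → ¬ R z y)
    Finset.card ⟨∅, by simp⟩
  have hs1' := (Finset.mem_filter.1 hs1).2
  refine ⟨s, hs1', ?_⟩
  intro z
  by_contra hcon
  push Not at hcon
  have hz : z ∉ s := fun h => hcon z h (hr z)
  have := hs2 (insert z s) (by
    simp only [Finset.mem_filter, Finset.mem_univ, true_and, Finset.mem_insert]
    rintro a (rfl | ha) b (rfl | hb) hab
    · exact absurd rfl hab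
    · exact hcon b hb
    · exact fun h => hcon a ha (hs _ _ h)
    · exact hs1' a ha b hb hab)
  rw [Finset.card_insert_of_notMem hz] at this
  omega

section kb
variable {n d q : ℕ} {ω : Fin n → CStarMatrix (Fin d) (Fin d) ℂ}

lemma mu_smul {A : Type u} [CStarAlgebra A] (c : ℂ) (x : CStarMatrix (Fin d) (Fin d) ℂ) :
    (mu (c • x) : CStarMatrix (Fin d) (Fin d) A) = c • mu x := by
  ext i j
  rw [CStarMatrix.smul_apply, mu_apply, mu_apply, CStarMatrix.smul_apply, smul_eq_mul, map_mul, ← Algebra.smul_def]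

lemma span_bound {S : Set (CStarMatrix (Fin d) (Fin d) ℂ)} {m : CStarMatrix (Fin d) (Fin d) ℂ} (hm : m ∈ Submodule.span ℂ S) :
    ∃ K : ℝ, 0 ≤ K ∧ ∀ (A : Type u) [CStarAlgebra A] (X Y : CStarMatrix (Fin d) (Fin d) A) (t : ℝ), 0 ≤ t →
      (∀ U ∈ S, ‖X * mu U * Y‖ ≤ t) → ‖X * mu m * Y‖ ≤ K * t := by
  induction hm using Submodule.span_induction with
  | mem x hx => exact ⟨1, zero_le_one, fun A _ X Y t ht h => by rw [one_mul]; exact h x hx⟩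
  | zero => exact ⟨0, le_rfl, fun A _ X Y t ht h => by simp⟩
  | add x y _ _ hx hy =>
    obtain ⟨K1, h1, H1⟩ := hx
    obtain ⟨K2, h2, H2⟩ := hy
    refine ⟨K1 + K2, add_nonneg h1 h2, fun A _ X Y t ht h => ?_⟩
    rw [map_add, mul_add, add_mul, add_mul]
    exact nadd (H1 A X Y t ht h) (H2 A X Y t ht h)
  | smul c x _ hx =>
    obtain ⟨K1, h1, H1⟩ := hx
    refine ⟨‖c‖ * K1, mul_nonneg (norm_nonneg _) h1, fun A _ X Y t ht h => ?_⟩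
    rw [mu_smul, mul_smul_comm, smul_mul_assoc, norm_smul, mul_assoc ‖c‖ K1 t]
    exact mul_le_mul_of_nonneg_left (H1 A X Y t ht h) (norm_nonneg _)

theorem Kbound [NeZero d] {L : Fin n → Fin n → ℂ} (hq0 : 0 < q) (hω : ∀ j, ω j ∈ unitary (CStarMatrix (Fin d) (Fin d) ℂ)) (hωq : ∀ j, ω j ^ q = 1)
    (hL : ∀ j k, ω k * ω j = L k j • (ω j * ω k)) (hLn : ∀ j k, ‖L j k‖ = 1)
    (hsch : ∀ M : CStarMatrix (Fin d) (Fin d) ℂ, (∀ j, M * ω j = ω j * M) → ∃ c : ℂ, M = c • 1) :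
    ∃ K : ℝ, 0 ≤ K ∧ ∀ (A : Type u) [CStarAlgebra A] (X Y : CStarMatrix (Fin d) (Fin d) A) (t : ℝ), 0 ≤ t →
      ((∀ U χ, Hom q ω U χ → ‖X * mu U * Y‖ ≤ t) → ∀ b b', ‖X * mu (eu b b') * Y‖ ≤ K * t) ∧
      ((∀ U χ, Hom q ω U χ → (∃ j, χ j ≠ 1) → ‖X * mu U * Y‖ ≤ t) → ∀ b b' b0, ‖X * mu (eu b b' - if b = b' then eu b0 b0 else 0) * Y‖ ≤ K * t) := by
  have s1 : ∀ m : CStarMatrix (Fin d) (Fin d) ℂ, m ∈ Submodule.span ℂ {U | ∃ χ, Hom q ω U χ} := by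
    intro m
    obtain ⟨c, hc⟩ := hom_span hq0 hω hωq hL hLn hsch m
    have h1 : (1 : CStarMatrix (Fin d) (Fin d) ℂ) ∈ Submodule.span ℂ {U | ∃ χ, Hom q ω U χ} :=
      Submodule.subset_span ⟨fun _ => 1, one_mem _, fun _ => one_pow _, fun j => by rw [mul_one, one_mul, one_smul]⟩
    have h2 := Submodule.span_mono (s := {U | ∃ χ, Hom q ω U χ ∧ ∃ j, χ j ≠ 1}) (t := {U | ∃ χ, Hom q ω U χ}) (R := ℂ)
      (by rintro U ⟨χ, h, _⟩; exact ⟨χ, h⟩) hc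
    have := Submodule.add_mem _ h2 (Submodule.smul_mem _ c h1)
    rwa [sub_add_cancel] at this
  have s2 : ∀ m : CStarMatrix (Fin d) (Fin d) ℂ, trc m = 0 → m ∈ Submodule.span ℂ {U | ∃ χ, Hom q ω U χ ∧ ∃ j, χ j ≠ 1} := by
    intro m hm
    obtain ⟨c, hc⟩ := hom_span hq0 hω hωq hL hLn hsch m
    have hle : Submodule.span ℂ {U | ∃ χ, Hom q ω U χ ∧ ∃ j, χ j ≠ 1} ≤ LinearMap.ker (trc (d := d)) := by
      rw [Submodule.span_le]
      rintro U ⟨χ, h, j, hj⟩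
      exact Hom.trz hω h hj
    have h1 := LinearMap.mem_ker.1 (hle hc)
    rw [map_sub, map_smul, hm, trc_one, zero_sub, neg_eq_zero, smul_eq_mul, mul_eq_zero] at h1
    rcases h1 with h1 | h1
    · rwa [h1, zero_smul, sub_zero] at hc
    · exact absurd h1 (by exact_mod_cast NeZero.ne d)
  have h1 := fun p : Fin d × Fin d => span_bound.{u} (s1 (eu p.1 p.2))
  have htr : ∀ b b' : Fin d, trc (eu b b') = if b = b' then 1 else 0 := by
    intro b b'
    rw [trc_apply]
    simp only [eu_apply]
    rw [Finset.sum_eq_single b]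
    · simp [eq_comm]
    · intro c _ hc; simp [hc]
    · simp
  have h2 := fun p : Fin d × Fin d × Fin d => span_bound.{u} (s2 (eu p.1 p.2.1 - if p.1 = p.2.1 then eu p.2.2 p.2.2 else 0) (by
    rw [map_sub, htr]
    split_ifs
    · rw [htr]; simp
    · simp))
  choose K1 hK1 H1 using h1
  choose K2 hK2 H2 using h2
  refine ⟨∑ p, K1 p + ∑ p, K2 p, add_nonneg (Finset.sum_nonneg fun p _ => hK1 p) (Finset.sum_nonneg fun p _ => hK2 p), ?_⟩
  intro A _ X Y t ht
  constructor
  · intro h b b'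
    refine (H1 (b, b') A X Y t ht (by rintro U ⟨χ, hU⟩; exact h U χ hU)).trans (mul_le_mul_of_nonneg_right ?_ ht)
    have := Finset.single_le_sum (f := K1) (fun p _ => hK1 p) (Finset.mem_univ (b, b'))
    linarith [Finset.sum_nonneg (s := Finset.univ) fun p _ => hK2 p]
  · intro h b b' b0
    refine (H2 (b, b', b0) A X Y t ht (by rintro U ⟨χ, hU, hj⟩; exact h U χ hU hj)).trans (mul_le_mul_of_nonneg_right ?_ ht)
    have := Finset.single_le_sum (f := K2) (fun p _ => hK2 p) (Finset.mem_univ (b, b', b0))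
    linarith [Finset.sum_nonneg (s := Finset.univ) fun p _ => hK1 p]
end kb

section rows
variable {d : ℕ} {A : Type u} [CStarAlgebra A]

lemma row_ex [NeZero d] (hA : IsPurelyInfiniteSimple A) (F : CStarMatrix (Fin d) (Fin d) A) {β : ℝ} (hβ : 0 < β) (hF : β ≤ ‖F‖) :
    ∃ a0 b0, ∃ x : A, ‖x‖ ≤ 2 * d ^ 2 / β ∧ star x * (F a0 b0 * star (F a0 b0)) * x = 1 := by
  have hd : (0 : ℝ) < d := by exact_mod_cast Nat.pos_of_ne_zero (NeZero.ne d)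
  have h1 : ∃ a0 b0, β / d ^ 2 ≤ ‖F a0 b0‖ := by
    by_contra hcon
    push Not at hcon
    have h2 : ∑ i, ∑ j, ‖F i j‖ < ∑ i : Fin d, ∑ j : Fin d, β / d ^ 2 :=
      Finset.sum_lt_sum_of_nonempty ⟨0, Finset.mem_univ _⟩ fun i _ => Finset.sum_lt_sum_of_nonempty ⟨0, Finset.mem_univ _⟩ fun j _ => hcon i j
    have h3 : ∑ i : Fin d, ∑ j : Fin d, β / (d : ℝ) ^ 2 = β := by
      simp; field_simp
    linarith [norm_cm_le_sum F]
  obtain ⟨a0, b0, h⟩ := h1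
  obtain ⟨x, hx, hn⟩ := PI1 hA (x := star (F a0 b0)) (ν := β / d ^ 2) (by positivity) (by rwa [norm_star])
  refine ⟨a0, b0, x, hn.trans (le_of_eq (by field_simp)), ?_⟩
  rwa [star_star] at hx

lemma mid_apply (F F' : CStarMatrix (Fin d) (Fin d) A) (b b' a a' : Fin d) :
    (F * mu (eu b b') * star F' : CStarMatrix (Fin d) (Fin d) A) a a' = F a b * star (F' a' b') := by
  rw [CStarMatrix.mul_apply, Finset.sum_eq_single b']
  · rw [CStarMatrix.mul_apply, Finset.sum_eq_single b, CStarMatrix.star_apply]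
    · simp [mu_apply, eu_apply]
    · intro c _ hc; simp [mu_apply, eu_apply, hc]
    · simp
  · intro c _ hc
    rw [CStarMatrix.mul_apply, Finset.sum_eq_zero, zero_mul]
    intro k _; simp [mu_apply, eu_apply, hc]
  · simp

lemma rowm_gram2 (o : Fin d) (V V' : Fin d → A) (a b : Fin d) : (star (rowm o V) * rowm o V') a b = star (V a) * V' b := by
  rw [star_rowm, CStarMatrix.mul_apply, Finset.sum_eq_single o]
  · simp [colm_apply, rowm_apply]
  · intro c _ hc; simp [colm_apply, hc]
  · simp

lemma cm_le_of_entry {M : CStarMatrix (Fin d) (Fin d) A} {κ : ℝ} (h : ∀ a b, ‖M a b‖ ≤ κ) : ‖M‖ ≤ d ^ 2 * κ := by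
  refine (norm_cm_le_sum M).trans ((Finset.sum_le_sum fun i _ => Finset.sum_le_sum fun j _ => h i j).trans (le_of_eq ?_))
  simp; ring

lemma gram_ne (o : Fin d) {F F' : CStarMatrix (Fin d) (Fin d) A} {a0 a0' : Fin d} {x x' : A} {X0 t : ℝ} (hx : ‖x‖ ≤ X0) (hx' : ‖x'‖ ≤ X0)
    (h : ∀ b b', ‖F * mu (eu b b') * star F'‖ ≤ t) (b b' : Fin d) :
    ‖star (star (F a0 b) * x) * (star (F' a0' b') * x')‖ ≤ X0 ^ 2 * t := by
  have e1 : star (star (F a0 b) * x) * (star (F' a0' b') * x') = star x * (F * mu (eu b b') * star F' : CStarMatrix (Fin d) (Fin d) A) a0 a0' * x' := by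
    rw [mid_apply, star_mul, star_star]; simp only [mul_assoc]
  have hX : 0 ≤ X0 := (norm_nonneg _).trans hx
  rw [e1]
  calc _ ≤ ‖star x‖ * ‖(F * mu (eu b b') * star F' : CStarMatrix (Fin d) (Fin d) A) a0 a0'‖ * ‖x'‖ := (norm_mul_le _ _).trans (mul_le_mul_of_nonneg_right (norm_mul_le _ _) (norm_nonneg _))
    _ ≤ X0 * t * X0 := by
      have := (cm_entry (F * mu (eu b b') * star F' : CStarMatrix (Fin d) (Fin d) A) a0 a0').trans (h b b')
      have ht := (norm_nonneg _).trans this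
      rw [norm_star]; gcongr
    _ = _ := by ring

lemma gram_eq (o : Fin d) {F : CStarMatrix (Fin d) (Fin d) A} {a0 b0 : Fin d} {x : A} {X0 t : ℝ} (hx : ‖x‖ ≤ X0)
    (hx1 : star x * (F a0 b0 * star (F a0 b0)) * x = 1)
    (h : ∀ b b', ‖F * mu (eu b b' - if b = b' then eu b0 b0 else 0) * star F‖ ≤ t) (b b' : Fin d) :
    ‖star (star (F a0 b) * x) * (star (F a0 b') * x) - (if b = b' then 1 else 0)‖ ≤ X0 ^ 2 * t := by
  have e1 : star (star (F a0 b) * x) * (star (F a0 b') * x) - (if b = b' then 1 else 0) = star x * (F * mu (eu b b' - if b = b' then eu b0 b0 else 0) * star F : CStarMatrix (Fin d) (Fin d) A) a0 a0 * x := by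
    rw [map_sub, mul_sub, sub_mul, CStarMatrix.sub_apply, mid_apply, star_mul, star_star]
    split_ifs with hb
    · rw [mid_apply, mul_sub, sub_mul, hx1]; simp only [mul_assoc]
    · simp [mul_assoc]
  have hX : 0 ≤ X0 := (norm_nonneg _).trans hx
  rw [e1]
  calc _ ≤ ‖star x‖ * ‖(F * mu (eu b b' - if b = b' then eu b0 b0 else 0) * star F : CStarMatrix (Fin d) (Fin d) A) a0 a0‖ * ‖x‖ := (norm_mul_le _ _).trans (mul_le_mul_of_nonneg_right (norm_mul_le _ _) (norm_nonneg _))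
    _ ≤ X0 * t * X0 := by
      have := (cm_entry (F * mu (eu b b' - if b = b' then eu b0 b0 else 0) * star F : CStarMatrix (Fin d) (Fin d) A) a0 a0).trans (h b b')
      have ht := (norm_nonneg _).trans this
      rw [norm_star]; gcongr
    _ = _ := by ring

lemma rv_bound (o : Fin d) {v : A} {ω : CStarMatrix (Fin d) (Fin d) ℂ} (hω : ω ∈ unitary (CStarMatrix (Fin d) (Fin d) ℂ)) {F : CStarMatrix (Fin d) (Fin d) A} {a0 : Fin d} {x : A}
    {X0 rad t : ℝ} {y : ℂ} (hr : 0 ≤ rad) (ht : 0 ≤ t) (hx : ‖x‖ ≤ X0) (hV : ∀ b, ‖star (F a0 b) * x‖ ≤ 2) {c : CStarMatrix (Fin d) (Fin d) A} (hc : ‖c‖ ≤ rad)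
    (h : ‖(iot (Fin d) v * mu ω - y • 1) * star F - c * star F‖ ≤ t) :
    ‖mu (eu o o) * iot (Fin d) v * rowm o (fun b => star (F a0 b) * x) - y • (rowm o (fun b => star (F a0 b) * x) * mu (cj ω))‖ ≤ d * (2 * d * rad + t * X0) := by
  obtain ⟨V, hVd⟩ : ∃ V : Fin d → A, ∀ b, V b = star (F a0 b) * x := ⟨_, fun _ => rfl⟩
  simp only [← hVd] at hV ⊢
  obtain ⟨E, hE⟩ : ∃ E, E = (iot (Fin d) v * mu ω - y • 1) * star F - c * star F := ⟨_, rfl⟩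
  rw [← hE] at h
  have hVm : ∀ (G : CStarMatrix (Fin d) (Fin d) A) b, (G * star F) b a0 * x = (G * colm a0 V) b a0 := by
    intro G b
    rw [CStarMatrix.mul_apply, CStarMatrix.mul_apply, Finset.sum_mul]
    apply Finset.sum_congr rfl
    intro k _
    rw [colm_apply, if_pos rfl, hVd, CStarMatrix.star_apply, mul_assoc]
  have key : mu (eu o o) * iot (Fin d) v * rowm o V - y • (rowm o V * mu (cj ω)) = rowm o (fun b => (mu (star ω) * (c * colm a0 V) : CStarMatrix (Fin d) (Fin d) A) b a0 + (mu (star ω) * E : CStarMatrix (Fin d) (Fin d) A) b a0 * x) := by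
    have e1 : y • (rowm o V * mu (cj ω)) = rowm o (fun b => y • ∑ k, V k * mu (cj ω) k b) := by
      ext a b
      rw [CStarMatrix.smul_apply, CStarMatrix.mul_apply, rowm_apply]
      simp only [rowm_apply]
      split_ifs with ha <;> simp
    rw [crn_mul_rowm, e1, rowm_sub]
    congr 1
    funext b
    have e2 : ∑ k, V k * (mu (cj ω) : CStarMatrix (Fin d) (Fin d) A) k b = (mu (star ω) * star F : CStarMatrix (Fin d) (Fin d) A) b a0 * x := by
      rw [hVm, CStarMatrix.mul_apply]
      apply Finset.sum_congr rfl
      intro k _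
      rw [mu_apply, mu_apply, colm_apply, if_pos rfl, cj_apply, CStarMatrix.star_apply, ← Algebra.commutes]
    have e3 : v * V b = (iot (Fin d) v * star F) b a0 * x := by
      rw [hVm, CStarMatrix.mul_apply, Finset.sum_eq_single b]
      · simp [iot_apply, colm_apply]
      · intro k _ hk; simp [iot_apply, hk.symm]
      · simp
    have e4 : iot (Fin d) v * star F - y • (mu (star ω) * star F) = mu (star ω) * (c * star F) + mu (star ω) * E := by
      rw [hE, ← mul_add, add_sub_cancel, ← mul_assoc, mul_sub, ← mul_assoc, mu_iot, mul_assoc (iot _ _), ← map_mul, hω.1, map_one, mul_one, sub_mul, mul_smul_comm, mul_one, smul_mul_assoc]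
    rw [e2, e3, ← smul_mul_assoc, ← sub_mul, ← CStarMatrix.smul_apply, ← CStarMatrix.sub_apply, e4, CStarMatrix.add_apply, add_mul, ← mul_assoc, hVm, mul_assoc]
  rw [key]
  have hstar : ‖(mu (star ω) : CStarMatrix (Fin d) (Fin d) A)‖ ≤ 1 := (norm_mu_le _).trans (norm_unitary_le (Unitary.star_mem hω))
  have hcol : ‖colm a0 V‖ ≤ 2 * d := by
    refine (norm_cm_le_sum _).trans ?_
    have : ∀ i, ∑ j, ‖colm a0 V i j‖ ≤ 2 := by
      intro i
      rw [Finset.sum_eq_single a0]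
      · rw [colm_apply, if_pos rfl]; exact hV i
      · intro k _ hk; simp [colm_apply, hk]
      · simp
    refine (Finset.sum_le_sum fun i _ => this i).trans (le_of_eq ?_)
    simp; ring
  have hent : ∀ b, ‖(mu (star ω) * (c * colm a0 V) : CStarMatrix (Fin d) (Fin d) A) b a0 + (mu (star ω) * E : CStarMatrix (Fin d) (Fin d) A) b a0 * x‖ ≤ 2 * d * rad + t * X0 := by
    intro b
    refine nadd ((cm_entry _ _ _).trans (nmulL hstar ?_)) (nmul ((cm_entry _ _ _).trans (nmulL hstar h)) hx)
    refine (norm_mul_le _ _).trans ?_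
    rw [mul_comm (2 * (d : ℝ))]
    gcongr
  refine (norm_cm_le_sum _).trans ?_
  rw [Finset.sum_eq_single o]
  · refine (Finset.sum_le_sum fun j _ => (?_ : _ ≤ 2 * d * rad + t * X0)).trans (le_of_eq ?_)
    · rw [rowm_apply, if_pos rfl]; exact hent j
    · simp; ring
  · intro k _ hk; simp [rowm_apply, hk]
  · simp
end rows

section col
variable {κ : Type} [Fintype κ] [DecidableEq κ] {D : Type u} [CStarAlgebra D]

lemma FE_bound (o : κ) {F X c : κ → D} {rad t : ℝ} (hr : 0 ≤ rad) (ht : 0 ≤ t) (hF : ‖∑ i, star (F i) * F i‖ ≤ 4) (hc : ∀ i, ‖c i‖ ≤ rad)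
    (h : ∀ i, ‖X i - c i * F i‖ ≤ t) : ‖∑ i, star (X i) * X i‖ ≤ (2 * rad + Fintype.card κ * t) ^ 2 := by
  have h1 : colm o X = dgh c * colm o F + colm o (fun i => X i - c i * F i) := by
    rw [dgh_mul_colm, ← colm_sub]; abel
  have h2 : ‖colm o (fun i => X i - c i * F i)‖ ≤ Fintype.card κ * t := by
    refine (norm_cm_le_sum _).trans ?_
    have : ∀ i, ∑ j, ‖colm o (fun i => X i - c i * F i) i j‖ ≤ t := by
      intro i
      rw [Finset.sum_eq_single o]
      · rw [colm_apply, if_pos rfl]; exact h i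
      · intro k _ hk; simp [colm_apply, hk]
      · simp
    refine (Finset.sum_le_sum fun i _ => this i).trans (le_of_eq ?_)
    simp
  have h3 : ‖colm o F‖ ≤ 2 := norm_colm_le o zero_le_two (hF.trans (by norm_num))
  have h4 : ‖colm o X‖ ≤ 2 * rad + Fintype.card κ * t := by
    rw [h1]
    refine nadd ((norm_mul_le _ _).trans ?_) h2
    rw [mul_comm]
    exact mul_le_mul h3 (norm_dgh_le hr hc) (norm_nonneg _) zero_le_two
  have h5 : (star (colm o X) * colm o X) o o = ∑ i, star (X i) * X i := by
    rw [star_colm, rowm_mul_colm, mu_iot_apply]; simp [eu_apply]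
  rw [← h5]
  refine (cm_entry _ _ _).trans ?_
  rw [CStarRing.norm_star_mul_self, sq]
  exact mul_le_mul h4 h4 (norm_nonneg _) ((norm_nonneg _).trans h4)
end col

end PIS

namespace PIS
universe u
set_option linter.all false

set_option maxHeartbeats 1000000 in
theorem init_core {n d q : ℕ} [NeZero d] (hq : 0 < q) {lam : Fin n → Fin n → ℂ} {ω : Fin n → CStarMatrix (Fin d) (Fin d) ℂ}
    (hω : ∀ j, ω j ∈ unitary (CStarMatrix (Fin d) (Fin d) ℂ)) (hωq : ∀ j, ω j ^ q = 1)
    (hrel : ∀ j k, cj (ω k) * cj (ω j) = lam j k • (cj (ω j) * cj (ω k)))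
    {A : Type u} [CStarAlgebra A] (hA : IsPurelyInfiniteSimple A) {v : Fin n → A} (hv : ∀ j, v j ∈ unitary A)
    {K : ℝ} (hK0 : 0 ≤ K) (hK : ∀ (X Y : CStarMatrix (Fin d) (Fin d) A) (t : ℝ), 0 ≤ t →
      ((∀ U χ, Hom q ω U χ → ‖X * mu U * Y‖ ≤ t) → ∀ b b', ‖X * mu (eu b b') * Y‖ ≤ K * t) ∧
      ((∀ U χ, Hom q ω U χ → (∃ j, χ j ≠ 1) → ‖X * mu U * Y‖ ≤ t) → ∀ b b' b0, ‖X * mu (eu b b' - if b = b' then eu b0 b0 else 0) * Y‖ ≤ K * t))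
    {ι : Type} [Fintype ι] [DecidableEq ι] {w : ι → ℂ} {N : ℕ} (hN : 0 < N) (hwN : ∀ i, w i ^ N = 1)
    {rad τ ε' g β η : ℝ} (hr0 : 0 < rad) (hτ0 : 0 < τ) (hε0 : 0 < ε') (hβ : 0 < β) (hgap : ∀ χ : ℂ, χ ^ q = 1 → χ ≠ 1 → g ≤ ‖1 - χ‖)
    (hr1 : 2 * rad ≤ ε') (hr2 : 2 * rad ≤ g)
    {F : (Fin n → ι) → CStarMatrix (Fin d) (Fin d) A} (hF1 : ∑ z, star (F z) * F z = 1)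
    (hF2 : ∀ z j, ∃ c : CStarMatrix (Fin d) (Fin d) A, ‖c‖ ≤ rad ∧ ‖F z * (iot (Fin d) (v j) * mu (ω j) - w (z j) • 1) - c * F z‖ ≤ 2 * n * τ ∧
        ‖(iot (Fin d) (v j) * mu (ω j) - w (z j) • 1) * star (F z) - c * star (F z)‖ ≤ n * τ)
    (hF3 : ∀ W ∈ unitary (CStarMatrix (Fin d) (Fin d) A), ∀ χ : Fin n → ℂ, (∀ j, χ j ^ q = 1) →
        (∀ j, (iot (Fin d) (v j) * mu (ω j)) * W = χ j • (W * (iot (Fin d) (v j) * mu (ω j)))) → ∀ z z' : Fin n → ι,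
        (∃ j, 2 * rad ≤ ‖w (z j) - χ j * w (z' j)‖) → ‖F z * W * star (F z')‖ ≤ 2 * n * τ)
    {ι' : Type} [Fintype ι'] {w' : ι' → ℂ} (hcov : ∀ z : ℂ, ‖z‖ = 1 → ∃ i, ‖z - w' i‖ < ε' / 2)
    {Nz KZ : ℕ} (hNz : Nz = Fintype.card ι ^ n) (hKZ : KZ = Fintype.card ι' ^ n) {X0 κ : ℝ} (hX0 : X0 = 2 * d ^ 2 / β) (hκ : κ = X0 ^ 2 * (K * (2 * n * τ)))
    (k1 : Nz * β ^ 2 ≤ 1 / 2) (k2 : κ ≤ 1) (k3 : (Nz * d : ℝ) ^ 2 * (d ^ 2 * κ) ≤ 1 / 2)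
    (k4 : 2 * rad + Nz * (2 * n * τ) + 8 * (Nz * β ^ 2) ≤ η)
    (k5 : KZ * (d * (2 * d * rad + n * τ * X0)) + 2 * ε' + 8 * ((Nz * d : ℝ) ^ 2 * (d ^ 2 * κ)) ≤ η) :
    Nonempty (Sys lam v η (fun _ => 2 * η)) := by
  classical
  have hwn : ∀ i, ‖w i‖ = 1 := fun i => Complex.norm_eq_one_of_pow_eq_one (hwN i) hN.ne'
  have hκ0 : 0 ≤ κ := by rw [hκ]; positivity
  have hX00 : 0 ≤ X0 := by rw [hX0]; positivity
  let o : Fin d := 0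
  obtain ⟨e, T1, T2, X, cz⟩ := PI3 hA
  have hone : ‖(1 : A)‖ = 1 := by
    have : Nontrivial A := by
      by_contra h
      rw [not_nontrivial_iff_subsingleton] at h
      obtain ⟨⟨a, ha⟩, _⟩ := hA
      exact ha ⟨0, Subsingleton.elim _ _⟩
    exact norm_one
  let Zt := {z : Fin n → ι // β ≤ ‖F z‖}
  have hcardZ : Fintype.card Zt ≤ Nz := by
    rw [hNz]
    refine (Fintype.card_subtype_le _).trans ?_
    simp
  have hcardZR : (Fintype.card Zt : ℝ) ≤ Nz := by exact_mod_cast hcardZ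
  have hF : ‖∑ z : Zt, star (F z) * F z - 1‖ ≤ Nz * β ^ 2 := by
    have h1 := Fintype.sum_subtype_add_sum_subtype (fun z : Fin n → ι => β ≤ ‖F z‖) (fun z => star (F z) * F z)
    rw [hF1] at h1
    have h2 : ∑ z : Zt, star (F z) * F z - 1 = - ∑ z : {z : Fin n → ι // ¬ β ≤ ‖F z‖}, star (F z) * F z := by
      rw [← h1]; abel
    rw [h2, norm_neg]
    refine (norm_sum_le _ _).trans ?_
    refine (Finset.sum_le_sum fun z _ => (?_ : _ ≤ β ^ 2)).trans ?_
    · rw [CStarRing.norm_star_mul_self, ← sq]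
      have := not_le.1 z.2
      gcongr
    · rw [Finset.sum_const, nsmul_eq_mul]
      have : (Finset.univ : Finset {z : Fin n → ι // ¬ β ≤ ‖F z‖}).card ≤ Nz := by
        rw [Finset.card_univ, hNz]
        refine (Fintype.card_subtype_le _).trans ?_
        simp
      have : ((Finset.univ : Finset {z : Fin n → ι // ¬ β ≤ ‖F z‖}).card : ℝ) ≤ Nz := by exact_mod_cast this
      gcongr
  have hone' : (1 : ℝ) ≤ ‖(1 : CStarMatrix (Fin d) (Fin d) A)‖ := by
    rw [← hone]
    have := cm_entry (1 : CStarMatrix (Fin d) (Fin d) A) o o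
    rwa [CStarMatrix.one_apply, if_pos rfl] at this
  have hne : Nonempty Zt := by
    by_contra h
    rw [not_nonempty_iff] at h
    rw [Fintype.sum_empty, zero_sub, norm_neg] at hF
    linarith
  obtain ⟨z0⟩ := hne
  -- relation
  let zz : Zt → Fin n → ℂ := fun z j => w (z.1 j)
  have hzzn : ∀ z j, ‖zz z j‖ = 1 := fun z j => hwn _
  have hχn : ∀ χ : ℂ, χ ^ q = 1 → ‖χ‖ = 1 := fun χ h => Complex.norm_eq_one_of_pow_eq_one h hq.ne'
  obtain ⟨S, hS1, hS2⟩ := dominate (fun z y : Zt => ∃ U χ, Hom q ω U χ ∧ ∀ j, ‖zz z j - χ j * zz y j‖ < ε')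
    (fun z => ⟨1, fun _ => 1, ⟨one_mem _, fun _ => one_pow _, fun j => by rw [mul_one, one_mul, one_smul]⟩, fun j => by simpa using hε0⟩)
    (by
      rintro z y ⟨U, χ, hU, h⟩
      refine ⟨star U, fun j => star (χ j), Hom.star hq hω hU, fun j => ?_⟩
      have h1 : χ j * star (χ j) = 1 := by
        rw [Complex.star_def, Complex.mul_conj, Complex.normSq_eq_norm_sq, hχn _ (hU.2.1 j)]; simp
      have h2 : zz y j - star (χ j) * zz z j = - (star (χ j) * (zz z j - χ j * zz y j)) := by
        linear_combination (- zz y j) * h1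
      rw [h2, norm_neg, norm_mul, norm_star, hχn _ (hU.2.1 j), one_mul]
      exact h j)
  let Y := {z : Zt // z ∈ S}
  have hcardY : Fintype.card Y ≤ KZ := by
    choose gg hgg using fun (z : Zt) (j : Fin n) => hcov (zz z j) (hzzn z j)
    rw [hKZ]
    have : Fintype.card Y ≤ Fintype.card (Fin n → ι') := by
      refine Fintype.card_le_of_injective (fun y : Y => gg y.1) ?_
      intro y y' hyy
      by_contra hne
      refine hS1 y.1 y.2 y'.1 y'.2 (fun h => hne (Subtype.ext h)) ⟨1, fun _ => 1, ⟨one_mem _, fun _ => one_pow _, fun j => by rw [mul_one, one_mul, one_smul]⟩, fun j => ?_⟩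
      have h1 := hgg y.1 j
      have h2 := hgg y'.1 j
      have h3 : gg y.1 j = gg y'.1 j := congrFun hyy j
      rw [← h3] at h2
      rw [one_mul]
      have : zz y.1 j - zz y'.1 j = (zz y.1 j - w' (gg y.1 j)) - (zz y'.1 j - w' (gg y.1 j)) := by ring
      rw [this]
      linarith [norm_sub_le (zz y.1 j - w' (gg y.1 j)) (zz y'.1 j - w' (gg y.1 j))]
    simpa using this
  have hcardYR : (Fintype.card Y : ℝ) ≤ KZ := by exact_mod_cast hcardY
  choose ys0 hys0 U χ hU hUχ using hS2
  -- the rows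
  choose a0 b0 x hx hx1 using fun z : Zt => row_ex hA (F z.1) hβ z.2
  rw [← hX0] at hx
  have hHom : ∀ U χ, Hom q ω U χ → (mu U : CStarMatrix (Fin d) (Fin d) A) ∈ unitary (CStarMatrix (Fin d) (Fin d) A) ∧ (∀ j, χ j ^ q = 1) ∧
      ∀ j, (iot (Fin d) (v j) * mu (ω j)) * mu U = χ j • (mu U * (iot (Fin d) (v j) * mu (ω j))) := by
    intro U χ h
    refine ⟨⟨by rw [← map_star, ← map_mul, h.1.1, map_one], by rw [← map_star, ← map_mul, h.1.2, map_one]⟩, h.2.1, fun j => ?_⟩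
    rw [mul_assoc, ← map_mul, h.2.2, mu_smul, mul_smul_comm, map_mul, ← mul_assoc, ← mu_iot, mul_assoc]
  have ht0 : (0 : ℝ) ≤ 2 * n * τ := by positivity
  have gne : ∀ y y' : Y, y ≠ y' → ∀ b b', ‖star (star (F y.1.1 (a0 y.1) b) * x y.1) * (star (F y'.1.1 (a0 y'.1) b') * x y'.1)‖ ≤ κ := by
    intro y y' hyy b b'
    rw [hκ]
    refine gram_ne o (hx _) (hx _) ((hK (F y.1.1) (star (F y'.1.1)) _ ht0).1 ?_) b b'
    intro U χ h
    obtain ⟨h1, h2, h3⟩ := hHom U χ h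
    refine hF3 _ h1 χ h2 h3 _ _ ?_
    by_contra hcon
    push Not at hcon
    refine hS1 y.1 y.2 y'.1 y'.2 (fun h => hyy (Subtype.ext h)) ⟨U, χ, h, fun j => ?_⟩
    exact (hcon j).trans_le hr1
  have geq : ∀ z : Zt, ∀ b b', ‖star (star (F z.1 (a0 z) b) * x z) * (star (F z.1 (a0 z) b') * x z) - (if b = b' then 1 else 0)‖ ≤ κ := by
    intro z b b'
    rw [hκ]
    refine gram_eq o (hx _) (hx1 _) (fun b b' => (hK (F z.1) (star (F z.1)) _ ht0).2 ?_ b b' (b0 z)) b b'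
    intro U χ h ⟨j, hj⟩
    obtain ⟨h1, h2, h3⟩ := hHom U χ h
    refine hF3 _ h1 χ h2 h3 _ _ ⟨j, ?_⟩
    have : w (z.1 j) - χ j * w (z.1 j) = (1 - χ j) * w (z.1 j) := by ring
    rw [this, norm_mul, hwn, mul_one]
    exact hr2.trans (hgap _ (h2 j) hj)
  have hV2 : ∀ z : Zt, ∀ b, ‖star (F z.1 (a0 z) b) * x z‖ ≤ 2 := by
    intro z b
    apply norm_le_of_sq zero_le_two
    have h1 := geq z b b
    rw [if_pos rfl] at h1
    have h2 := norm_le_norm_add_norm_sub' (star (star (F z.1 (a0 z) b) * x z) * (star (F z.1 (a0 z) b) * x z)) 1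
    rw [hone] at h2
    linarith
  choose c hc hc1 hc2 using hF2
  refine init_sys2 hv o hq hω hωq hrel z0 zz hN (fun z j => hwN _) (fun z : Zt => F z.1) (τ1 := Nz * β ^ 2) (τ2 := d ^ 2 * κ)
    (τ' := d * (2 * d * rad + n * τ * X0)) (ε' := ε') (η1 := 2 * rad + Nz * (2 * n * τ)) (η := η) k1 hF (by positivity) ?_ cz
    (fun y : Y => zz y.1) (fun z => ⟨ys0 z, hys0 z⟩) (fun y => rowm o (fun b => star (F y.1.1 (a0 y.1) b) * x y.1)) ?_ ?_ ?_
    (fun z => cj (star (U z))) (fun z => cj_unitary (Unitary.star_mem (hU z).1)) χ ?_ hε0.le ?_ ?_ k4 ?_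
  · intro j
    have h1 : ‖∑ z : Zt, star (F z) * F z‖ ≤ 4 := by
      have := norm_le_norm_add_norm_sub' (∑ z : Zt, star (F z) * F z) 1
      have h2 : ‖(1 : CStarMatrix (Fin d) (Fin d) A)‖ ≤ 1 := norm_one_le
      linarith
    refine (FE_bound z0 (X := fun z : Zt => F z.1 * (iot (Fin d) (v j) * mu (ω j) - zz z j • 1)) (c := fun z : Zt => c z.1 j) hr0.le ht0 h1 (fun z => hc _ _) (fun z => hc1 _ _)).trans ?_
    have := hr0.le
    gcongr
  · intro y
    have := crn_mul_rowm o (fun b => star (F y.1.1 (a0 y.1) b) * x y.1) 1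
    rw [map_one, mul_one] at this
    simpa using this
  · intro y y'
    apply cm_le_of_entry
    intro b b'
    rw [CStarMatrix.sub_apply, rowm_gram2]
    by_cases hyy : y = y'
    · subst hyy
      rw [if_pos rfl, CStarMatrix.one_apply]
      exact geq y.1 b b'
    · rw [if_neg hyy, CStarMatrix.zero_apply, sub_zero]
      exact gne y y' hyy b b'
  · intro y j
    exact rv_bound o (hω j) hr0.le (by positivity) (hx _) (hV2 _) (hc y.1.1 j) (hc2 y.1.1 j)
  · intro z j
    have := congrArg cj ((Hom.star hq hω (hU z)).2.2 j)
    rw [cj_mul, cj_smul, cj_mul, star_star] at this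
    exact this
  · intro z j
    rw [mul_comm, norm_sub_rev]
    exact (hUχ z j).le
  · refine le_trans ?_ k3
    gcongr
  · refine le_trans ?_ k5
    gcongr

theorem init_exists {n q : ℕ} (hq : 0 < q) {lam : Fin n → Fin n → ℂ} (hlq : ∀ j k, lam j k ^ q = 1) (hld : ∀ j, lam j j = 1)
    (hls : ∀ j k, lam j k * lam k j = 1) {η : ℝ} (hη : 0 < η) :
    ∃ δ > (0 : ℝ), ∀ (A : Type u) [CStarAlgebra A], IsPurelyInfiniteSimple A → ∀ v : Fin n → A, (∀ j, v j ∈ unitary A) →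
      (∀ j k, ‖v k * v j - lam j k • (v j * v k)‖ ≤ δ) → Nonempty (Sys lam v η (fun _ => 2 * η)) := by
  obtain ⟨d, hd, ω, hω, hωq, hL, hsch⟩ := rep_exists (L := fun k j => star (lam j k)) hq (fun j k => by rw [← star_pow, hlq, star_one])
    (fun j => by rw [hld, star_one]) (fun j k => by rw [← star_mul', hls, star_one])
  have : NeZero d := ⟨hd.ne'⟩
  have hln : ∀ j k, ‖lam j k‖ = 1 := fun j k => Complex.norm_eq_one_of_pow_eq_one (hlq j k) hq.ne'
  obtain ⟨K, hK0, hK⟩ := Kbound.{u} hq hω hωq hL (fun j k => by rw [norm_star]; exact hln _ _) hsch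
  obtain ⟨g, g0, hgap⟩ := root_gap hq
  obtain ⟨ε', hε'⟩ : ∃ ε', ε' = η / 16 := ⟨_, rfl⟩
  have hε0 : 0 < ε' := by rw [hε']; positivity
  have hrel : ∀ j k, cj (ω k) * cj (ω j) = lam j k • (cj (ω j) * cj (ω k)) := by
    intro j k
    have := congrArg cj (hL j k)
    rw [cj_mul, cj_smul, cj_mul, star_star] at this
    exact this
  obtain ⟨ι', i1, i2, w', N', f', hN', hwN', -, -, -, hsum', hsup'⟩ := grid (half_pos hε0)
  have hcov : ∀ z : ℂ, ‖z‖ = 1 → ∃ i, ‖z - w' i‖ < ε' / 2 := by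
    intro z hz
    by_contra hcon
    push Not at hcon
    have h1 := hsum' z (by simpa using hz)
    rw [Finset.sum_eq_zero] at h1
    · exact zero_ne_one h1
    · intro i _
      have : f' i z = 0 := by
        by_contra h
        exact absurd (hsup' i z h) (not_lt.2 (hcon i))
      rw [this, zero_mul]
  obtain ⟨KZ, hKZ⟩ : ∃ KZ : ℕ, KZ = Fintype.card ι' ^ n := ⟨_, rfl⟩
  obtain ⟨r1, r10, hr1⟩ := small_of (KZ * (d * (2 * d))) (s := η / 16) (by positivity)
  obtain ⟨rad, hrad⟩ : ∃ rad, rad = min r1 (min (ε' / 2) (g / 2)) := ⟨_, rfl⟩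
  have hr0 : 0 < rad := by rw [hrad]; positivity
  have hrr1 : rad ≤ r1 := hrad ▸ min_le_left _ _
  have hrr2 : rad ≤ ε' / 2 := hrad ▸ (min_le_right _ _).trans (min_le_left _ _)
  have hrr3 : rad ≤ g / 2 := hrad ▸ (min_le_right _ _).trans (min_le_right _ _)
  obtain ⟨ι, i3, i4, w, N, f, hN, hwN, hf, hfs, hf1, hsum, hsup⟩ := grid hr0
  obtain ⟨Nz, hNz⟩ : ∃ Nz : ℕ, Nz = Fintype.card ι ^ n := ⟨_, rfl⟩
  obtain ⟨β2, β20, hβ2⟩ := small_of (Nz : ℝ) (s := min (1 / 2) (η / 64)) (by positivity)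
  obtain ⟨β, hβ⟩ : ∃ β, β = Real.sqrt β2 := ⟨_, rfl⟩
  have hβ0 : 0 < β := by rw [hβ]; positivity
  have hββ : β ^ 2 = β2 := by rw [hβ, Real.sq_sqrt β20.le]
  rw [← hββ, abs_of_nonneg (by positivity)] at hβ2
  obtain ⟨X0, hX0⟩ : ∃ X0 : ℝ, X0 = 2 * d ^ 2 / β := ⟨_, rfl⟩
  have hX00 : 0 ≤ X0 := by rw [hX0]; positivity
  obtain ⟨C1, hC1⟩ : ∃ C1 : ℝ, C1 = X0 ^ 2 * (K * (2 * n)) := ⟨_, rfl⟩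
  obtain ⟨C2, hC2⟩ : ∃ C2 : ℝ, C2 = (Nz * d : ℝ) ^ 2 * (d ^ 2 * C1) := ⟨_, rfl⟩
  obtain ⟨C3, hC3⟩ : ∃ C3 : ℝ, C3 = Nz * (2 * n) := ⟨_, rfl⟩
  obtain ⟨C4, hC4⟩ : ∃ C4 : ℝ, C4 = KZ * (d * (n * X0)) := ⟨_, rfl⟩
  have hC10 : 0 ≤ C1 := by rw [hC1]; positivity
  have hC20 : 0 ≤ C2 := by rw [hC2]; positivity
  have hC30 : 0 ≤ C3 := by rw [hC3]; positivity
  have hC40 : 0 ≤ C4 := by rw [hC4]; positivity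
  obtain ⟨τ, τ0, hτ⟩ := small_of (C1 + C2 + C3 + C4) (s := min (1 / 2) (η / 64)) (by positivity)
  rw [abs_of_nonneg (by positivity)] at hτ
  have m1 : min (1 / 2) (η / 64) ≤ 1 / 2 := min_le_left _ _
  have m2 : min (1 / 2) (η / 64) ≤ η / 64 := min_le_right _ _
  have p1 : 0 ≤ C1 * τ := by positivity
  have p2 : 0 ≤ C2 * τ := by positivity
  have p3 : 0 ≤ C3 * τ := by positivity
  have p4 : 0 ≤ C4 * τ := by positivity
  have hτ' : C1 * τ + C2 * τ + C3 * τ + C4 * τ ≤ min (1 / 2) (η / 64) := by linarith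
  obtain ⟨δ, δ0, hδ⟩ := T2.{u} (n := n) hq hr0 τ0 hf hfs hf1 hsum hsup
  refine ⟨δ, δ0, ?_⟩
  intro A _ hA v hv hcom
  have hΩ : ∀ j, (iot (Fin d) (v j) * mu (ω j) : CStarMatrix (Fin d) (Fin d) A) ∈ unitary (CStarMatrix (Fin d) (Fin d) A) := by
    intro j
    refine mul_mem ⟨?_, ?_⟩ ⟨?_, ?_⟩
    · rw [← map_star, ← map_mul, (Unitary.mem_iff.1 (hv j)).1, map_one]
    · rw [← map_star, ← map_mul, (Unitary.mem_iff.1 (hv j)).2, map_one]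
    · rw [← map_star, ← map_mul, (hω j).1, map_one]
    · rw [← map_star, ← map_mul, (hω j).2, map_one]
  obtain ⟨F, hF1, -, hF2, hF3⟩ := hδ (CStarMatrix (Fin d) (Fin d) A) (fun j => iot (Fin d) (v j) * mu (ω j)) hΩ (by
    intro j k
    have h0 : ∀ a b : Fin n, (iot (Fin d) (v a) * mu (ω a)) * (iot (Fin d) (v b) * mu (ω b)) = (iot (Fin d) (v a * v b) * mu (ω a * ω b) : CStarMatrix (Fin d) (Fin d) A) := by
      intro a b
      rw [map_mul, map_mul, mul_assoc, ← mul_assoc (mu (ω a)), mu_iot]; simp only [mul_assoc]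
    have h1 : ω j * ω k = lam j k • (ω k * ω j) := by
      have hc : lam j k * star (lam j k) = 1 := by
        rw [Complex.star_def, Complex.mul_conj, Complex.normSq_eq_norm_sq, hln]; simp
      rw [hL j k, smul_smul, hc, one_smul]
    have h2 : (iot (Fin d) (v k) * mu (ω k)) * (iot (Fin d) (v j) * mu (ω j)) - (iot (Fin d) (v j) * mu (ω j)) * (iot (Fin d) (v k) * mu (ω k))
        = (iot (Fin d) (v k * v j - lam j k • (v j * v k)) * mu (ω k * ω j) : CStarMatrix (Fin d) (Fin d) A) := by
      have h3 : iot (Fin d) (lam j k • (v j * v k)) = lam j k • iot (Fin d) (v j * v k) := by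
        ext a b
        rw [CStarMatrix.smul_apply, iot_apply, iot_apply]; split_ifs <;> simp
      rw [h0, h0, h1, mu_smul, map_sub, h3, sub_mul, smul_mul_assoc, mul_smul_comm]
    rw [h2]
    exact nmulR ((norm_iot_le _).trans (hcom j k)) ((norm_mu_le _).trans (norm_unitary_le (mul_mem (hω k) (hω j)))))
  have hC1' : C1 * τ = X0 ^ 2 * (K * (2 * n * τ)) := by rw [hC1]; ring
  have hC2' : (Nz * d : ℝ) ^ 2 * (d ^ 2 * (C1 * τ)) = C2 * τ := by rw [hC2]; ring
  have hC3' : Nz * (2 * n * τ) = C3 * τ := by rw [hC3]; ring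
  have hC4' : KZ * (d * (2 * d * rad + n * τ * X0)) = KZ * (d * (2 * d)) * rad + C4 * τ := by rw [hC4]; ring
  have hrr : KZ * (d * (2 * d)) * rad ≤ η / 16 := by
    rw [abs_of_nonneg (by positivity)] at hr1
    refine le_trans ?_ hr1
    gcongr
  refine init_core hq hω hωq hrel hA hv hK0 (fun X Y t ht => hK A X Y t ht) hN hwN hr0 τ0 hε0 hβ0 hgap (by linarith) (by linarith) hF1 hF2 hF3 hcov hNz hKZ hX0 hC1' ?_ ?_ ?_ ?_ ?_
  · linarith
  · linarith
  · rw [hC2']; linarith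
  · rw [hC3']; linarith
  · rw [hC2', hC4']; linarith

end PIS

namespace PIS
universe u
set_option linter.all false

theorem improve {n q : ℕ} (hq : 0 < q) {lam : Fin n → Fin n → ℂ} (hlq : ∀ j k, lam j k ^ q = 1) (hld : ∀ j, lam j j = 1)
    (hls : ∀ j k, lam j k * lam k j = 1) {ε : ℝ} (hε : 0 < ε) :
    ∃ δ > (0 : ℝ), ∀ δ0 > (0 : ℝ), ∀ (A : Type u) [CStarAlgebra A], IsPurelyInfiniteSimple A → ∀ v : Fin n → A, (∀ j, v j ∈ unitary A) →
      (∀ j k, ‖v k * v j - lam j k • (v j * v k)‖ ≤ δ) → ∃ w : Fin n → A, (∀ j, w j ∈ unitary A) ∧ (∀ j, ‖w j - v j‖ ≤ ε) ∧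
        ∀ j k, ‖w k * w j - lam j k • (w j * w k)‖ ≤ δ0 := by
  classical
  have hln : ∀ j k, ‖lam j k‖ = 1 := fun j k => Complex.norm_eq_one_of_pow_eq_one (hlq j k) hq.ne'
  obtain ⟨η, hη⟩ : ∃ η, η = ε / (16 * (n + 1)) := ⟨_, rfl⟩
  have hη0 : 0 < η := by rw [hη]; positivity
  choose cc cc0 hsq using fun i : Fin n => squeeze.{u} hq hlq hls hld i hη0
  obtain ⟨c0, c00, hc0⟩ : ∃ c0 > (0 : ℝ), ∀ i, c0 ≤ cc i := by
    by_cases hne : Nonempty (Fin n)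
    · obtain ⟨i0, h0⟩ := Finite.exists_min cc
      exact ⟨cc i0, cc0 i0, h0⟩
    · exact ⟨1, one_pos, fun i => absurd ⟨i⟩ hne⟩
  obtain ⟨c1, hc1⟩ : ∃ c1, c1 = c0 / 16 ^ n := ⟨_, rfl⟩
  have hc10 : 0 < c1 := by rw [hc1]; positivity
  have hc1' : 16 ^ n * c1 = c0 := by rw [hc1]; field_simp
  obtain ⟨η0, hη0'⟩ : ∃ η0, η0 = min η (c1 / 2) := ⟨_, rfl⟩
  have hη00 : 0 < η0 := by rw [hη0']; positivity
  have e1 : η0 ≤ η := hη0' ▸ min_le_left _ _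
  have e2 : η0 ≤ c1 / 2 := hη0' ▸ min_le_right _ _
  obtain ⟨δ, δpos, hδ⟩ := init_exists.{u} hq hlq hld hls hη00
  refine ⟨δ, δpos, ?_⟩
  intro δ0 hδ0 A _ hA v hv hcom
  obtain ⟨t, ht⟩ : ∃ t, t = min (1 / 50) (min (ε / 36) (δ0 / 60)) := ⟨_, rfl⟩
  have t0 : 0 < t := by rw [ht]; positivity
  have t1 : t ≤ 1 / 50 := ht ▸ min_le_left _ _
  have t2 : t ≤ ε / 36 := ht ▸ (min_le_right _ _).trans (min_le_left _ _)
  have t3 : t ≤ δ0 / 60 := ht ▸ (min_le_right _ _).trans (min_le_right _ _)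
  obtain ⟨d', hd'⟩ : ∃ d', d' = min c1 (t ^ 2 / 16 ^ n) := ⟨_, rfl⟩
  have d0 : 0 < d' := by rw [hd']; positivity
  have d1 : d' ≤ c1 := hd' ▸ min_le_left _ _
  have d2 : d' ≤ t ^ 2 / 16 ^ n := hd' ▸ min_le_right _ _
  have d2' : 16 ^ n * d' ≤ t ^ 2 := by
    rw [le_div_iff₀ (by positivity)] at d2; linarith
  have key : ∀ s : Finset (Fin n), ∃ c : Fin n → ℝ, Nonempty (Sys lam v (η0 + s.card * η) c) ∧ (∀ j ∈ s, c j ≤ 16 ^ s.card * d') ∧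
      ∀ j, c j ≤ 16 ^ s.card * c1 := by
    intro s
    induction s using Finset.induction_on with
    | empty =>
      refine ⟨fun _ => 2 * η0, ?_, by simp, fun j => ?_⟩
      · simpa using hδ A hA v hv hcom
      · simp; linarith
    | insert i s hi ih =>
      obtain ⟨c, ⟨S⟩, h1, h2⟩ := ih
      have hcard : s.card + 1 ≤ n := by
        rw [← Finset.card_insert_of_notMem hi]
        exact (Finset.card_le_univ _).trans (by simp)
      have hle : ∀ j, c j ≤ cc i := by
        intro j
        refine (h2 j).trans (le_trans ?_ (hc0 i))
        rw [← hc1']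
        gcongr
        · norm_num
        · omega
      have hS := hsq i d' d0 A v _ c hle S
      rw [Finset.card_insert_of_notMem hi]
      have h16 : (1 : ℝ) ≤ 16 ^ (s.card + 1) := one_le_pow₀ (by norm_num)
      refine ⟨fun j => if j = i then d' else 16 * c j, ?_, ?_, ?_⟩
      · have : η0 + ((s.card + 1 : ℕ) : ℝ) * η = η0 + s.card * η + η := by push_cast; ring
        rw [this]; exact hS
      · intro j hj
        show (if j = i then d' else 16 * c j) ≤ _
        split_ifs with hji
        · nlinarith
        · have := h1 j ((Finset.mem_insert.1 hj).resolve_left hji)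
          rw [pow_succ]; linarith
      · intro j
        show (if j = i then d' else 16 * c j) ≤ _
        split_ifs with hji
        · nlinarith
        · have := h2 j
          rw [pow_succ]; linarith
  obtain ⟨c, ⟨S⟩, h1, -⟩ := key Finset.univ
  rw [Finset.card_univ, Fintype.card_fin] at h1 S
  obtain ⟨w, hw1, hw2, hw3⟩ := final (fun j k => (hln j k).le) hv t0.le t1 (fun j => (h1 j (Finset.mem_univ _)).trans d2') S
  refine ⟨w, hw1, fun j => (hw2 j).trans ?_, fun j k => (hw3 j k).trans (by linarith)⟩
  have h3 : 16 * ((n + 1) * η) = ε := by rw [hη]; field_simp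
  nlinarith

theorem stable {n q : ℕ} (hq : 0 < q) {lam : Fin n → Fin n → ℂ} (hlq : ∀ j k, lam j k ^ q = 1) (hld : ∀ j, lam j j = 1)
    (hls : ∀ j k, lam j k * lam k j = 1) {ε : ℝ} (hε : 0 < ε) :
    ∃ δ > (0 : ℝ), ∀ (A : Type u) [CStarAlgebra A], IsPurelyInfiniteSimple A → ∀ v : Fin n → A, (∀ j, v j ∈ unitary A) →
      (∀ j k, ‖v k * v j - lam j k • (v j * v k)‖ < δ) → ∃ w : Fin n → A, (∀ j, w j ∈ unitary A) ∧
        (∀ j k, w k * w j = lam j k • (w j * w k)) ∧ ∀ j, ‖w j - v j‖ < ε := by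
  choose D D0 hD using fun k : ℕ => improve.{u} hq hlq hld hls (ε := ε / 2 / 2 / 2 ^ k) (by positivity)
  obtain ⟨δ, hδ⟩ : ∃ δ : ℕ → ℝ, ∀ k, δ k = min (D k) (1 / ((k : ℝ) + 1)) := ⟨_, fun _ => rfl⟩
  have δ0 : ∀ k, 0 < δ k := fun k => by rw [hδ]; exact lt_min (D0 k) (by positivity)
  have δD : ∀ k, δ k ≤ D k := fun k => by rw [hδ]; exact min_le_left _ _
  have δ1 : ∀ k, δ k ≤ 1 / ((k : ℝ) + 1) := fun k => by rw [hδ]; exact min_le_right _ _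
  refine ⟨δ 0, δ0 0, ?_⟩
  intro A _ hA v hv hcom
  let S : ℕ → Type u := fun k => {v : Fin n → A // (∀ j, v j ∈ unitary A) ∧ ∀ i j, ‖v j * v i - lam i j • (v i * v j)‖ ≤ δ k}
  have step : ∀ k (x : S k), ∃ y : S (k + 1), ∀ j, ‖y.1 j - x.1 j‖ ≤ ε / 2 / 2 / 2 ^ k := by
    intro k x
    obtain ⟨w, h1, h2, h3⟩ := hD k (δ (k + 1)) (δ0 _) A hA x.1 x.2.1 (fun i j => (x.2.2 i j).trans (δD k))
    exact ⟨⟨w, h1, h3⟩, h2⟩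
  choose st hst using step
  let sq : (k : ℕ) → S k := fun k => Nat.rec (motive := S) ⟨v, hv, fun i j => (hcom i j).le⟩ st k
  have hsq : ∀ k j, ‖(sq (k + 1)).1 j - (sq k).1 j‖ ≤ ε / 2 / 2 / 2 ^ k := fun k j => hst k (sq k) j
  have hd : ∀ j k, dist ((sq k).1 j) ((sq (k + 1)).1 j) ≤ ε / 2 / 2 / 2 ^ k := by
    intro j k
    rw [dist_comm, dist_eq_norm]; exact hsq k j
  have hlim : ∀ j, ∃ w, Filter.Tendsto (fun k => (sq k).1 j) Filter.atTop (nhds w) := fun j =>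
    cauchySeq_tendsto_of_complete (cauchySeq_of_le_geometric_two (hd j))
  choose w hw using hlim
  refine ⟨w, ?_, ?_, ?_⟩
  · intro j
    rw [Unitary.mem_iff]
    constructor
    · refine tendsto_nhds_unique ((hw j).star.mul (hw j)) ?_
      refine tendsto_const_nhds.congr fun k => ?_
      exact (Unitary.mem_iff.1 ((sq k).2.1 j)).1.symm
    · refine tendsto_nhds_unique ((hw j).mul (hw j).star) ?_
      refine tendsto_const_nhds.congr fun k => ?_
      exact (Unitary.mem_iff.1 ((sq k).2.1 j)).2.symm
  · intro i j
    rw [← sub_eq_zero, ← norm_le_zero_iff]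
    refine le_of_tendsto_of_tendsto (((hw j).mul (hw i)).sub (((hw i).mul (hw j)).const_smul (lam i j))).norm tendsto_one_div_add_atTop_nhds_zero_nat ?_
    exact Filter.Eventually.of_forall fun k => ((sq k).2.2 i j).trans (δ1 k)
  · intro j
    have := dist_le_of_le_geometric_two_of_tendsto₀ (hd j) (hw j)
    rw [dist_comm, dist_eq_norm] at this
    have h0 : (sq 0).1 j = v j := rfl
    rw [h0] at this
    linarith

lemma rat_q {n : ℕ} (Θ : Fin n → Fin n → ℝ) (hrat : ∀ j k, ∃ q : ℚ, Θ j k = (q : ℝ)) :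
    ∃ q : ℕ, 0 < q ∧ ∀ j k, ∃ m : ℤ, Θ j k * q = m := by
  choose r hr using hrat
  refine ⟨∏ p : Fin n × Fin n, (r p.1 p.2).den, Finset.prod_pos fun p _ => (r p.1 p.2).den_pos, ?_⟩
  intro j k
  obtain ⟨c, hc⟩ := Finset.dvd_prod_of_mem (fun p : Fin n × Fin n => (r p.1 p.2).den) (Finset.mem_univ (j, k))
  refine ⟨(r j k).num * c, ?_⟩
  have h1 : ((r j k : ℚ) : ℝ) * (r j k).den = (r j k).num := by exact_mod_cast Rat.mul_den_eq_num (r j k)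
  rw [hc, hr]
  push_cast
  rw [← mul_assoc, h1]
end PIS

theorem stmt8 (n : ℕ) (hn : 1 ≤ n) (Θ : Fin n → Fin n → ℝ)
    (hskew : ∀ j k, Θ k j = -Θ j k) (hrat : ∀ j k, ∃ q : ℚ, Θ j k = (q : ℝ))
    (ε : ℝ) (hε : 0 < ε) :
    ∃ δ > (0 : ℝ), ∀ (A : Type*) [CStarAlgebra A], IsPurelyInfiniteSimple A →
      ∀ v : Fin n → A, (∀ j, v j ∈ unitary A) →
      (∀ j k, ‖v k * v j - Complex.exp (2 * π * Complex.I * (Θ j k)) • (v j * v k)‖ < δ) →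
      ∃ w : Fin n → A, (∀ j, w j ∈ unitary A) ∧
        (∀ j k, w k * w j = Complex.exp (2 * π * Complex.I * (Θ j k)) • (w j * w k)) ∧
        ∀ j, ‖w j - v j‖ < ε := by
  obtain ⟨q, hq, hm⟩ := PIS.rat_q Θ hrat
  refine PIS.stable (lam := fun j k => Complex.exp (2 * π * Complex.I * (Θ j k))) hq ?_ ?_ ?_ hε
  · intro j k
    obtain ⟨m, hm⟩ := hm j k
    have hm' : ((Θ j k : ℝ) : ℂ) * q = m := by exact_mod_cast hm
    rw [← Complex.exp_nat_mul, Complex.exp_eq_one_iff]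
    refine ⟨m, ?_⟩
    rw [← hm']; ring
  · intro j
    have : Θ j j = 0 := by linarith [hskew j j]
    simp [this]
  · intro j k
    rw [← Complex.exp_add, hskew j k]
    simp
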